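/- Let Ω be an n-connected domain of finite area with no degenerate boundary components. Suppose there exist a proper holomorphic map f of Ω onto the open unit disc 𝔻, a point b ∈ Ω with an Ahlfors map f_b of Ω at b, and polynomials P, Q ∈ ℂ[X,Y] such that z ↦ Q(f(z), f_b(z)) is not identically zero on Ω and f'(z)·Q(f(z), f_b(z)) = P(f(z), f_b(z)) for all z ∈ Ω (i.e., f' is a rational function of f and f_b). Then Ω is a generalized quadrature domain. -/

import Mathlib

open MeasureTheory Complex ComplexConjugate Metric Set

noncomputable section

/-- `f` belongs to the Bergman space `A²(Ω)`. -/
def BergmanFun (Ω : Set ℂ) (f : ℂ → ℂ) : Prop :=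
  DifferentiableOn ℂ f Ω ∧ IntegrableOn (fun z => ‖f z‖ ^ 2) Ω volume

/-- `Ω` is a finitely connected domain none of whose complementary components is a point. -/
def IsFinConnDomain (Ω : Set ℂ) : Prop :=
  IsOpen Ω ∧ IsConnected Ω ∧
  {C : Set ℂ | ∃ x ∈ Ωᶜ, C = connectedComponentIn Ωᶜ x}.Finite ∧
  ∀ x ∈ Ωᶜ, ¬ (connectedComponentIn Ωᶜ x).Subsingleton

/-- `Ω` is a quadrature domain. -/
def IsQuadratureDomain (Ω : Set ℂ) : Prop :=
  ∃ N : ℕ, 0 < N ∧ ∃ (w : Fin N → ℂ) (n : Fin N → ℕ) (c : Fin N → ℕ → ℂ),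
    (∀ j, w j ∈ Ω) ∧
    ∀ f : ℂ → ℂ, BergmanFun Ω f →
      (∫ z in Ω, f z) =
        ∑ j, ∑ k ∈ Finset.range (n j + 1), c j k * iteratedDerivWithin k f Ω (w j)

/-- `fa` is an Ahlfors map of `Ω` at `a`. -/
def IsAhlforsMap (Ω : Set ℂ) (a : ℂ) (fa : ℂ → ℂ) : Prop :=
  DifferentiableOn ℂ fa Ω ∧ (∀ z ∈ Ω, ‖fa z‖ < 1) ∧
  (deriv fa a).im = 0 ∧ 0 < (deriv fa a).re ∧
  ∀ g : ℂ → ℂ, DifferentiableOn ℂ g Ω → (∀ z ∈ Ω, ‖g z‖ < 1) →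
    ‖deriv g a‖ ≤ (deriv fa a).re

/-- `Ω` is bounded with `C^∞` smooth boundary consisting of finitely many disjoint
simple closed curves. -/
def HasSmoothBoundary (Ω : Set ℂ) : Prop :=
  Bornology.IsBounded Ω ∧
  ∃ (n : ℕ) (γ : Fin n → ℝ → ℂ),
    (∀ i, ContDiff ℝ (⊤ : ℕ∞) (γ i)) ∧
    (∀ i, Function.Periodic (γ i) (2 * Real.pi)) ∧
    (∀ i, InjOn (γ i) (Ico 0 (2 * Real.pi))) ∧
    (∀ i t, deriv (γ i) t ≠ 0) ∧
    (Pairwise fun i j => Disjoint (range (γ i)) (range (γ j))) ∧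
    frontier Ω = ⋃ i, range (γ i)

/-- Partial derivative in the `x`-direction of a real-valued function on `ℂ`. -/
def pdx (u : ℂ → ℝ) (z : ℂ) : ℝ := deriv (fun t : ℝ => u (z + (t : ℂ))) 0

/-- Partial derivative in the `y`-direction of a real-valued function on `ℂ`. -/
def pdy (u : ℂ → ℝ) (z : ℂ) : ℝ := deriv (fun t : ℝ => u (z + (t : ℂ) * Complex.I)) 0

/-- `f` is a proper holomorphic map of `Ω` onto the open unit disc. -/
def IsProperOntoDisc (Ω : Set ℂ) (f : ℂ → ℂ) : Prop :=
  DifferentiableOn ℂ f Ω ∧ f '' Ω = ball (0 : ℂ) 1 ∧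
  ∀ L : Set ℂ, L ⊆ ball (0 : ℂ) 1 → IsCompact L → IsCompact (Ω ∩ f ⁻¹' L)

/-- `g` is `(m, δ)`-close to the identity on `closure Ω`. -/
def CloseToId (Ω : Set ℂ) (m : ℕ) (δ : ℝ) (g : ℂ → ℂ) : Prop :=
  ∀ k ≤ m, ∀ z ∈ closure Ω, ‖iteratedFDeriv ℝ k (fun w => g w - w) z‖ ≤ δ

/-- `σ : [0,1] → ℂ` is a piecewise continuously differentiable curve. -/
def PiecewiseC1On01 (σ : ℝ → ℂ) : Prop :=
  ContinuousOn σ (Icc 0 1) ∧ ∃ s : Finset ℝ, ContDiffOn ℝ 1 σ (Icc (0 : ℝ) 1 \ s)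

/-- `Ω` is a generalized quadrature domain. -/
def IsGenQuadratureDomain (Ω : Set ℂ) : Prop :=
  ∃ (N M : ℕ) (w : Fin N → ℂ) (n : Fin N → ℕ) (c : Fin N → ℕ → ℂ)
    (b : Fin M → ℂ) (σ : Fin M → ℝ → ℂ),
    (∀ j, w j ∈ Ω) ∧
    (∀ m, PiecewiseC1On01 (σ m)) ∧
    (∀ m, ∀ t ∈ Icc (0 : ℝ) 1, σ m t ∈ Ω) ∧
    ∀ f : ℂ → ℂ, BergmanFun Ω f →
      (∫ z in Ω, f z) =
        (∑ j, ∑ k ∈ Finset.range (n j + 1), c j k * iteratedDerivWithin k f Ω (w j)) +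
        ∑ m, b m * ∫ t in (0 : ℝ)..1, f (σ m t) * deriv (σ m) t

section

open Filter Topology

/-- The Wirtinger derivative `∂u/∂z̄`. -/
def dbar (u : ℂ → ℂ) (z : ℂ) : ℂ := (fderiv ℝ u z 1 + I * fderiv ℝ u z I) / 2

theorem HasFDerivAt.dbar_eq {u : ℂ → ℂ} {z : ℂ} {L : ℂ →L[ℝ] ℂ} (h : HasFDerivAt u L z) :
    dbar u z = (L 1 + I * L I) / 2 := by
  rw [dbar, h.fderiv]

theorem dbar_congr {u v : ℂ → ℂ} {z : ℂ} (h : u =ᶠ[𝓝 z] v) : dbar u z = dbar v z := by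
  rw [dbar, dbar, h.fderiv_eq]

theorem dbar_of_differentiableAt {u : ℂ → ℂ} {z : ℂ} (h : DifferentiableAt ℂ u z) :
    dbar u z = 0 := by
  rw [(h.hasDerivAt.hasFDerivAt.restrictScalars ℝ).dbar_eq]
  simp [← mul_assoc]

theorem dbar_mul {u v : ℂ → ℂ} {z : ℂ} (hu : DifferentiableAt ℝ u z)
    (hv : DifferentiableAt ℝ v z) :
    dbar (fun w => u w * v w) z = u z * dbar v z + v z * dbar u z := by
  rw [HasFDerivAt.dbar_eq (u := fun w => u w * v w) (hu.hasFDerivAt.mul hv.hasFDerivAt), dbar,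
    dbar]
  simp
  ring

theorem dbar_mul_right {u v : ℂ → ℂ} {z : ℂ} (hu : DifferentiableAt ℝ u z)
    (hv : DifferentiableAt ℂ v z) :
    dbar (fun w => u w * v w) z = dbar u z * v z := by
  rw [dbar_mul hu (hv.restrictScalars ℝ), dbar_of_differentiableAt hv]
  ring

theorem dbar_sub {u v : ℂ → ℂ} {z : ℂ} (hu : DifferentiableAt ℝ u z)
    (hv : DifferentiableAt ℝ v z) :
    dbar (fun w => u w - v w) z = dbar u z - dbar v z := by
  rw [HasFDerivAt.dbar_eq (u := fun w => u w - v w) (hu.hasFDerivAt.sub hv.hasFDerivAt), dbar,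
    dbar]
  simp
  ring

theorem hasFDerivAt_comp_norm_sq {a : ℝ → ℝ} {φ : ℂ → ℂ} {z : ℂ}
    (ha : DifferentiableAt ℝ a (‖φ z‖ ^ 2)) (hφ : DifferentiableAt ℂ φ z) :
    ∃ L : ℂ →L[ℝ] ℂ, HasFDerivAt (fun w => ((a (‖φ w‖ ^ 2) : ℝ) : ℂ)) L z ∧
      ∀ v, L v = ((deriv a (‖φ z‖ ^ 2) *
        (2 * (φ z * conj (deriv φ z * v)).re) : ℝ) : ℂ) := by
  have h1 : HasFDerivAt φ ((ContinuousLinearMap.toSpanSingleton ℂ (deriv φ z)).restrictScalars ℝ)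
      z := hφ.hasDerivAt.hasFDerivAt.restrictScalars ℝ
  have h2 := h1.norm_sq
  have h3 := ha.hasDerivAt.hasFDerivAt.comp z h2
  have h4 := Complex.ofRealCLM.hasFDerivAt.comp z h3
  refine ⟨_, h4, fun v => ?_⟩
  simp [Complex.inner]
  ring

theorem dbar_comp_norm_sq {a : ℝ → ℝ} {φ : ℂ → ℂ} {z : ℂ}
    (ha : DifferentiableAt ℝ a (‖φ z‖ ^ 2)) (hφ : DifferentiableAt ℂ φ z) :
    dbar (fun w => ((a (‖φ w‖ ^ 2) : ℝ) : ℂ)) z =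
      (deriv a (‖φ z‖ ^ 2) : ℝ) * (φ z * conj (deriv φ z)) := by
  obtain ⟨L, hL, hv⟩ := hasFDerivAt_comp_norm_sq ha hφ
  rw [hL.dbar_eq, hv, hv]
  apply Complex.ext <;> simp <;> ring

theorem dbar_conj {u : ℂ → ℂ} {z : ℂ} (h : DifferentiableAt ℂ u z) :
    dbar (fun w => conj (u w)) z = conj (deriv u z) := by
  have h1 : HasFDerivAt u ((ContinuousLinearMap.toSpanSingleton ℂ (deriv u z)).restrictScalars ℝ)
      z := h.hasDerivAt.hasFDerivAt.restrictScalars ℝ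
  have h2 := (Complex.conjCLE : ℂ →L[ℝ] ℂ).hasFDerivAt.comp z h1
  rw [HasFDerivAt.dbar_eq (u := fun w => conj (u w)) h2]
  simp [← mul_assoc]

theorem contDiff_of_eq_zero_off {n : WithTop ℕ∞} {E : Type*} [NormedAddCommGroup E]
    [NormedSpace ℝ E] {U K : Set ℂ} {u : ℂ → E} (hU : IsOpen U)
    (hK : IsClosed K) (hKU : K ⊆ U) (hu : ContDiffOn ℝ n u U) (h0 : ∀ z ∉ K, u z = 0) :
    ContDiff ℝ n u := by
  rw [contDiff_iff_contDiffAt]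
  intro z
  by_cases hz : z ∈ U
  · exact hu.contDiffAt (hU.mem_nhds hz)
  · have : u =ᶠ[𝓝 z] fun _ => 0 := by
      filter_upwards [hK.isOpen_compl.mem_nhds (fun h => hz (hKU h))] with w hw using h0 w hw
    exact contDiffAt_const.congr_of_eventuallyEq this

theorem continuous_dbar {u : ℂ → ℂ} (hu : ContDiff ℝ 1 u) : Continuous (dbar u) := by
  have := hu.continuous_fderiv one_ne_zero
  unfold dbar
  fun_prop

theorem continuousOn_dbar {u : ℂ → ℂ} {U : Set ℂ} (hU : IsOpen U) (hu : ContDiffOn ℝ 1 u U) :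
    ContinuousOn (dbar u) U := by
  have := hu.continuousOn_fderiv_of_isOpen hU le_rfl
  unfold dbar
  fun_prop

theorem hasCompactSupport_dbar {u : ℂ → ℂ} (hu : HasCompactSupport u) :
    HasCompactSupport (dbar u) := by
  have h := hu.fderiv (𝕜 := ℝ)
  refine h.mono ?_
  intro z hz
  contrapose! hz
  simp only [Function.mem_support, not_not] at hz ⊢
  simp [dbar, hz]

theorem integrable_dbar {u : ℂ → ℂ} (hu : ContDiff ℝ 1 u) (hc : HasCompactSupport u) :
    Integrable (dbar u) :=
  (continuous_dbar hu).integrable_of_hasCompactSupport (hasCompactSupport_dbar hc)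

theorem integral_fderiv_apply_eq_zero {u : ℂ → ℂ} (hu : ContDiff ℝ 1 u) (hc : HasCompactSupport u)
    (v : ℂ) : ∫ z, fderiv ℝ u z v = 0 := by
  have h1 : Continuous fun z => fderiv ℝ u z v :=
    (hu.continuous_fderiv one_ne_zero).clm_apply continuous_const
  have h2 : HasCompactSupport fun z => fderiv ℝ u z v := by
    refine (hc.fderiv (𝕜 := ℝ)).mono ?_
    intro z hz
    contrapose! hz
    simp only [Function.mem_support, not_not] at hz ⊢
    simp [hz]
  have hI := h1.integrable_of_hasCompactSupport (μ := volume) h2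
  have := integral_mul_fderiv_eq_neg_fderiv_mul_of_integrable (μ := (volume : Measure ℂ))
    (f := fun _ : ℂ => (1 : ℂ)) (g := u) (v := v) (by simp)
    (by simpa using hI)
    (by simpa using hu.continuous.integrable_of_hasCompactSupport hc)
    (fun x _ => differentiableAt_const _)
    (fun x _ => (hu.differentiable one_ne_zero) x)
  simpa using this

theorem integral_dbar_eq_zero {u : ℂ → ℂ} (hu : ContDiff ℝ 1 u) (hc : HasCompactSupport u) :
    ∫ z, dbar u z = 0 := by
  have hI (v : ℂ) : Integrable fun z => fderiv ℝ u z v := by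
    refine ((hu.continuous_fderiv one_ne_zero).clm_apply
      continuous_const).integrable_of_hasCompactSupport ((hc.fderiv (𝕜 := ℝ)).mono ?_)
    intro z hz
    contrapose! hz
    simp only [Function.mem_support, not_not] at hz ⊢
    simp [hz]
  unfold dbar
  rw [integral_div, integral_add (hI 1) ((hI I).const_mul I), integral_const_mul,
    integral_fderiv_apply_eq_zero hu hc, integral_fderiv_apply_eq_zero hu hc]
  simp

/-- Extension by zero of a function vanishing off a compact subset of an open set. -/
theorem contDiff_indicator {U K : Set ℂ} {u : ℂ → ℂ} (hU : IsOpen U)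
    (hK : IsCompact K) (hKU : K ⊆ U) (hu : ContDiffOn ℝ 1 u U) (h0 : ∀ z ∈ U \ K, u z = 0) :
    ContDiff ℝ 1 (U.indicator u) ∧ HasCompactSupport (U.indicator u) ∧
      dbar (U.indicator u) = U.indicator (dbar u) := by
  have h0' : ∀ z ∉ K, U.indicator u z = 0 := by
    intro z hz
    by_cases h : z ∈ U
    · rw [indicator_of_mem h, h0 z ⟨h, hz⟩]
    · rw [indicator_of_notMem h]
  have hu' : ContDiffOn ℝ 1 (U.indicator u) U := hu.congr fun z hz => indicator_of_mem hz _
  refine ⟨contDiff_of_eq_zero_off hU hK.isClosed hKU hu' h0', HasCompactSupport.intro hK h0', ?_⟩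
  funext z
  by_cases hz : z ∈ U
  · rw [indicator_of_mem hz]
    apply dbar_congr
    filter_upwards [hU.mem_nhds hz] with w hw using indicator_of_mem hw _
  · rw [indicator_of_notMem hz]
    have : U.indicator u =ᶠ[𝓝 z] fun _ => 0 := by
      filter_upwards [hK.isClosed.isOpen_compl.mem_nhds (fun h => hz (hKU h))] with w hw
        using h0' w hw
    rw [dbar_congr this]
    simp [dbar]

theorem integrableOn_dbar {U K : Set ℂ} {u : ℂ → ℂ} (hU : IsOpen U)
    (hK : IsCompact K) (hKU : K ⊆ U) (hu : ContDiffOn ℝ 1 u U) (h0 : ∀ z ∈ U \ K, u z = 0) :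
    IntegrableOn (dbar u) U := by
  obtain ⟨h1, h2, h3⟩ := contDiff_indicator hU hK hKU hu h0
  rw [← integrable_indicator_iff hU.measurableSet, ← h3]
  exact integrable_dbar h1 h2

theorem setIntegral_dbar_eq_zero {U K : Set ℂ} {u : ℂ → ℂ} (hU : IsOpen U)
    (hK : IsCompact K) (hKU : K ⊆ U) (hu : ContDiffOn ℝ 1 u U) (h0 : ∀ z ∈ U \ K, u z = 0) :
    ∫ z in U, dbar u z = 0 := by
  obtain ⟨h1, h2, h3⟩ := contDiff_indicator hU hK hKU hu h0
  rw [← integral_indicator hU.measurableSet, ← h3]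
  exact integral_dbar_eq_zero h1 h2

/-- Smooth step function, `0` below `a` and `1` above `b`. -/
def stepFn (a b t : ℝ) : ℝ := Real.smoothTransition ((t - a) / (b - a))

theorem stepFn_contDiff (a b : ℝ) {n : ℕ∞} : ContDiff ℝ n (stepFn a b) := by
  unfold stepFn
  exact Real.smoothTransition.contDiff.comp (by fun_prop)

theorem stepFn_of_le {a b t : ℝ} (hab : a < b) (h : t ≤ a) : stepFn a b t = 0 :=
  Real.smoothTransition.zero_of_nonpos
    (div_nonpos_of_nonpos_of_nonneg (by linarith) (by linarith))

theorem stepFn_of_ge {a b t : ℝ} (hab : a < b) (h : b ≤ t) : stepFn a b t = 1 :=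
  Real.smoothTransition.one_of_one_le (by rw [le_div_iff₀ (by linarith)]; linarith)

theorem stepFn_nonneg (a b t : ℝ) : 0 ≤ stepFn a b t := Real.smoothTransition.nonneg _

theorem stepFn_le_one (a b t : ℝ) : stepFn a b t ≤ 1 := Real.smoothTransition.le_one _

theorem stepFn_monotone {a b : ℝ} (hab : a < b) : Monotone (stepFn a b) := fun s t hst =>
  Real.smoothTransition.monotone (div_le_div_of_nonneg_right (by linarith) (by linarith))

theorem deriv_stepFn_nonneg {a b : ℝ} (hab : a < b) (t : ℝ) : 0 ≤ deriv (stepFn a b) t :=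
  (stepFn_monotone hab).deriv_nonneg

theorem deriv_stepFn_of_lt {a b t : ℝ} (hab : a < b) (h : t < a) : deriv (stepFn a b) t = 0 := by
  have : stepFn a b =ᶠ[𝓝 t] fun _ => 0 := by
    filter_upwards [Iio_mem_nhds h] with s hs using stepFn_of_le hab (le_of_lt hs)
  rw [this.deriv_eq]; simp

theorem deriv_stepFn_of_gt {a b t : ℝ} (hab : a < b) (h : b < t) : deriv (stepFn a b) t = 0 := by
  have : stepFn a b =ᶠ[𝓝 t] fun _ => 1 := by
    filter_upwards [Ioi_mem_nhds h] with s hs using stepFn_of_ge hab (le_of_lt hs)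
  rw [this.deriv_eq]; simp

theorem contDiffOn_comp_norm_sq {a : ℝ → ℝ} {φ : ℂ → ℂ} {U : Set ℂ} (ha : ContDiff ℝ 1 a)
    (hU : IsOpen U) (hφ : DifferentiableOn ℂ φ U) :
    ContDiffOn ℝ 1 (fun w => ((a (‖φ w‖ ^ 2) : ℝ) : ℂ)) U := by
  have h1 : ContDiffOn ℝ 1 φ U := (hφ.contDiffOn hU).restrict_scalars ℝ
  exact Complex.ofRealCLM.contDiff.comp_contDiffOn (ha.comp_contDiffOn (h1.norm_sq ℝ))

theorem integrable_div_sub {w : ℂ → ℂ} (hw : Continuous w) (hc : HasCompactSupport w) (z : ℂ) :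
    Integrable fun ζ => w ζ / (z - ζ) := by
  rw [← (measurePreserving_add_left volume z).integrable_comp_emb
    (MeasurableEquiv.addLeft z).measurableEmbedding]
  change Integrable fun x => w (z + x) / (z - (z + x))
  have hmeas : Measurable fun x => w (z + x) / (z - (z + x)) := by
    have := hw.measurable
    fun_prop
  refine ⟨hmeas.aestronglyMeasurable, ?_⟩
  rw [hasFiniteIntegral_iff_enorm, ← Complex.lintegral_comp_polarCoord_symm]
  obtain ⟨C, hC⟩ := hw.bounded_above_of_compact_support hc
  obtain ⟨R, hR⟩ := hc.isCompact.isBounded.subset_closedBall z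
  have hle : ∀ p ∈ polarCoord.target, ENNReal.ofReal p.1 •
      ‖w (z + Complex.polarCoord.symm p) / (z - (z + Complex.polarCoord.symm p))‖ₑ ≤
      (Icc 0 R ×ˢ Icc (-Real.pi) Real.pi).indicator (fun _ => ENNReal.ofReal C) p := by
    intro p hp
    simp only [polarCoord_target, mem_prod, mem_Ioi, mem_Ioo] at hp
    have hn : ‖(Complex.polarCoord.symm p : ℂ)‖ = p.1 := by
      rw [Complex.norm_polarCoord_symm, abs_of_pos hp.1]
    rw [← ofReal_norm, smul_eq_mul, ← ENNReal.ofReal_mul hp.1.le, norm_div,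
      show z - (z + Complex.polarCoord.symm p) = -Complex.polarCoord.symm p by ring, norm_neg, hn,
      mul_div_cancel₀ _ hp.1.ne']
    by_cases h : p.1 ≤ R
    · rw [indicator_of_mem (show p ∈ Icc 0 R ×ˢ Icc (-Real.pi) Real.pi from
        ⟨⟨hp.1.le, h⟩, hp.2.1.le, hp.2.2.le⟩)]
      exact ENNReal.ofReal_le_ofReal (hC _)
    · have : w (z + Complex.polarCoord.symm p) = 0 := by
        by_contra h0
        have := hR (subset_tsupport w h0)
        simp only [mem_closedBall, dist_self_add_left, hn] at this
        exact h this
      rw [this, norm_zero, ENNReal.ofReal_zero]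
      exact zero_le
  refine lt_of_le_of_lt (setLIntegral_mono' polarCoord.open_target.measurableSet hle) ?_
  refine lt_of_le_of_lt (setLIntegral_le_lintegral _ _) ?_
  rw [lintegral_indicator (by measurability)]
  simp only [lintegral_const, MeasurableSet.univ, Measure.restrict_apply, univ_inter]
  refine ENNReal.mul_lt_top ENNReal.ofReal_lt_top ?_
  exact (isCompact_Icc.prod isCompact_Icc).measure_lt_top

theorem integrableOn_target_of_continuous {F : ℝ × ℝ → ℂ} {R : ℝ}
    (hF : Continuous F) (h0 : ∀ p : ℝ × ℝ, R < p.1 → F p = 0) :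
    IntegrableOn F (Ioi 0 ×ˢ Ioo (-Real.pi) Real.pi) := by
  have h1 : IntegrableOn F (Icc 0 R ×ˢ Icc (-Real.pi) Real.pi) :=
    hF.continuousOn.integrableOn_compact (isCompact_Icc.prod isCompact_Icc)
  refine h1.of_forall_sdiff_eq_zero (by measurability) ?_
  rintro p ⟨⟨hp1, hp2⟩, hp3⟩
  apply h0
  by_contra h
  exact hp3 ⟨⟨le_of_lt hp1, not_lt.1 h⟩, ⟨hp2.1.le, hp2.2.le⟩⟩

/-- The Cauchy–Pompeiu formula for compactly supported functions. -/
theorem integral_dbar_div_sub {u : ℂ → ℂ} (hu : ContDiff ℝ 1 u) (hc : HasCompactSupport u)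
    (z : ℂ) : ∫ ζ, dbar u ζ / (z - ζ) = Real.pi * u z := by
  set D : ℂ → ℂ →L[ℝ] ℂ := fderiv ℝ u with hD
  have hDc : Continuous D := hu.continuous_fderiv one_ne_zero
  set e : ℝ → ℂ := fun θ => (Real.cos θ : ℂ) + Real.sin θ * I with he
  have hec : Continuous e := by fun_prop
  have heI (θ : ℝ) : HasDerivAt e (I * e θ) θ := by
    have := ((Real.hasDerivAt_cos θ).ofReal_comp).add
      (((Real.hasDerivAt_sin θ).ofReal_comp).mul_const I)
    refine this.congr_deriv ?_
    simp only [he, ofReal_neg]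
    linear_combination (Real.sin θ : ℂ) * I_mul_I.symm
  obtain ⟨R, hR⟩ := hc.isCompact.isBounded.subset_closedBall z
  have hu0 : ∀ ρ θ : ℝ, R < ρ → u (z + ρ * e θ) = 0 := by
    intro ρ θ h
    by_contra h0
    have h1 := hR (subset_tsupport u h0)
    have h2 := Complex.norm_polarCoord_symm (ρ, θ)
    rw [Complex.polarCoord_symm_apply] at h2
    simp only [mem_closedBall, dist_self_add_left, he, h2] at h1
    exact absurd (lt_of_lt_of_le h (le_abs_self ρ)) (not_lt.2 h1)
  have hD0 : ∀ ρ θ : ℝ, R < ρ → D (z + ρ * e θ) = 0 := by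
    intro ρ θ h
    by_contra h0
    have h1 := hR ((tsupport_fderiv_subset ℝ) (subset_tsupport _ h0))
    have h2 := Complex.norm_polarCoord_symm (ρ, θ)
    rw [Complex.polarCoord_symm_apply] at h2
    simp only [mem_closedBall, dist_self_add_left, he, h2] at h1
    exact absurd (lt_of_lt_of_le h (le_abs_self ρ)) (not_lt.2 h1)
  have key : ∀ p : ℝ × ℝ, p ∈ polarCoord.target →
      p.1 • (dbar u (z + Complex.polarCoord.symm p) / (z - (z + Complex.polarCoord.symm p))) =
      -(1 / 2 : ℂ) * D (z + p.1 * e p.2) (e p.2) +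
        (-(I / 2)) * D (z + p.1 * e p.2) (I * e p.2) := by
    rintro ⟨ρ, θ⟩ hp
    simp only [polarCoord_target, mem_prod, mem_Ioi, mem_Ioo] at hp
    rw [Complex.polarCoord_symm_apply, real_smul]
    have hρ : (ρ : ℂ) ≠ 0 := by exact_mod_cast hp.1.ne'
    have hn : e θ * (Real.cos θ - Real.sin θ * I) = 1 := by
      have := Complex.sin_sq_add_cos_sq θ
      simp only [he, ofReal_cos, ofReal_sin]
      linear_combination this - Complex.sin θ ^ 2 * I_mul_I
    have he0 : e θ ≠ 0 := left_ne_zero_of_mul_eq_one hn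
    have hinv : (e θ)⁻¹ = Real.cos θ - Real.sin θ * I :=
      inv_eq_of_mul_eq_one_right hn
    have e1 (L : ℂ →L[ℝ] ℂ) : L (e θ) = Real.cos θ * L 1 + Real.sin θ * L I := by
      rw [show e θ = Real.cos θ • (1 : ℂ) + Real.sin θ • I by simp [he], map_add, map_smul,
        map_smul, real_smul, real_smul]
    have e2 (L : ℂ →L[ℝ] ℂ) : L (I * e θ) = -Real.sin θ * L 1 + Real.cos θ * L I := by
      rw [show I * e θ = (-Real.sin θ) • (1 : ℂ) + Real.cos θ • I by
        simp only [he, real_smul, ofReal_neg]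
        linear_combination (Real.sin θ : ℂ) * I_mul_I, map_add, map_smul,
        map_smul, real_smul, real_smul, ofReal_neg]
    change (ρ : ℂ) * (dbar u (z + ρ * e θ) / (z - (z + ρ * e θ))) =
      -(1 / 2 : ℂ) * D (z + ρ * e θ) (e θ) + (-(I / 2)) * D (z + ρ * e θ) (I * e θ)
    have : (ρ : ℂ) * (dbar u (z + ρ * e θ) / (z - (z + ρ * e θ))) =
        - dbar u (z + ρ * e θ) * (e θ)⁻¹ := by
      field_simp
      ring
    rw [this, hinv, e2, e1, dbar]
    change -((D (z + ρ * e θ) 1 + I * D (z + ρ * e θ) I) / 2) * _ = _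
    linear_combination ((1 / 2 : ℂ) * Real.sin θ * D (z + ρ * e θ) I) * I_mul_I
  have hF1 : Continuous fun p : ℝ × ℝ => D (z + p.1 * e p.2) (e p.2) := by fun_prop
  have hF2 : Continuous fun p : ℝ × ℝ => D (z + p.1 * e p.2) (I * e p.2) := by fun_prop
  have hI1 := integrableOn_target_of_continuous (R := R) hF1 (fun p hp => by simp [hD0 _ _ hp])
  have hI2 := integrableOn_target_of_continuous (R := R) hF2 (fun p hp => by simp [hD0 _ _ hp])
  have hs (ρ θ : ℝ) : HasFDerivAt u (D (z + ρ * e θ)) (z + ρ * e θ) :=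
    (hu.differentiable one_ne_zero _).hasFDerivAt
  have hA : ∫ p in Ioi (0 : ℝ) ×ˢ Ioo (-Real.pi) Real.pi, D (z + p.1 * e p.2) (e p.2) =
      -(2 * Real.pi) * u z := by
    have h1 : ∀ θ : ℝ, ∫ ρ in Ioi (0 : ℝ), D (z + ρ * e θ) (e θ) = - u z := by
      intro θ
      have hd : ∀ ρ : ℝ, HasDerivAt (fun ρ : ℝ => u (z + ρ * e θ)) (D (z + ρ * e θ) (e θ)) ρ := by
        intro ρ
        have h2 : HasDerivAt (fun ρ : ℝ => z + ρ * e θ) (e θ) ρ := by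
          simpa using ((hasDerivAt_id ρ).ofReal_comp.mul_const (e θ)).const_add z
        exact (hs ρ θ).comp_hasDerivAt ρ h2
      have hcont : Continuous fun ρ : ℝ => D (z + ρ * e θ) (e θ) := by fun_prop
      have hintegr : IntegrableOn (fun ρ : ℝ => D (z + ρ * e θ) (e θ)) (Ioi 0) := by
        have h1 : IntegrableOn (fun ρ : ℝ => D (z + ρ * e θ) (e θ)) (Icc 0 R) :=
          hcont.continuousOn.integrableOn_compact isCompact_Icc
        refine h1.of_forall_sdiff_eq_zero measurableSet_Ioi ?_
        rintro p ⟨hp1, hp3⟩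
        rw [hD0]
        · simp
        · by_contra h
          exact hp3 ⟨le_of_lt hp1, not_lt.1 h⟩
      rw [integral_Ioi_of_hasDerivAt_of_tendsto (hd 0).continuousAt.continuousWithinAt
        (fun ρ _ => hd ρ) hintegr (m := 0)]
      · simp
      · refine tendsto_const_nhds.congr' ?_
        filter_upwards [Ioi_mem_atTop R] with ρ hρ using (hu0 ρ θ hρ).symm
    have hsw := setIntegral_prod_swap (μ := volume) (ν := volume) (Ioi (0 : ℝ))
      (Ioo (-Real.pi) Real.pi) fun p : ℝ × ℝ => D (z + p.1 * e p.2) (e p.2)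
    rw [Measure.volume_eq_prod, ← hsw, setIntegral_prod]
    · simp only [Prod.swap_prod_mk, h1]
      simp [Real.pi_pos.le]
      left
      ring
    · exact hI1.swap
  have hB : ∫ p in Ioi (0 : ℝ) ×ˢ Ioo (-Real.pi) Real.pi, D (z + p.1 * e p.2) (I * e p.2) = 0 := by
    rw [Measure.volume_eq_prod, setIntegral_prod _ hI2]
    refine setIntegral_eq_zero_of_forall_eq_zero fun ρ hρ => ?_
    have hρ' : (ρ : ℂ) ≠ 0 := by exact_mod_cast (mem_Ioi.1 hρ).ne'
    have hd : ∀ θ : ℝ, HasDerivAt (fun θ : ℝ => (ρ : ℂ)⁻¹ * u (z + ρ * e θ))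
        (D (z + ρ * e θ) (I * e θ)) θ := by
      intro θ
      have h2 : HasDerivAt (fun θ : ℝ => z + ρ * e θ) (ρ • (I * e θ)) θ := by
        simpa using ((heI θ).const_mul (ρ : ℂ)).const_add z
      have h3 := ((hs ρ θ).comp_hasDerivAt θ h2).const_mul (ρ : ℂ)⁻¹
      refine h3.congr_deriv ?_
      rw [map_smul, real_smul, inv_mul_cancel_left₀ hρ']
    have hcont : Continuous fun θ : ℝ => D (z + ρ * e θ) (I * e θ) := by fun_prop
    rw [← integral_Ioc_eq_integral_Ioo,
      ← intervalIntegral.integral_of_le (by linarith [Real.pi_pos]),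
      intervalIntegral.integral_eq_sub_of_hasDerivAt (fun θ _ => hd θ)
        (hcont.intervalIntegrable _ _)]
    simp [he]
  rw [← integral_add_left_eq_self _ z, ← Complex.integral_comp_polarCoord_symm,
    setIntegral_congr_fun polarCoord.open_target.measurableSet key, polarCoord_target,
    integral_add (hI1.const_mul _) (hI2.const_mul _), integral_const_mul, integral_const_mul, hA,
    hB]
  ring

theorem hasDerivAt_integral_div_sub {c : ℂ → ℂ} (hc : Continuous c) (hs : HasCompactSupport c)
    {z₀ : ℂ} (h0 : z₀ ∉ tsupport c) :
    HasDerivAt (fun z => ∫ ζ, c ζ / (z - ζ)) (-∫ ζ, c ζ / (z₀ - ζ) ^ 2) z₀ := by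
  obtain ⟨ε, hε, hball⟩ := Metric.isOpen_iff.1 (isClosed_tsupport c).isOpen_compl z₀ h0
  have hsep : ∀ z ∈ ball z₀ (ε / 2), ∀ ζ ∈ tsupport c, ε / 2 ≤ ‖z - ζ‖ := by
    intro z hz ζ hζ
    have h1 : ε ≤ dist ζ z₀ := by
      by_contra h
      exact hball (mem_ball.2 (not_le.1 h)) hζ
    have h2 := dist_triangle ζ z z₀
    rw [mem_ball] at hz
    rw [← dist_eq_norm, dist_comm]
    linarith
  have hcI := hc.integrable_of_hasCompactSupport (μ := volume) hs
  have key := hasDerivAt_integral_of_dominated_loc_of_deriv_le (μ := (volume : Measure ℂ))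
    (F := fun z ζ => c ζ / (z - ζ)) (F' := fun z ζ => -(c ζ / (z - ζ) ^ 2)) (x₀ := z₀)
    (bound := fun ζ => ‖c ζ‖ / (ε / 2) ^ 2) (ball_mem_nhds z₀ (half_pos hε))
    (Eventually.of_forall fun z => (integrable_div_sub hc hs z).aestronglyMeasurable)
    (integrable_div_sub hc hs z₀) (by
      have := hc.measurable
      exact (show Measurable fun ζ => -(c ζ / (z₀ - ζ) ^ 2) by fun_prop).aestronglyMeasurable)
    (Eventually.of_forall fun ζ z hz => by
      by_cases h : ζ ∈ tsupport c
      · rw [norm_neg, norm_div, norm_pow]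
        have := hsep z hz ζ h
        gcongr
      · simp [image_eq_zero_of_notMem_tsupport h])
    (hcI.norm.div_const _)
    (Eventually.of_forall fun ζ z hz => by
      by_cases h : ζ ∈ tsupport c
      · have hne : z - ζ ≠ 0 := by
          have := hsep z hz ζ h
          exact norm_pos_iff.1 (by linarith)
        have := ((hasDerivAt_id z).sub_const ζ).inv hne |>.const_mul (c ζ)
        simp only [id] at this
        refine (this.congr_deriv ?_)
        ring
      · simp [image_eq_zero_of_notMem_tsupport h, hasDerivAt_const])
  have := key.2
  rwa [integral_neg] at this

/-- Integral of `g` along the segment from `p` to `q`. -/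
def segInt (g : ℂ → ℂ) (p q : ℂ) : ℂ := ∫ t in (0 : ℝ)..1, g (p + t * (q - p)) * (q - p)

theorem segment_param_mem {p q : ℂ} {t : ℝ} (ht : t ∈ Icc (0 : ℝ) 1) :
    p + t * (q - p) ∈ segment ℝ p q := by
  rw [segment_eq_image']
  exact ⟨t, ht, by simp⟩

theorem segInt_continuousOn {g : ℂ → ℂ} {p q : ℂ} (hg : ContinuousOn g (segment ℝ p q)) :
    ContinuousOn (fun t : ℝ => g (p + t * (q - p)) * (q - p)) (Icc 0 1) := by
  refine ContinuousOn.mul (hg.comp (by fun_prop) fun t ht => segment_param_mem ht) (by fun_prop)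

theorem segInt_intervalIntegrable {g : ℂ → ℂ} {p q : ℂ} (hg : ContinuousOn g (segment ℝ p q)) :
    IntervalIntegrable (fun t : ℝ => g (p + t * (q - p)) * (q - p)) volume 0 1 := by
  apply ContinuousOn.intervalIntegrable
  rw [uIcc_of_le zero_le_one]
  exact segInt_continuousOn hg

theorem segInt_congr {g h : ℂ → ℂ} {p q : ℂ} (H : EqOn g h (segment ℝ p q)) :
    segInt g p q = segInt h p q := by
  refine intervalIntegral.integral_congr fun t ht => ?_
  rw [uIcc_of_le zero_le_one] at ht
  simp only [H (segment_param_mem ht)]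

theorem segInt_symm (g : ℂ → ℂ) (p q : ℂ) : segInt g q p = -segInt g p q := by
  have h := intervalIntegral.integral_comp_sub_left (a := 0) (b := 1)
    (fun t : ℝ => g (p + t * (q - p)) * (p - q)) 1
  simp only [sub_self, sub_zero] at h
  rw [segInt, segInt, ← intervalIntegral.integral_neg]
  rw [show (fun t : ℝ => -(g (p + t * (q - p)) * (q - p))) =
    fun t : ℝ => g (p + t * (q - p)) * (p - q) by ext; ring, ← h]
  congr 1
  ext t
  push_cast
  congr 2
  ring

theorem segInt_add_mul {g h : ℂ → ℂ} {p q : ℂ} (c : ℂ) (hg : ContinuousOn g (segment ℝ p q))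
    (hh : ContinuousOn h (segment ℝ p q)) :
    segInt (fun z => g z + c * h z) p q = segInt g p q + c * segInt h p q := by
  rw [segInt, segInt, segInt, ← intervalIntegral.integral_const_mul,
    ← intervalIntegral.integral_add (segInt_intervalIntegrable hg)
      ((segInt_intervalIntegrable hh).const_mul c)]
  congr 1
  ext t
  ring

/-- Logarithmic fundamental theorem of calculus along a segment. -/
theorem exp_segInt {h ξ : ℂ → ℂ} {p q : ℂ} (hh : ContinuousOn h (segment ℝ p q))
    (hξ : ∀ z ∈ segment ℝ p q, HasDerivAt ξ (h z * ξ z) z) :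
    exp (segInt h p q) * ξ p = ξ q := by
  set κ : ℝ → ℂ := IccExtend (zero_le_one' ℝ)
    (fun t : Icc (0 : ℝ) 1 => h (p + (t : ℝ) * (q - p)) * (q - p)) with hκ
  have hκc : Continuous κ :=
    (continuousOn_iff_continuous_domRestrict.1 (segInt_continuousOn hh)).Icc_extend'
  have hκe : ∀ t ∈ Icc (0 : ℝ) 1, κ t = h (p + t * (q - p)) * (q - p) := fun t ht => by
    rw [hκ, IccExtend_of_mem _ _ ht]
  have hE (t : ℝ) : HasDerivAt (fun t => ∫ s in (0 : ℝ)..t, κ s) (κ t) t :=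
    intervalIntegral.integral_hasDerivAt_right (hκc.intervalIntegrable _ _)
      hκc.aestronglyMeasurable.stronglyMeasurableAtFilter hκc.continuousAt
  have hpath (t : ℝ) : HasDerivAt (fun t : ℝ => p + t * (q - p)) (q - p) t := by
    simpa using ((hasDerivAt_id t).ofReal_comp.mul_const (q - p)).const_add p
  have hG : ∀ t ∈ Icc (0 : ℝ) 1, HasDerivAt
      (fun t : ℝ => exp (-∫ s in (0 : ℝ)..t, κ s) * ξ (p + t * (q - p))) 0 t := by
    intro t ht
    have h1 := (hE t).neg.cexp
    have h2 := (hξ _ (segment_param_mem (p := p) (q := q) ht)).comp t (hpath t)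
    refine (h1.mul h2).congr_deriv ?_
    rw [hκe t ht]
    simp only [Pi.neg_apply, Function.comp]
    ring
  have := constant_of_has_deriv_right_zero (fun t ht => (hG t ht).continuousAt.continuousWithinAt)
    (fun t ht => (hG t (Ico_subset_Icc_self ht)).hasDerivWithinAt) 1 (by simp)
  simp only [intervalIntegral.integral_same] at this
  have hs : segInt h p q = ∫ s in (0 : ℝ)..1, κ s := by
    refine intervalIntegral.integral_congr fun t ht => ?_
    rw [uIcc_of_le zero_le_one] at ht
    exact (hκe t ht).symm
  rw [hs]
  simp only [ofReal_one, one_mul, add_sub_cancel, neg_zero, exp_zero, ofReal_zero, zero_mul,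
    add_zero] at this
  rw [← this, ← mul_assoc, ← exp_add]
  simp

theorem segInt_of_hasDerivAt {g G : ℂ → ℂ} {p q : ℂ} (hg : ContinuousOn g (segment ℝ p q))
    (hG : ∀ z ∈ segment ℝ p q, HasDerivAt G (g z) z) : segInt g p q = G q - G p := by
  have hpath (t : ℝ) : HasDerivAt (fun t : ℝ => p + t * (q - p)) (q - p) t := by
    simpa using ((hasDerivAt_id t).ofReal_comp.mul_const (q - p)).const_add p
  rw [segInt, intervalIntegral.integral_eq_sub_of_hasDerivAt
    (f := fun t : ℝ => G (p + t * (q - p)))]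
  · simp
  · intro t ht
    rw [uIcc_of_le zero_le_one] at ht
    exact (hG _ (segment_param_mem ht)).comp t (hpath t)
  · exact segInt_intervalIntegrable hg

/-- `PolyPath S p q Φ`: `Φ` is integration along some polygonal path in `S` from `p` to `q`. -/
inductive PolyPath (S : Set ℂ) : ℂ → ℂ → ((ℂ → ℂ) → ℂ) → Prop
  | refl {p : ℂ} (hp : p ∈ S) : PolyPath S p p fun _ => 0
  | step {p q r : ℂ} {Φ : (ℂ → ℂ) → ℂ} (h : PolyPath S p q Φ) (hs : segment ℝ q r ⊆ S) :
      PolyPath S p r fun g => Φ g + segInt g q r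

namespace PolyPath

variable {S T : Set ℂ} {p q r : ℂ} {Φ Ψ : (ℂ → ℂ) → ℂ}

theorem mono (h : PolyPath S p q Φ) (hST : S ⊆ T) : PolyPath T p q Φ := by
  induction h with
  | refl hp => exact refl (hST hp)
  | step _ hs ih => exact step ih (hs.trans hST)

theorem source_mem (h : PolyPath S p q Φ) : p ∈ S := by
  induction h with
  | refl hp => exact hp
  | step _ hs ih => exact ih

theorem target_mem (h : PolyPath S p q Φ) : q ∈ S := by
  cases h with
  | refl hp => exact hp
  | step _ hs => exact hs (right_mem_segment ℝ _ _)

theorem trans (h : PolyPath S p q Φ) (h' : PolyPath S q r Ψ) :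
    PolyPath S p r fun g => Φ g + Ψ g := by
  induction h' with
  | refl hp => simpa using h
  | step _ hs ih => simpa only [add_assoc] using step ih hs

theorem seg (h : segment ℝ p q ⊆ S) : PolyPath S p q fun g => segInt g p q := by
  simpa using step (refl (h (left_mem_segment ℝ p q))) h

theorem symm (h : PolyPath S p q Φ) : PolyPath S q p fun g => -Φ g := by
  induction h with
  | refl hp => simpa using refl hp
  | @step q r Φ _ hs ih =>
    have := (seg (S := S) (p := r) (q := q) (by rwa [segment_symm])).trans ih
    simpa only [segInt_symm _ q r, neg_add_rev] using this

theorem exists_isCompact (h : PolyPath S p q Φ) :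
    ∃ K ⊆ S, IsCompact K ∧ PolyPath K p q Φ := by
  induction h with
  | refl hp => exact ⟨{p}, by simpa using hp, isCompact_singleton, refl rfl⟩
  | @step q r Φ _ hs ih =>
    obtain ⟨K, hK, hc, h⟩ := ih
    refine ⟨K ∪ segment ℝ q r, union_subset hK hs, hc.union ?_,
      step (h.mono subset_union_left) subset_union_right⟩
    rw [segment_eq_image']
    exact isCompact_Icc.image (by fun_prop)

theorem congr {g h : ℂ → ℂ} (H : PolyPath S p q Φ) (hgh : EqOn g h S) : Φ g = Φ h := by
  induction H with
  | refl hp => rfl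
  | step _ hs ih => beta_reduce; rw [ih, segInt_congr (hgh.mono hs)]

theorem add_mul {g h : ℂ → ℂ} (H : PolyPath S p q Φ) (c : ℂ) (hg : ContinuousOn g S)
    (hh : ContinuousOn h S) : Φ (fun z => g z + c * h z) = Φ g + c * Φ h := by
  induction H with
  | refl hp => simp
  | step _ hs ih =>
    beta_reduce
    rw [ih, segInt_add_mul c (hg.mono hs) (hh.mono hs)]
    ring

theorem zero (H : PolyPath S p q Φ) : Φ (fun _ => 0) = 0 := by
  induction H with
  | refl hp => simp
  | step _ hs ih => beta_reduce; rw [ih]; simp [segInt]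

theorem eq_sub {g G : ℂ → ℂ} (H : PolyPath S p q Φ) (hg : ContinuousOn g S)
    (hG : ∀ z ∈ S, HasDerivAt G (g z) z) : Φ g = G q - G p := by
  induction H with
  | refl hp => simp
  | step _ hs ih =>
    beta_reduce
    rw [ih, segInt_of_hasDerivAt (hg.mono hs) fun z hz => hG z (hs hz)]
    ring

theorem exp_mul {h ξ : ℂ → ℂ} (H : PolyPath S p q Φ) (hh : ContinuousOn h S)
    (hξ : ∀ z ∈ S, HasDerivAt ξ (h z * ξ z) z) : exp (Φ h) * ξ p = ξ q := by
  induction H with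
  | refl hp => simp
  | step _ hs ih =>
    rw [exp_add, mul_right_comm, ih, mul_comm, exp_segInt (hh.mono hs) fun z hz => hξ z (hs hz)]

end PolyPath

theorem segInt_integral_swap {w : ℂ → ℂ} (hw : Continuous w) (hc : HasCompactSupport w) {p q : ℂ}
    (hd : Disjoint (tsupport w) (segment ℝ p q)) :
    Integrable (fun ζ => w ζ * segInt (fun z => 1 / (z - ζ)) p q) ∧
    segInt (fun z => ∫ ζ, w ζ / (z - ζ)) p q =
      ∫ ζ, w ζ * segInt (fun z => 1 / (z - ζ)) p q := by
  have hne : ∀ t ∈ Icc (0 : ℝ) 1, ∀ ζ ∈ tsupport w, p + t * (q - p) - ζ ≠ 0 := by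
    intro t ht ζ hζ h
    rw [sub_eq_zero] at h
    exact disjoint_left.1 hd hζ (h ▸ segment_param_mem ht)
  set F : ℝ → ℂ → ℂ := fun t ζ => w ζ / (p + t * (q - p) - ζ) * (q - p) with hF
  have hFI : Integrable (Function.uncurry F)
      ((volume.restrict (Set.uIoc (0 : ℝ) 1)).prod volume) := by
    rw [uIoc_of_le zero_le_one]
    have h1 : IntegrableOn (Function.uncurry F) (Icc (0 : ℝ) 1 ×ˢ tsupport w) := by
      apply ContinuousOn.integrableOn_compact (isCompact_Icc.prod hc)
      apply ContinuousOn.mul _ continuousOn_const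
      apply ContinuousOn.div (by fun_prop) (by fun_prop)
      rintro ⟨t, ζ⟩ ⟨ht, hζ⟩
      exact hne t ht ζ hζ
    have h2 : IntegrableOn (Function.uncurry F) (Ioc (0 : ℝ) 1 ×ˢ univ) := by
      refine h1.of_forall_sdiff_eq_zero (by measurability) ?_
      rintro ⟨t, ζ⟩ ⟨⟨ht, _⟩, h⟩
      have : ζ ∉ tsupport w := fun hζ => h ⟨Ioc_subset_Icc_self ht, hζ⟩
      simp [Function.uncurry, F, image_eq_zero_of_notMem_tsupport this]
    rwa [IntegrableOn, Measure.volume_eq_prod, ← Measure.prod_restrict, Measure.restrict_univ] at h2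
  have hs : ∀ ζ, ∫ t in (0 : ℝ)..1, F t ζ = w ζ * segInt (fun z => 1 / (z - ζ)) p q := by
    intro ζ
    rw [segInt, ← intervalIntegral.integral_const_mul]
    congr 1
    ext t
    simp only [hF]
    ring
  constructor
  · have := hFI.integral_prod_right
    refine this.congr (Eventually.of_forall fun ζ => ?_)
    simp only [← hs, intervalIntegral.integral_of_le (zero_le_one' ℝ), uIoc_of_le (zero_le_one' ℝ)]
    rfl
  · rw [← integral_congr_ae (Eventually.of_forall hs), ← intervalIntegral_integral_swap hFI, segInt]
    congr 1
    ext t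
    rw [← integral_mul_const]

namespace PolyPath

variable {S T U : Set ℂ} {p q r : ℂ} {Φ Ψ : (ℂ → ℂ) → ℂ}

theorem integral_swap (H : PolyPath S p q Φ) {w : ℂ → ℂ} (hw : Continuous w)
    (hc : HasCompactSupport w) (hd : Disjoint (tsupport w) S) :
    Integrable (fun ζ => w ζ * Φ (fun z => 1 / (z - ζ))) ∧
    Φ (fun z => ∫ ζ, w ζ / (z - ζ)) = ∫ ζ, w ζ * Φ (fun z => 1 / (z - ζ)) := by
  induction H with
  | refl hp => simp
  | step _ hs ih =>
    obtain ⟨h1, h2⟩ := segInt_integral_swap hw hc (hd.mono_right hs)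
    constructor
    · simp only [mul_add]
      exact ih.1.add h1
    · simp only [mul_add]
      rw [integral_add ih.1 h1, ih.2, h2]

/-- The winding function of a closed path (times `2 * π * I`). -/
theorem exp_winding (H : PolyPath S p p Φ) {ζ : ℂ} (hζ : ζ ∉ S) :
    exp (Φ fun z => 1 / (z - ζ)) = 1 := by
  have hne : ∀ z ∈ S, z - ζ ≠ 0 := fun z hz h => hζ (sub_eq_zero.1 h ▸ hz)
  have := H.exp_mul (h := fun z => 1 / (z - ζ)) (ξ := fun z => z - ζ)
    (ContinuousOn.div continuousOn_const (by fun_prop) hne) fun z hz => by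
      rw [one_div, inv_mul_cancel₀ (hne z hz)]
      exact (hasDerivAt_id z).sub_const ζ
  exact mul_right_cancel₀ (hne p H.source_mem) (by rw [this, one_mul])

theorem winding_eq_of_dist (H : PolyPath S p p Φ) {ζ ζ₀ : ℂ} {ε : ℝ}
    (h0 : ∀ z ∈ S, ε ≤ dist z ζ₀) (hζ : dist ζ ζ₀ < ε) :
    (Φ fun z => 1 / (z - ζ)) = Φ fun z => 1 / (z - ζ₀) := by
  have hε : 0 < ε := dist_nonneg.trans_lt hζ
  have hne0 : ∀ z ∈ S, z - ζ₀ ≠ 0 := fun z hz h => by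
    have := h0 z hz
    rw [dist_eq_norm, h, norm_zero] at this
    linarith
  have hne : ∀ z ∈ S, z - ζ ≠ 0 := fun z hz h => by
    have := h0 z hz
    rw [sub_eq_zero.1 h] at this
    linarith
  have hc : ContinuousOn (fun z => 1 / (z - ζ)) S :=
    ContinuousOn.div continuousOn_const (by fun_prop) hne
  have hc0 : ContinuousOn (fun z => 1 / (z - ζ₀)) S :=
    ContinuousOn.div continuousOn_const (by fun_prop) hne0
  have h1 := H.eq_sub (g := fun z => 1 / (z - ζ) + (-1) * (1 / (z - ζ₀)))
    (G := fun z => log ((z - ζ) / (z - ζ₀))) (hc.add (hc0.const_smul (-1 : ℂ))) fun z hz => by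
      have hs : (z - ζ) / (z - ζ₀) ∈ slitPlane := by
        have : (z - ζ) / (z - ζ₀) = 1 + (ζ₀ - ζ) / (z - ζ₀) := by
          have := hne0 z hz
          field_simp
          ring
        rw [this]
        apply mem_slitPlane_of_norm_lt_one
        rw [norm_div, div_lt_one (norm_pos_iff.2 (hne0 z hz)), ← dist_eq_norm, ← dist_eq_norm,
          dist_comm ζ₀]
        exact hζ.trans_le (h0 z hz)
      have hd := (((hasDerivAt_id z).sub_const ζ).div ((hasDerivAt_id z).sub_const ζ₀)
        (hne0 z hz)).clog hs
      refine hd.congr_deriv ?_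
      have := hne0 z hz
      have := hne z hz
      simp only [id, Pi.div_apply]
      field_simp
      ring
  rw [sub_self, H.add_mul _ hc hc0] at h1
  linear_combination h1

theorem winding_eq_zero_of_far (H : PolyPath S p p Φ) {ζ : ℂ} {R : ℝ}
    (h0 : ∀ z ∈ S, ‖z‖ < R) (hζ : R ≤ ‖ζ‖) : (Φ fun z => 1 / (z - ζ)) = 0 := by
  have hζ0 : ζ ≠ 0 := fun h => by
    have := (norm_nonneg p).trans_lt (h0 p H.source_mem)
    rw [h, norm_zero] at hζ
    linarith
  have hne : ∀ z ∈ S, z - ζ ≠ 0 := fun z hz h => by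
    have := h0 z hz
    rw [sub_eq_zero.1 h] at this
    linarith
  rw [H.eq_sub (g := fun z => 1 / (z - ζ)) (G := fun z => log (1 + -z / ζ))
    (ContinuousOn.div continuousOn_const (by fun_prop) hne), sub_self]
  intro z hz
  have hs : 1 + -z / ζ ∈ slitPlane := by
    apply mem_slitPlane_of_norm_lt_one
    rw [norm_div, norm_neg, div_lt_one (norm_pos_iff.2 hζ0)]
    exact (h0 z hz).trans_le hζ
  have hd := (((hasDerivAt_id z).neg.div_const ζ).const_add 1).clog hs
  refine hd.congr_deriv ?_
  have h1 := hne z hz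
  have h2 : ζ - z ≠ 0 := fun h => h1 (by linear_combination -h)
  simp only [id, Pi.neg_apply]
  rw [show 1 + -z / ζ = (ζ - z) / ζ by field_simp; ring]
  field_simp
  ring

theorem winding_eq_of_isPreconnected (H : PolyPath S p p Φ) (hS : IsClosed S) {E : Set ℂ}
    (hE : IsPreconnected E) (hES : Disjoint E S) {ζ ζ₀ : ℂ} (hζ : ζ ∈ E) (hζ₀ : ζ₀ ∈ E) :
    (Φ fun z => 1 / (z - ζ)) = Φ fun z => 1 / (z - ζ₀) := by
  set W : ℂ → ℂ := fun ζ => Φ fun z => 1 / (z - ζ) with hW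
  have hloc : ∀ ζ ∈ Sᶜ, ∀ᶠ η in 𝓝 ζ, W η = W ζ ∧ η ∈ Sᶜ := by
    intro ζ hζ
    obtain ⟨ε, hε, hb⟩ := Metric.isOpen_iff.1 hS.isOpen_compl ζ hζ
    filter_upwards [ball_mem_nhds ζ hε] with η hη
    refine ⟨H.winding_eq_of_dist (fun z hz => ?_) hη, hb hη⟩
    by_contra h
    exact hb (mem_ball.2 (not_le.1 h)) hz
  have ho (P : ℂ → Prop) : IsOpen {ζ | ζ ∈ Sᶜ ∧ P (W ζ)} := by
    rw [isOpen_iff_mem_nhds]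
    rintro ζ ⟨h1, h2⟩
    filter_upwards [hloc ζ h1] with η hη
    exact ⟨hη.2, hη.1 ▸ h2⟩
  have := hE.subset_left_of_subset_union (ho fun c => c = W ζ₀) (ho fun c => c ≠ W ζ₀)
    (disjoint_left.2 fun x h1 h2 => h2.2 h1.2) (fun x hx => by
      have hx' : x ∈ Sᶜ := disjoint_left.1 hES hx
      by_cases h : W x = W ζ₀
      · exact Or.inl ⟨hx', h⟩
      · exact Or.inr ⟨hx', h⟩) ⟨ζ₀, hζ₀, disjoint_left.1 hES hζ₀, rfl⟩
  exact (this hζ).2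

/-- Cauchy's formula for a path, by means of a cutoff function equal to one near the path. -/
theorem eq_integral_dbar (H : PolyPath S p q Φ) (hU : IsOpen U) (hSU : S ⊆ U)
    {K : Set ℂ} (hK : IsCompact K) (hKU : K ⊆ U) {X : ℂ → ℂ} (hX : ContDiffOn ℝ 1 X U)
    (hX0 : ∀ z ∈ U \ K, X z = 0) (hX1 : ∀ z ∈ S, ∀ᶠ w in 𝓝 z, X w = 1)
    {g : ℂ → ℂ} (hg : DifferentiableOn ℂ g U) :
    Real.pi * Φ g = ∫ ζ in U, dbar X ζ * g ζ * Φ (fun z => 1 / (z - ζ)) := by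
  have hgC : ContDiffOn ℝ 1 g U := (hg.contDiffOn hU).restrict_scalars ℝ
  obtain ⟨h1, h2, h3⟩ := contDiff_indicator (u := fun z => X z * g z) hU hK hKU (hX.mul hgC)
    fun z hz => by simp [hX0 z hz]
  set u := U.indicator fun z => X z * g z with hu
  have hXd : ∀ z ∈ U, DifferentiableAt ℝ X z := fun z hz =>
    (hX.differentiableOn one_ne_zero).differentiableAt (hU.mem_nhds hz)
  have hgd : ∀ z ∈ U, DifferentiableAt ℂ g z := fun z hz => hg.differentiableAt (hU.mem_nhds hz)
  have hdu : dbar u = U.indicator fun ζ => dbar X ζ * g ζ := by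
    rw [h3]
    refine indicator_congr fun z hz => dbar_mul_right (hXd z hz) (hgd z hz)
  have hug : EqOn u g S := fun z hz => by
    rw [hu, indicator_of_mem (hSU hz), (hX1 z hz).self_of_nhds, one_mul]
  have hdis : Disjoint (tsupport (dbar u)) S := by
    rw [disjoint_right]
    intro z hz hz'
    refine (notMem_tsupport_iff_eventuallyEq.2 ?_) hz'
    have hX1' := (hX1 z hz).eventually_nhds
    filter_upwards [hX1', hU.mem_nhds (hSU hz)] with ζ hζ hζU
    rw [hdu, indicator_of_mem hζU, dbar_congr (v := fun _ => 1) hζ,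
      dbar_of_differentiableAt (differentiableAt_const _)]
    simp
  have hsw := (H.integral_swap (continuous_dbar h1) (hasCompactSupport_dbar h2) hdis).2
  have hpi : (fun z => ∫ ζ, dbar u ζ / (z - ζ)) = fun z => 0 + (Real.pi : ℂ) * u z := by
    funext z
    rw [integral_dbar_div_sub h1 h2, zero_add]
  rw [hpi, H.add_mul _ continuousOn_const h1.continuous.continuousOn, H.zero, zero_add,
    H.congr hug] at hsw
  rw [hsw, ← integral_indicator hU.measurableSet]
  congr 1
  funext ζ
  rw [hdu]
  by_cases h : ζ ∈ U
  · simp [indicator_of_mem h]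
  · simp [indicator_of_notMem h]

/-- A locally coherent choice of integration functionals on an open set. -/
theorem exists_coherent (hU : IsOpen U) :
    ∃ T : ℂ → (ℂ → ℂ) → ℂ, ∀ z₀ ∈ U, ∀ᶠ z in 𝓝 z₀, ∃ p, ∃ Ψ, PolyPath U p p Ψ ∧
      segment ℝ z₀ z ⊆ U ∧ ∀ g, T z g = T z₀ g + segInt g z₀ z + Ψ g := by
  classical
  let s : Setoid U := ⟨fun a b => ∃ Φ, PolyPath U a b Φ,
    ⟨fun a => ⟨_, refl a.2⟩, fun ⟨_, h⟩ => ⟨_, h.symm⟩, fun ⟨_, h⟩ ⟨_, h'⟩ => ⟨_, h.trans h'⟩⟩⟩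
  have hrep : ∀ a : U, ∃ Φ, PolyPath U ((Quotient.mk s a).out : U) a Φ := fun a =>
    Quotient.mk_out (s := s) a
  choose F hF using hrep
  refine ⟨fun z => if h : z ∈ U then F ⟨z, h⟩ else fun _ => 0, fun z₀ hz₀ => ?_⟩
  obtain ⟨ε, hε, hb⟩ := Metric.isOpen_iff.1 hU z₀ hz₀
  filter_upwards [ball_mem_nhds z₀ hε] with z hz
  have hseg : segment ℝ z₀ z ⊆ U :=
    ((convex_ball z₀ ε).segment_subset (mem_ball_self hε) hz).trans hb
  have hzU := hb hz
  have hcls : Quotient.mk s ⟨z, hzU⟩ = Quotient.mk s ⟨z₀, hz₀⟩ :=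
    (Quotient.sound (s := s) (⟨_, seg hseg⟩ : ∃ Φ, PolyPath U z₀ z Φ)).symm
  have h1 := hF ⟨z₀, hz₀⟩
  have h2 := hF ⟨z, hzU⟩
  rw [hcls] at h2
  have h3 := (((h1.trans (seg hseg)).trans h2.symm)).symm
  refine ⟨_, _, h3, hseg, fun g => ?_⟩
  simp only [dif_pos hzU, dif_pos hz₀]
  ring

/-- A holomorphic function all of whose periods vanish has a primitive. -/
theorem exists_primitive (hU : IsOpen U) {g : ℂ → ℂ} (hg : DifferentiableOn ℂ g U)
    (hper : ∀ p Ψ, PolyPath U p p Ψ → Ψ g = 0) : ∃ G : ℂ → ℂ, ∀ z ∈ U, HasDerivAt G (g z) z := by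
  obtain ⟨T, hT⟩ := exists_coherent hU
  refine ⟨fun z => T z g, fun z₀ hz₀ => ?_⟩
  obtain ⟨ε, hε, hb⟩ := Metric.isOpen_iff.1 hU z₀ hz₀
  obtain ⟨H, hH⟩ := (hg.mono hb).isExactOn_ball
  have h1 : HasDerivAt (fun z => T z₀ g + (H z - H z₀)) (g z₀) z₀ :=
    ((hH z₀ (mem_ball_self hε)).sub_const _).const_add _
  refine h1.congr_of_eventuallyEq ?_
  filter_upwards [hT z₀ hz₀, ball_mem_nhds z₀ hε] with z ⟨p, Ψ, hΨ, _, hz⟩ hzb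
  have hseg := (convex_ball z₀ ε).segment_subset (mem_ball_self hε) hzb
  rw [hz, hper p Ψ hΨ, add_zero, segInt_of_hasDerivAt ((hg.continuousOn.mono hb).mono hseg)
    fun w hw => hH w (hseg hw)]

/-- A holomorphic function all of whose periods lie in `2 * π * I * ℤ` is a logarithmic derivative. -/
theorem exists_exp_primitive (hU : IsOpen U) {h : ℂ → ℂ} (hh : DifferentiableOn ℂ h U)
    (hper : ∀ p Ψ, PolyPath U p p Ψ → exp (Ψ h) = 1) :
    ∃ ξ : ℂ → ℂ, ∀ z ∈ U, ξ z ≠ 0 ∧ HasDerivAt ξ (h z * ξ z) z := by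
  obtain ⟨T, hT⟩ := exists_coherent hU
  refine ⟨fun z => exp (T z h), fun z₀ hz₀ => ⟨exp_ne_zero _, ?_⟩⟩
  obtain ⟨ε, hε, hb⟩ := Metric.isOpen_iff.1 hU z₀ hz₀
  obtain ⟨H, hH⟩ := (hh.mono hb).isExactOn_ball
  have h1 : HasDerivAt (fun z => exp (T z₀ h) * exp (H z - H z₀)) (h z₀ * exp (T z₀ h)) z₀ := by
    refine (((hH z₀ (mem_ball_self hε)).sub_const _).cexp.const_mul _).congr_deriv ?_
    simp [mul_comm]
  refine h1.congr_of_eventuallyEq ?_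
  filter_upwards [hT z₀ hz₀, ball_mem_nhds z₀ hε] with z ⟨p, Ψ, hΨ, _, hz⟩ hzb
  have hseg := (convex_ball z₀ ε).segment_subset (mem_ball_self hε) hzb
  rw [hz, exp_add, exp_add, hper p Ψ hΨ, mul_one,
    segInt_of_hasDerivAt ((hh.continuousOn.mono hb).mono hseg) fun w hw => hH w (hseg hw)]

theorem exists_of_isPreconnected (hU : IsOpen U) (hc : IsPreconnected U) (hp : p ∈ U)
    (hq : q ∈ U) : ∃ Φ, PolyPath U p q Φ := by
  have hstep : ∀ z ∈ U, ∀ᶠ w in 𝓝 z, segment ℝ z w ⊆ U := by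
    intro z hz
    obtain ⟨ε, hε, hb⟩ := Metric.isOpen_iff.1 hU z hz
    filter_upwards [ball_mem_nhds z hε] with w hw
    exact ((convex_ball z ε).segment_subset (mem_ball_self hε) hw).trans hb
  have := hc.subset_left_of_subset_union (u := {z | ∃ Φ, PolyPath U p z Φ})
    (v := {z | z ∈ U ∧ ¬ ∃ Φ, PolyPath U p z Φ}) ?_ ?_
    (disjoint_left.2 fun x h1 h2 => h2.2 h1) (fun x hx => by
      by_cases h : ∃ Φ, PolyPath U p x Φ
      · exact Or.inl h
      · exact Or.inr ⟨hx, h⟩) ⟨p, hp, _, refl hp⟩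
  · exact this hq
  · rw [isOpen_iff_mem_nhds]
    rintro z ⟨Φ, h⟩
    filter_upwards [hstep z h.target_mem] with w hw using ⟨_, step h hw⟩
  · rw [isOpen_iff_mem_nhds]
    rintro z ⟨hz, h⟩
    filter_upwards [hstep z hz, hU.mem_nhds hz] with w hw hwU
    refine ⟨hwU, fun ⟨Φ, h'⟩ => h ⟨_, step h' (segment_symm ℝ z w ▸ hw)⟩⟩

end PolyPath

section

/-- A `C¹` cutoff function. -/
theorem exists_cutoff {K U : Set ℂ} (hK : IsCompact K) (hU : IsOpen U) (hKU : K ⊆ U) :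
    ∃ (X : ℂ → ℂ) (K' : Set ℂ), ContDiff ℝ 1 X ∧ IsCompact K' ∧ K' ⊆ U ∧ (∀ z ∉ K', X z = 0) ∧
      (∀ z ∈ K, ∀ᶠ w in 𝓝 z, X w = 1) ∧ ∀ z, ‖X z‖ ≤ 1 := by
  obtain ⟨K', hK', h1, h2⟩ := exists_compact_between hK hU hKU
  obtain ⟨f, hf1, hf2, hf3⟩ := exists_contMDiffMap_one_nhds_of_subset_interior (n := 1)
    (modelWithCornersSelf ℝ ℂ) hK.isClosed h1
  refine ⟨fun z => (f z : ℂ), K', ?_, hK', h2, fun z hz => by simp [hf2 z hz], fun z hz => ?_,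
    fun z => ?_⟩
  · exact ofRealCLM.contDiff.comp f.contMDiff.contDiff
  · filter_upwards [eventually_nhdsSet_iff_forall.1 hf1 z hz] with w hw
    simp [hw]
  · rw [norm_real, Real.norm_eq_abs, abs_of_nonneg (hf3 z).1]
    exact (hf3 z).2

open PolyPath

/-- Winding numbers are locally constant off the carrier. -/
theorem PolyPath.continuousOn_winding {S : Set ℂ} {p : ℂ} {Φ : (ℂ → ℂ) → ℂ}
    (H : PolyPath S p p Φ) (hS : IsClosed S) :
    ContinuousOn (fun ζ => Φ fun z => 1 / (z - ζ)) Sᶜ := by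
  intro ζ₀ hζ₀
  obtain ⟨ε, hε, hb⟩ := Metric.isOpen_iff.1 hS.isOpen_compl ζ₀ hζ₀
  refine ContinuousAt.continuousWithinAt (continuousAt_const.congr (f := fun _ => Φ fun z => 1 / (z - ζ₀)) ?_)
  filter_upwards [ball_mem_nhds ζ₀ hε] with ζ hζ
  refine (H.winding_eq_of_dist (fun z hz => ?_) hζ).symm
  by_contra! h
  exact hb h hz

theorem PolyPath.integrableOn_dbar_mul {S U K : Set ℂ} {p : ℂ} {Φ : (ℂ → ℂ) → ℂ}
    (H : PolyPath S p p Φ) (hS : IsCompact S) (hU : IsOpen U) (hK : IsCompact K) (hKU : K ⊆ U)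
    {X : ℂ → ℂ} (hX : ContDiff ℝ 1 X) (hX0 : ∀ z ∉ K, X z = 0)
    (hX1 : ∀ z ∈ S, ∀ᶠ w in 𝓝 z, X w = 1) {g : ℂ → ℂ} (hg : ContinuousOn g U) :
    IntegrableOn (fun ζ => dbar X ζ * g ζ * Φ (fun z => 1 / (z - ζ))) U := by
  have hz : ∀ ζ ∉ K, dbar X ζ = 0 := fun ζ hζ => by
    rw [dbar_congr (v := fun _ => 0)
      (eventually_of_mem (hK.isClosed.isOpen_compl.mem_nhds hζ) fun w hw => hX0 w hw)]
    simp [dbar]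
  set C := tsupport (dbar X)
  have hCK : C ⊆ K := closure_minimal (fun ζ hζ => by
    by_contra h
    exact hζ (hz ζ h)) hK.isClosed
  have hCS : C ⊆ Sᶜ := fun ζ hζ hS' => by
    refine (notMem_tsupport_iff_eventuallyEq.2 ?_) hζ
    filter_upwards [(hX1 ζ hS').eventually_nhds] with w hw
    rw [dbar_congr (v := fun _ => 1) hw]
    simp [dbar]
  have hCc : IsCompact C := hK.of_isClosed_subset (isClosed_tsupport _) hCK
  have h1 : IntegrableOn (fun ζ => dbar X ζ * g ζ * Φ (fun z => 1 / (z - ζ))) C := by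
    refine ContinuousOn.integrableOn_compact hCc ?_
    exact ((continuous_dbar hX).continuousOn.mul (hg.mono (hCK.trans hKU))).mul
      ((H.continuousOn_winding hS.isClosed).mono hCS)
  refine h1.of_forall_sdiff_eq_zero hU.measurableSet fun ζ hζ => ?_
  rw [image_eq_zero_of_notMem_tsupport hζ.2]
  ring

/-- Periods of holomorphic functions on a finitely connected open
set are determined by finitely many of them. -/
theorem exists_finite_periods {U : Set ℂ} (hU : IsOpen U)
    (hfin : {C : Set ℂ | ∃ x ∈ Uᶜ, C = connectedComponentIn Uᶜ x}.Finite) :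
    ∃ s : Set ((ℂ → ℂ) → ℂ), s.Finite ∧ (∀ Φ ∈ s, ∃ p, PolyPath U p p Φ) ∧
      ∀ g : ℂ → ℂ, DifferentiableOn ℂ g U → (∀ Φ ∈ s, Φ g = 0) →
        ∀ p Ψ, PolyPath U p p Ψ → Ψ g = 0 := by
  classical
  set 𝒞 := {C : Set ℂ | ∃ x ∈ Uᶜ, C = connectedComponentIn Uᶜ x} with h𝒞
  have : Finite 𝒞 := hfin
  have : Fintype 𝒞 := Fintype.ofFinite _
  have hrep : ∀ C : 𝒞, ∃ e ∈ Uᶜ, (C : Set ℂ) = connectedComponentIn Uᶜ e := fun C => C.2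
  choose e he1 he2 using hrep
  let nv : ((ℂ → ℂ) → ℂ) → (𝒞 → ℂ) := fun Φ C => Φ fun z => 1 / (z - e C)
  let T : Set ((ℂ → ℂ) → ℂ) := {Φ | ∃ p, PolyPath U p p Φ}
  obtain ⟨b, hb1, hb2, hb3⟩ := exists_linearIndependent ℂ (nv '' T)
  have hbf : b.Finite := hb3.setFinite
  have hch : ∀ v : (𝒞 → ℂ), ∃ Φ : (ℂ → ℂ) → ℂ, v ∈ b → Φ ∈ T ∧ nv Φ = v := by
    intro v
    by_cases hv : v ∈ b
    · obtain ⟨Φ, h1, h2⟩ := hb1 hv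
      exact ⟨Φ, fun _ => ⟨h1, h2⟩⟩
    · exact ⟨fun _ => 0, fun h => absurd h hv⟩
  choose F hF using hch
  refine ⟨F '' b, hbf.image F, ?_, ?_⟩
  · rintro _ ⟨v, hv, rfl⟩
    exact (hF v hv).1
  intro g hg hg0 p Ψ hΨ
  have hmem : nv Ψ ∈ Submodule.span ℂ b := by
    rw [hb2]
    exact Submodule.subset_span ⟨Ψ, ⟨p, hΨ⟩, rfl⟩
  lift b to Finset (𝒞 → ℂ) using hbf
  obtain ⟨c, -, hc⟩ := Submodule.mem_span_finset.1 hmem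
  -- compact carriers
  have hcar : ∀ v : (𝒞 → ℂ), ∃ (q : ℂ) (S : Set ℂ), v ∈ b → S ⊆ U ∧ IsCompact S ∧ PolyPath S q q (F v) := by
    intro v
    by_cases hv : v ∈ b
    · obtain ⟨q, hq⟩ := (hF v hv).1
      obtain ⟨S, h1, h2, h3⟩ := hq.exists_isCompact
      exact ⟨q, S, fun _ => ⟨h1, h2, h3⟩⟩
    · exact ⟨0, ∅, fun h => absurd h hv⟩
  choose q S hS using hcar
  obtain ⟨S0, hS01, hS02, hS03⟩ := hΨ.exists_isCompact
  set K := S0 ∪ ⋃ v ∈ b, S v with hKdef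
  have hKc : IsCompact K := hS02.union (b.finite_toSet.isCompact_biUnion fun v hv => (hS v hv).2.1)
  have hKU : K ⊆ U := union_subset hS01 (iUnion₂_subset fun v hv => (hS v hv).1)
  have hΨK : PolyPath K p p Ψ := hS03.mono subset_union_left
  have hFK : ∀ v ∈ b, PolyPath K (q v) (q v) (F v) := fun v hv => (hS v hv).2.2.mono
    ((subset_biUnion_of_mem (u := S) (show v ∈ (b : Set (𝒞 → ℂ)) from hv)).trans subset_union_right)
  obtain ⟨δ, hδ, hδU⟩ := hKc.exists_cthickening_subset_open hU hKU
  obtain ⟨R, hR⟩ := hKc.isBounded.subset_ball 0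
  set K0 := closedBall (0 : ℂ) R ∩ (thickening δ Uᶜ)ᶜ with hK0
  have hK0c : IsCompact K0 := (isCompact_closedBall _ _).inter_right isOpen_thickening.isClosed_compl
  have hK0U : K0 ⊆ U := fun z hz => by
    by_contra h
    exact hz.2 (self_subset_thickening hδ _ h)
  obtain ⟨X, K', hX1, hK', hK'U, hX0, hX2, -⟩ := exists_cutoff (hK0c.union hKc) hU
    (union_subset hK0U hKU)
  -- winding numbers of the combination vanish off `K0`
  have hdist : ∀ e' ∈ Uᶜ, ∀ z ∈ K, δ ≤ dist z e' := by
    intro e' he' z hz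
    by_contra! h
    exact he' (hδU (mem_cthickening_of_dist_le e' z δ K hz (by rw [dist_comm]; exact h.le)))
  have hwind : ∀ ζ ∈ U, ζ ∉ K0 → ∃ v : Option 𝒞, ∀ p' Φ, PolyPath K p' p' Φ →
      (Φ fun z => 1 / (z - ζ)) = v.elim 0 (nv Φ) := by
    intro ζ hζ hζ0
    by_cases hζR : ζ ∈ closedBall (0 : ℂ) R
    · have hth : ζ ∈ thickening δ Uᶜ := by
        by_contra h
        exact hζ0 ⟨hζR, h⟩
      obtain ⟨e', he', hd⟩ := mem_thickening_iff.1 hth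
      refine ⟨some ⟨connectedComponentIn Uᶜ e', e', he', rfl⟩, fun p' Φ hΦ => ?_⟩
      rw [hΦ.winding_eq_of_dist (hdist e' he') hd]
      set C : 𝒞 := ⟨connectedComponentIn Uᶜ e', e', he', rfl⟩
      have hsub := connectedComponentIn_subset Uᶜ e'
      refine hΦ.winding_eq_of_isPreconnected hKc.isClosed
        (isPreconnected_connectedComponentIn (F := Uᶜ) (x := e'))
        (disjoint_left.2 fun z hz hz' => hsub hz (hKU hz')) (mem_connectedComponentIn he') ?_
      rw [show connectedComponentIn Uᶜ e' = C from rfl, he2 C]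
      exact mem_connectedComponentIn (he1 C)
    · refine ⟨none, fun p' Φ hΦ => ?_⟩
      refine hΦ.winding_eq_zero_of_far (R := R) (fun z hz => by simpa using hR hz) ?_
      rw [mem_closedBall, dist_zero_right, not_le] at hζR
      exact hζR.le
  have key : ∀ p' Φ, PolyPath K p' p' Φ →
      Real.pi * Φ g = ∫ ζ in U, dbar X ζ * g ζ * Φ (fun z => 1 / (z - ζ)) := fun p' Φ hΦ =>
    hΦ.eq_integral_dbar hU hKU hK' hK'U hX1.contDiffOn (fun z hz => hX0 z hz.2)
      (fun z hz => hX2 z (Or.inr hz)) hg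
  have hintegr : ∀ p' Φ, PolyPath K p' p' Φ →
      IntegrableOn (fun ζ => dbar X ζ * g ζ * Φ (fun z => 1 / (z - ζ))) U := fun p' Φ hΦ =>
    hΦ.integrableOn_dbar_mul hKc hU hK' hK'U hX1 hX0 (fun z hz => hX2 z (Or.inr hz)) hg.continuousOn
  have hsum : ∀ ζ ∈ U, dbar X ζ * g ζ * Ψ (fun z => 1 / (z - ζ)) =
      ∑ v ∈ b, c v * (dbar X ζ * g ζ * F v (fun z => 1 / (z - ζ))) := by
    intro ζ hζ
    by_cases h0 : ζ ∈ K0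
    · rw [dbar_congr (hX2 ζ (Or.inl h0))]
      simp [dbar]
    · obtain ⟨o, ho⟩ := hwind ζ hζ h0
      have : (Ψ fun z => 1 / (z - ζ)) = ∑ v ∈ b, c v * F v (fun z => 1 / (z - ζ)) := by
        rw [ho p Ψ hΨK, Finset.sum_congr rfl fun v hv => by rw [ho (q v) (F v) (hFK v hv)]]
        cases o with
        | none => simp
        | some C =>
          simp only [Option.elim]
          rw [← hc, Finset.sum_apply]
          refine Finset.sum_congr rfl fun v hv => ?_
          rw [Pi.smul_apply, (hF v hv).2, smul_eq_mul]
      rw [this, Finset.mul_sum]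
      exact Finset.sum_congr rfl fun v _ => by ring
  have hfinal : Real.pi * Ψ g = 0 := by
    rw [key p Ψ hΨK, setIntegral_congr_fun hU.measurableSet hsum, integral_finsetSum]
    · refine Finset.sum_eq_zero fun v hv => ?_
      rw [integral_const_mul, ← key (q v) (F v) (hFK v hv), hg0 (F v) ⟨v, hv, rfl⟩]
      simp
    · exact fun v hv => (hintegr (q v) (F v) (hFK v hv)).const_mul _
  simpa [Real.pi_ne_zero] using hfinal

end

theorem exists_factor_pow {U : Set ℂ} (hU : IsOpen U) {φ : ℂ → ℂ} (hφ : DifferentiableOn ℂ φ U)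
    {a : ℂ} (ha : a ∈ U) (hne : ¬ ∀ᶠ w in 𝓝 a, φ w = 0) :
    ∃ (n : ℕ) (h : ℂ → ℂ), DifferentiableOn ℂ h U ∧ h a ≠ 0 ∧
      ∀ z ∈ U, φ z = (z - a) ^ n * h z := by
  have hA : AnalyticAt ℂ φ a := hφ.analyticAt (hU.mem_nhds ha)
  obtain ⟨n, g, hg, hga, hgeq⟩ := hA.exists_eventuallyEq_pow_smul_nonzero_iff.2 hne
  simp only [smul_eq_mul] at hgeq
  classical
  refine ⟨n, fun z => if z = a then g a else φ z / (z - a) ^ n, fun z hz => ?_, by simpa, ?_⟩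
  · refine DifferentiableAt.differentiableWithinAt ?_
    by_cases hza : z = a
    · subst hza
      refine hg.differentiableAt.congr_of_eventuallyEq ?_
      filter_upwards [hgeq] with w hw
      split_ifs with h
      · rw [h]
      · rw [hw, mul_div_cancel_left₀ _ (pow_ne_zero _ (sub_ne_zero.2 h))]
    · have h1 : DifferentiableAt ℂ (fun z => φ z / (z - a) ^ n) z :=
        (hφ.differentiableAt (hU.mem_nhds hz)).div (by fun_prop)
          (pow_ne_zero _ (sub_ne_zero.2 hza))
      refine h1.congr_of_eventuallyEq ?_
      filter_upwards [isOpen_ne.mem_nhds hza] with w hw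
      exact if_neg hw
  · intro z hz
    beta_reduce
    split_ifs with h
    · rw [h]
      exact hgeq.self_of_nhds
    · rw [mul_div_cancel₀ _ (pow_ne_zero _ (sub_ne_zero.2 h))]

theorem exists_factor {U : Set ℂ} (hU : IsOpen U) (s : Finset ℂ) : ∀ {φ : ℂ → ℂ},
    DifferentiableOn ℂ φ U → (∀ z ∈ U, φ z = 0 → z ∈ s) → (∀ z ∈ U, ¬ ∀ᶠ w in 𝓝 z, φ w = 0) →
    ∃ (L : Multiset ℂ) (h : ℂ → ℂ), DifferentiableOn ℂ h U ∧ (∀ z ∈ U, h z ≠ 0) ∧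
      (∀ a ∈ L, a ∈ U) ∧ ∀ z ∈ U, φ z = (L.map fun a => z - a).prod * h z := by
  classical
  induction s using Finset.induction_on with
  | empty =>
    intro φ hφ h0 _
    exact ⟨0, φ, hφ, fun z hz h => by simpa using h0 z hz h, by simp, by simp⟩
  | insert a s has ih =>
    intro φ hφ h0 hne
    by_cases ha : a ∈ U
    · obtain ⟨n, g, hg, hga, hgeq⟩ := exists_factor_pow hU hφ ha (hne a ha)
      obtain ⟨L, h, hh, hh0, hL, hLe⟩ := ih (φ := g) hg (fun z hz hgz => by
        have h1 := h0 z hz (by rw [hgeq z hz, hgz, mul_zero])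
        refine (Finset.mem_insert.1 h1).resolve_left fun h => hga (h ▸ hgz)) fun z hz hev => by
        refine hne z hz ?_
        filter_upwards [hev, hU.mem_nhds hz] with w hw hwU
        rw [hgeq w hwU, hw, mul_zero]
      refine ⟨Multiset.replicate n a + L, h, hh, hh0, ?_, fun z hz => ?_⟩
      · intro b hb
        rcases Multiset.mem_add.1 hb with hb | hb
        · rwa [Multiset.eq_of_mem_replicate hb]
        · exact hL b hb
      · rw [hgeq z hz, hLe z hz]
        simp [mul_assoc]
    · exact ih hφ (fun z hz hz0 => (Finset.mem_insert.1 (h0 z hz hz0)).resolve_left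
        fun h => ha (h ▸ hz)) hne

theorem logDeriv_prod_sub_mul {L : Multiset ℂ} {h : ℂ → ℂ} {z : ℂ} (hh : DifferentiableAt ℂ h z)
    (hh0 : h z ≠ 0) (hL : ∀ a ∈ L, z - a ≠ 0) :
    logDeriv (fun w => (L.map fun a => w - a).prod * h w) z =
      (L.map fun a => 1 / (z - a)).sum + logDeriv h z := by
  induction L using Multiset.induction_on with
  | empty => simp
  | cons a L ih =>
    have hL' : ∀ b ∈ L, z - b ≠ 0 := fun b hb => hL b (Multiset.mem_cons_of_mem hb)
    have hd : DifferentiableAt ℂ (fun w => (L.map fun a => w - a).prod) z := by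
      clear ih hL hL'
      induction L using Multiset.induction_on with
      | empty => simp
      | cons b L ih =>
        simp only [Multiset.map_cons, Multiset.prod_cons]
        exact DifferentiableAt.fun_mul (by fun_prop) ih
    have hne : (L.map fun a => z - a).prod ≠ 0 := by
      intro h0
      obtain ⟨b, hb, hb0⟩ := Multiset.mem_map.1 (Multiset.prod_eq_zero_iff.1 h0)
      exact hL b (Multiset.mem_cons_of_mem hb) hb0
    simp only [Multiset.map_cons, Multiset.prod_cons, mul_assoc, Multiset.sum_cons]
    rw [logDeriv_mul (f := fun w => w - a) (g := fun w => (L.map fun a => w - a).prod * h w) z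
      (hL a (Multiset.mem_cons_self a L)) (mul_ne_zero hne hh0) (by fun_prop)
      (hd.fun_mul hh), ih hL', add_assoc]
    congr 1
    simp [logDeriv]

theorem integral_dbar_mul_eq_zero {U K : Set ℂ} {u g : ℂ → ℂ} (hU : IsOpen U)
    (hK : IsCompact K) (hKU : K ⊆ U) (hu : ContDiffOn ℝ 1 u U) (h0 : ∀ z ∈ U \ K, u z = 0)
    (hg : DifferentiableOn ℂ g U) :
    IntegrableOn (fun z => dbar u z * g z) U ∧ ∫ z in U, dbar u z * g z = 0 := by
  have h1 : ContDiffOn ℝ 1 (fun z => u z * g z) U :=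
    hu.mul ((hg.contDiffOn hU).restrict_scalars ℝ)
  have h2 : ∀ z ∈ U \ K, u z * g z = 0 := fun z hz => by rw [h0 z hz, zero_mul]
  have h3 : EqOn (dbar fun z => u z * g z) (fun z => dbar u z * g z) U := fun z hz =>
    dbar_mul_right ((hu.differentiableOn one_ne_zero).differentiableAt (hU.mem_nhds hz))
      (hg.differentiableAt (hU.mem_nhds hz))
  exact ⟨(integrableOn_dbar hU hK hKU h1 h2).congr_fun h3 hU.measurableSet,
    (setIntegral_congr_fun hU.measurableSet h3).symm.trans
      (setIntegral_dbar_eq_zero hU hK hKU h1 h2)⟩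

/-- The argument principle in terms of a cutoff function. -/
theorem integral_dbar_mul_logDeriv {U K : Set ℂ} {u φ : ℂ → ℂ} (hU : IsOpen U)
    (hK : IsCompact K) (hKU : K ⊆ U) (hu : ContDiffOn ℝ 1 u U) (h0 : ∀ z ∈ U \ K, u z = 0)
    (hφ : DifferentiableOn ℂ φ U) (hfin : {z ∈ U | φ z = 0}.Finite)
    (hne : ∀ z ∈ U, ¬ ∀ᶠ w in 𝓝 z, φ w = 0)
    (hu1 : ∀ z ∈ U, φ z = 0 → ∀ᶠ w in 𝓝 z, u w = 1) :
    ∃ (L : Multiset ℂ) (h : ℂ → ℂ), DifferentiableOn ℂ h U ∧ (∀ z ∈ U, h z ≠ 0) ∧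
      (∀ a ∈ L, a ∈ U) ∧ (∀ z ∈ U, φ z = (L.map fun a => z - a).prod * h z) ∧
      ∫ z in U, dbar u z * logDeriv φ z = -(Real.pi * L.card) := by
  obtain ⟨L, h, hh, hh0, hL, hLe⟩ := exists_factor hU hfin.toFinset hφ
    (fun z hz h => hfin.mem_toFinset.2 ⟨hz, h⟩) hne
  refine ⟨L, h, hh, hh0, hL, hLe, ?_⟩
  have hz0 : ∀ a ∈ L, φ a = 0 := fun a ha => by
    rw [hLe a (hL a ha), Multiset.prod_eq_zero, zero_mul]
    exact Multiset.mem_map.2 ⟨a, ha, sub_self a⟩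
  obtain ⟨i1, i2⟩ := integral_dbar_mul_eq_zero (g := logDeriv h) hU hK hKU hu h0
    ((hh.deriv hU).div hh hh0)
  obtain ⟨c1, c2, c3⟩ := contDiff_indicator hU hK hKU hu h0
  have hsingle : ∀ a ∈ L, IntegrableOn (fun z => dbar u z * (1 / (z - a))) U ∧
      ∫ z in U, dbar u z * (1 / (z - a)) = -Real.pi := by
    intro a ha
    have e : (U.indicator fun z => dbar u z * (1 / (z - a))) =
        fun z => -(dbar (U.indicator u) z / (a - z)) := by
      ext z
      rw [c3]
      by_cases hz : z ∈ U
      · rw [indicator_of_mem hz, indicator_of_mem hz, ← neg_sub a z, div_neg, mul_neg, mul_one_div]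
      · simp [indicator_of_notMem hz]
    constructor
    · rw [← integrable_indicator_iff hU.measurableSet, e]
      refine (integrable_div_sub (continuous_dbar c1) ?_ a).neg
      exact hasCompactSupport_dbar c2
    · rw [← integral_indicator hU.measurableSet, e, integral_neg, integral_dbar_div_sub c1 c2,
        indicator_of_mem (hL a ha), (hu1 a (hL a ha) (hz0 a ha)).self_of_nhds, mul_one]
  have hpt : ∀ z ∈ U, dbar u z * logDeriv φ z =
      (L.map fun a => dbar u z * (1 / (z - a))).sum + dbar u z * logDeriv h z := by
    intro z hz
    by_cases hφz : φ z = 0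
    · rw [dbar_congr (hu1 z hz hφz)]
      simp [dbar]
    · have e1 : logDeriv φ z = logDeriv (fun w => (L.map fun a => w - a).prod * h w) z := by
        have : φ =ᶠ[𝓝 z] fun w => (L.map fun a => w - a).prod * h w :=
          eventually_of_mem (hU.mem_nhds hz) hLe
        simp only [logDeriv, Pi.div_apply, this.deriv_eq, this.self_of_nhds]
      rw [e1, logDeriv_prod_sub_mul (hh.differentiableAt (hU.mem_nhds hz)) (hh0 z hz)
        fun a ha h => hφz (by rw [sub_eq_zero.1 h]; exact hz0 a ha), mul_add,
        Multiset.sum_map_mul_left]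
  rw [setIntegral_congr_fun hU.measurableSet hpt]
  have hsum : IntegrableOn (fun z => (L.map fun a => dbar u z * (1 / (z - a))).sum) U ∧
      ∫ z in U, (L.map fun a => dbar u z * (1 / (z - a))).sum = -(Real.pi * L.card) := by
    clear hpt hz0 hLe hL
    induction L using Multiset.induction_on with
    | empty => simp
    | cons a L ih =>
      obtain ⟨j1, j2⟩ := ih fun b hb => hsingle b (Multiset.mem_cons_of_mem hb)
      obtain ⟨s1, s2⟩ := hsingle a (Multiset.mem_cons_self a L)
      simp only [Multiset.map_cons, Multiset.sum_cons, Multiset.card_cons]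
      refine ⟨s1.add j1, ?_⟩
      rw [integral_add s1 j1, s2, j2]
      push_cast
      ring
  rw [integral_add hsum.1 i1, hsum.2, i2, add_zero]

/-- Exact forms are annihilated by compactly supported radial weights. -/
theorem integral_radial_mul_deriv_eq_zero {U K : Set ℂ} {q : ℝ → ℝ} {ζ G : ℂ → ℂ} (hU : IsOpen U)
    (hK : IsCompact K) (hKU : K ⊆ U) (hq : ContDiff ℝ 1 q) (hζ : DifferentiableOn ℂ ζ U)
    (hζ0 : ∀ z ∈ U, ζ z ≠ 0) (h0 : ∀ z ∈ U \ K, q (‖ζ z‖ ^ 2) = 0)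
    (hG : DifferentiableOn ℂ G U) :
    ∫ z in U, ((q (‖ζ z‖ ^ 2) : ℝ) : ℂ) * conj (logDeriv ζ z) * deriv G z = 0 := by
  have hqc := contDiffOn_comp_norm_sq hq hU hζ
  have hL : DifferentiableOn ℂ (logDeriv ζ) U := (hζ.deriv hU).div hζ hζ0
  have hGc : ContDiffOn ℝ 1 (fun z => conj (G z)) U :=
    conjCLE.contDiff.comp_contDiffOn ((hG.contDiffOn hU).restrict_scalars ℝ)
  have hLc : ContDiffOn ℝ 1 (logDeriv ζ) U := (hL.contDiffOn hU).restrict_scalars ℝ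
  have hd1 : ∀ z ∈ U, DifferentiableAt ℝ (fun z => ((q (‖ζ z‖ ^ 2) : ℝ) : ℂ)) z := fun z hz =>
    (hqc.differentiableOn one_ne_zero).differentiableAt (hU.mem_nhds hz)
  have hd2 : ∀ z ∈ U, DifferentiableAt ℝ (fun z => conj (G z)) z := fun z hz =>
    (hGc.differentiableOn one_ne_zero).differentiableAt (hU.mem_nhds hz)
  have hdL : ∀ z ∈ U, DifferentiableAt ℂ (logDeriv ζ) z := fun z hz =>
    hL.differentiableAt (hU.mem_nhds hz)
  have hdq : ∀ z ∈ U, dbar (fun z => ((q (‖ζ z‖ ^ 2) : ℝ) : ℂ)) z =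
      (deriv q (‖ζ z‖ ^ 2) : ℝ) * (ζ z * conj (deriv ζ z)) := fun z hz =>
    dbar_comp_norm_sq (hq.differentiable one_ne_zero _) (hζ.differentiableAt (hU.mem_nhds hz))
  -- first integration by parts
  have A1 : ContDiffOn ℝ 1 (fun z => ((q (‖ζ z‖ ^ 2) : ℝ) : ℂ) * logDeriv ζ z * conj (G z)) U :=
    (hqc.mul hLc).mul hGc
  have A2 := setIntegral_dbar_eq_zero hU hK hKU A1 fun z hz => by simp [h0 z hz]
  have A3 := integrableOn_dbar hU hK hKU A1 fun z hz => by simp [h0 z hz]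
  obtain ⟨B1, B2⟩ := integral_dbar_mul_eq_zero hU hK hKU hqc (fun z hz => by simp [h0 z hz])
    (hL.mul hG)
  have hB : ∀ z ∈ U, dbar (fun z => ((q (‖ζ z‖ ^ 2) : ℝ) : ℂ)) z * (logDeriv ζ z * G z) =
      ((deriv q (‖ζ z‖ ^ 2) * ‖deriv ζ z‖ ^ 2 : ℝ) : ℂ) * G z := fun z hz => by
    rw [hdq z hz, logDeriv_apply]
    have := hζ0 z hz
    push_cast
    rw [← Complex.mul_conj']
    field_simp
  have hA : ∀ z ∈ U, dbar (fun z => ((q (‖ζ z‖ ^ 2) : ℝ) : ℂ) * logDeriv ζ z * conj (G z)) z =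
      conj (((deriv q (‖ζ z‖ ^ 2) * ‖deriv ζ z‖ ^ 2 : ℝ) : ℂ) * G z) +
        conj (((q (‖ζ z‖ ^ 2) : ℝ) : ℂ) * conj (logDeriv ζ z) * deriv G z) := fun z hz => by
    rw [dbar_mul (u := fun z => ((q (‖ζ z‖ ^ 2) : ℝ) : ℂ) * logDeriv ζ z)
      ((hd1 z hz).fun_mul ((hdL z hz).restrictScalars ℝ)) (hd2 z hz), dbar_mul_right (u := fun z => ((q (‖ζ z‖ ^ 2) : ℝ) : ℂ)) (hd1 z hz) (hdL z hz),
      dbar_conj (hG.differentiableAt (hU.mem_nhds hz)), hdq z hz]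
    simp only [map_mul, conj_ofReal, conj_conj]
    rw [add_comm]
    congr 1
    rw [logDeriv_apply]
    have := hζ0 z hz
    push_cast
    rw [← Complex.mul_conj']
    field_simp
  change ∫ z in U, dbar (fun z => ((q (‖ζ z‖ ^ 2) : ℝ) : ℂ)) z * (logDeriv ζ z * G z) = 0 at B2
  rw [setIntegral_congr_fun hU.measurableSet hA] at A2
  have A3' := A3.congr_fun hA hU.measurableSet
  have B1' := B1.congr_fun hB hU.measurableSet
  rw [setIntegral_congr_fun hU.measurableSet (g := fun z => ((deriv q (‖ζ z‖ ^ 2) * ‖deriv ζ z‖ ^ 2 : ℝ) : ℂ) * G z) hB] at B2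
  have C1 : IntegrableOn (fun z => conj (((deriv q (‖ζ z‖ ^ 2) * ‖deriv ζ z‖ ^ 2 : ℝ) : ℂ) * G z)) U :=
    (conjCLE.integrable_comp_iff (φ := fun z => ((deriv q (‖ζ z‖ ^ 2) * ‖deriv ζ z‖ ^ 2 : ℝ) : ℂ) * G z)).2 B1'
  have C2 : IntegrableOn (fun z => conj (((q (‖ζ z‖ ^ 2) : ℝ) : ℂ) * conj (logDeriv ζ z) * deriv G z)) U := by
    refine (A3'.sub C1).congr_fun (fun z hz => ?_) hU.measurableSet
    simp only [Pi.sub_apply, add_sub_cancel_left]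
  rw [integral_add C1 C2, integral_conj, B2, map_zero, zero_add, integral_conj] at A2
  exact (map_eq_zero_iff _ (starRingEnd ℂ).injective).1 A2

/-- The radial step function of `‖ζ‖²`. -/
def radStep (ζ : ℂ → ℂ) (a b : ℝ) (z : ℂ) : ℂ := ((stepFn a b (‖ζ z‖ ^ 2) : ℝ) : ℂ)

/-- The part of `U` where `a ≤ ‖ζ‖² ≤ b`. -/
def shell (U : Set ℂ) (ζ : ℂ → ℂ) (a b : ℝ) : Set ℂ := {z | z ∈ U ∧ a ≤ ‖ζ z‖ ^ 2 ∧ ‖ζ z‖ ^ 2 ≤ b}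

theorem shell_subset {U : Set ℂ} {ζ : ℂ → ℂ} {a b : ℝ} : shell U ζ a b ⊆ U := fun _ hz => hz.1

theorem shell_mono {U : Set ℂ} {ζ : ℂ → ℂ} {a b a' b' : ℝ} (ha : a ≤ a') (hb : b' ≤ b) :
    shell U ζ a' b' ⊆ shell U ζ a b := fun _ hz => ⟨hz.1, ha.trans hz.2.1, hz.2.2.trans hb⟩

theorem isCompact_shell_mono {U : Set ℂ} {ζ : ℂ → ℂ} {a b a' b' : ℝ} (hζ : ContinuousOn ζ U)
    (hK : IsCompact (shell U ζ a b)) (ha : a ≤ a') (hb : b' ≤ b) :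
    IsCompact (shell U ζ a' b') := by
  have e : shell U ζ a' b' = shell U ζ a b ∩ (fun z => ‖ζ z‖ ^ 2) ⁻¹' Icc a' b' := by
    ext z
    exact ⟨fun h => ⟨shell_mono ha hb h, h.2⟩, fun h => ⟨h.1.1, h.2⟩⟩
  have hc : ContinuousOn (fun z => ‖ζ z‖ ^ 2) (shell U ζ a b) := (hζ.mono shell_subset).norm.pow 2
  rw [e]
  exact hK.of_isClosed_subset (hc.preimage_isClosed_of_isClosed hK.isClosed isClosed_Icc)
    inter_subset_left

theorem radStep_contDiffOn {U : Set ℂ} (hU : IsOpen U) {ζ : ℂ → ℂ} (hζ : DifferentiableOn ℂ ζ U)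
    (a b : ℝ) : ContDiffOn ℝ 1 (radStep ζ a b) U :=
  contDiffOn_comp_norm_sq (stepFn_contDiff a b (n := 1)) hU hζ

theorem dbar_radStep {ζ : ℂ → ℂ} {z : ℂ} (hζ : DifferentiableAt ℂ ζ z) (a b : ℝ) :
    dbar (radStep ζ a b) z = (deriv (stepFn a b) (‖ζ z‖ ^ 2) : ℝ) * (ζ z * conj (deriv ζ z)) :=
  dbar_comp_norm_sq ((stepFn_contDiff a b (n := 1)).differentiable one_ne_zero _) hζ

theorem dbar_radStep_eq_zero {ζ : ℂ → ℂ} {z : ℂ} (hζ : DifferentiableAt ℂ ζ z) {a b : ℝ}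
    (hab : a < b) (hz : ¬ (a ≤ ‖ζ z‖ ^ 2 ∧ ‖ζ z‖ ^ 2 ≤ b)) : dbar (radStep ζ a b) z = 0 := by
  rw [dbar_radStep hζ]
  rcases not_and_or.1 hz with h | h
  · rw [deriv_stepFn_of_lt hab (not_le.1 h)]
    simp
  · rw [deriv_stepFn_of_gt hab (not_le.1 h)]
    simp

theorem continuousOn_dbar_radStep {U : Set ℂ} (hU : IsOpen U) {ζ : ℂ → ℂ}
    (hζ : DifferentiableOn ℂ ζ U) (a b : ℝ) : ContinuousOn (dbar (radStep ζ a b)) U :=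
  continuousOn_dbar hU (radStep_contDiffOn hU hζ a b)

theorem integrableOn_dbar_radStep_mul {U : Set ℂ} (hU : IsOpen U) {ζ g : ℂ → ℂ}
    (hζ : DifferentiableOn ℂ ζ U) {a b : ℝ} (hab : a < b)
    (hK : IsCompact (shell U ζ a b))
    (hg : ContinuousOn g (shell U ζ a b)) :
    IntegrableOn (fun z => dbar (radStep ζ a b) z * g z) U := by
  refine (ContinuousOn.integrableOn_compact hK (((continuousOn_dbar_radStep hU hζ a b).mono
    shell_subset).mul hg)).of_forall_sdiff_eq_zero hU.measurableSet fun z hz => ?_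
  rw [Pi.mul_apply, dbar_radStep_eq_zero (hζ.differentiableAt (hU.mem_nhds hz.1)) hab
    fun h => hz.2 ⟨hz.1, h⟩, zero_mul]

theorem integral_dbar_radStep_mul_deriv {U V : Set ℂ} (hU : IsOpen U) (hV : IsOpen V)
    (hVU : V ⊆ U) {ζ g G : ℂ → ℂ} (hζ : DifferentiableOn ℂ ζ U) (hζ0 : ∀ z ∈ U, ζ z ≠ 0)
    {a b : ℝ} (hab : a < b) (hK : IsCompact (shell U ζ a b))
    (hKV : shell U ζ a b ⊆ V)
    (hG : ∀ z ∈ V, HasDerivAt G (g z) z) :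
    ∫ z in U, dbar (radStep ζ a b) z * g z = 0 := by
  have h1 := integral_radial_mul_deriv_eq_zero (q := fun t => t * deriv (stepFn a b) t) (G := G)
    hV hK hKV (contDiff_id.mul (ContDiff.deriv' (n := 1) (stepFn_contDiff a b (n := 2))))
    (hζ.mono hVU) (fun z hz => hζ0 z (hVU hz)) (fun z hz => ?_)
    fun z hz => (hG z hz).differentiableAt.differentiableWithinAt
  · rw [← h1]
    have h2 : ∫ z in U, dbar (radStep ζ a b) z * g z = ∫ z in V, dbar (radStep ζ a b) z * g z := by
      refine setIntegral_eq_of_subset_of_forall_sdiff_eq_zero hU.measurableSet hVU fun z hz => ?_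
      rw [dbar_radStep_eq_zero (hζ.differentiableAt (hU.mem_nhds hz.1)) hab
        fun h => hz.2 (hKV ⟨hz.1, h⟩), zero_mul]
    rw [h2]
    refine setIntegral_congr_fun hV.measurableSet fun z hz => ?_
    rw [dbar_radStep (hζ.differentiableAt (hU.mem_nhds (hVU hz))), (hG z hz).deriv,
      logDeriv_apply, map_div₀]
    have h3 := hζ0 z (hVU hz)
    have h4 : conj (ζ z) ≠ 0 := (map_ne_zero _).2 h3
    push_cast
    rw [← Complex.mul_conj']
    field_simp
  · by_cases h : ‖ζ z‖ ^ 2 < a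
    · rw [deriv_stepFn_of_lt hab h, mul_zero]
    · rw [deriv_stepFn_of_gt hab, mul_zero]
      by_contra! h'
      exact hz.2 ⟨hVU hz.1, not_lt.1 h, h'⟩

theorem radStep_sub_eq_zero {ζ : ℂ → ℂ} {z : ℂ} {a b a' b' : ℝ} (hab : a < b) (hab' : a' < b')
    (hz : ¬ (min a a' ≤ ‖ζ z‖ ^ 2 ∧ ‖ζ z‖ ^ 2 ≤ max b b')) :
    radStep ζ a b z - radStep ζ a' b' z = 0 := by
  rw [radStep, radStep]
  rcases not_and_or.1 hz with h | h
  · rw [not_le, lt_min_iff] at h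
    rw [stepFn_of_le hab h.1.le, stepFn_of_le hab' h.2.le, sub_self]
  · rw [not_le, max_lt_iff] at h
    rw [stepFn_of_ge hab h.1.le, stepFn_of_ge hab' h.2.le, sub_self]

theorem dbar_radStep_sub {ζ : ℂ → ℂ} {z : ℂ} (hζ : DifferentiableAt ℂ ζ z) (a b a' b' : ℝ) :
    dbar (fun z => radStep ζ a b z - radStep ζ a' b' z) z =
      dbar (radStep ζ a b) z - dbar (radStep ζ a' b') z := by
  have (a b : ℝ) : DifferentiableAt ℝ (radStep ζ a b) z := by
    have h1 : DifferentiableAt ℝ (fun w => ‖ζ w‖ ^ 2) z := (hζ.restrictScalars ℝ).norm_sq ℝ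
    exact (ofRealCLM.differentiableAt.comp z
      (((stepFn_contDiff a b (n := 1)).differentiable one_ne_zero _).comp z h1))
  exact dbar_sub (this a b) (this a' b')

/-- The step can be moved without changing integrals against holomorphic functions. -/
theorem integral_dbar_radStep_mul_congr {U : Set ℂ} (hU : IsOpen U) {ζ g : ℂ → ℂ}
    (hζ : DifferentiableOn ℂ ζ U) {a b a' b' : ℝ} (hab : a < b) (hab' : a' < b')
    (hK : IsCompact (shell U ζ (min a a') (max b b')))
    (hg : DifferentiableOn ℂ g U) :
    ∫ z in U, dbar (radStep ζ a b) z * g z = ∫ z in U, dbar (radStep ζ a' b') z * g z := by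
  have hζc := hζ.continuousOn
  have h1 := integrableOn_dbar_radStep_mul hU hζ hab
    (isCompact_shell_mono hζc hK (min_le_left _ _) (le_max_left _ _))
    (hg.continuousOn.mono shell_subset)
  have h2 := integrableOn_dbar_radStep_mul hU hζ hab'
    (isCompact_shell_mono hζc hK (min_le_right _ _) (le_max_right _ _))
    (hg.continuousOn.mono shell_subset)
  have h3 := (integral_dbar_mul_eq_zero hU hK shell_subset
    ((radStep_contDiffOn hU hζ a b).sub (radStep_contDiffOn hU hζ a' b'))
    (fun z hz => radStep_sub_eq_zero hab hab' fun h => hz.2 ⟨hz.1, h⟩) hg).2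
  rw [← sub_eq_zero, ← integral_sub h1 h2, ← h3]
  refine setIntegral_congr_fun hU.measurableSet fun z hz => ?_
  rw [← sub_mul, ← dbar_radStep_sub (hζ.differentiableAt (hU.mem_nhds hz))]

theorem finite_fiber {U : Set ℂ} (hU : IsOpen U) {φ : ℂ → ℂ} (hφ : DifferentiableOn ℂ φ U)
    (hK : IsCompact {z | z ∈ U ∧ φ z = 0}) (hne : ∀ z ∈ U, ¬ ∀ᶠ w in 𝓝 z, φ w = 0) :
    {z | z ∈ U ∧ φ z = 0}.Finite := by
  by_contra hinf
  obtain ⟨z, hz, hacc⟩ := Set.Infinite.exists_accPt_of_subset_isCompact hinf hK Subset.rfl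
  have hA : AnalyticAt ℂ φ z := hφ.analyticAt (hU.mem_nhds hz.1)
  rcases hA.eventually_eq_zero_or_eventually_ne_zero with h | h
  · exact hne z hz.1 h
  · rw [accPt_iff_frequently_nhdsNE] at hacc
    exact hacc (h.mono fun w hw hw' => hw hw'.2)

/-- A proper holomorphic map to an annulus whose logarithmic derivative has period `2 * π * I` is
bijective. -/
theorem bijective_of_integral_logDeriv {U : Set ℂ} (hU : IsOpen U) {ζ : ℂ → ℂ}
    (hζ : DifferentiableOn ℂ ζ U) {ρ : ℝ} (hρ : 0 ≤ ρ)
    (hmap : ∀ z ∈ U, ρ < ‖ζ z‖ ^ 2 ∧ ‖ζ z‖ ^ 2 < 1)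
    (hK : ∀ s t, ρ < s → t < 1 → IsCompact (shell U ζ s t))
    (hne : ∀ z ∈ U, ¬ ∀ᶠ w in 𝓝 z, ζ w = ζ z) {a₀ b₀ : ℝ} (ha₀ : ρ < a₀) (hab₀ : a₀ < b₀)
    (hb₀ : b₀ < 1) (hJ : ∫ z in U, dbar (radStep ζ a₀ b₀) z * logDeriv ζ z = Real.pi)
    {ω : ℂ} (hω1 : ρ < ‖ω‖ ^ 2) (hω2 : ‖ω‖ ^ 2 < 1) :
    ∃ z ∈ U, ζ z = ω ∧ deriv ζ z ≠ 0 ∧ ∀ z' ∈ U, ζ z' = ω → z' = z := by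
  have hζc := hζ.continuousOn
  have hζ0 : ∀ z ∈ U, ζ z ≠ 0 := fun z hz h => by
    have := (hmap z hz).1
    rw [h] at this
    simp at this
    linarith
  have hω0 : ω ≠ 0 := fun h => by
    rw [h] at hω1
    simp at hω1
    linarith
  obtain ⟨a₁, ha₁, h1⟩ := exists_between hω1
  obtain ⟨b₁, hab₁, hb₁⟩ := exists_between h1
  obtain ⟨a₂, ha₂, h2⟩ := exists_between hω2
  obtain ⟨b₂, hab₂, hb₂⟩ := exists_between h2
  have hd : ∀ z ∈ U, HasDerivAt ζ (deriv ζ z) z := fun z hz =>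
    (hζ.differentiableAt (hU.mem_nhds hz)).hasDerivAt
  have hφ : DifferentiableOn ℂ (fun z => ζ z - ω) U := hζ.sub_const ω
  have hLφ : ∀ z, logDeriv (fun z => ζ z - ω) z = deriv ζ z / (ζ z - ω) := fun z => by
    rw [logDeriv_apply, deriv_sub_const]
  have hsqc : ContinuousOn (fun z => ‖ζ z‖ ^ 2) U := hζc.norm.pow 2
  -- inner circle
  have I1 : ∫ z in U, dbar (radStep ζ a₁ b₁) z * logDeriv (fun z => ζ z - ω) z = 0 := by
    refine integral_dbar_radStep_mul_deriv (V := U ∩ (fun z => ‖ζ z‖ ^ 2) ⁻¹' Iio (‖ω‖ ^ 2))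
      (G := fun z => log (1 - ζ z / ω)) hU (hsqc.isOpen_inter_preimage hU isOpen_Iio)
      inter_subset_left hζ hζ0 hab₁ (hK _ _ ha₁ (hb₁.trans hω2))
      (fun z hz => ⟨hz.1, hz.2.2.trans_lt hb₁⟩) fun z hz => ?_
    have hlt : ‖ζ z‖ < ‖ω‖ := lt_of_pow_lt_pow_left₀ 2 (norm_nonneg _) hz.2
    have hne' : ζ z - ω ≠ 0 := fun h => by
      rw [sub_eq_zero.1 h] at hlt
      exact lt_irrefl _ hlt
    have hs : 1 - ζ z / ω ∈ slitPlane := by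
      have : 1 + -(ζ z / ω) ∈ slitPlane := by
        refine mem_slitPlane_of_norm_lt_one ?_
        rwa [norm_neg, norm_div, div_lt_one (norm_pos_iff.2 hω0)]
      rwa [← sub_eq_add_neg] at this
    refine ((((hd z hz.1).div_const ω).const_sub 1).clog hs).congr_deriv ?_
    have h3 := slitPlane_ne_zero hs
    have h4 : ω - ζ z ≠ 0 := fun h => hne' (by rw [← neg_sub, h, neg_zero])
    rw [hLφ, one_sub_div hω0]
    field_simp
    ring
  -- outer circle
  have hK2 := hK _ _ (hω1.trans ha₂) hb₂
  have hout : ∀ z ∈ U, ‖ω‖ ^ 2 < ‖ζ z‖ ^ 2 → ζ z - ω ≠ 0 := fun z hz h h' => by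
    rw [sub_eq_zero.1 h'] at h
    exact lt_irrefl _ h
  have I2 : ∫ z in U, dbar (radStep ζ a₂ b₂) z *
      (logDeriv (fun z => ζ z - ω) z - logDeriv ζ z) = 0 := by
    refine integral_dbar_radStep_mul_deriv (V := U ∩ (fun z => ‖ζ z‖ ^ 2) ⁻¹' Ioi (‖ω‖ ^ 2))
      (G := fun z => log (1 - ω / ζ z)) hU (hsqc.isOpen_inter_preimage hU isOpen_Ioi)
      inter_subset_left hζ hζ0 hab₂ hK2
      (fun z hz => ⟨hz.1, ha₂.trans_le hz.2.1⟩) fun z hz => ?_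
    have hlt : ‖ω‖ < ‖ζ z‖ := lt_of_pow_lt_pow_left₀ 2 (norm_nonneg _) hz.2
    have hne' := hout z hz.1 hz.2
    have hs : 1 - ω / ζ z ∈ slitPlane := by
      have : 1 + -(ω / ζ z) ∈ slitPlane := by
        refine mem_slitPlane_of_norm_lt_one ?_
        rwa [norm_neg, norm_div, div_lt_one (norm_pos_iff.2 (hζ0 z hz.1))]
      rwa [← sub_eq_add_neg] at this
    have hz0 := hζ0 z hz.1
    refine ((((hasDerivAt_const z ω).div (hd z hz.1) hz0).const_sub 1).clog hs).congr_deriv ?_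
    rw [hLφ, logDeriv_apply, Pi.div_apply, one_sub_div hz0]
    field_simp
    ring
  have hLc : DifferentiableOn ℂ (logDeriv ζ) U := (hζ.deriv hU).div hζ hζ0
  have hc2 : ContinuousOn (logDeriv fun z => ζ z - ω) (shell U ζ a₂ b₂) := by
    have : logDeriv (fun z => ζ z - ω) = fun z => deriv ζ z / (ζ z - ω) := funext hLφ
    rw [this]
    exact ((hζ.deriv hU).continuousOn.mono shell_subset).div
      (hφ.continuousOn.mono shell_subset) fun z hz => hout z hz.1 (ha₂.trans_le hz.2.1)
  have hc1 : ContinuousOn (logDeriv fun z => ζ z - ω) (shell U ζ a₁ b₁) := by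
    have : logDeriv (fun z => ζ z - ω) = fun z => deriv ζ z / (ζ z - ω) := funext hLφ
    rw [this]
    refine ((hζ.deriv hU).continuousOn.mono shell_subset).div
      (hφ.continuousOn.mono shell_subset) fun z hz h => ?_
    have := hz.2.2.trans_lt hb₁
    rw [sub_eq_zero.1 h] at this
    exact lt_irrefl _ this
  have i1 := integrableOn_dbar_radStep_mul hU hζ hab₁ (hK _ _ ha₁ (hb₁.trans hω2)) hc1
  have i2 := integrableOn_dbar_radStep_mul hU hζ hab₂ hK2 hc2
  have i3 := integrableOn_dbar_radStep_mul hU hζ hab₂ hK2 (hLc.continuousOn.mono shell_subset)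
  have I3 : ∫ z in U, dbar (radStep ζ a₂ b₂) z * logDeriv (fun z => ζ z - ω) z = Real.pi := by
    rw [← hJ, integral_dbar_radStep_mul_congr hU hζ hab₀ hab₂
      (hK _ _ (lt_min ha₀ (hω1.trans ha₂)) (max_lt hb₀ hb₂)) hLc, ← sub_eq_zero,
      ← integral_sub i2 i3, ← I2]
    simp only [mul_sub]
  have hfin : {z | z ∈ U ∧ ζ z - ω = 0}.Finite := by
    refine finite_fiber (φ := fun z => ζ z - ω) hU hφ ?_ fun z hz hev => ?_
    · have hKω := hK _ _ hω1 hω2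
      have e : {z | z ∈ U ∧ ζ z - ω = 0} = shell U ζ (‖ω‖ ^ 2) (‖ω‖ ^ 2) ∩ ζ ⁻¹' {ω} := by
        ext z
        refine ⟨fun h => ?_, fun h => ⟨h.1.1, sub_eq_zero.2 h.2⟩⟩
        have h' := sub_eq_zero.1 h.2
        exact ⟨⟨h.1, by rw [h'], by rw [h']⟩, h'⟩
      rw [e]
      exact hKω.of_isClosed_subset ((hζc.mono shell_subset).preimage_isClosed_of_isClosed
        hKω.isClosed isClosed_singleton) inter_subset_left
    · refine hne z hz ?_
      filter_upwards [hev] with w hw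
      rw [sub_eq_zero.1 hw, sub_eq_zero.1 hev.self_of_nhds]
  obtain ⟨L, h, hh, hh0, hL, hLe, hI⟩ := integral_dbar_mul_logDeriv
    (u := fun z => radStep ζ a₁ b₁ z - radStep ζ a₂ b₂ z) (φ := fun z => ζ z - ω) hU
    (hK _ _ (lt_min ha₁ (hω1.trans ha₂)) (max_lt (hb₁.trans hω2) hb₂)) shell_subset
    ((radStep_contDiffOn hU hζ a₁ b₁).sub (radStep_contDiffOn hU hζ a₂ b₂))
    (fun z hz => radStep_sub_eq_zero hab₁ hab₂ fun h => hz.2 ⟨hz.1, h⟩) hφ hfin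
    (fun z hz hev => hne z hz (by
      filter_upwards [hev] with w hw
      rw [sub_eq_zero.1 hw, sub_eq_zero.1 hev.self_of_nhds]))
    (fun z hz hz0 => by
      have hcz : ContinuousAt (fun z => ‖ζ z‖ ^ 2) z := hsqc.continuousAt (hU.mem_nhds hz)
      have hzω := sub_eq_zero.1 hz0
      filter_upwards [hcz.tendsto.eventually_const_lt (u := b₁) (by rwa [hzω]),
        hcz.tendsto.eventually_lt_const (u := a₂) (by rwa [hzω])] with w hw1 hw2
      rw [radStep, radStep, stepFn_of_ge hab₁ hw1.le, stepFn_of_le hab₂ hw2.le]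
      simp)
  have hcard : L.card = 1 := by
    have h3 : ∫ z in U, dbar (fun z => radStep ζ a₁ b₁ z - radStep ζ a₂ b₂ z) z *
        logDeriv (fun z => ζ z - ω) z = 0 - Real.pi := by
      rw [← I1, ← I3, ← integral_sub i1 i2]
      refine setIntegral_congr_fun hU.measurableSet fun z hz => ?_
      rw [dbar_radStep_sub (hζ.differentiableAt (hU.mem_nhds hz)), sub_mul]
    rw [h3, zero_sub, neg_inj] at hI
    have hpi : (Real.pi : ℂ) ≠ 0 := by exact_mod_cast Real.pi_ne_zero
    have : (Real.pi : ℂ) * 1 = Real.pi * L.card := by rw [mul_one]; exact hI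
    exact_mod_cast (mul_left_cancel₀ hpi this).symm
  obtain ⟨z, rfl⟩ := Multiset.card_eq_one.1 hcard
  have hz : z ∈ U := hL z (Multiset.mem_singleton_self z)
  simp only [Multiset.map_singleton, Multiset.prod_singleton] at hLe
  refine ⟨z, hz, ?_, ?_, fun z' hz' h' => ?_⟩
  · have := hLe z hz
    rw [sub_self, zero_mul] at this
    exact sub_eq_zero.1 this
  · have h4 : HasDerivAt (fun w => (w - z) * h w) (1 * h z + (z - z) * deriv h z) z :=
      ((hasDerivAt_id z).sub_const z).mul (hh.differentiableAt (hU.mem_nhds hz)).hasDerivAt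
    have h5 : (fun w => ζ w - ω) =ᶠ[𝓝 z] fun w => (w - z) * h w :=
      eventually_of_mem (hU.mem_nhds hz) hLe
    have h6 := h5.deriv_eq
    rw [deriv_sub_const, h4.deriv] at h6
    rw [h6]
    simpa using hh0 z hz
  · have h7 := hLe z' hz'
    rw [h', sub_self] at h7
    rcases mul_eq_zero.1 h7.symm with h8 | h8
    · exact sub_eq_zero.1 h8
    · exact absurd h8 (hh0 z' hz')

/-- A bounded holomorphic function near one end `E` of an open set `O`, whose modulus tends to one
at `E`, together with a neighbourhood `V` of `E` and levels `r₀ < r₁ < r₂` of the function. -/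
structure EndData (O V E : Set ℂ) (F : ℂ → ℂ) (r₀ r₁ r₂ : ℝ) : Prop where
  isOpen_O : IsOpen O
  isOpen_V : IsOpen V
  isCompact_E : IsCompact E
  isPreconnected_E : IsPreconnected E
  nonempty_E : E.Nonempty
  E_subset : E ⊆ V
  disjoint : Disjoint E O
  diff_subset : V \ O ⊆ E
  differentiableOn : DifferentiableOn ℂ F O
  norm_lt : ∀ z ∈ O, ‖F z‖ ^ 2 < 1
  r₀_nonneg : 0 ≤ r₀
  r₀_lt : r₀ < r₁
  r₁_lt : r₁ < r₂
  r₂_lt : r₂ < 1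
  isCompact_level : ∀ s, r₀ < s → IsCompact {z | z ∈ V ∧ (z ∉ O ∨ s ≤ ‖F z‖ ^ 2)}
  isClosed_sub : ∀ t < 1, IsClosed {z | z ∈ O ∧ ‖F z‖ ^ 2 ≤ t}
  not_const : ∀ z ∈ O, ¬ ∀ᶠ w in 𝓝 z, F w = F z
  winding : ∀ S p Φ, IsCompact S → S ⊆ {z | z ∈ V ∩ O ∧ r₂ < ‖F z‖ ^ 2} → PolyPath S p p Φ →
    ∀ ζ ∈ O, ‖F ζ‖ ^ 2 ≤ r₁ → (Φ fun z => 1 / (z - ζ)) = 0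

/-- The part of the end where `‖F‖² > r`. -/
def endSet (O V : Set ℂ) (F : ℂ → ℂ) (r : ℝ) : Set ℂ := {z | z ∈ V ∩ O ∧ r < ‖F z‖ ^ 2}

namespace EndData

variable {O V E : Set ℂ} {F : ℂ → ℂ} {r₀ r₁ r₂ : ℝ}

theorem continuousOn_sq (D : EndData O V E F r₀ r₁ r₂) : ContinuousOn (fun z => ‖F z‖ ^ 2) O :=
  D.differentiableOn.continuousOn.norm.pow 2

theorem isOpen_endSet (D : EndData O V E F r₀ r₁ r₂) (r : ℝ) : IsOpen (endSet O V F r) := by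
  have h := (D.continuousOn_sq.mono inter_subset_right).isOpen_inter_preimage
    (D.isOpen_V.inter D.isOpen_O) (isOpen_Ioi (a := r))
  exact h

theorem endSet_subset (r : ℝ) : endSet O V F r ⊆ O := fun _ hz => hz.1.2

theorem isCompact_shell (D : EndData O V E F r₀ r₁ r₂) {r s t : ℝ} (hr : r₀ ≤ r) (hs : r < s)
    (ht : t < 1) : IsCompact (shell (endSet O V F r) F s t) := by
  have e : shell (endSet O V F r) F s t =
      {z | z ∈ V ∧ (z ∉ O ∨ s ≤ ‖F z‖ ^ 2)} ∩ {z | z ∈ O ∧ ‖F z‖ ^ 2 ≤ t} := by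
    ext z
    refine ⟨fun h => ⟨⟨h.1.1.1, Or.inr h.2.1⟩, h.1.1.2, h.2.2⟩, fun h => ?_⟩
    have h1 := h.1.2.resolve_left fun h' => h' h.2.1
    exact ⟨⟨⟨h.1.1, h.2.1⟩, hs.trans_le h1⟩, h1, h.2.2⟩
  rw [e]
  exact (D.isCompact_level s (hr.trans_lt hs)).inter_right (D.isClosed_sub t ht)

theorem exists_level (D : EndData O V E F r₀ r₁ r₂) {s : ℝ} (hs : r₀ < s) (hs1 : s < 1) :
    ∃ z ∈ V ∩ O, ‖F z‖ ^ 2 = s := by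
  by_contra! hne
  have e : {z | z ∈ V ∧ (z ∉ O ∨ s ≤ ‖F z‖ ^ 2)} = V ∩ {z | z ∈ O ∧ ‖F z‖ ^ 2 ≤ s}ᶜ := by
    ext z
    refine ⟨fun h => ⟨h.1, fun h' => ?_⟩, fun h => ⟨h.1, ?_⟩⟩
    · exact hne z ⟨h.1, h'.1⟩ (le_antisymm h'.2 (h.2.resolve_left fun h2 => h2 h'.1))
    · by_cases hz : z ∈ O
      · exact Or.inr (not_le.1 fun h' => h.2 ⟨hz, h'⟩).le
      · exact Or.inl hz
  have hc := D.isCompact_level s hs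
  have hcl : IsClopen {z | z ∈ V ∧ (z ∉ O ∨ s ≤ ‖F z‖ ^ 2)} := by
    refine ⟨hc.isClosed, ?_⟩
    rw [e]
    exact D.isOpen_V.inter (D.isClosed_sub s hs1).isOpen_compl
  obtain ⟨e0, he0⟩ := D.nonempty_E
  have := hcl.eq_univ ⟨e0, D.E_subset he0, Or.inl (disjoint_left.1 D.disjoint he0)⟩
  rw [this] at hc
  exact noncompact_univ ℂ hc

/-- Near the end every point is close to `E`. -/
theorem exists_near (D : EndData O V E F r₀ r₁ r₂) {δ : ℝ} (hδ : 0 < δ) :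
    ∃ t < 1, ∀ z ∈ V ∩ O, t ≤ ‖F z‖ ^ 2 → z ∈ thickening δ E := by
  have hK : IsCompact ({z | z ∈ V ∧ (z ∉ O ∨ r₁ ≤ ‖F z‖ ^ 2)} \ thickening δ E) :=
    (D.isCompact_level r₁ D.r₀_lt).diff isOpen_thickening
  have hKO : ({z | z ∈ V ∧ (z ∉ O ∨ r₁ ≤ ‖F z‖ ^ 2)} \ thickening δ E) ⊆ O := fun z hz => by
    by_contra hO
    exact hz.2 (self_subset_thickening hδ E (D.diff_subset ⟨hz.1.1, hO⟩))
  obtain ⟨M, hM, hM'⟩ : ∃ M < 1, ∀ z ∈ ({z | z ∈ V ∧ (z ∉ O ∨ r₁ ≤ ‖F z‖ ^ 2)} \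
      thickening δ E), ‖F z‖ ^ 2 ≤ M := by
    rcases eq_empty_or_nonempty ({z | z ∈ V ∧ (z ∉ O ∨ r₁ ≤ ‖F z‖ ^ 2)} \ thickening δ E)
      with h | h
    · exact ⟨0, one_pos, by rw [h]; simp⟩
    · obtain ⟨m, hm, hmax⟩ := hK.exists_isMaxOn h (D.continuousOn_sq.mono hKO)
      exact ⟨_, D.norm_lt m (hKO hm), fun z hz => hmax hz⟩
  obtain ⟨t, ht, ht1⟩ := exists_between (max_lt hM (D.r₁_lt.trans D.r₂_lt))
  refine ⟨t, ht1, fun z hz hzt => ?_⟩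
  by_contra hzE
  have := hM' z ⟨⟨hz.1, Or.inr ((le_max_right _ _).trans (ht.le.trans hzt))⟩, hzE⟩
  exact absurd (hzt.trans this) (not_le.2 ((le_max_left _ _).trans_lt ht))

/-- The periods of holomorphic functions along cycles near the end are multiples of a single
one. -/
theorem period_eq (D : EndData O V E F r₀ r₁ r₂) {e₀ : ℂ} (he₀ : e₀ ∈ E) {S : Set ℂ} {p : ℂ}
    {Φ : (ℂ → ℂ) → ℂ} (hS : IsCompact S) (hSU : S ⊆ endSet O V F r₂) (H : PolyPath S p p Φ)
    {a b : ℝ} (ha : r₀ < a) (hab : a < b) (hb : b ≤ r₁) {g : ℂ → ℂ}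
    (hg : DifferentiableOn ℂ g (endSet O V F r₀)) :
    Real.pi * Φ g = -(Φ fun z => 1 / (z - e₀)) *
      ∫ ζ in endSet O V F r₀, dbar (radStep F a b) ζ * g ζ := by
  set U := endSet O V F r₀ with hU
  have hUo : IsOpen U := D.isOpen_endSet r₀
  have hSO : S ⊆ O := hSU.trans (endSet_subset _)
  have hF : DifferentiableOn ℂ F U := D.differentiableOn.mono (endSet_subset _)
  have hES : Disjoint E S := D.disjoint.mono_right hSO
  obtain ⟨δ, hδ, hdis⟩ := hES.exists_thickenings D.isCompact_E hS.isClosed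
  obtain ⟨t₀, ht₀, hnear⟩ := D.exists_near hδ
  obtain ⟨m, hm, hmax⟩ := hS.exists_isMaxOn ⟨p, H.source_mem⟩ (D.continuousOn_sq.mono hSO)
  have hmax' : ∀ z ∈ S, ‖F z‖ ^ 2 ≤ ‖F m‖ ^ 2 := fun z hz => hmax hz
  obtain ⟨t₁, ht₁, ht₁'⟩ := exists_between (max_lt (D.norm_lt m (hSO hm)) ht₀)
  obtain ⟨t₂, ht₁₂, ht₂⟩ := exists_between ht₁'
  have hmt : ‖F m‖ ^ 2 < t₁ := (le_max_left _ _).trans_lt ht₁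
  have hbt : b < t₁ := hb.trans_lt (D.r₁_lt.trans ((hSU hm).2.trans hmt))
  have hKs : ∀ s t, r₀ < s → t < 1 → IsCompact (shell U F s t) := fun s t hs ht =>
    D.isCompact_shell le_rfl hs ht
  have hmin : min a t₁ = a := min_eq_left (hab.trans hbt).le
  have hmax2 : max b t₂ = t₂ := max_eq_right (hbt.trans ht₁₂).le
  have hcong := integral_dbar_radStep_mul_congr hUo hF hab ht₁₂
    (by rw [hmin, hmax2]; exact hKs _ _ ha ht₂) hg
  have key := H.eq_integral_dbar (X := fun z => radStep F a b z - radStep F t₁ t₂ z) hUo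
    (fun z hz => ⟨(hSU hz).1, D.r₀_lt.trans (D.r₁_lt.trans (hSU hz).2)⟩)
    (hKs a t₂ ha ht₂) shell_subset
    ((radStep_contDiffOn hUo hF a b).sub (radStep_contDiffOn hUo hF t₁ t₂))
    (fun z hz => radStep_sub_eq_zero hab ht₁₂ fun h => hz.2 ⟨hz.1, by
      rwa [hmin, hmax2] at h⟩)
    (fun z hz => by
      have hcz : ContinuousAt (fun z => ‖F z‖ ^ 2) z :=
        D.continuousOn_sq.continuousAt (D.isOpen_O.mem_nhds (hSO hz))
      filter_upwards [hcz.tendsto.eventually_const_lt (u := b)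
          (hb.trans_lt (D.r₁_lt.trans (hSU hz).2)),
        hcz.tendsto.eventually_lt_const (u := t₁) ((hmax' z hz).trans_lt hmt)] with w hw1 hw2
      rw [radStep, radStep, stepFn_of_ge hab hw1.le, stepFn_of_le ht₁₂ hw2.le]
      simp) hg
  rw [key, hcong, ← integral_const_mul]
  refine setIntegral_congr_fun hUo.measurableSet fun ζ hζ => ?_
  have hFd := hF.differentiableAt (hUo.mem_nhds hζ)
  rw [dbar_radStep_sub hFd]
  by_cases h1 : a ≤ ‖F ζ‖ ^ 2 ∧ ‖F ζ‖ ^ 2 ≤ b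
  · rw [D.winding S p Φ hS hSU H ζ hζ.1.2 (h1.2.trans hb), dbar_radStep_eq_zero hFd ht₁₂
      fun h => absurd (h.1.trans h1.2) (not_le.2 hbt)]
    simp
  rw [dbar_radStep_eq_zero hFd hab h1]
  by_cases h2 : t₁ ≤ ‖F ζ‖ ^ 2 ∧ ‖F ζ‖ ^ 2 ≤ t₂
  · have h3 := hnear ζ hζ.1 (((le_max_right _ _).trans ht₁.le).trans h2.1)
    obtain ⟨e, he, hed⟩ := mem_thickening_iff.1 h3
    rw [H.winding_eq_of_dist (ε := δ) (ζ₀ := e) (fun z hz => ?_) hed,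
      H.winding_eq_of_isPreconnected hS.isClosed D.isPreconnected_E hES he he₀]
    · ring
    · by_contra hlt
      refine disjoint_left.1 hdis (mem_thickening_iff.2 ⟨e, he, ?_⟩) (self_subset_thickening hδ S hz)
      exact not_le.1 hlt
  · rw [dbar_radStep_eq_zero hFd ht₁₂ h2]
    ring

/-- The number of zeros of `F` carried by the end. -/
theorem integral_logDeriv_pos (D : EndData O V E F r₀ r₁ r₂) {a b : ℝ} (ha : r₀ < a) (hab : a < b)
    (hb : b < 1) : ∃ k : ℝ, 0 < k ∧
      ∫ ζ in endSet O V F r₀, dbar (radStep F a b) ζ * logDeriv F ζ = (Real.pi * k : ℝ) := by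
  set U := endSet O V F r₀ with hU
  have hUo : IsOpen U := D.isOpen_endSet r₀
  have hF : DifferentiableOn ℂ F U := D.differentiableOn.mono (endSet_subset _)
  have hFc := hF.continuousOn
  have hF' : ContinuousOn (deriv F) U := (hF.deriv hUo).continuousOn
  have hF0 : ∀ z ∈ U, F z ≠ 0 := fun z hz h => by
    have := hz.2
    rw [h] at this
    simp at this
    linarith [D.r₀_nonneg]
  set q : ℂ → ℝ := fun z => deriv (stepFn a b) (‖F z‖ ^ 2) * ‖deriv F z‖ ^ 2 with hq
  have hqe : ∀ z ∈ U, dbar (radStep F a b) z * logDeriv F z = (q z : ℝ) := fun z hz => by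
    rw [dbar_radStep (hF.differentiableAt (hUo.mem_nhds hz)), logDeriv_apply, hq]
    have : conj (deriv F z) * deriv F z = (‖deriv F z‖ : ℂ) ^ 2 := by
      rw [mul_comm, mul_conj, normSq_eq_norm_sq]
      push_cast
      rfl
    push_cast
    rw [← this]
    field_simp [hF0 z hz]
  have hq0 : ∀ z, 0 ≤ q z := fun z => mul_nonneg (deriv_stepFn_nonneg hab _) (by positivity)
  have hdc : Continuous (deriv (stepFn a b)) :=
    (stepFn_contDiff a b (n := 1)).continuous_deriv le_rfl
  have hqc : ContinuousOn q U := (hdc.comp_continuousOn (hFc.norm.pow 2)).mul (hF'.norm.pow 2)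
  have hlog : DifferentiableOn ℂ (logDeriv F) U := (hF.deriv hUo).div hF hF0
  have hintegr := integrableOn_dbar_radStep_mul hUo hF hab (D.isCompact_shell le_rfl ha hb)
    (hlog.continuousOn.mono shell_subset)
  have hqi : IntegrableOn q U := by
    have := (hintegr.congr_fun (fun z hz => hqe z hz) hUo.measurableSet).re
    exact this.congr (Eventually.of_forall fun z => by simp)
  have hI : ∫ ζ in U, dbar (radStep F a b) ζ * logDeriv F ζ = ((∫ ζ in U, q ζ : ℝ) : ℂ) := by
    rw [setIntegral_congr_fun hUo.measurableSet hqe]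
    exact integral_ofReal
  have hpos : 0 < ∫ ζ in U, q ζ := by
    refine lt_of_le_of_ne (integral_nonneg hq0) fun h0 => ?_
    have h1 := (setIntegral_eq_zero_iff_of_nonneg_ae (Eventually.of_forall hq0) hqi).1 h0.symm
    have h2 : EqOn q (fun _ => 0) U := Measure.eqOn_open_of_ae_eq h1 hUo hqc continuousOn_const
    obtain ⟨s, hs, hds⟩ : ∃ s ∈ Ioo a b, deriv (stepFn a b) s = (1 - 0) / (b - a) := by
      have := exists_deriv_eq_slope (stepFn a b) hab
        (stepFn_contDiff a b (n := 1)).continuous.continuousOn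
        ((stepFn_contDiff a b (n := 1)).differentiable one_ne_zero).differentiableOn
      rwa [stepFn_of_ge hab le_rfl, stepFn_of_le hab le_rfl] at this
    have hds' : 0 < deriv (stepFn a b) s := by
      rw [hds]
      exact div_pos (by norm_num) (sub_pos.2 hab)
    obtain ⟨z, hz, hzs⟩ := D.exists_level (ha.trans hs.1) (hs.2.trans hb)
    have hzU : z ∈ U := ⟨hz, by rw [hzs]; exact ha.trans hs.1⟩
    have hcz : ContinuousAt (fun z => deriv (stepFn a b) (‖F z‖ ^ 2)) z :=
      hdc.continuousAt.comp (f := fun z => ‖F z‖ ^ 2)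
        (D.continuousOn_sq.continuousAt (D.isOpen_O.mem_nhds hz.2))
    have hev : ∀ᶠ w in 𝓝 z, w ∈ U ∧ deriv F w = 0 := by
      filter_upwards [hcz.tendsto.eventually_const_lt (u := 0) (by rwa [hzs]),
        hUo.mem_nhds hzU] with w hw hwU
      refine ⟨hwU, ?_⟩
      have := h2 hwU
      simp only [hq] at this
      rcases mul_eq_zero.1 this with h | h
      · exact absurd h hw.ne'
      · simpa using h
    obtain ⟨ε, hε, hball⟩ := Metric.eventually_nhds_iff_ball.1 hev
    refine D.not_const z hz.2 (eventually_of_mem (ball_mem_nhds z hε) fun w hw => ?_)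
    exact isOpen_ball.is_const_of_deriv_eq_zero (convex_ball z ε).isPreconnected
      (hF.mono fun w hw => (hball w hw).1) (fun w hw => (hball w hw).2) hw (mem_ball_self hε)
  refine ⟨(∫ ζ in U, q ζ) / Real.pi, div_pos hpos Real.pi_pos, ?_⟩
  rw [hI]
  congr 1
  field_simp

end EndData

theorem hasDerivAt_of_inverse {U A : Set ℂ} (hU : IsOpen U) {ζ ψ : ℂ → ℂ}
    (hζ : DifferentiableOn ℂ ζ U) (hψ : ∀ ω ∈ A, ψ ω ∈ U ∧ ζ (ψ ω) = ω)
    (hinv : ∀ z ∈ U, ψ (ζ z) = z) {ω : ℂ} (hω : ω ∈ A) (hne : deriv ζ (ψ ω) ≠ 0) :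
    HasDerivAt ψ (deriv ζ (ψ ω))⁻¹ ω := by
  obtain ⟨hz, hzω⟩ := hψ ω hω
  have hs : HasStrictDerivAt ζ (deriv ζ (ψ ω)) (ψ ω) :=
    (((hζ.contDiffOn hU).contDiffAt (hU.mem_nhds hz)).hasStrictDerivAt (n := 1) one_ne_zero)
  have h1 := hs.to_localInverse hne
  have h2 := (hs.hasStrictFDerivAt_equiv hne).eventually_right_inverse
  have h4 : hs.localInverse ζ (deriv ζ (ψ ω)) (ψ ω) hne (ζ (ψ ω)) = ψ ω :=
    (hs.hasStrictFDerivAt_equiv hne).localInverse_apply_image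
  change HasStrictDerivAt (hs.localInverse ζ (deriv ζ (ψ ω)) (ψ ω) hne) _ _ at h1
  rw [hzω] at h1 h2
  have h3 : ∀ᶠ y in 𝓝 ω, hs.localInverse ζ (deriv ζ (ψ ω)) (ψ ω) hne y ∈ U := by
    refine h1.hasDerivAt.continuousAt.preimage_mem_nhds (hU.mem_nhds ?_)
    rw [hzω] at h4
    rw [h4]
    exact hz
  refine h1.hasDerivAt.congr_of_eventuallyEq ?_
  filter_upwards [h2, h3] with y hy hyU
  have := hinv _ hyU
  rw [← this]
  congr 1
  exact hy.symm

/-- The unimodular normalisation of a multivalued root. -/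
theorem exists_normalized {U : Set ℂ} (hU : IsOpen U) {F h ξ : ℂ → ℂ} {k : ℝ} (hk : 0 < k)
    (hF0 : ∀ z ∈ U, F z ≠ 0) (hF : ∀ z ∈ U, HasDerivAt F (k * h z * F z) z)
    (hξ : ∀ z ∈ U, ξ z ≠ 0 ∧ HasDerivAt ξ (h z * ξ z) z) :
    ∃ ζ : ℂ → ℂ, ∀ z ∈ U, ‖ζ z‖ = ‖F z‖ ^ (1 / k) ∧ HasDerivAt ζ (h z * ζ z) z := by
  have hlog {G : ℂ → ℂ} {c : ℂ} {z : ℂ} (hG : HasDerivAt G (c * G z) z) (h0 : G z ≠ 0) :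
      HasFDerivAt (fun z => Real.log (‖G z‖ ^ 2))
        (2 • (reCLM.comp (c • (1 : ℂ →L[ℝ] ℂ)))) z := by
    have h1 := (hG.complexToReal_fderiv).norm_sq.log
      (pow_ne_zero 2 (norm_ne_zero_iff.2 h0))
    refine h1.congr_fderiv ?_
    ext v
    have h2 : inner ℝ (G z) (c * G z * v) = ‖G z‖ ^ 2 * (c * v).re := by
      rw [Complex.inner, show c * G z * v * conj (G z) = (G z * conj (G z)) * (c * v) by ring, mul_conj, normSq_eq_norm_sq,
        re_ofReal_mul]
    have h3 : ‖G z‖ ^ 2 ≠ 0 := pow_ne_zero 2 (norm_ne_zero_iff.2 h0)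
    simp [h2] 
    field_simp
  have hconst : ∀ z₀ ∈ U, ∃ C : ℝ, ∀ᶠ z in 𝓝 z₀, ‖F z‖ ^ (1 / k) / ‖ξ z‖ = C := by
    intro z₀ hz₀
    obtain ⟨ε, hε, hb⟩ := Metric.isOpen_iff.1 hU z₀ hz₀
    set N : ℂ → ℝ := fun z => (1 / k) * Real.log (‖F z‖ ^ 2) - Real.log (‖ξ z‖ ^ 2) with hN
    have hNd : ∀ z ∈ ball z₀ ε, HasFDerivAt N (0 : ℂ →L[ℝ] ℝ) z := fun z hz => by
      have h1 := ((hlog (hF z (hb hz)) (hF0 z (hb hz))).const_mul (1 / k)).sub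
        (hlog (hξ z (hb hz)).2 (hξ z (hb hz)).1)
      refine h1.congr_fderiv ?_
      ext v
      have : ((k : ℂ) * h z * v).re = k * (h z * v).re := by
        rw [mul_assoc, re_ofReal_mul]
      simp [this]
      field_simp
      simp
    have hNc : ∀ z ∈ ball z₀ ε, N z = N z₀ := fun z hz =>
      isOpen_ball.is_const_of_fderiv_eq_zero (convex_ball z₀ ε).isPreconnected
        (fun w hw => (hNd w hw).differentiableAt.differentiableWithinAt)
        (fun w hw => (hNd w hw).fderiv) hz (mem_ball_self hε)
    refine ⟨Real.exp (N z₀ / 2), eventually_of_mem (ball_mem_nhds z₀ hε) fun z hz => ?_⟩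
    have hF1 : 0 < ‖F z‖ := norm_pos_iff.2 (hF0 z (hb hz))
    have hξ1 : 0 < ‖ξ z‖ := norm_pos_iff.2 (hξ z (hb hz)).1
    rw [← hNc z hz, hN]
    simp only [Real.log_pow]
    rw [show (1 / k * ((2 : ℕ) * Real.log ‖F z‖) - (2 : ℕ) * Real.log ‖ξ z‖) / 2 =
      Real.log ‖F z‖ * (1 / k) - Real.log ‖ξ z‖ by push_cast; ring, Real.exp_sub,
      Real.exp_log hξ1, ← Real.rpow_def_of_pos hF1]
  refine ⟨fun z => (‖F z‖ ^ (1 / k) / ‖ξ z‖ : ℝ) * ξ z, fun z hz => ⟨?_, ?_⟩⟩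
  · rw [norm_mul, norm_real, Real.norm_of_nonneg (by positivity),
      div_mul_cancel₀ _ (norm_ne_zero_iff.2 (hξ z hz).1)]
  · obtain ⟨C, hC⟩ := hconst z hz
    have h1 := (hξ z hz).2.const_mul (C : ℂ)
    have h2 := h1.congr_of_eventuallyEq (f₁ := fun z => ((‖F z‖ ^ (1 / k) / ‖ξ z‖ : ℝ) : ℂ) * ξ z)
      (by filter_upwards [hC] with w hw; rw [hw])
    refine h2.congr_deriv ?_
    beta_reduce
    rw [hC.self_of_nhds]
    ring

/-- A function on an annulus whose logarithmic derivative is `k / ω` is a monomial. -/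
theorem exists_eq_mul_pow {ρ : ℝ} (hρ0 : 0 < ρ) (hρ1 : ρ < 1) {f : ℂ → ℂ} {k : ℝ} (hk : 0 < k)
    (hf : ∀ ω, ρ < ‖ω‖ ^ 2 → ‖ω‖ ^ 2 < 1 → f ω ≠ 0 ∧ HasDerivAt f (k / ω * f ω) ω) :
    ∃ (n : ℕ) (c : ℂ), (n : ℝ) = k ∧ ∀ ω, ρ < ‖ω‖ ^ 2 → ‖ω‖ ^ 2 < 1 → f ω = c * ω ^ n := by
  set A : Set ℂ := {s | Real.log ρ / 2 < s.re} ∩ {s | s.re < 0} with hA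
  have hAconv : Convex ℝ A := (convex_halfSpace_re_gt _).inter (convex_halfSpace_re_lt _)
  have hAo : IsOpen A := (isOpen_lt continuous_const continuous_re).inter
    (isOpen_lt continuous_re continuous_const)
  have hmem : ∀ s, s ∈ A ↔ ρ < ‖exp s‖ ^ 2 ∧ ‖exp s‖ ^ 2 < 1 := fun s => by
    rw [norm_exp, ← Real.exp_nat_mul, Real.exp_lt_one_iff, ← Real.log_lt_iff_lt_exp hρ0]
    simp only [hA, mem_inter_iff, mem_ofPred_eq]
    push_cast
    constructor <;> rintro ⟨h1, h2⟩ <;> constructor <;> linarith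
  have hd : ∀ s ∈ A, HasDerivAt (fun s => f (exp s) * exp (-(k * s))) 0 s := fun s hs => by
    obtain ⟨h1, h2⟩ := (hmem s).1 hs
    have h3 := (hf _ h1 h2).2.comp s (Complex.hasDerivAt_exp s)
    have h4 : HasDerivAt (fun s : ℂ => exp (-(k * s))) (exp (-(k * s)) * -(k * 1)) s :=
      (((hasDerivAt_id s).const_mul (k : ℂ)).neg).cexp
    have h5 := h3.fun_mul h4
    refine h5.congr_deriv ?_
    simp only [Function.comp]
    field_simp [exp_ne_zero s]
    ring
  obtain ⟨c, hc⟩ : ∃ c, ∀ s ∈ A, f (exp s) * exp (-(k * s)) = c := by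
    have hlog : Real.log ρ / 2 < 0 := by linarith [Real.log_neg hρ0 hρ1]
    obtain ⟨x, hx, hx'⟩ := exists_between hlog
    refine ⟨_, fun s hs => hAo.is_const_of_deriv_eq_zero hAconv.isPreconnected
      (fun s hs => (hd s hs).differentiableAt.differentiableWithinAt)
      (fun s hs => (hd s hs).deriv) hs (y := (x : ℂ)) ⟨by simpa using hx, by simpa using hx'⟩⟩
  have hfe : ∀ s ∈ A, f (exp s) = c * exp (k * s) := fun s hs => by
    rw [← hc s hs, mul_assoc, ← exp_add]
    simp
  have hlog : Real.log ρ / 2 < 0 := by linarith [Real.log_neg hρ0 hρ1]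
  obtain ⟨x, hx, hx'⟩ := exists_between hlog
  have hxA : (x : ℂ) ∈ A := ⟨by simpa using hx, by simpa using hx'⟩
  have hxA' : (x : ℂ) + 2 * Real.pi * I ∈ A := ⟨by simpa using hx, by simpa using hx'⟩
  have hc0 : c ≠ 0 := fun h => by
    have := hfe _ hxA
    rw [h, zero_mul] at this
    obtain ⟨h1, h2⟩ := (hmem _).1 hxA
    exact (hf _ h1 h2).1 this
  have h1 : exp (k * (2 * Real.pi * I)) = 1 := by
    have e1 := hfe _ hxA
    have e2 := hfe _ hxA'
    rw [exp_add, exp_two_pi_mul_I, mul_one, e1, mul_add, exp_add] at e2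
    have := mul_left_cancel₀ hc0 e2
    exact (mul_left_cancel₀ (exp_ne_zero _) (by rw [mul_one]; exact this)).symm
  obtain ⟨n, hn⟩ := Complex.exp_eq_one_iff.1 h1
  have hkn : k = n := by
    have h2 : (2 * Real.pi * I : ℂ) ≠ 0 := two_pi_I_ne_zero
    have := mul_right_cancel₀ h2 hn
    exact_mod_cast this
  have hn0 : 0 < n := by
    rw [hkn] at hk
    exact_mod_cast hk
  lift n to ℕ using hn0.le
  refine ⟨n, c, by rw [hkn]; simp, fun ω h1 h2 => ?_⟩
  have hω0 : ω ≠ 0 := fun h => by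
    rw [h] at h1
    simp at h1
    linarith
  have := hfe (log ω) ((hmem _).2 (by rw [exp_log hω0]; exact ⟨h1, h2⟩))
  rw [exp_log hω0] at this
  rw [this, hkn]
  congr 1
  push_cast
  rw [exp_nat_mul, exp_log hω0]


/-- A coordinate of a doubly connected end: the function is a power of a conformal map onto an
annulus. -/
structure AnnulusChart (W : Set ℂ) (F : ℂ → ℂ) (ρ : ℝ) (k : ℕ) (c : ℂ) (ζ ψ : ℂ → ℂ) : Prop where
  isOpen : IsOpen W
  ρ_pos : 0 < ρ
  ρ_lt : ρ < 1
  k_pos : 0 < k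
  norm_c : ‖c‖ = 1
  differentiableOn : DifferentiableOn ℂ ζ W
  mapsTo : ∀ z ∈ W, ρ < ‖ζ z‖ ^ 2 ∧ ‖ζ z‖ ^ 2 < 1
  eq_pow : ∀ z ∈ W, F z = c * ζ z ^ k
  left_inv : ∀ z ∈ W, ψ (ζ z) = z
  mem : ∀ ω, ρ < ‖ω‖ ^ 2 → ‖ω‖ ^ 2 < 1 → ψ ω ∈ W
  right_inv : ∀ ω, ρ < ‖ω‖ ^ 2 → ‖ω‖ ^ 2 < 1 → ζ (ψ ω) = ω
  differentiableAt : ∀ ω, ρ < ‖ω‖ ^ 2 → ‖ω‖ ^ 2 < 1 → DifferentiableAt ℂ ψ ω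

theorem EndData.exists_annulusChart {O V E : Set ℂ} {F : ℂ → ℂ} {r₀ r₁ r₂ : ℝ}
    (D : EndData O V E F r₀ r₁ r₂) :
    ∃ ρ k c ζ ψ, AnnulusChart (endSet O V F r₂) F ρ k c ζ ψ := by
  obtain ⟨e₀, he₀⟩ := D.nonempty_E
  set U := endSet O V F r₀ with hU
  set U' := endSet O V F r₂ with hU'
  have hr₀₂ : r₀ < r₂ := D.r₀_lt.trans D.r₁_lt
  have hr₂ : 0 < r₂ := D.r₀_nonneg.trans_lt hr₀₂
  have hUo : IsOpen U := D.isOpen_endSet r₀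
  have hUo' : IsOpen U' := D.isOpen_endSet r₂
  have hUU : U' ⊆ U := fun z hz => ⟨hz.1, hr₀₂.trans hz.2⟩
  have hF : DifferentiableOn ℂ F U := D.differentiableOn.mono (endSet_subset _)
  have hFd : ∀ z ∈ U, HasDerivAt F (deriv F z) z := fun z hz =>
    (hF.differentiableAt (hUo.mem_nhds hz)).hasDerivAt
  have hF0 : ∀ z ∈ U, F z ≠ 0 := fun z hz h => by
    have := hz.2
    rw [h] at this
    simp at this
    linarith [D.r₀_nonneg]
  obtain ⟨a, ha, ha'⟩ := exists_between D.r₀_lt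
  obtain ⟨k, hk, hI⟩ := D.integral_logDeriv_pos ha ha' (D.r₁_lt.trans D.r₂_lt)
  have hk0 : (k : ℂ) ≠ 0 := by exact_mod_cast hk.ne'
  have hlog : DifferentiableOn ℂ (logDeriv F) U := (hF.deriv hUo).div hF hF0
  set h : ℂ → ℂ := fun z => logDeriv F z / k with hh
  have hhe : ∀ z, h z = deriv F z / F z / k := fun z => rfl
  have hhd : DifferentiableOn ℂ h U := hlog.div_const _
  have hpi : (Real.pi : ℂ) ≠ 0 := by exact_mod_cast Real.pi_ne_zero
  have hper : ∀ p Ψ, PolyPath U' p p Ψ → exp (Ψ h) = 1 := fun p Ψ H => by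
    obtain ⟨S, hSU, hS, HS⟩ := H.exists_isCompact
    have h1 := D.period_eq he₀ hS hSU HS ha ha' le_rfl hhd
    have h2 : ∫ ζ in U, dbar (radStep F a r₁) ζ * h ζ = Real.pi := by
      have : ∀ ζ, dbar (radStep F a r₁) ζ * h ζ =
          (dbar (radStep F a r₁) ζ * logDeriv F ζ) / k := fun ζ => by rw [hh]; ring
      simp_rw [this]
      rw [integral_div, hI]
      push_cast
      field_simp
    rw [← hU, h2] at h1
    have h3 : Ψ h = -(Ψ fun z => 1 / (z - e₀)) :=
      mul_left_cancel₀ hpi (by rw [h1]; ring)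
    rw [h3, exp_neg, HS.exp_winding (disjoint_left.1
      (D.disjoint.mono_right (hSU.trans (endSet_subset _))) he₀), inv_one]
  obtain ⟨ξ, hξ⟩ := PolyPath.exists_exp_primitive hUo' (hhd.mono hUU) hper
  obtain ⟨ζ, hζ⟩ := exists_normalized hUo' (F := F) (h := h) hk (fun z hz => hF0 z (hUU hz))
    (fun z hz => (hFd z (hUU hz)).congr_deriv (by
      have := hF0 z (hUU hz)
      rw [hhe]
      field_simp)) hξ
  have hζd : DifferentiableOn ℂ ζ U' := fun z hz =>
    (hζ z hz).2.differentiableAt.differentiableWithinAt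
  have hsq : ∀ z ∈ U', ‖ζ z‖ ^ 2 = (‖F z‖ ^ 2) ^ (1 / k) := fun z hz => by
    rw [(hζ z hz).1, ← Real.rpow_natCast, ← Real.rpow_natCast, ← Real.rpow_mul (norm_nonneg _),
      ← Real.rpow_mul (norm_nonneg _), mul_comm]
  have hk1 : 0 < 1 / k := by positivity
  set ρ : ℝ := r₂ ^ (1 / k) with hρ
  have hρ0 : 0 < ρ := Real.rpow_pos_of_pos hr₂ _
  have hρ1 : ρ < 1 := Real.rpow_lt_one hr₂.le D.r₂_lt hk1
  have hmap : ∀ z ∈ U', ρ < ‖ζ z‖ ^ 2 ∧ ‖ζ z‖ ^ 2 < 1 := fun z hz => by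
    rw [hsq z hz]
    exact ⟨Real.rpow_lt_rpow hr₂.le hz.2 hk1,
      Real.rpow_lt_one (sq_nonneg _) (D.norm_lt z hz.1.2) hk1⟩
  have hζ0 : ∀ z ∈ U', ζ z ≠ 0 := fun z hz h => by
    have := (hmap z hz).1
    rw [h] at this
    simp at this
    linarith
  have hroot : ∀ s, 0 < s → ∀ z ∈ U', (s ≤ ‖ζ z‖ ^ 2 ↔ s ^ k ≤ ‖F z‖ ^ 2) ∧
      (‖ζ z‖ ^ 2 ≤ s ↔ ‖F z‖ ^ 2 ≤ s ^ k) := fun s hs z hz => by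
    have hsk : s = (s ^ k) ^ (1 / k) := by
      rw [← Real.rpow_mul hs.le, mul_one_div_cancel hk.ne', Real.rpow_one]
    have hsk0 : 0 ≤ s ^ k := (Real.rpow_pos_of_pos hs _).le
    rw [hsq z hz]
    nth_rewrite 1 [hsk]
    nth_rewrite 3 [hsk]
    exact ⟨Real.rpow_le_rpow_iff hsk0 (sq_nonneg _) hk1,
      Real.rpow_le_rpow_iff (sq_nonneg _) hsk0 hk1⟩
  have hρk : ρ ^ k = r₂ := by
    rw [hρ, ← Real.rpow_mul hr₂.le, one_div_mul_cancel hk.ne', Real.rpow_one]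
  have hK : ∀ s t, ρ < s → t < 1 → IsCompact (shell U' ζ s t) := fun s t hs ht => by
    rcases le_or_gt s t with hst | hst
    · have ht0 : 0 < t := hρ0.trans (hs.trans_le hst)
      have e : shell U' ζ s t = shell U' F (s ^ k) (t ^ k) := by
        ext z
        exact and_congr_right fun hz =>
          and_congr (hroot s (hρ0.trans hs) z hz).1 (hroot t ht0 z hz).2
      rw [e]
      refine D.isCompact_shell hr₀₂.le ?_ (Real.rpow_lt_one ht0.le ht hk)
      rw [← hρk]
      exact Real.rpow_lt_rpow hρ0.le hs hk
    · have : shell U' ζ s t = ∅ := by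
        ext z
        simp only [mem_empty_iff_false, iff_false]
        exact fun h => absurd (h.2.1.trans h.2.2) (not_le.2 hst)
      rw [this]
      exact isCompact_empty
  have hderiv : ∀ z ∈ U', deriv ζ z = h z * ζ z := fun z hz => (hζ z hz).2.deriv
  have hne : ∀ z ∈ U', ¬ ∀ᶠ w in 𝓝 z, ζ w = ζ z := fun z hz hev => by
    have h1 : ∀ᶠ w in 𝓝 z, w ∈ U' ∧ deriv F w = 0 := by
      filter_upwards [hev.eventually_nhds, hUo'.mem_nhds hz] with w hw hwU
      refine ⟨hwU, ?_⟩
      have h2 : ζ =ᶠ[𝓝 w] fun _ => ζ z := hw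
      have h3 := h2.deriv_eq
      rw [deriv_const, hderiv w hwU] at h3
      have h4 := (mul_eq_zero.1 h3).resolve_right (hζ0 w hwU)
      rw [hhe] at h4
      have h5 := (div_eq_zero_iff.1 h4).resolve_right hk0
      exact (div_eq_zero_iff.1 h5).resolve_right (hF0 w (hUU hwU))
    obtain ⟨ε, hε, hball⟩ := Metric.eventually_nhds_iff_ball.1 h1
    refine D.not_const z hz.1.2 (eventually_of_mem (ball_mem_nhds z hε) fun w hw => ?_)
    exact isOpen_ball.is_const_of_deriv_eq_zero (convex_ball z ε).isPreconnected
      (hF.mono fun w hw => hUU (hball w hw).1) (fun w hw => (hball w hw).2) hw (mem_ball_self hε)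
  obtain ⟨a', ha₂, ha₂'⟩ := exists_between D.r₂_lt
  obtain ⟨b', hab', hb'⟩ := exists_between ha₂'
  obtain ⟨a₀, ha₀, ha₀'⟩ := exists_between hρ1
  obtain ⟨b₀, hab₀, hb₀⟩ := exists_between ha₀'
  have hJ : ∫ z in U', dbar (radStep ζ a₀ b₀) z * logDeriv ζ z = Real.pi := by
    have hFU' := hF.mono hUU
    have hlU' : DifferentiableOn ℂ (logDeriv F) U' := hlog.mono hUU
    have e1 : ∫ z in U', dbar (radStep F a' b') z * logDeriv F z = (Real.pi * k : ℝ) := by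
      rw [← hI, integral_dbar_radStep_mul_congr hUo hF ha' hab' (D.isCompact_shell le_rfl
        (lt_min ha (hr₀₂.trans ha₂)) (max_lt (D.r₁_lt.trans D.r₂_lt) hb')) hlog]
      refine (setIntegral_eq_of_subset_of_forall_sdiff_eq_zero hUo.measurableSet hUU
        fun z hz => ?_).symm
      rw [dbar_radStep_eq_zero (hFd z hz.1).differentiableAt hab', zero_mul]
      exact fun h' => hz.2 ⟨hz.1.1, ha₂.trans_le h'.1⟩
    have e2 : ∀ z ∈ U', logDeriv ζ z = h z := fun z hz => by
      rw [logDeriv_apply, hderiv z hz, mul_div_cancel_right₀ _ (hζ0 z hz)]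
    set s : ℝ := min a₀ (a' ^ (1 / k)) with hs
    set t : ℝ := max b₀ (b' ^ (1 / k)) with ht
    have ha'0 : 0 < a' := hr₂.trans ha₂
    have hb'0 : 0 < b' := ha'0.trans hab'
    have hρs : ρ < s := lt_min ha₀ (Real.rpow_lt_rpow hr₂.le ha₂ hk1)
    have ht1 : t < 1 := max_lt hb₀ (Real.rpow_lt_one hb'0.le hb' hk1)
    have e3 := integral_dbar_mul_eq_zero (u := fun z => radStep ζ a₀ b₀ z - radStep F a' b' z)
      (g := logDeriv F) hUo' (hK s t hρs ht1) shell_subset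
      ((radStep_contDiffOn hUo' hζd a₀ b₀).sub (radStep_contDiffOn hUo' hFU' a' b'))
      (fun z hz => by
        have hz' : ¬ (s ≤ ‖ζ z‖ ^ 2 ∧ ‖ζ z‖ ^ 2 ≤ t) := fun h' => hz.2 ⟨hz.1, h'⟩
        have hFz : (0 : ℝ) ≤ ‖F z‖ ^ 2 := sq_nonneg _
        simp only [radStep]
        rcases not_and_or.1 hz' with h1 | h1
        · rw [not_le] at h1
          rw [stepFn_of_le hab₀ (h1.le.trans (min_le_left _ _)), stepFn_of_le hab', sub_self]
          have h2 := h1.trans_le (min_le_right _ _)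
          rw [hsq z hz.1] at h2
          exact ((Real.rpow_lt_rpow_iff hFz ha'0.le hk1).1 h2).le
        · rw [not_le] at h1
          rw [stepFn_of_ge hab₀ ((le_max_left _ _).trans h1.le), stepFn_of_ge hab', sub_self]
          have h2 := (le_max_right _ _).trans_lt h1
          rw [hsq z hz.1] at h2
          exact ((Real.rpow_lt_rpow_iff hb'0.le hFz hk1).1 h2).le) hlU'
    have i1 := integrableOn_dbar_radStep_mul (g := logDeriv F) hUo' hζd hab₀ (hK a₀ b₀ ha₀ hb₀)
      (hlU'.continuousOn.mono shell_subset)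
    have i2 := integrableOn_dbar_radStep_mul (g := logDeriv F) hUo' hFU' hab'
      (D.isCompact_shell hr₀₂.le ha₂ hb') (hlU'.continuousOn.mono shell_subset)
    have e4 : ∫ z in U', dbar (radStep ζ a₀ b₀) z * logDeriv F z = (Real.pi * k : ℝ) := by
      rw [← e1, ← sub_eq_zero, ← integral_sub i1 i2, ← e3.2]
      refine setIntegral_congr_fun hUo'.measurableSet fun z hz => ?_
      have hd {φ : ℂ → ℂ} (hφ : DifferentiableOn ℂ φ U') (a b : ℝ) :
          DifferentiableAt ℝ (radStep φ a b) z :=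
        ((radStep_contDiffOn hUo' hφ a b).differentiableOn one_ne_zero).differentiableAt
          (hUo'.mem_nhds hz)
      rw [← sub_mul, ← dbar_sub (hd hζd a₀ b₀) (hd hFU' a' b')]
    have e5 : ∫ z in U', dbar (radStep ζ a₀ b₀) z * logDeriv ζ z =
        (∫ z in U', dbar (radStep ζ a₀ b₀) z * logDeriv F z) / k := by
      rw [← integral_div]
      refine setIntegral_congr_fun hUo'.measurableSet fun z hz => ?_
      rw [e2 z hz, mul_div_assoc]
    rw [e5, e4]
    push_cast
    field_simp
  have hbij := fun ω hω1 hω2 => bijective_of_integral_logDeriv (ω := ω) hUo' hζd hρ0.le hmap hK hne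
    ha₀ hab₀ hb₀ hJ hω1 hω2
  choose! ψ hψU hζψ hψd hψu using hbij
  have hleft : ∀ z ∈ U', ψ (ζ z) = z := fun z hz =>
    (hψu (ζ z) (hmap z hz).1 (hmap z hz).2 z hz rfl).symm
  have hψder : ∀ ω, ρ < ‖ω‖ ^ 2 → ‖ω‖ ^ 2 < 1 → HasDerivAt ψ (deriv ζ (ψ ω))⁻¹ ω :=
    fun ω h1 h2 => hasDerivAt_of_inverse (A := {ω | ρ < ‖ω‖ ^ 2 ∧ ‖ω‖ ^ 2 < 1}) hUo' hζd
      (fun ω h => ⟨hψU ω h.1 h.2, hζψ ω h.1 h.2⟩) hleft ⟨h1, h2⟩ (hψd ω h1 h2)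
  obtain ⟨n, c, hn, hc⟩ := exists_eq_mul_pow hρ0 hρ1 (f := fun ω => F (ψ ω)) hk
    fun ω h1 h2 => by
      have hz := hψU ω h1 h2
      refine ⟨hF0 _ (hUU hz), ((hFd _ (hUU hz)).comp ω (hψder ω h1 h2)).congr_deriv ?_⟩
      have hω0 : ω ≠ 0 := fun h' => by
        have := hζ0 _ hz
        rw [hζψ ω h1 h2] at this
        exact this h'
      have hd := hψd ω h1 h2
      have e := hderiv _ hz
      rw [hζψ ω h1 h2] at e
      rw [e] at hd ⊢
      rw [hhe] at hd ⊢
      have := hF0 _ (hUU hz)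
      have hF'0 : deriv F (ψ ω) ≠ 0 := fun h' => hd (by rw [h']; simp)
      field_simp
  have hn0 : 0 < n := by
    rw [← hn] at hk
    exact_mod_cast hk
  have hFe : ∀ z ∈ U', F z = c * ζ z ^ n := fun z hz => by
    have := hc (ζ z) (hmap z hz).1 (hmap z hz).2
    rwa [hleft z hz] at this
  refine ⟨ρ, n, c, ζ, ψ, hUo', hρ0, hρ1, hn0, ?_, hζd, hmap, hFe, hleft, hψU, hζψ,
    fun ω h1 h2 => (hψder ω h1 h2).differentiableAt⟩
  obtain ⟨z, hz, hzs⟩ := D.exists_level (hr₀₂.trans ha₂) (hab'.trans hb')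
  have hzU : z ∈ U' := ⟨hz, by rw [hzs]; exact ha₂⟩
  have h1 := congrArg norm (hFe z hzU)
  rw [norm_mul, norm_pow, (hζ z hzU).1, ← Real.rpow_natCast, ← Real.rpow_mul (norm_nonneg _), hn,
    one_div_mul_cancel hk.ne', Real.rpow_one] at h1
  exact mul_right_cancel₀ (norm_ne_zero_iff.2 (hF0 z (hUU hzU))) (by rw [one_mul]; exact h1.symm)

theorem isPreconnected_ball_sdiff_singleton (z : ℂ) (ε : ℝ) : IsPreconnected (ball z ε \ {z}) := by
  rcases le_or_gt ε 0 with hε | hε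
  · rw [ball_eq_empty.2 hε, empty_sdiff]
    exact isPreconnected_empty
  have h : ball z ε \ {z} = (fun s => z + exp s) '' {s | s.re < Real.log ε} := by
    ext w
    simp only [Set.mem_sdiff, mem_ball, mem_singleton_iff, mem_image]
    constructor
    · rintro ⟨h1, h2⟩
      have h3 := sub_ne_zero.2 h2
      refine ⟨log (w - z), ?_, by rw [exp_log h3]; ring⟩
      change (log (w - z)).re < _
      rw [log_re]
      exact Real.log_lt_log (norm_pos_iff.2 h3) (by rwa [← dist_eq_norm])
    · rintro ⟨s, hs, rfl⟩
      refine ⟨?_, fun h => exp_ne_zero s (add_eq_left.1 h)⟩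
      rw [dist_eq_norm, add_sub_cancel_left, norm_exp]
      exact (Real.lt_log_iff_exp_lt hε).1 hs
  rw [h]
  exact (convex_halfSpace_re_lt _).isPreconnected.image _ (by fun_prop)

theorem IsPreconnected.sdiff_singleton {U : Set ℂ} (hU : IsOpen U) (hc : IsPreconnected U) (z : ℂ) :
    IsPreconnected (U \ {z}) := by
  by_cases hz : z ∈ U
  swap
  · rwa [sdiff_singleton_eq_self hz]
  obtain ⟨ε, hε, hb⟩ := Metric.isOpen_iff.1 hU z hz
  have key : ∀ u v : Set ℂ, IsOpen u → IsOpen v → U \ {z} ⊆ u ∪ v → U \ {z} ∩ (u ∩ v) = ∅ →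
      ball z ε \ {z} ⊆ u → U \ {z} ⊆ u := fun u v hu hv huv hd hbu => by
    have h1 := isPreconnected_iff_subset_of_disjoint.1 hc (u ∪ ball z ε) (v \ {z})
      (hu.union isOpen_ball) (hv.sdiff isClosed_singleton) (fun x hx => ?_) ?_
    · rcases h1 with h1 | h1
      · rintro x ⟨hx, hxz⟩
        exact (h1 hx).elim id fun h => hbu ⟨h, hxz⟩
      · exact absurd rfl (h1 hz).2
    · by_cases hxz : x = z
      · exact Or.inl (Or.inr (by rw [hxz]; exact mem_ball_self hε))
      · exact (huv ⟨hx, hxz⟩).imp Or.inl fun h => ⟨h, hxz⟩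
    · rw [eq_empty_iff_forall_notMem] at hd ⊢
      rintro x ⟨hx, h1, h2, hxz⟩
      exact hd x ⟨⟨hx, hxz⟩, h1.elim id fun h => hbu ⟨h, hxz⟩, h2⟩
  refine isPreconnected_iff_subset_of_disjoint.2 fun u v hu hv huv hd => ?_
  have hbU : ball z ε \ {z} ⊆ U \ {z} := sdiff_subset_sdiff_left hb
  rcases isPreconnected_iff_subset_of_disjoint.1 (isPreconnected_ball_sdiff_singleton z ε) u v hu hv
    (hbU.trans huv) (eq_empty_of_subset_empty ((inter_subset_inter_left _ hbU).trans hd.subset))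
    with h | h
  · exact Or.inl (key u v hu hv huv hd h)
  · exact Or.inr (key v u hv hu (by rwa [union_comm]) (by rwa [inter_comm v u]) h)

/-- Cycles on which a function is close to one do not wind around points where it is small. -/
theorem exists_winding_level {O : Set ℂ} {F : ℂ → ℂ} (hO : IsOpen O) (hc : IsPreconnected O)
    (hF : ContinuousOn F O) (hF1 : ∀ z ∈ O, ‖F z‖ ^ 2 < 1) {R r : ℝ} (hr : r < 1)
    (hR : ∀ z, R ≤ ‖z‖ → z ∈ O ∧ ‖F z‖ ^ 2 ≤ r) {K : Set ℂ} (hK : IsCompact K) (hKO : K ⊆ O) :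
    ∃ t < 1, ∀ S p Φ, S ⊆ {z | z ∈ O ∧ t < ‖F z‖ ^ 2} → IsCompact S → PolyPath S p p Φ →
      ∀ ζ ∈ K, (Φ fun z => 1 / (z - ζ)) = 0 := by
  set P : Set ℂ → Prop := fun N => ∃ t < 1, ∀ S p Φ, S ⊆ {z | z ∈ O ∧ t < ‖F z‖ ^ 2} →
    IsCompact S → PolyPath S p p Φ → ∀ ζ ∈ N, (Φ fun z => 1 / (z - ζ)) = 0 with hP
  set T : Set ℂ := {ζ | ∃ N ∈ 𝓝 ζ, P N} with hT
  have hTo : IsOpen T := by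
    refine isOpen_iff_mem_nhds.2 fun ζ ⟨N, hN, hPN⟩ => ?_
    filter_upwards [eventually_mem_nhds_iff.2 hN] with w hw
    exact ⟨N, hw, hPN⟩
  have hfar : ∀ ζ, R < ‖ζ‖ → ζ ∈ T := fun ζ hζ =>
    ⟨{z | R < ‖z‖}, (isOpen_lt continuous_const continuous_norm).mem_nhds hζ, r, hr,
      fun S p Φ hS _ H ζ hζ => H.winding_eq_zero_of_far (fun z hz => by
        by_contra h
        exact absurd (hS hz).2 (not_lt.2 (hR z (not_lt.1 h)).2)) (mem_ofPred.1 hζ).le⟩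
  have hOT : O ⊆ T := by
    refine hc.subset_of_closure_inter_subset hTo ?_ ?_
    · have h1 : R < ‖((|R| + 1 : ℝ) : ℂ)‖ := by
        rw [norm_real, Real.norm_of_nonneg (by positivity)]
        linarith [le_abs_self R]
      exact ⟨_, (hR _ h1.le).1, hfar _ h1⟩
    · rintro ζ ⟨hζT, hζO⟩
      obtain ⟨s, hs, hs1⟩ := exists_between (hF1 ζ hζO)
      have hO' := (hF.norm.pow 2).isOpen_inter_preimage hO (isOpen_Iio (a := s))
      obtain ⟨ε, hε, hb⟩ := Metric.isOpen_iff.1 hO' ζ ⟨hζO, hs⟩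
      obtain ⟨ζ₁, hζ₁, N, hN, t, ht, hPN⟩ := mem_closure_iff_nhds.1 hζT _ (ball_mem_nhds ζ hε)
      refine ⟨ball ζ ε, ball_mem_nhds ζ hε, max s t, max_lt hs1 ht, fun S p Φ hS hSc H η hη => ?_⟩
      rw [H.winding_eq_of_isPreconnected hSc.isClosed isPreconnected_ball
        (disjoint_left.2 fun x hx hxS => absurd ((le_max_left _ _).trans_lt (hS hxS).2)
          (not_lt.2 (mem_Iio.1 (hb hx).2).le)) hη hζ₁]
      exact hPN S p Φ (fun z hz => ⟨(hS hz).1, (le_max_right _ _).trans_lt (hS hz).2⟩) hSc H ζ₁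
        (mem_of_mem_nhds hN)
  refine hK.induction_on (p := P) ⟨0, one_pos, fun _ _ _ _ _ _ ζ hζ => hζ.elim⟩
    (fun A B hAB ⟨t, ht, h⟩ => ⟨t, ht, fun S p Φ hS hSc H ζ hζ => h S p Φ hS hSc H ζ (hAB hζ)⟩)
    (fun A B ⟨t, ht, h⟩ ⟨t', ht', h'⟩ => ⟨max t t', max_lt ht ht', fun S p Φ hS hSc H ζ hζ => ?_⟩)
    fun ζ hζ => ?_
  · rcases hζ with hζ | hζ
    · exact h S p Φ (fun z hz => ⟨(hS hz).1, (le_max_left _ _).trans_lt (hS hz).2⟩) hSc H ζ hζ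
    · exact h' S p Φ (fun z hz => ⟨(hS hz).1, (le_max_right _ _).trans_lt (hS hz).2⟩) hSc H ζ hζ
  · obtain ⟨N, hN, hPN⟩ := hOT (hKO hζ)
    exact ⟨N, mem_nhdsWithin_of_mem_nhds hN, hPN⟩

theorem finite_connectedComponentIn {A : Set ℂ} {T : Set (Set ℂ)} (hT : T.Finite)
    (hc : ∀ B ∈ T, IsPreconnected B ∧ B ⊆ A) (hA : A ⊆ ⋃₀ T) :
    {C | ∃ x ∈ A, C = connectedComponentIn A x}.Finite := by
  classical
  refine (hT.image fun B => if h : B.Nonempty then connectedComponentIn A h.some else ∅).subset ?_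
  rintro C ⟨x, hx, rfl⟩
  obtain ⟨B, hB, hxB⟩ := hA hx
  refine ⟨B, hB, ?_⟩
  have hne : B.Nonempty := ⟨x, hxB⟩
  simp only [hne, dite_true]
  exact connectedComponentIn_eq ((hc B hB).1.subset_connectedComponentIn hne.some_mem (hc B hB).2 hxB)

/-- A proper function to the disc, in the complement of finitely many continua: every end is an
annulus. -/
theorem exists_annulusCharts {O : Set ℂ} {F : ℂ → ℂ} (hO : IsOpen O) (hc : IsPreconnected O)
    (hF : DifferentiableOn ℂ F O) (hF1 : ∀ z ∈ O, ‖F z‖ ^ 2 < 1)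
    (hnc : ∀ z ∈ O, ¬ ∀ᶠ w in 𝓝 z, F w = F z) {R r : ℝ} (hr : r < 1) (hr0 : 0 ≤ r)
    (hR : ∀ z, R ≤ ‖z‖ → z ∈ O ∧ ‖F z‖ ^ 2 ≤ r)
    (hcl : ∀ t < 1, IsClosed {z | z ∈ O ∧ ‖F z‖ ^ 2 ≤ t})
    (hfin : {C | ∃ x ∈ Oᶜ, C = connectedComponentIn Oᶜ x}.Finite) :
    ∃ t < 1, ∃ (ι : Type) (W : ι → Set ℂ) (ρ : ι → ℝ) (k : ι → ℕ) (c : ι → ℂ) (ζ ψ : ι → ℂ → ℂ),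
      Finite ι ∧ (∀ i, W i ⊆ O ∧ AnnulusChart (W i) F (ρ i) (k i) (c i) (ζ i) (ψ i)) ∧
      ∀ z ∈ O, t < ‖F z‖ ^ 2 → ∃ i, z ∈ W i := by
  have hFc := hF.continuousOn
  set ι := {C | ∃ x ∈ Oᶜ, C = connectedComponentIn Oᶜ x} with hι
  have hfinι : Finite ι := hfin
  have hOc : IsCompact Oᶜ := by
    refine (isCompact_closedBall (0 : ℂ) R).of_isClosed_subset hO.isClosed_compl fun z hz => ?_
    rw [mem_closedBall_zero_iff]
    exact (not_le.1 fun h => hz (hR z h).1).le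
  have hE : ∀ C : ι, IsClosed (C : Set ℂ) ∧ IsPreconnected (C : Set ℂ) ∧ (C : Set ℂ).Nonempty ∧
      (C : Set ℂ) ⊆ Oᶜ := by
    rintro ⟨C, x, hx, rfl⟩
    refine ⟨?_, isPreconnected_connectedComponentIn, ⟨x, mem_connectedComponentIn hx⟩,
      connectedComponentIn_subset _ _⟩
    refine isClosed_of_closure_subset ?_
    exact (isPreconnected_connectedComponentIn.closure).subset_connectedComponentIn
      (subset_closure (mem_connectedComponentIn hx))
      (closure_minimal (connectedComponentIn_subset _ _) hO.isClosed_compl)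
  have hEd : ∀ C D : ι, ∀ x, x ∈ (C : Set ℂ) → x ∈ (D : Set ℂ) → C = D := by
    rintro ⟨C, x, hx, rfl⟩ ⟨D, y, hy, rfl⟩ z hz hz'
    exact Subtype.ext ((connectedComponentIn_eq hz).trans (connectedComponentIn_eq hz').symm)
  set V : ι → Set ℂ := fun C => ⋂ D : ι, {z | D ≠ C → infDist z C < infDist z D} with hV
  have hVo : ∀ C, IsOpen (V C) := fun C => isOpen_iInter_of_finite fun D => by
    by_cases h : D = C
    · simp [h]
    · simpa [h] using isOpen_lt (continuous_infDist_pt (C : Set ℂ)) (continuous_infDist_pt (D : Set ℂ))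
  have hVd : ∀ C D, ∀ z ∈ V C, z ∈ V D → C = D := fun C D z hC hD => by
    by_contra h
    exact lt_asymm (mem_iInter.1 hC D (Ne.symm h)) (mem_iInter.1 hD C h)
  have hEV : ∀ C : ι, (C : Set ℂ) ⊆ V C := fun C z hz => mem_iInter.2 fun D hD => by
    rw [((hE C).1.mem_iff_infDist_zero (hE C).2.2.1).1 hz]
    exact ((hE D).1.notMem_iff_infDist_pos (hE D).2.2.1).1 fun h => hD (hEd D C z h hz)
  have hcov : ∀ z ∉ O, ∃ C : ι, z ∈ (C : Set ℂ) := fun z hz =>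
    ⟨⟨_, z, hz, rfl⟩, mem_connectedComponentIn hz⟩
  obtain ⟨m, hm1, hm⟩ : ∃ m < 1, ∀ z ∈ closedBall (0 : ℂ) R \ ⋃ C, V C, ‖F z‖ ^ 2 ≤ m := by
    have hKO : closedBall (0 : ℂ) R \ ⋃ C, V C ⊆ O := fun z hz => by
      by_contra h
      obtain ⟨C, hC⟩ := hcov z h
      exact hz.2 (mem_iUnion.2 ⟨C, hEV C hC⟩)
    have hK : IsCompact (closedBall (0 : ℂ) R \ ⋃ C, V C) :=
      (isCompact_closedBall _ _).diff (isOpen_iUnion hVo)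
    rcases (closedBall (0 : ℂ) R \ ⋃ C, V C).eq_empty_or_nonempty with h | h
    · exact ⟨0, one_pos, by rw [h]; simp⟩
    · obtain ⟨m, hm, hmax⟩ := hK.exists_isMaxOn h ((hFc.norm.pow 2).mono hKO)
      exact ⟨_, hF1 m (hKO hm), fun z hz => hmax hz⟩
  set r₀ := max r m with hr₀
  have hr₀1 : r₀ < 1 := max_lt hr hm1
  have hVcov : ∀ z ∈ O, r₀ < ‖F z‖ ^ 2 → ∃ C, z ∈ V C := fun z hz h => by
    by_contra! h'
    have hzR : z ∈ closedBall (0 : ℂ) R := by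
      rw [mem_closedBall_zero_iff]
      by_contra h2
      exact absurd ((le_max_left _ _).trans_lt h) (not_lt.2 (hR z (not_le.1 h2).le).2)
    exact absurd ((le_max_right _ _).trans_lt h) (not_lt.2 (hm z ⟨hzR, by simpa using h'⟩))
  obtain ⟨r₁, hr₁, hr₁1⟩ := exists_between hr₀1
  have hK₁ : IsCompact {z | z ∈ O ∧ ‖F z‖ ^ 2 ≤ r₁ ∧ ‖z‖ ≤ R} := by
    have := (isCompact_closedBall (0 : ℂ) R).inter_left (hcl r₁ hr₁1)
    refine (congrArg IsCompact (Set.ext fun z => ?_)).mp this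
    change (_ ∧ _) ∧ z ∈ closedBall (0 : ℂ) R ↔ _ ∧ _ ∧ _
    rw [mem_closedBall_zero_iff, and_assoc]
  obtain ⟨t, ht, hwind⟩ := exists_winding_level hO hc hFc hF1 hr hR hK₁ fun z hz => hz.1
  obtain ⟨r₂, hr₂, hr₂1⟩ := exists_between (max_lt ht hr₁1)
  have hr₁₂ : r₁ < r₂ := (le_max_right _ _).trans_lt hr₂
  have hD : ∀ C : ι, EndData O (V C) C F r₀ r₁ r₂ := fun C =>
    { isOpen_O := hO
      isOpen_V := hVo C
      isCompact_E := hOc.of_isClosed_subset (hE C).1 (hE C).2.2.2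
      isPreconnected_E := (hE C).2.1
      nonempty_E := (hE C).2.2.1
      E_subset := hEV C
      disjoint := disjoint_left.2 fun z hz => (hE C).2.2.2 hz
      diff_subset := fun z hz => by
        obtain ⟨D, hD⟩ := hcov z hz.2
        rwa [hVd C D z hz.1 (hEV D hD)]
      differentiableOn := hF
      norm_lt := hF1
      r₀_nonneg := hr0.trans (le_max_left _ _)
      r₀_lt := hr₁
      r₁_lt := hr₁₂
      r₂_lt := hr₂1
      isCompact_level := fun s hs => by
        have h1 : IsOpen {z | z ∈ O ∧ ‖F z‖ ^ 2 < s} :=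
          (hFc.norm.pow 2).isOpen_inter_preimage hO (isOpen_Iio (a := s))
        have h2 : IsOpen (⋃ D : ι, ⋃ _ : D ≠ C, V D) :=
          isOpen_iUnion fun D => isOpen_iUnion fun _ => hVo D
        have e : {z | z ∈ V C ∧ (z ∉ O ∨ s ≤ ‖F z‖ ^ 2)} =
            {z | z ∈ O ∧ ‖F z‖ ^ 2 < s}ᶜ ∩ (⋃ D : ι, ⋃ _ : D ≠ C, V D)ᶜ := by
          ext z
          constructor
          · rintro ⟨h, h'⟩
            refine ⟨fun h3 => ?_, fun h3 => ?_⟩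
            · exact h'.elim (fun h4 => h4 h3.1) fun h4 => absurd h3.2 (not_lt.2 h4)
            · simp only [mem_iUnion] at h3
              obtain ⟨D, hD, hz⟩ := h3
              exact hD (hVd D C z hz h)
          · rintro ⟨h, h'⟩
            have h3 : z ∉ O ∨ s ≤ ‖F z‖ ^ 2 := by
              by_contra! h4
              exact h h4
            refine ⟨?_, h3⟩
            obtain ⟨D, hD⟩ : ∃ D, z ∈ V D := by
              by_cases hz : z ∈ O
              · exact hVcov z hz (hs.trans_le (h3.resolve_left fun h => h hz))
              · obtain ⟨D, hD⟩ := hcov z hz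
                exact ⟨D, hEV D hD⟩
            by_cases hDC : D = C
            · rwa [← hDC]
            · exact absurd (mem_iUnion.2 ⟨D, mem_iUnion.2 ⟨hDC, hD⟩⟩) h'
        rw [e]
        refine (isCompact_closedBall (0 : ℂ) R).of_isClosed_subset
          (h1.isClosed_compl.inter h2.isClosed_compl) fun z hz => ?_
        rw [mem_closedBall_zero_iff]
        by_contra h3
        obtain ⟨h4, h5⟩ := hR z (not_le.1 h3).le
        exact hz.1 ⟨h4, (h5.trans (le_max_left _ _)).trans_lt hs⟩
      isClosed_sub := hcl
      not_const := hnc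
      winding := fun S p Φ hS hSs H ζ hζ hζr => by
        have hSO : S ⊆ {z | z ∈ O ∧ r₂ < ‖F z‖ ^ 2} := fun z hz => ⟨(hSs hz).1.2, (hSs hz).2⟩
        by_cases h : ‖ζ‖ ≤ R
        · exact hwind S p Φ (fun z hz => ⟨(hSO hz).1,
            ((le_max_left _ _).trans_lt hr₂).trans (hSO hz).2⟩) hS H ζ ⟨hζ, hζr, h⟩
        · refine H.winding_eq_zero_of_far (fun z hz => ?_) (not_le.1 h).le
          by_contra h2
          have h3 : r < r₂ := (le_max_left _ _).trans_lt (hr₁.trans hr₁₂)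
          exact absurd (h3.trans (hSO hz).2) (not_lt.2 (hR z (not_lt.1 h2)).2) }
  choose ρ k c ζ ψ hchart using fun C => (hD C).exists_annulusChart
  obtain ⟨n, ⟨e⟩⟩ := Finite.exists_equiv_fin ι
  refine ⟨r₂, hr₂1, Fin n, fun i => endSet O (V (e.symm i)) F r₂, fun i => ρ (e.symm i),
    fun i => k (e.symm i), fun i => c (e.symm i), fun i => ζ (e.symm i), fun i => ψ (e.symm i),
    inferInstance, fun i => ⟨EndData.endSet_subset _, hchart _⟩, fun z hz h => ?_⟩
  obtain ⟨C, hC⟩ := hVcov z hz ((hr₁.trans hr₁₂).trans h)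
  exact ⟨e C, ⟨by simpa using hC, hz⟩, h⟩

theorem IsProperOntoDisc.norm_sq_lt {Ω : Set ℂ} {f : ℂ → ℂ} (hf : IsProperOntoDisc Ω f) {z : ℂ}
    (hz : z ∈ Ω) : ‖f z‖ ^ 2 < 1 := by
  have h : f z ∈ ball (0 : ℂ) 1 := hf.2.1 ▸ mem_image_of_mem f hz
  rw [mem_ball_zero_iff] at h
  nlinarith [norm_nonneg (f z)]

theorem IsProperOntoDisc.isCompact_sublevel {Ω : Set ℂ} {f : ℂ → ℂ} (hf : IsProperOntoDisc Ω f)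
    {t : ℝ} (ht : t < 1) : IsCompact {z | z ∈ Ω ∧ ‖f z‖ ^ 2 ≤ t} := by
  refine hf.2.2 {v | ‖v‖ ^ 2 ≤ t} (fun v hv => ?_) ?_
  · have hv' : ‖v‖ ^ 2 ≤ t := hv
    rw [mem_ball_zero_iff]
    nlinarith [norm_nonneg v]
  · refine (isCompact_closedBall (0 : ℂ) 1).of_isClosed_subset
      (isClosed_le (by fun_prop) continuous_const) fun v hv => ?_
    have hv' : ‖v‖ ^ 2 ≤ t := hv
    rw [mem_closedBall_zero_iff]
    nlinarith [norm_nonneg v]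

theorem IsProperOntoDisc.not_eventually_const {Ω : Set ℂ} {f : ℂ → ℂ} (hΩ : IsFinConnDomain Ω)
    (hf : IsProperOntoDisc Ω f) {z : ℂ} (hz : z ∈ Ω) : ¬ ∀ᶠ w in 𝓝 z, f w = f z := fun h => by
  have h1 := (hf.1.analyticOnNhd hΩ.1).eqOn_of_preconnected_of_eventuallyEq
    (analyticOnNhd_const (v := f z)) hΩ.2.1.isPreconnected hz h
  have h2 : ∀ v ∈ ball (0 : ℂ) 1, v = f z := fun v hv => by
    rw [← hf.2.1] at hv
    obtain ⟨w, hw, rfl⟩ := hv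
    exact h1 hw
  have h3 := h2 0 (by simp)
  have h4 := h2 (1 / 2) (by rw [mem_ball_zero_iff]; norm_num)
  rw [← h3] at h4
  norm_num at h4

/-- Near the boundary, a finitely connected domain with a proper map to the disc is covered by
annuli on which the map is a power. -/
theorem exists_collar {Ω : Set ℂ} {f : ℂ → ℂ} (hΩ : IsFinConnDomain Ω)
    (hf : IsProperOntoDisc Ω f) :
    ∃ r < 1, ∃ (ι : Type) (W : ι → Set ℂ) (ρ : ι → ℝ) (k : ι → ℕ) (c : ι → ℂ) (ζ ψ : ι → ℂ → ℂ),
      Finite ι ∧ (∀ i, W i ⊆ Ω ∧ AnnulusChart (W i) f (ρ i) (k i) (c i) (ζ i) (ψ i)) ∧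
      ∀ z ∈ Ω, r < ‖f z‖ ^ 2 → ∃ i, z ∈ W i := by
  obtain ⟨z₀, hz₀⟩ := hΩ.2.1.nonempty
  set φ : ℂ → ℂ := fun z => (z - z₀)⁻¹ with hφ
  set θ : ℂ → ℂ := fun w => z₀ + w⁻¹ with hθ
  have hφe : ∀ z, φ z = (z - z₀)⁻¹ := fun z => rfl
  have hθe : ∀ z, θ z = z₀ + z⁻¹ := fun z => rfl
  have hθφ : ∀ z, θ (φ z) = z := fun z => by simp [hφe, hθe]
  have hφθ : ∀ z, φ (θ z) = z := fun z => by simp [hφe, hθe]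
  have hφ0 : ∀ z, φ z = 0 ↔ z = z₀ := fun z => by simp [hφe, sub_eq_zero]
  have hφd : ∀ z, z ≠ z₀ → DifferentiableAt ℂ φ z := fun z hz =>
    ((differentiableAt_id.sub_const z₀).inv (sub_ne_zero.2 hz))
  have hθd : ∀ w, w ≠ 0 → DifferentiableAt ℂ θ w := fun w hw =>
    (differentiableAt_id.inv hw).const_add z₀
  set O : Set ℂ := {w | w ≠ 0 ∧ θ w ∈ Ω} with hO
  have hOi : O = φ '' (Ω \ {z₀}) := by
    ext w
    constructor
    · rintro ⟨h1, h2⟩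
      refine ⟨θ w, ⟨h2, fun h => h1 ?_⟩, hφθ w⟩
      rw [← hφθ w]
      exact (hφ0 _).2 h
    · rintro ⟨z, ⟨h1, h2⟩, rfl⟩
      exact ⟨fun h => h2 ((hφ0 z).1 h), by rwa [hθφ]⟩
  have hOo : IsOpen O := by
    have h : ContinuousOn θ {0}ᶜ := fun w hw => (hθd w hw).continuousAt.continuousWithinAt
    exact h.isOpen_inter_preimage isOpen_compl_singleton hΩ.1
  have hOc : IsPreconnected O := by
    rw [hOi]
    exact (hΩ.2.1.isPreconnected.sdiff_singleton hΩ.1 z₀).image _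
      fun z hz => (hφd z hz.2).continuousAt.continuousWithinAt
  set F : ℂ → ℂ := fun w => f (θ w) with hF
  have hfd : ∀ z ∈ Ω, DifferentiableAt ℂ f z := fun z hz =>
    hf.1.differentiableAt (hΩ.1.mem_nhds hz)
  have hFd : DifferentiableOn ℂ F O := fun w hw =>
    ((hfd _ hw.2).comp w (hθd w hw.1)).differentiableWithinAt
  have hF1 : ∀ w ∈ O, ‖F w‖ ^ 2 < 1 := fun w hw => hf.norm_sq_lt hw.2
  have hnc : ∀ w ∈ O, ¬ ∀ᶠ v in 𝓝 w, F v = F w := fun w hw h => by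
    refine hf.not_eventually_const hΩ hw.2 ?_
    have h1 : θ w ≠ z₀ := fun h1 => hw.1 (by rw [← hφθ w]; exact (hφ0 _).2 h1)
    have h2 : Tendsto φ (𝓝 (θ w)) (𝓝 w) := by
      have := (hφd _ h1).continuousAt.tendsto
      rwa [hφθ] at this
    filter_upwards [h2.eventually h] with z hz
    simpa only [hF, hθφ] using hz
  have hz1 := hf.norm_sq_lt hz₀
  set r := (‖f z₀‖ ^ 2 + 1) / 2 with hr
  have hr1 : r < 1 := by rw [hr]; linarith
  have hr0 : 0 ≤ r := by positivity
  have hzr : ‖f z₀‖ ^ 2 < r := by rw [hr]; linarith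
  obtain ⟨ε, hε, hεb⟩ : ∃ ε > 0, ∀ z ∈ ball z₀ ε, z ∈ Ω ∧ ‖f z‖ ^ 2 ≤ r := by
    have h1 : ∀ᶠ z in 𝓝 z₀, ‖f z‖ ^ 2 < r :=
      (((hfd _ hz₀).continuousAt.norm).pow 2).tendsto.eventually_lt_const hzr
    obtain ⟨ε, hε, h⟩ := Metric.eventually_nhds_iff_ball.1
      (Filter.Eventually.and (hΩ.1.eventually_mem hz₀) h1)
    exact ⟨ε, hε, fun z hz => ⟨(h z hz).1, (h z hz).2.le⟩⟩
  have hR : ∀ w, 2 / ε ≤ ‖w‖ → w ∈ O ∧ ‖F w‖ ^ 2 ≤ r := fun w hw => by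
    have h0 : 0 < ‖w‖ := lt_of_lt_of_le (by positivity) hw
    have h1 : θ w ∈ ball z₀ ε := by
      rw [mem_ball, dist_eq_norm, hθe, add_sub_cancel_left, norm_inv, inv_lt_comm₀ h0 hε]
      refine lt_of_lt_of_le ?_ hw
      rw [inv_eq_one_div]
      gcongr
      norm_num
    exact ⟨⟨norm_pos_iff.1 h0, (hεb _ h1).1⟩, (hεb _ h1).2⟩
  have hcl : ∀ t < 1, IsClosed {w | w ∈ O ∧ ‖F w‖ ^ 2 ≤ t} := fun t ht => by
    have hC := hf.isCompact_sublevel ht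
    obtain ⟨M, hM⟩ := hC.isBounded.exists_norm_le
    have hM1 : 0 < |M| + ‖z₀‖ + 1 := by positivity
    have hcont : ContinuousOn θ {w | (|M| + ‖z₀‖ + 1)⁻¹ ≤ ‖w‖} := fun w hw => by
      refine (hθd w ?_).continuousAt.continuousWithinAt
      exact norm_pos_iff.1 (lt_of_lt_of_le (by positivity) hw)
    have h1 := hcont.preimage_isClosed_of_isClosed
      (isClosed_le continuous_const continuous_norm) hC.isClosed
    convert h1 using 1
    ext w
    constructor
    · rintro ⟨⟨h2, h3⟩, h4⟩
      refine ⟨?_, h3, h4⟩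
      change _ ≤ ‖w‖
      have h5 := hM _ ⟨h3, h4⟩
      have h6 : ‖w⁻¹‖ ≤ |M| + ‖z₀‖ + 1 := by
        have : w⁻¹ = θ w - z₀ := by rw [hθe]; ring
        rw [this]
        linarith [norm_sub_le (θ w) z₀, le_abs_self M]
      rw [norm_inv] at h6
      exact inv_le_of_inv_le₀ (norm_pos_iff.2 h2) h6
    · rintro ⟨h2, h3, h4⟩
      exact ⟨⟨norm_pos_iff.1 (lt_of_lt_of_le (by positivity) h2), h3⟩, h4⟩
  have hfin : {C | ∃ x ∈ Oᶜ, C = connectedComponentIn Oᶜ x}.Finite := by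
    refine finite_connectedComponentIn (T := insert {0}
      ((fun C => φ '' C) '' {C | ∃ x ∈ Ωᶜ, C = connectedComponentIn Ωᶜ x}))
      ((hΩ.2.2.1.image _).insert _) ?_ ?_
    · rintro B (rfl | ⟨C, ⟨x, hx, rfl⟩, rfl⟩)
      · exact ⟨isPreconnected_singleton, singleton_subset_iff.2 fun h => h.1 rfl⟩
      · refine ⟨isPreconnected_connectedComponentIn.image _ fun z hz => ?_, ?_⟩
        · refine (hφd z fun h => ?_).continuousAt.continuousWithinAt
          exact connectedComponentIn_subset _ _ hz (h ▸ hz₀)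
        · rintro _ ⟨z, hz, rfl⟩ h
          have h1 := h.2
          rw [hθφ] at h1
          exact connectedComponentIn_subset _ _ hz h1
    · intro w hw
      by_cases h0 : w = 0
      · exact ⟨{0}, Or.inl rfl, h0⟩
      · have h1 : θ w ∈ Ωᶜ := fun h => hw ⟨h0, h⟩
        exact ⟨_, Or.inr ⟨_, ⟨θ w, h1, rfl⟩, rfl⟩, θ w, mem_connectedComponentIn h1, hφθ w⟩
  obtain ⟨t, ht, ι, W, ρ, k, c, ζ, ψ, hι, hW, hcov⟩ :=
    exists_annulusCharts hOo hOc hFd hF1 hnc hr1 hr0 hR hcl hfin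
  have hW0 : ∀ i, ∀ w ∈ W i, w ≠ 0 := fun i w hw => ((hW i).1 hw).1
  refine ⟨max t r, max_lt ht hr1, ι, fun i => {z | z ≠ z₀ ∧ φ z ∈ W i}, ρ, k, c, fun i z => ζ i (φ z),
    fun i ω => θ (ψ i ω), hι, fun i => ⟨fun z hz => ?_, ?_⟩, fun z hz hzt => ?_⟩
  · have := ((hW i).1 hz.2).2
    rwa [hθφ] at this
  · obtain ⟨h1, h2, h3, h4, h5, h6, h7, h8, h9, h10, h11, h12⟩ := (hW i).2
    refine ⟨?_, h2, h3, h4, h5, fun z hz => ?_, fun z hz => h7 _ hz.2, fun z hz => ?_,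
      fun z hz => ?_, fun ω hω hω1 => ⟨?_, ?_⟩, fun ω hω hω1 => ?_, fun ω hω hω1 => ?_⟩
    · have h : ContinuousOn φ {z₀}ᶜ := fun w hw => (hφd w hw).continuousAt.continuousWithinAt
      exact h.isOpen_inter_preimage isOpen_compl_singleton h1
    · exact ((h6.differentiableAt (h1.mem_nhds hz.2)).comp z (hφd z hz.1)).differentiableWithinAt
    · rw [← h8 _ hz.2, hF]
      simp only [hθφ]
    · change θ (ψ i (ζ i (φ z))) = z
      rw [h9 _ hz.2, hθφ]
    · intro h
      exact hW0 i _ (h10 ω hω hω1) (by rw [← hφθ (ψ i ω)]; exact (hφ0 _).2 h)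
    · rw [hφθ]
      exact h10 ω hω hω1
    · change ζ i (φ (θ (ψ i ω))) = ω
      rw [hφθ, h11 ω hω hω1]
    · exact (hθd _ (hW0 i _ (h10 ω hω hω1))).comp ω (h12 ω hω hω1)
  · have hne : z ≠ z₀ := fun h => by
      rw [h] at hzt
      exact absurd ((le_max_right _ _).trans_lt hzt) (not_lt.2 hzr.le)
    obtain ⟨i, hi⟩ := hcov (φ z) ⟨fun h => hne ((hφ0 z).1 h), by rwa [hθφ]⟩
      (by simpa only [hF, hθφ] using (le_max_left _ _).trans_lt hzt)
    exact ⟨i, hne, hi⟩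

section

/-- Bounded continuous functions on a plane set. -/
def BddOn (Ω : Set ℂ) (u : ℂ → ℂ) : Prop :=
  ContinuousOn u Ω ∧ ∃ C, ∀ z ∈ Ω, ‖u z‖ ≤ C

open Classical in
/-- The restriction of a function to `Ω`, as a bounded continuous function. -/
def toBdd (Ω : Set ℂ) (u : ℂ → ℂ) : BoundedContinuousFunction Ω ℂ :=
  if h : BddOn Ω u then
    BoundedContinuousFunction.ofNormedAddCommGroup (fun z : Ω => u z)
      (continuousOn_iff_continuous_domRestrict.1 h.1) h.2.choose fun z => h.2.choose_spec z z.2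
  else 0

variable {Ω : Set ℂ} {u v : ℂ → ℂ} {b : ℂ} {g : ℂ → ℂ} {m : ℝ}

theorem toBdd_apply (h : BddOn Ω u) (z : Ω) : toBdd Ω u z = u z := by
  rw [toBdd, dif_pos h]
  rfl

theorem toBdd_congr (h : EqOn u v Ω) : toBdd Ω u = toBdd Ω v := by
  have h1 : ∀ {u v : ℂ → ℂ}, EqOn u v Ω → BddOn Ω u → BddOn Ω v := fun h h' =>
    ⟨h'.1.congr h.symm, h'.2.imp fun C hC z hz => by rw [← h hz]; exact hC z hz⟩
  by_cases hu : BddOn Ω u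
  · ext z
    rw [toBdd_apply hu, toBdd_apply (h1 h hu), h z.2]
  · rw [toBdd, toBdd, dif_neg hu, dif_neg fun h' => hu (h1 h.symm h')]

theorem BddOn.add (hu : BddOn Ω u) (hv : BddOn Ω v) : BddOn Ω fun z => u z + v z := by
  obtain ⟨C, hC⟩ := hu.2
  obtain ⟨D, hD⟩ := hv.2
  exact ⟨hu.1.add hv.1, C + D, fun z hz => (norm_add_le _ _).trans (add_le_add (hC z hz) (hD z hz))⟩

theorem BddOn.mul (hu : BddOn Ω u) (hv : BddOn Ω v) : BddOn Ω fun z => u z * v z := by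
  obtain ⟨C, hC⟩ := hu.2
  obtain ⟨D, hD⟩ := hv.2
  refine ⟨hu.1.mul hv.1, C * D, fun z hz => ?_⟩
  rw [norm_mul]
  exact mul_le_mul (hC z hz) (hD z hz) (norm_nonneg _) ((norm_nonneg _).trans (hC z hz))

theorem BddOn.const (c : ℂ) : BddOn Ω fun _ => c :=
  ⟨continuousOn_const, ‖c‖, fun _ _ => le_rfl⟩

theorem BddOn.conj (hu : BddOn Ω u) : BddOn Ω fun z => conj (u z) :=
  ⟨continuous_conj.comp_continuousOn hu.1, hu.2.imp fun C hC z hz => by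
    rw [RCLike.norm_conj]; exact hC z hz⟩

theorem BddOn.sub (hu : BddOn Ω u) (hv : BddOn Ω v) : BddOn Ω fun z => u z - v z := by
  have := hu.add ((BddOn.const (-1)).mul hv)
  simpa only [neg_mul, one_mul, ← sub_eq_add_neg] using this

/-- A continuous function with compact support in `Ω` is bounded. -/
theorem BddOn.of_compact (hu : ContinuousOn u Ω) {K : Set ℂ} (hK : IsCompact K) (hKΩ : K ⊆ Ω)
    (h0 : ∀ z ∈ Ω \ K, u z = 0) : BddOn Ω u := by
  obtain ⟨C, hC⟩ := (hK.image_of_continuousOn (hu.mono hKΩ)).isBounded.exists_norm_le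
  refine ⟨hu, max C 0, fun z hz => ?_⟩
  by_cases h : z ∈ K
  · exact (hC _ ⟨z, h, rfl⟩).trans (le_max_left _ _)
  · rw [h0 z ⟨hz, h⟩, norm_zero]
    exact le_max_right _ _

/-- A functional on bounded continuous functions which extends `h ↦ h' b` with the same norm. -/
structure AhlforsFunctional (Ω : Set ℂ) (b : ℂ) (g : ℂ → ℂ) (m : ℝ)
    (L : BoundedContinuousFunction Ω ℂ →L[ℂ] ℂ) : Prop where
  m_pos : 0 < m
  bddOn : BddOn Ω g
  norm_lt : ∀ z ∈ Ω, ‖g z‖ < 1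
  norm_le : ‖L‖ ≤ m
  apply_holo : ∀ h, BddOn Ω h → DifferentiableOn ℂ h Ω → L (toBdd Ω h) = deriv h b
  apply_self : L (toBdd Ω g) = m

theorem IsAhlforsMap.norm_deriv_le (hg : IsAhlforsMap Ω b g) {h : ℂ → ℂ}
    (hh : DifferentiableOn ℂ h Ω) {C : ℝ} (hC0 : 0 ≤ C) (hC : ∀ z ∈ Ω, ‖h z‖ ≤ C) :
    ‖deriv h b‖ ≤ (deriv g b).re * C := by
  have hm := hg.2.2.2.1
  refine le_of_forall_pos_le_add fun ε hε => ?_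
  set D := C + ε / (deriv g b).re with hD
  have hD0 : 0 < D := by positivity
  have h1 := hg.2.2.2.2 (fun z => (D : ℂ)⁻¹ * h z) (hh.const_mul _) fun z hz => by
    rw [norm_mul, norm_inv, norm_real, Real.norm_of_nonneg hD0.le, inv_mul_lt_one₀ hD0]
    exact (hC z hz).trans_lt (by rw [hD]; linarith [div_pos hε hm])
  rw [deriv_const_mul_field, norm_mul, norm_inv, norm_real, Real.norm_of_nonneg hD0.le,
    inv_mul_le_iff₀ hD0, hD] at h1
  calc _ ≤ _ := h1
    _ = _ := by field_simp

theorem IsAhlforsMap.exists_functional (hΩ : IsOpen Ω) (hb : b ∈ Ω) (hg : IsAhlforsMap Ω b g) :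
    ∃ L, AhlforsFunctional Ω b g (deriv g b).re L := by
  classical
  set ext : BoundedContinuousFunction Ω ℂ → ℂ → ℂ := fun φ z => if hz : z ∈ Ω then φ ⟨z, hz⟩ else 0
    with hext
  have hexte : ∀ φ z (hz : z ∈ Ω), ext φ z = φ ⟨z, hz⟩ := fun φ z hz => by
    simp only [hext, dif_pos hz]
  have hadd : ∀ φ χ, EqOn (ext (φ + χ)) (fun z => ext φ z + ext χ z) Ω := fun φ χ z hz => by
    simp only [hexte _ z hz, BoundedContinuousFunction.coe_add, Pi.add_apply]
  have hsmul : ∀ (c : ℂ) φ, EqOn (ext (c • φ)) (fun z => c * ext φ z) Ω := fun c φ z hz => by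
    simp only [hexte _ z hz, BoundedContinuousFunction.coe_smul, smul_eq_mul]
  let p : Submodule ℂ (BoundedContinuousFunction Ω ℂ) :=
    { carrier := {φ | DifferentiableOn ℂ (ext φ) Ω}
      add_mem' := fun {φ χ} hφ hχ =>
        DifferentiableOn.congr (f := fun z => ext φ z + ext χ z) (hφ.add hχ) (hadd φ χ)
      zero_mem' := (differentiableOn_const (0 : ℂ)).congr fun z hz => by simp [hexte _ z hz]
      smul_mem' := fun c φ hφ =>
        DifferentiableOn.congr (f := fun z => c * ext φ z) (hφ.const_mul c) (hsmul c φ) }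
  have hp : ∀ φ : p, DifferentiableAt ℂ (ext φ) b := fun φ =>
    (show DifferentiableOn ℂ (ext φ) Ω from φ.2).differentiableAt (hΩ.mem_nhds hb)
  have hder : ∀ {h k : ℂ → ℂ}, EqOn h k Ω → deriv h b = deriv k b := fun h =>
    (h.eventuallyEq_of_mem (hΩ.mem_nhds hb)).deriv_eq
  let ℓ : p →ₗ[ℂ] ℂ :=
    { toFun := fun φ => deriv (ext φ) b
      map_add' := fun φ χ => by
        rw [← deriv_fun_add (hp φ) (hp χ)]
        exact hder (hadd φ χ)
      map_smul' := fun c φ => by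
        rw [RingHom.id_apply, smul_eq_mul, ← deriv_const_mul_field]
        exact hder (hsmul c φ) }
  have hm := hg.2.2.2.1
  have hℓ : ∀ φ, ‖ℓ φ‖ ≤ (deriv g b).re * ‖φ‖ := fun φ =>
    hg.norm_deriv_le φ.2 (norm_nonneg _) fun z hz => by
      rw [hexte _ z hz]
      exact BoundedContinuousFunction.norm_coe_le_norm _ _
  obtain ⟨L, hL, hLn⟩ := exists_extension_norm_eq p (ℓ.mkContinuous _ hℓ)
  have hgb : BddOn Ω g := ⟨hg.1.continuousOn, 1, fun z hz => (hg.2.1 z hz).le⟩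
  have hLd : ∀ h, BddOn Ω h → DifferentiableOn ℂ h Ω → L (toBdd Ω h) = deriv h b :=
      fun h hh hd => by
    have h1 : EqOn (ext (toBdd Ω h)) h Ω := fun z hz => by rw [hexte _ z hz, toBdd_apply hh]
    have h2 := hL ⟨toBdd Ω h, hd.congr h1⟩
    exact h2.trans (hder h1)
  refine ⟨L, hm, hgb, hg.2.1, hLn.trans_le (LinearMap.mkContinuous_norm_le _ hm.le _), hLd, ?_⟩
  rw [hLd g hgb hg.1]
  exact Complex.ext (by simp) (by simp [hg.2.2.1])

namespace AhlforsFunctional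

variable {L : BoundedContinuousFunction Ω ℂ →L[ℂ] ℂ}

theorem map_add (L : BoundedContinuousFunction Ω ℂ →L[ℂ] ℂ) (hu : BddOn Ω u) (hv : BddOn Ω v) :
    L (toBdd Ω fun z => u z + v z) = L (toBdd Ω u) + L (toBdd Ω v) := by
  rw [← _root_.map_add]
  congr 1
  ext z
  simp [toBdd_apply hu, toBdd_apply hv, toBdd_apply (hu.add hv)]

theorem map_mul (L : BoundedContinuousFunction Ω ℂ →L[ℂ] ℂ) (c : ℂ) (hu : BddOn Ω u) :
    L (toBdd Ω fun z => c * u z) = c * L (toBdd Ω u) := by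
  rw [← smul_eq_mul c (L _), ← _root_.map_smul]
  congr 1
  ext z
  simp [toBdd_apply hu, toBdd_apply ((BddOn.const c).mul hu)]

theorem map_sub (L : BoundedContinuousFunction Ω ℂ →L[ℂ] ℂ) (hu : BddOn Ω u) (hv : BddOn Ω v) :
    L (toBdd Ω fun z => u z - v z) = L (toBdd Ω u) - L (toBdd Ω v) := by
  rw [← _root_.map_sub]
  congr 1
  ext z
  simp [toBdd_apply hu, toBdd_apply hv, toBdd_apply (hu.sub hv)]

theorem norm_apply_le (hL : AhlforsFunctional Ω b g m L) (hu : BddOn Ω u) {C : ℝ} (hC0 : 0 ≤ C)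
    (hC : ∀ z ∈ Ω, ‖u z‖ ≤ C) : ‖L (toBdd Ω u)‖ ≤ m * C := by
  refine (L.le_opNorm _).trans (mul_le_mul hL.norm_le ?_ (norm_nonneg _) hL.m_pos.le)
  refine (BoundedContinuousFunction.norm_le hC0).2 fun z => ?_
  rw [toBdd_apply hu]
  exact hC z z.2

theorem apply_defect (hL : AhlforsFunctional Ω b g m L) (hu : BddOn Ω u) :
    L (toBdd Ω fun z => (1 - g z * conj (g z)) * u z) = 0 := by
  have hd : BddOn Ω fun z => (1 - g z * conj (g z)) * u z :=
    ((BddOn.const 1).sub (hL.bddOn.mul hL.bddOn.conj)).mul hu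
  obtain ⟨C, hC⟩ := hu.2
  set a := L (toBdd Ω fun z => (1 - g z * conj (g z)) * u z) with ha
  set D := |C| + 1 with hD
  have hD0 : 0 < D := by positivity
  by_contra hne
  set t : ℂ := (1 / (2 * D) : ℝ) * (conj a / ‖a‖) with ht
  have hna : 0 < ‖a‖ := norm_pos_iff.2 hne
  have htn : ‖t‖ = 1 / (2 * D) := by
    rw [ht, norm_mul, norm_div, norm_real, norm_real, norm_norm, RCLike.norm_conj, div_self hna.ne',
      mul_one, Real.norm_of_nonneg (by positivity)]
  have hta : t * a = ((‖a‖ / (2 * D) : ℝ) : ℂ) := by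
    have h1 : conj a * a = (‖a‖ : ℂ) ^ 2 := by rw [mul_comm, mul_conj']
    have h2 : (‖a‖ : ℂ) ≠ 0 := ofReal_ne_zero.2 hna.ne'
    have h3 : (D : ℂ) ≠ 0 := ofReal_ne_zero.2 hD0.ne'
    rw [ht]
    push_cast
    calc _ = 1 / (2 * (D : ℂ)) * (conj a * a / ‖a‖) := by ring
      _ = _ := by rw [h1]; field_simp
  have h1 := hL.norm_apply_le (hL.bddOn.add ((BddOn.const t).mul hd)) zero_le_one fun z hz => by
    have h2 := hL.norm_lt z hz
    have h3 : ‖1 - g z * conj (g z)‖ = 1 - ‖g z‖ ^ 2 := by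
      rw [mul_conj', show (1 : ℂ) - (‖g z‖ : ℂ) ^ 2 = ((1 - ‖g z‖ ^ 2 : ℝ) : ℂ) by push_cast; rfl,
        norm_real, Real.norm_of_nonneg (by nlinarith [norm_nonneg (g z)])]
    have h4 : ‖u z‖ ≤ D := (hC z hz).trans (by rw [hD]; linarith [le_abs_self C])
    refine (norm_add_le _ _).trans ?_
    rw [norm_mul t, norm_mul _ (u z), h3, htn]
    have h5 : 1 / (2 * D) * ((1 - ‖g z‖ ^ 2) * ‖u z‖) ≤ 1 / (2 * D) * ((1 - ‖g z‖ ^ 2) * D) := by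
      have : 0 ≤ 1 - ‖g z‖ ^ 2 := by nlinarith [norm_nonneg (g z)]
      gcongr
    have h6 : 1 / (2 * D) * ((1 - ‖g z‖ ^ 2) * D) = (1 - ‖g z‖ ^ 2) / 2 := by field_simp
    nlinarith [sq_nonneg (1 - ‖g z‖)]
  rw [map_add L hL.bddOn ((BddOn.const t).mul hd), map_mul L t hd, hL.apply_self, ← ha, hta,
    ← ofReal_add, norm_real, mul_one] at h1
  have h2 := (le_abs_self _).trans h1
  have h3 : 0 < ‖a‖ / (2 * D) := by positivity
  linarith

theorem apply_of_compact (hL : AhlforsFunctional Ω b g m L) (hu : ContinuousOn u Ω) {K : Set ℂ}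
    (hK : IsCompact K) (hKΩ : K ⊆ Ω) (h0 : ∀ z ∈ Ω \ K, u z = 0) : L (toBdd Ω u) = 0 := by
  have hne : ∀ z ∈ Ω, 1 - g z * conj (g z) ≠ 0 := fun z hz h => by
    have h1 := hL.norm_lt z hz
    rw [mul_conj', sub_eq_zero] at h
    have h2 : ‖g z‖ ^ 2 = 1 := by exact_mod_cast h.symm
    nlinarith [norm_nonneg (g z)]
  have hc : ContinuousOn (fun z => (1 - g z * conj (g z))⁻¹ * u z) Ω :=
    ((continuousOn_const.sub (hL.bddOn.1.mul hL.bddOn.conj.1)).inv₀ hne).mul hu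
  rw [← hL.apply_defect (BddOn.of_compact hc hK hKΩ fun z hz => by rw [h0 z hz, mul_zero])]
  refine congrArg L (toBdd_congr fun z hz => ?_)
  exact (mul_inv_cancel_left₀ (hne z hz) _).symm

/-- The functional vanishes on functions tending to zero at the boundary. -/
theorem apply_of_vanishing (hL : AhlforsFunctional Ω b g m L) (hu : BddOn Ω u)
    (h : ∀ ε > 0, ∃ K ⊆ Ω, IsCompact K ∧ ∀ z ∈ Ω \ K, ‖u z‖ ≤ ε) : L (toBdd Ω u) = 0 := by
  rw [← norm_le_zero_iff]
  refine le_of_forall_pos_le_add fun δ hδ => ?_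
  rw [zero_add]
  set ε := δ / m with hε
  have hm := hL.m_pos
  have hε0 : 0 < ε := div_pos hδ hm
  obtain ⟨K, hKΩ, hK, hKu⟩ := h ε hε0
  have hpos : ∀ z, 0 < max ‖u z‖ ε := fun z => lt_max_of_lt_right hε0
  set w : ℂ → ℂ := fun z => ((ε / max ‖u z‖ ε : ℝ) : ℂ) * u z with hw
  have hwc : ContinuousOn w Ω := by
    refine ContinuousOn.mul ?_ hu.1
    exact continuous_ofReal.comp_continuousOn (continuousOn_const.div
      ((continuous_id.max continuous_const).comp_continuousOn hu.1.norm) fun z _ => (hpos z).ne')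
  have hwn : ∀ z, ‖w z‖ ≤ ε := fun z => by
    rw [hw, norm_mul, norm_real, Real.norm_of_nonneg (div_pos hε0 (hpos z)).le, div_mul_eq_mul_div,
      div_le_iff₀ (hpos z)]
    exact mul_le_mul_of_nonneg_left (le_max_left _ _) hε0.le
  have hwb : BddOn Ω w := ⟨hwc, ε, fun z _ => hwn z⟩
  have h1 := hL.apply_of_compact (u := fun z => u z - w z) (hu.1.sub hwc) hK hKΩ fun z hz => by
    have : max ‖u z‖ ε = ε := max_eq_right (hKu z hz)
    simp only [hw]
    rw [this, div_self hε0.ne', ofReal_one, one_mul, sub_self]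
  rw [map_sub L hu hwb, sub_eq_zero] at h1
  rw [h1]
  calc _ ≤ m * ε := hL.norm_apply_le hwb hε0.le fun z _ => hwn z
    _ = δ := by rw [hε]; field_simp

theorem im_apply_mul_eq_zero (hL : AhlforsFunctional Ω b g m L) (hu : BddOn Ω u)
    (him : ∀ z ∈ Ω, (u z).im = 0) : (L (toBdd Ω fun z => g z * u z)).im = 0 := by
  obtain ⟨C, hC⟩ := hu.2
  have hm := hL.m_pos
  set a := L (toBdd Ω fun z => g z * u z) with ha
  have key : ∀ s : ℝ, (a.im + m * s) ^ 2 ≤ m ^ 2 * (C ^ 2 + s ^ 2) := fun s => by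
    have hb := hu.add (BddOn.const (Ω := Ω) (I * s))
    have h1 := hL.norm_apply_le (hL.bddOn.mul hb) (Real.sqrt_nonneg (C ^ 2 + s ^ 2)) fun z hz => by
      rw [norm_mul]
      refine (mul_le_of_le_one_left (norm_nonneg _) (hL.norm_lt z hz).le).trans ?_
      refine Real.le_sqrt_of_sq_le ?_
      have h2 := hC z hz
      rw [Complex.sq_norm, normSq_apply]
      have h3 : ‖u z‖ ^ 2 = (u z).re ^ 2 := by
        rw [Complex.sq_norm, normSq_apply, him z hz]; ring
      simp only [add_re, mul_re, I_re, I_im, ofReal_re, ofReal_im, add_im, mul_im, him z hz]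
      nlinarith [norm_nonneg (u z)]
    have h2 : L (toBdd Ω fun z => g z * (u z + I * s)) = a + I * (m * s) := by
      have h3 : I * (m * s) = I * s * L (toBdd Ω g) := by rw [hL.apply_self]; ring
      rw [ha, h3, ← map_mul L _ hL.bddOn,
        ← map_add L (hL.bddOn.mul hu) ((BddOn.const _).mul hL.bddOn)]
      refine congrArg L (toBdd_congr fun z _ => ?_)
      ring
    rw [h2] at h1
    have h3 : |(a + I * (m * s)).im| ≤ m * √(C ^ 2 + s ^ 2) := (abs_im_le_norm _).trans h1
    have h4 : (a + I * (m * s)).im = a.im + m * s := by simp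
    rw [h4] at h3
    have h5 := sq_le_sq' (by linarith [neg_abs_le (a.im + m * s)]) ((le_abs_self _).trans h3)
    rwa [mul_pow, Real.sq_sqrt (by positivity)] at h5
  by_contra hne
  have h1 := key (m * C ^ 2 / (2 * a.im) + m * C ^ 2 / (2 * a.im))
  have h2 : (a.im + m * (m * C ^ 2 / (2 * a.im) + m * C ^ 2 / (2 * a.im))) ^ 2 =
    a.im ^ 2 + 2 * m ^ 2 * C ^ 2 + m ^ 2 * (m * C ^ 2 / (2 * a.im) + m * C ^ 2 / (2 * a.im)) ^ 2 := by
    field_simp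
    ring
  rw [h2] at h1
  nlinarith [sq_pos_of_ne_zero hne, sq_nonneg (m * C)]

theorem conj_apply_mul (hL : AhlforsFunctional Ω b g m L) (hu : BddOn Ω u) :
    conj (L (toBdd Ω fun z => g z * u z)) = L (toBdd Ω fun z => g z * conj (u z)) := by
  have hg := hL.bddOn
  have h1 := hL.im_apply_mul_eq_zero (hu.add hu.conj) fun z _ => by simp
  have h2 := hL.im_apply_mul_eq_zero ((BddOn.const I).mul (hu.sub hu.conj)) fun z _ => by simp
  have h3 : L (toBdd Ω fun z => g z * (u z + conj (u z))) =
      L (toBdd Ω fun z => g z * u z) + L (toBdd Ω fun z => g z * conj (u z)) := by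
    rw [← map_add L (hg.mul hu) (hg.mul hu.conj)]
    exact congrArg L (toBdd_congr fun z _ => by ring)
  have h4 : L (toBdd Ω fun z => g z * (I * (u z - conj (u z)))) =
      I * (L (toBdd Ω fun z => g z * u z) - L (toBdd Ω fun z => g z * conj (u z))) := by
    rw [← map_sub L (hg.mul hu) (hg.mul hu.conj),
      ← map_mul L _ ((hg.mul hu).sub (hg.mul hu.conj))]
    exact congrArg L (toBdd_congr fun z _ => by ring)
  rw [h3] at h1
  rw [h4] at h2
  simp only [add_im, mul_im, I_re, I_im, sub_re, sub_im, zero_mul, one_mul, zero_add] at h1 h2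
  exact Complex.ext (by rw [conj_re]; linarith) (by rw [conj_im]; linarith)

end AhlforsFunctional

end

section

variable {Ω : Set ℂ} {u v : ℂ → ℂ} {b : ℂ} {g : ℂ → ℂ} {m : ℝ}

/-- The Cauchy kernel with pole at `ζ`, cut off by `1 - X`. -/
def cutKernel (Ω : Set ℂ) (X : ℂ → ℂ) (ζ : ℂ) : BoundedContinuousFunction Ω ℂ :=
  toBdd Ω fun z => (1 - X z) / (z - ζ) ^ 1

theorem bddOn_cutKernel {X : ℂ → ℂ} (hX : Continuous X) (hX1 : ∀ z, ‖X z‖ ≤ 1) {ζ : ℂ}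
    (h : ∀ᶠ w in 𝓝 ζ, X w = 1) (n : ℕ) : BddOn Ω fun z => (1 - X z) / (z - ζ) ^ n := by
  obtain ⟨ε, hε, hb⟩ := Metric.eventually_nhds_iff_ball.1 h
  refine ⟨fun z _ => ?_, 2 / ε ^ n, fun z _ => ?_⟩
  · refine ContinuousAt.continuousWithinAt ?_
    by_cases hz : z = ζ
    · rw [hz]
      have : (fun z => (1 - X z) / (z - ζ) ^ n) =ᶠ[𝓝 ζ] fun _ => 0 :=
        h.mono fun w hw => by simp only [hw, sub_self, zero_div]
      exact continuousAt_const.congr this.symm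
    · exact (continuousAt_const.sub hX.continuousAt).div (by fun_prop)
        (pow_ne_zero _ (sub_ne_zero.2 hz))
  · beta_reduce
    by_cases hz : z ∈ ball ζ ε
    · rw [hb z hz, sub_self, zero_div, norm_zero]
      positivity
    · rw [mem_ball, not_lt, dist_eq_norm] at hz
      rw [norm_div, norm_pow]
      have h1 : ‖1 - X z‖ ≤ 2 := (norm_sub_le _ _).trans (by rw [norm_one]; linarith [hX1 z])
      gcongr

theorem hasDerivAt_cutKernel {X : ℂ → ℂ} (hX : Continuous X) (hX1 : ∀ z, ‖X z‖ ≤ 1) {ζ : ℂ}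
    (h : ∀ᶠ w in 𝓝 ζ, X w = 1) :
    HasDerivAt (cutKernel Ω X) (toBdd Ω fun z => (1 - X z) / (z - ζ) ^ 2) ζ := by
  obtain ⟨ε, hε, hb⟩ := Metric.eventually_nhds_iff_ball.1 h
  have hnear : ∀ᶠ ξ in 𝓝 ζ, ‖cutKernel Ω X ξ - cutKernel Ω X ζ -
      (ξ - ζ) • toBdd Ω fun z => (1 - X z) / (z - ζ) ^ 2‖ ≤ 4 / ε ^ 3 * ‖ξ - ζ‖ ^ 2 := by
    filter_upwards [h.eventually_nhds, ball_mem_nhds ζ (half_pos hε)] with ξ hξ hξε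
    refine (BoundedContinuousFunction.norm_le (by positivity)).2 fun z => ?_
    simp only [BoundedContinuousFunction.coe_sub, BoundedContinuousFunction.coe_smul, Pi.sub_apply,
      cutKernel, smul_eq_mul, toBdd_apply (bddOn_cutKernel hX hX1 hξ 1),
      toBdd_apply (bddOn_cutKernel hX hX1 h 1), toBdd_apply (bddOn_cutKernel hX hX1 h 2)]
    by_cases hz : (z : ℂ) ∈ ball ζ ε
    · simp only [hb z hz, sub_self, zero_div, mul_zero, norm_zero]
      positivity
    · rw [mem_ball, not_lt, dist_eq_norm] at hz
      rw [mem_ball, dist_eq_norm] at hξε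
      have h1 : ε / 2 ≤ ‖(z : ℂ) - ξ‖ := by
        have := norm_sub_le ((z : ℂ) - ξ) (ζ - ξ)
        rw [sub_sub_sub_cancel_right, norm_sub_rev ζ ξ] at this
        linarith
      have hz0 : (z : ℂ) - ζ ≠ 0 := norm_pos_iff.1 (hε.trans_le hz)
      have hξ0 : (z : ℂ) - ξ ≠ 0 := norm_pos_iff.1 ((half_pos hε).trans_le h1)
      have h2 : (1 - X z) / (z - ξ) ^ 1 - (1 - X z) / (z - ζ) ^ 1 -
          (ξ - ζ) * ((1 - X z) / (z - ζ) ^ 2) =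
          (1 - X z) * (ξ - ζ) ^ 2 / ((z - ξ) * (z - ζ) ^ 2) := by
        field_simp
        ring
      have h3 : ‖1 - X z‖ ≤ 2 := (norm_sub_le _ _).trans (by rw [norm_one]; linarith [hX1 z])
      rw [h2, norm_div, norm_mul, norm_mul, norm_pow, norm_pow]
      calc _ ≤ 2 * ‖ξ - ζ‖ ^ 2 / (ε / 2 * ε ^ 2) := by gcongr
        _ = _ := by field_simp; ring
  rw [hasDerivAt_iff_tendsto]
  refine squeeze_zero' (.of_forall fun ξ => by positivity)
    (hnear.mono fun ξ hξ => mul_le_mul_of_nonneg_left hξ (inv_nonneg.2 (norm_nonneg _))) ?_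
  have h4 : Tendsto (fun ξ => 4 / ε ^ 3 * ‖ξ - ζ‖) (𝓝 ζ) (𝓝 (4 / ε ^ 3 * ‖ζ - ζ‖)) :=
    Continuous.tendsto (by fun_prop) ζ
  rw [sub_self, norm_zero, mul_zero] at h4
  refine h4.congr fun ξ => ?_
  rcases eq_or_ne ‖ξ - ζ‖ 0 with h5 | h5
  · rw [h5]; simp
  · field_simp

theorem integrable_smul_of_eq_zero_off {E : Type*} [NormedAddCommGroup E] [NormedSpace ℂ E]
    {w : ℂ → ℂ} {q : ℂ → E} {K : Set ℂ} (hw : Continuous w) (hK : IsCompact K)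
    (h0 : ∀ z ∉ K, w z = 0) (hq : ∀ z ∈ K, ContinuousAt q z) : Integrable fun z => w z • q z := by
  refine Continuous.integrable_of_hasCompactSupport (continuous_iff_continuousAt.2 fun z => ?_)
    (HasCompactSupport.intro hK fun z hz => by rw [h0 z hz, zero_smul])
  by_cases hz : z ∈ K
  · exact hw.continuousAt.smul (hq z hz)
  · have : (fun z => w z • q z) =ᶠ[𝓝 z] fun _ => 0 :=
      (hK.isClosed.isOpen_compl.eventually_mem hz).mono fun w hw => by simp only [h0 w hw, zero_smul]
    exact continuousAt_const.congr this.symm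

/-- The Cauchy potential solving `∂̄v = ∂̄u`, and the holomorphic difference `u - v`. -/
theorem differentiableAt_sub_potential (hΩ : IsOpen Ω) (hu : ContDiffOn ℝ 1 u Ω) {K : Set ℂ}
    (hK : IsCompact K) (hKΩ : K ⊆ Ω) (hd : ∀ z ∈ Ω \ K, dbar u z = 0) {z₀ : ℂ} (hz₀ : z₀ ∈ Ω)
    (hw : Continuous (Ω.indicator (dbar u))) :
    DifferentiableAt ℂ
      (fun z => u z - (Real.pi : ℂ)⁻¹ * ∫ ζ, Ω.indicator (dbar u) ζ / (z - ζ)) z₀ := by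
  obtain ⟨Y, K', hY, hK', hK'Ω, hY0, hY1, -⟩ := exists_cutoff (hK.union isCompact_singleton) hΩ
    (union_subset hKΩ (singleton_subset_iff.2 hz₀))
  have hwK : ∀ z ∉ K, Ω.indicator (dbar u) z = 0 := fun z hz => by
    by_cases h : z ∈ Ω
    · rw [indicator_of_mem h, hd z ⟨h, hz⟩]
    · rw [indicator_of_notMem h]
  have hwc : HasCompactSupport (Ω.indicator (dbar u)) := HasCompactSupport.intro hK hwK
  obtain ⟨hc1, hc2, hc3⟩ := contDiff_indicator (u := fun z => u z * Y z) hΩ hK' hK'Ω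
    (hu.mul hY.contDiffOn) fun z hz => by rw [hY0 z hz.2, mul_zero]
  set U := Ω.indicator fun z => u z * Y z with hU
  set p := fun ζ => dbar U ζ - Ω.indicator (dbar u) ζ with hp
  have hpc : Continuous p := (continuous_dbar hc1).sub hw
  have hps : HasCompactSupport p := (hasCompactSupport_dbar hc2).sub hwc
  have hYz := hY1 z₀ (Or.inr rfl)
  have hpz : ∀ᶠ z in 𝓝 z₀, p z = 0 := by
    filter_upwards [hYz.eventually_nhds, hΩ.eventually_mem hz₀] with z hz hzΩ
    have h1 : (fun z => u z * Y z) =ᶠ[𝓝 z] u := hz.mono fun w hw => by simp only [hw, mul_one]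
    simp only [hp]
    rw [hc3, indicator_of_mem hzΩ, indicator_of_mem hzΩ, dbar_congr h1, sub_self]
  have hpt : z₀ ∉ tsupport p := by
    rw [notMem_tsupport_iff_eventuallyEq]
    exact hpz
  have h2 := ((hasDerivAt_integral_div_sub hpc hps hpt).const_mul (Real.pi : ℂ)⁻¹).differentiableAt
  refine h2.congr_of_eventuallyEq ?_
  filter_upwards [hYz, hΩ.eventually_mem hz₀] with z hz hzΩ
  have h3 : ∫ ζ, p ζ / (z - ζ) =
      (∫ ζ, dbar U ζ / (z - ζ)) - ∫ ζ, Ω.indicator (dbar u) ζ / (z - ζ) := by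
    rw [← integral_sub (integrable_div_sub (continuous_dbar hc1) (hasCompactSupport_dbar hc2) z)
      (integrable_div_sub hw hwc z)]
    exact integral_congr_ae (.of_forall fun ζ => sub_div _ _ _)
  have hpi : (Real.pi : ℂ) ≠ 0 := ofReal_ne_zero.2 Real.pi_ne_zero
  rw [h3, integral_dbar_div_sub hc1 hc2, hU, indicator_of_mem hzΩ, hz, mul_one, mul_sub,
    inv_mul_cancel_left₀ hpi]

namespace AhlforsFunctional

variable {L : BoundedContinuousFunction Ω ℂ →L[ℂ] ℂ}

theorem exists_density (hL : AhlforsFunctional Ω b g m L) (hΩ : IsOpen Ω) :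
    ∃ N : ℂ → ℂ, DifferentiableOn ℂ N Ω ∧ ∀ ζ ∈ Ω, ∀ X K', Continuous X → IsCompact K' → K' ⊆ Ω →
      (∀ z ∉ K', X z = 0) → (∀ᶠ w in 𝓝 ζ, X w = 1) → (∀ z, ‖X z‖ ≤ 1) →
      L (cutKernel Ω X ζ) = N ζ := by
  have hex : ∀ ζ ∈ Ω, ∃ (X : ℂ → ℂ) (K' : Set ℂ), Continuous X ∧ IsCompact K' ∧ K' ⊆ Ω ∧
      (∀ z ∉ K', X z = 0) ∧ (∀ᶠ w in 𝓝 ζ, X w = 1) ∧ ∀ z, ‖X z‖ ≤ 1 := fun ζ hζ => by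
    obtain ⟨X, K', h1, h2, h3, h4, h5, h6⟩ := exists_cutoff (isCompact_singleton (x := ζ)) hΩ
      (singleton_subset_iff.2 hζ)
    exact ⟨X, K', h1.continuous, h2, h3, h4, h5 ζ rfl, h6⟩
  choose! X K' h1 h2 h3 h4 h5 h6 using hex
  have hind : ∀ ζ ∈ Ω, ∀ Y C, Continuous Y → IsCompact C → C ⊆ Ω →
      (∀ z ∉ C, Y z = 0) → (∀ᶠ w in 𝓝 ζ, Y w = 1) → (∀ z, ‖Y z‖ ≤ 1) →
      L (cutKernel Ω Y ζ) = L (cutKernel Ω (X ζ) ζ) := fun ζ hζ Y C g1 g2 g3 g4 g5 g6 => by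
    have hb1 := bddOn_cutKernel (Ω := Ω) g1 g6 g5 1
    have hb2 := bddOn_cutKernel (Ω := Ω) (h1 ζ hζ) (h6 ζ hζ) (h5 ζ hζ) 1
    rw [← sub_eq_zero, cutKernel, cutKernel, ← map_sub L hb1 hb2]
    refine hL.apply_of_compact (hb1.sub hb2).1 (g2.union (h2 ζ hζ)) (union_subset g3 (h3 ζ hζ))
      fun z hz => ?_
    rw [Set.mem_sdiff, mem_union, not_or] at hz
    rw [g4 z hz.2.1, h4 ζ hζ z hz.2.2, sub_self]
  refine ⟨fun ζ => L (cutKernel Ω (X ζ) ζ), fun ζ hζ => ?_, hind⟩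
  have hd := (L.hasFDerivAt.comp_hasDerivAt ζ
    (hasDerivAt_cutKernel (Ω := Ω) (h1 ζ hζ) (h6 ζ hζ) (h5 ζ hζ))).differentiableAt
  refine (hd.congr_of_eventuallyEq ?_).differentiableWithinAt
  filter_upwards [(h5 ζ hζ).eventually_nhds, hΩ.eventually_mem hζ] with ξ hξ hξΩ
  exact (hind ξ hξΩ _ _ (h1 ζ hζ) (h2 ζ hζ) (h3 ζ hζ) (h4 ζ hζ) hξ (h6 ζ hζ)).symm

/-- The functional is given by a holomorphic density. -/
theorem exists_kernel (hL : AhlforsFunctional Ω b g m L) (hΩ : IsOpen Ω) :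
    ∃ κ : ℂ → ℂ, DifferentiableOn ℂ κ (Ω \ {b}) ∧ ∀ u K, ContDiffOn ℝ 1 u Ω → BddOn Ω u →
      IsCompact K → K ⊆ Ω → b ∉ K → (∀ z ∈ Ω \ K, dbar u z = 0) → (∀ᶠ z in 𝓝 b, u z = 0) →
      L (toBdd Ω u) = (Real.pi : ℂ)⁻¹ * ∫ z in Ω, dbar u z * κ z := by
  obtain ⟨N, hN, hNX⟩ := hL.exists_density hΩ
  refine ⟨fun z => N z + 1 / (b - z) ^ 2, (hN.mono sdiff_subset).add fun z hz => ?_,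
    fun u K hu hub hK hKΩ hbK hd hu0 => ?_⟩
  · refine DifferentiableAt.differentiableWithinAt ?_
    have : b - z ≠ 0 := sub_ne_zero.2 fun h => hz.2 h.symm
    exact (differentiableAt_const _).div (by fun_prop) (pow_ne_zero _ this)
  obtain ⟨X, K', hX, hK', hK'Ω, hX0, hX1, hXn⟩ := exists_cutoff hK hΩ hKΩ
  set w := Ω.indicator (dbar u) with hw
  have hwK : ∀ z ∉ K, w z = 0 := fun z hz => by
    by_cases h : z ∈ Ω
    · rw [hw, indicator_of_mem h, hd z ⟨h, hz⟩]
    · rw [hw, indicator_of_notMem h]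
  have hwc : Continuous w := continuous_iff_continuousAt.2 fun z => by
    by_cases hz : z ∈ Ω
    · refine ((continuousOn_dbar hΩ hu).continuousAt (hΩ.mem_nhds hz)).congr ?_
      filter_upwards [hΩ.eventually_mem hz] with ξ hξ
      rw [hw, indicator_of_mem hξ]
    · have : w =ᶠ[𝓝 z] fun _ => 0 :=
        (hK.isClosed.isOpen_compl.eventually_mem fun h => hz (hKΩ h)).mono hwK
      exact continuousAt_const.congr this.symm
  have hws : HasCompactSupport w := HasCompactSupport.intro hK hwK
  have hintegr : Integrable fun ζ => w ζ • cutKernel Ω X ζ :=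
    integrable_smul_of_eq_zero_off hwc hK hwK fun ζ hζ =>
      (hasDerivAt_cutKernel hX.continuous hXn (hX1 ζ hζ)).continuousAt
  set v : ℂ → ℂ := fun z => (Real.pi : ℂ)⁻¹ * ∫ ζ, w ζ / (z - ζ) with hv
  set V : BoundedContinuousFunction Ω ℂ := (Real.pi : ℂ)⁻¹ • ∫ ζ, w ζ • cutKernel Ω X ζ with hV
  have hVz : ∀ z : Ω, V z = (1 - X z) * v z := fun z => by
    have h1 := (BoundedContinuousFunction.evalCLM ℂ z).integral_comp_comm hintegr
    have h2 : V z = (Real.pi : ℂ)⁻¹ * ∫ ζ, (BoundedContinuousFunction.evalCLM ℂ z)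
        (w ζ • cutKernel Ω X ζ) := by rw [h1]; rfl
    rw [h2]
    simp only [hv]
    rw [mul_left_comm, ← integral_const_mul (1 - X (z : ℂ))]
    congr 2
    funext ζ
    by_cases hζ : ζ ∈ K
    · change w ζ * (cutKernel Ω X ζ z) = _
      rw [cutKernel, toBdd_apply (bddOn_cutKernel hX.continuous hXn (hX1 ζ hζ) 1), pow_one]
      ring
    · rw [hwK ζ hζ, zero_smul, _root_.map_zero, zero_div, mul_zero]
  have hLV : L V = (Real.pi : ℂ)⁻¹ * ∫ ζ, w ζ * N ζ := by
    rw [hV, _root_.map_smul, smul_eq_mul, ← L.integral_comp_comm hintegr]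
    congr 2
    funext ζ
    by_cases hζ : ζ ∈ K
    · rw [_root_.map_smul, smul_eq_mul, hNX ζ (hKΩ hζ) X K' hX.continuous hK' hK'Ω hX0 (hX1 ζ hζ) hXn]
    · rw [hwK ζ hζ, zero_smul, _root_.map_zero, zero_mul]
  set h : ℂ → ℂ := fun z => u z - v z with hh
  have hhd : DifferentiableOn ℂ h Ω := fun z hz =>
    (differentiableAt_sub_potential hΩ hu hK hKΩ hd hz hwc).differentiableWithinAt
  have hvc : ContinuousOn v Ω := (hub.1.sub hhd.continuousOn).congr fun z _ => by
    simp [hh]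
  have hXv : ContinuousOn (fun z => X z * v z) Ω := hX.continuous.continuousOn.mul hvc
  have hXv0 : ∀ z ∈ Ω \ K', X z * v z = 0 := fun z hz => by rw [hX0 z hz.2, zero_mul]
  have hXvb := BddOn.of_compact hXv hK' hK'Ω hXv0
  have hvb : BddOn Ω v := by
    obtain ⟨C, hC⟩ := hXvb.2
    refine ⟨hvc, C + ‖V‖, fun z hz => ?_⟩
    have h1 : v z = X z * v z + V ⟨z, hz⟩ := by rw [hVz]; ring
    rw [h1]
    exact (norm_add_le _ _).trans (add_le_add (hC z hz) (V.norm_coe_le_norm _))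
  have hhb : BddOn Ω h := hub.sub hvb
  have hsum : toBdd Ω u = toBdd Ω h + V + toBdd Ω fun z => X z * v z := by
    ext z
    rw [BoundedContinuousFunction.add_apply, BoundedContinuousFunction.add_apply, toBdd_apply hub,
      toBdd_apply hhb, toBdd_apply hXvb, hVz, hh]
    ring
  have hbt : b ∉ tsupport w := fun hbt =>
    hbK (closure_minimal (s := Function.support w)
      (fun z hz => by_contra fun h' => hz (hwK z h')) hK.isClosed hbt)
  have hderiv : deriv h b = (Real.pi : ℂ)⁻¹ * ∫ ζ, w ζ * (1 / (b - ζ) ^ 2) := by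
    have h1 := ((hasDerivAt_integral_div_sub hwc hws hbt).const_mul (Real.pi : ℂ)⁻¹).neg
    have h2 : h =ᶠ[𝓝 b] -fun z => (Real.pi : ℂ)⁻¹ * ∫ ζ, w ζ / (z - ζ) := hu0.mono fun z hz => by
      rw [hh]; simp only [hz, zero_sub, hv, Pi.neg_apply]
    rw [(h1.congr_of_eventuallyEq h2).deriv, mul_neg, neg_neg]
    simp only [mul_one_div]
  have hi1 : Integrable fun ζ => w ζ * N ζ := integrable_smul_of_eq_zero_off hwc hK hwK
    fun ζ hζ => (hN.continuousOn.continuousAt (hΩ.mem_nhds (hKΩ hζ)))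
  have hi2 : Integrable fun ζ => w ζ * (1 / (b - ζ) ^ 2) := integrable_smul_of_eq_zero_off hwc hK hwK
    fun ζ hζ => continuousAt_const.div (by fun_prop)
      (pow_ne_zero _ (sub_ne_zero.2 fun h => hbK (h ▸ hζ)))
  rw [hsum, _root_.map_add, _root_.map_add, hL.apply_holo h hhb hhd,
    hL.apply_of_compact hXv hK' hK'Ω hXv0, add_zero, hderiv, hLV, ← mul_add, ← integral_add hi2 hi1,
    ← integral_indicator hΩ.measurableSet]
  congr 2
  funext ζ
  by_cases hζ : ζ ∈ Ω
  · rw [indicator_of_mem hζ, hw, indicator_of_mem hζ]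
    ring
  · rw [indicator_of_notMem hζ, hw, indicator_of_notMem hζ]
    ring

end AhlforsFunctional

theorem dbar_eq_zero_of_eventually {u : ℂ → ℂ} {z : ℂ} {c : ℂ} (h : ∀ᶠ w in 𝓝 z, u w = c) :
    dbar u z = 0 := by
  rw [dbar_congr (v := fun _ => c) h]
  exact dbar_of_differentiableAt (differentiableAt_const c)

/-- An Ahlfors map has a holomorphic kernel whose boundary values have reflection symmetries. -/
theorem IsAhlforsMap.exists_kernel (hΩ : IsOpen Ω) (hb : b ∈ Ω) (hg : IsAhlforsMap Ω b g) :
    ∃ κ : ℂ → ℂ, DifferentiableOn ℂ κ (Ω \ {b}) ∧ (∃ z ∈ Ω \ {b}, κ z ≠ 0) ∧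
      ∀ u v K, ContDiffOn ℝ 1 u Ω → BddOn Ω u → ContDiffOn ℝ 1 v Ω → BddOn Ω v →
        IsCompact K → K ⊆ Ω → b ∉ K → (∀ z ∈ Ω \ K, dbar u z = 0) → (∀ z ∈ Ω \ K, dbar v z = 0) →
        (∀ᶠ z in 𝓝 b, u z = 0) → (∀ᶠ z in 𝓝 b, v z = 0) →
        (∀ ε > 0, ∃ K' ⊆ Ω, IsCompact K' ∧ ∀ z ∈ Ω \ K', ‖conj (u z) - v z‖ ≤ ε) →
        conj (∫ z in Ω, dbar u z * (g z * κ z)) = ∫ z in Ω, dbar v z * (g z * κ z) ∧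
        conj (∫ z in Ω, dbar u z * (g z ^ 2 * κ z)) = ∫ z in Ω, dbar v z * κ z := by
  obtain ⟨L, hL⟩ := hg.exists_functional hΩ hb
  obtain ⟨κ, hκ, hLκ⟩ := hL.exists_kernel hΩ
  have hgb := hL.bddOn
  have hgd := fun z (hz : z ∈ Ω) => hg.1.differentiableAt (hΩ.mem_nhds hz)
  have hgR : ContDiffOn ℝ 1 g Ω := ((hg.1.contDiffOn hΩ).restrict_scalars ℝ : ContDiffOn ℝ 1 g Ω)
  have hpi : (Real.pi : ℂ) ≠ 0 := ofReal_ne_zero.2 Real.pi_ne_zero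
  refine ⟨κ, hκ, ?_, fun u v K hu hub hv hvb hK hKΩ hbK hdu hdv hu0 hv0 huv => ?_⟩
  · by_contra! hκ0
    obtain ⟨X, K', hX, hK', hK'Ω, hX0, hX1, -⟩ := exists_cutoff (isCompact_singleton (x := b)) hΩ
      (singleton_subset_iff.2 hb)
    obtain ⟨ε, hε, hball⟩ := Metric.eventually_nhds_iff_ball.1 (hX1 b rfl)
    have hXg : BddOn Ω fun z => X z * g z :=
      BddOn.of_compact (hX.continuous.continuousOn.mul hgb.1) hK' hK'Ω fun z hz => by
        rw [hX0 z hz.2, zero_mul]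
    have hsplit : L (toBdd Ω fun z => g z - X z * g z) = (deriv g b).re := by
      rw [AhlforsFunctional.map_sub L hgb hXg, hL.apply_self, hL.apply_of_compact hXg.1 hK' hK'Ω,
        sub_zero]
      intro z hz
      rw [hX0 z hz.2, zero_mul]
    have hball0 : ∀ z ∈ ball b ε, g z - X z * g z = 0 := fun z hz => by
      rw [hball z hz, one_mul, sub_self]
    rw [hLκ _ (K' \ ball b ε) (hgR.sub (hX.contDiffOn.mul hgR)) (hgb.sub hXg)
      (hK'.diff isOpen_ball) (sdiff_subset.trans hK'Ω) (fun h => h.2 (mem_ball_self hε))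
      (fun z hz => ?_) (Filter.mem_of_superset (ball_mem_nhds b hε) fun z hz => hball0 z hz)] at hsplit
    · have h1 : ∫ z in Ω, dbar (fun z => g z - X z * g z) z * κ z = 0 := by
        refine setIntegral_eq_zero_of_forall_eq_zero fun z hz => ?_
        by_cases h : z = b
        · rw [h, dbar_eq_zero_of_eventually (c := 0), zero_mul]
          filter_upwards [ball_mem_nhds b hε] with z hz using hball0 z hz
        · rw [hκ0 z ⟨hz, h⟩, mul_zero]
      rw [h1, mul_zero] at hsplit
      exact hL.m_pos.ne (ofReal_injective hsplit)
    · by_cases h : z ∈ ball b ε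
      · refine dbar_eq_zero_of_eventually (c := 0) ?_
        filter_upwards [isOpen_ball.mem_nhds h] with z hz using hball0 z hz
      · have h1 : (fun z => g z - X z * g z) =ᶠ[𝓝 z] g := by
          filter_upwards [hK'.isClosed.isOpen_compl.mem_nhds fun h' => hz.2 ⟨h', h⟩] with w hw
          rw [hX0 w hw, zero_mul, sub_zero]
        rw [dbar_congr h1, dbar_of_differentiableAt (hgd z hz.1)]
  · have hform : ∀ (q w : ℂ → ℂ), DifferentiableOn ℂ q Ω → BddOn Ω q → ContDiffOn ℝ 1 w Ω →
        BddOn Ω w → (∀ z ∈ Ω \ K, dbar w z = 0) → (∀ᶠ z in 𝓝 b, w z = 0) →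
        ∫ z in Ω, dbar w z * (q z * κ z) = Real.pi * L (toBdd Ω fun z => w z * q z) :=
        fun q w hq hqb hw hwb hdw hw0 => by
      have hmul : ∀ z ∈ Ω, dbar (fun z => w z * q z) z = dbar w z * q z := fun z hz =>
        dbar_mul_right ((hw.differentiableOn one_ne_zero).differentiableAt (hΩ.mem_nhds hz))
          (hq.differentiableAt (hΩ.mem_nhds hz))
      have hqR : ContDiffOn ℝ 1 q Ω := ((hq.contDiffOn hΩ).restrict_scalars ℝ : ContDiffOn ℝ 1 q Ω)
      rw [hLκ _ K (hw.mul hqR) (hwb.mul hqb) hK hKΩ hbK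
        (fun z hz => by rw [hmul z hz.1, hdw z hz, zero_mul])
        (hw0.mono fun z hz => by simp only [hz, zero_mul]), mul_inv_cancel_left₀ hpi]
      refine setIntegral_congr_fun hΩ.measurableSet fun z hz => ?_
      simp only [hmul z hz, mul_assoc]
    have hsub : BddOn Ω fun z => conj (u z) - v z := hub.conj.sub hvb
    have hgc := hgb.mul hgb.conj
    have hvan : L (toBdd Ω fun z => conj (u z)) = L (toBdd Ω v) := by
      rw [← sub_eq_zero, ← AhlforsFunctional.map_sub L hub.conj hvb]
      exact hL.apply_of_vanishing hsub huv
    have hg1 : DifferentiableOn ℂ (fun _ : ℂ => (1 : ℂ)) Ω := differentiableOn_const 1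
    constructor
    · rw [hform g u hg.1 hgb hu hub hdu hu0, hform g v hg.1 hgb hv hvb hdv hv0, _root_.map_mul,
        conj_ofReal]
      congr 1
      have h1 := hL.conj_apply_mul hub
      simp only [mul_comm (g _)] at h1
      rw [h1, ← sub_eq_zero, ← AhlforsFunctional.map_sub L (hub.conj.mul hgb) (hvb.mul hgb)]
      refine hL.apply_of_vanishing ((hub.conj.mul hgb).sub (hvb.mul hgb)) fun ε hε => ?_
      obtain ⟨K', h2, h3, h4⟩ := huv ε hε
      refine ⟨K', h2, h3, fun z hz => ?_⟩
      rw [← sub_mul, norm_mul]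
      exact (mul_le_of_le_one_right (norm_nonneg _) (hL.norm_lt z hz.1).le).trans (h4 z hz)
    · have h1 := hform _ v hg1 (BddOn.const 1) hv hvb hdv hv0
      simp only [one_mul, mul_one] at h1
      rw [h1, hform (fun z => g z ^ 2) u (hg.1.pow 2) (by simpa only [pow_two] using hgb.mul hgb) hu hub hdu hu0,
        _root_.map_mul, conj_ofReal]
      congr 1
      have h2 := hL.conj_apply_mul (hub.mul hgb)
      have h3 : L (toBdd Ω fun z => (1 - g z * conj (g z)) * conj (u z)) = 0 :=
        hL.apply_defect hub.conj
      have h4 : (fun z => (1 - g z * conj (g z)) * conj (u z)) =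
          fun z => conj (u z) - g z * conj (u z * g z) := by
        funext z
        rw [_root_.map_mul]
        ring
      rw [h4, AhlforsFunctional.map_sub L hub.conj (hgb.mul (hub.mul hgb).conj), sub_eq_zero] at h3
      rw [← hvan, h3, ← h2]
      congr 2
      refine toBdd_congr fun z _ => ?_
      ring

end

/-- The open annulus `s < ‖ω‖² < t`. -/
def ann (s t : ℝ) : Set ℂ := {ω | s < ‖ω‖ ^ 2 ∧ ‖ω‖ ^ 2 < t}

theorem isOpen_ann (s t : ℝ) : IsOpen (ann s t) := by
  have h : Continuous fun ω : ℂ => ‖ω‖ ^ 2 := by fun_prop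
  exact (isOpen_lt continuous_const h).inter (isOpen_lt h continuous_const)

theorem ann_mono {s t s' t' : ℝ} (hs : s ≤ s') (ht : t' ≤ t) : ann s' t' ⊆ ann s t :=
  fun _ h => ⟨hs.trans_lt h.1, h.2.trans_le ht⟩

theorem ne_zero_of_mem_ann {s t : ℝ} (hs : 0 ≤ s) {ω : ℂ} (h : ω ∈ ann s t) : ω ≠ 0 := by
  rintro rfl
  have := h.1
  simp at this
  linarith

theorem isCompact_shell_ann {ρ σ a b : ℝ} (ha : ρ < a) (hb : b < σ) :
    IsCompact (shell (ann ρ σ) (fun ω => ω) a b) := by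
  have e : shell (ann ρ σ) (fun ω => ω) a b = {ω : ℂ | a ≤ ‖ω‖ ^ 2 ∧ ‖ω‖ ^ 2 ≤ b} := by
    ext ω
    exact ⟨fun h => h.2, fun h => ⟨⟨ha.trans_le h.1, h.2.trans_lt hb⟩, h⟩⟩
  have hc : Continuous fun ω : ℂ => ‖ω‖ ^ 2 := by fun_prop
  rw [e]
  refine (isCompact_closedBall (0 : ℂ) (√b)).of_isClosed_subset
    ((isClosed_le continuous_const hc).inter (isClosed_le hc continuous_const)) fun ω h => ?_
  rw [mem_closedBall_zero_iff]
  exact Real.le_sqrt_of_sq_le h.2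

theorem norm_sq_inv_conj (ω : ℂ) : ‖(conj ω)⁻¹‖ ^ 2 = (‖ω‖ ^ 2)⁻¹ := by
  rw [norm_inv, norm_conj, inv_pow]

theorem inv_conj_mem_ann {s t : ℝ} (hs : 0 < s) (ht : 0 < t) {ω : ℂ} (h : ω ∈ ann s t) :
    (conj ω)⁻¹ ∈ ann t⁻¹ s⁻¹ := by
  have h0 : 0 < ‖ω‖ ^ 2 := hs.trans h.1
  rw [ann, mem_ofPred_eq, norm_sq_inv_conj]
  exact ⟨(inv_lt_inv₀ ht h0).2 h.2, (inv_lt_inv₀ h0 hs).2 h.1⟩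

/-- The Cauchy transform of `∂̄η · Z`, for a radial step `η`. -/
def stepCauchy (ρ a b : ℝ) (Z : ℂ → ℂ) (w : ℂ) : ℂ :=
  ∫ ω in ann ρ 1, dbar (radStep (fun ω => ω) a b) ω * (Z ω / (w - ω))

theorem differentiableAt_stepCauchy {ρ a b : ℝ} {Z : ℂ → ℂ} (ha : ρ < a) (hab : a < b)
    (hb : b < 1) (hZ : DifferentiableOn ℂ Z (ann ρ 1)) {w : ℂ} (hw : b < ‖w‖ ^ 2) :
    DifferentiableAt ℂ (stepCauchy ρ a b Z) w := by
  have hid : DifferentiableOn ℂ (fun ω : ℂ => ω) (ann ρ 1) := differentiableOn_id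
  have hO := isOpen_ann ρ 1
  have hK := isCompact_shell_ann ha hb
  set K := shell (ann ρ 1) (fun ω => ω) a b
  set c := (ann ρ 1).indicator fun ω => dbar (radStep (fun ω => ω) a b) ω * Z ω
  have hc0 : ∀ ω ∉ K, c ω = 0 := by
    intro ω hω
    by_cases h : ω ∈ ann ρ 1
    · simp only [c]
      rw [indicator_of_mem h, dbar_radStep_eq_zero differentiableAt_fun_id hab fun h' => hω ⟨h, h'⟩,
        zero_mul]
    · exact indicator_of_notMem h _
  have hcc : Continuous c := by
    rw [continuous_iff_continuousAt]
    intro ω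
    by_cases h : ω ∈ K
    · have h1 : ContinuousOn (fun ω => dbar (radStep (fun ω => ω) a b) ω * Z ω) (ann ρ 1) :=
        (continuousOn_dbar_radStep hO hid a b).mul hZ.continuousOn
      refine (h1.continuousAt (hO.mem_nhds h.1)).congr ?_
      filter_upwards [hO.mem_nhds h.1] with x hx
      exact (indicator_of_mem hx fun ω => dbar (radStep (fun ω => ω) a b) ω * Z ω).symm
    · refine (continuousAt_const (y := (0 : ℂ))).congr ?_
      filter_upwards [hK.isClosed.isOpen_compl.mem_nhds h] with x hx
      exact (hc0 x hx).symm
  have hts : tsupport c ⊆ K := closure_minimal (fun ω h => by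
    by_contra h'
    exact h (hc0 ω h')) hK.isClosed
  have hwK : w ∉ tsupport c := fun h => (hts h).2.2.not_gt hw
  have h1 := (hasDerivAt_integral_div_sub hcc (hK.of_isClosed_subset (isClosed_tsupport c) hts)
    hwK).differentiableAt
  refine h1.congr_of_eventuallyEq (Eventually.of_forall fun z => ?_)
  rw [stepCauchy, ← integral_indicator hO.measurableSet]
  refine integral_congr_ae (Eventually.of_forall fun ω => ?_)
  simp only [c]
  by_cases h : ω ∈ ann ρ 1
  · rw [indicator_of_mem h, indicator_of_mem h, mul_div_assoc]
  · rw [indicator_of_notMem h, indicator_of_notMem h, zero_div]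

theorem pi_mul_eq_stepCauchy_sub {ρ a b a' b' : ℝ} {Z : ℂ → ℂ} (ha : ρ < a) (hab : a < b)
    (hab' : a' < b') (hb : b' < 1) (hZ : DifferentiableOn ℂ Z (ann ρ 1)) {w : ℂ}
    (hw : b < ‖w‖ ^ 2) (hw' : ‖w‖ ^ 2 < a') :
    Real.pi * Z w = stepCauchy ρ a b Z w - stepCauchy ρ a' b' Z w := by
  have hid : DifferentiableOn ℂ (fun ω : ℂ => ω) (ann ρ 1) := differentiableOn_id
  have hO := isOpen_ann ρ 1
  have hba : b < a' := hw.trans hw'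
  have hK : IsCompact (shell (ann ρ 1) (fun ω => ω) a b') := isCompact_shell_ann ha hb
  have hwA : w ∈ ann ρ 1 := ⟨by linarith, by linarith⟩
  have hZc := (hZ.contDiffOn (n := 1) hO).restrict_scalars ℝ
  have hu := ((radStep_contDiffOn hO hid a b).sub (radStep_contDiffOn hO hid a' b')).mul hZc
  have hmin : min a a' = a := min_eq_left (by linarith)
  have hmax : max b b' = b' := max_eq_right (by linarith)
  obtain ⟨h1, h2, h3⟩ := contDiff_indicator hO hK shell_subset hu fun z hz => by
    have := radStep_sub_eq_zero hab hab' (z := z) (ζ := fun ω => ω)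
      (by rw [hmin, hmax]; exact fun h => hz.2 ⟨hz.1, h⟩)
    simp only [this, zero_mul]
  have h4 := integral_dbar_div_sub h1 h2 w
  rw [indicator_of_mem hwA] at h4
  have e1 : radStep (fun ω => ω) a b w = 1 := by
    rw [radStep, stepFn_of_ge hab hw.le, ofReal_one]
  have e2 : radStep (fun ω => ω) a' b' w = 0 := by
    rw [radStep, stepFn_of_le hab' hw'.le, ofReal_zero]
  simp only [e1, e2, sub_zero, one_mul] at h4
  rw [← h4, h3, stepCauchy, stepCauchy, ← integral_sub]
  · rw [← integral_indicator hO.measurableSet]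
    refine integral_congr_ae (Eventually.of_forall fun ω => ?_)
    beta_reduce
    by_cases h : ω ∈ ann ρ 1
    · rw [indicator_of_mem h, indicator_of_mem h]
      have hd := dbar_mul_right (u := fun z => radStep (fun ω => ω) a b z -
        radStep (fun ω => ω) a' b' z) (v := Z) (z := ω)
        (((radStep_contDiffOn hO hid a b).sub
          (radStep_contDiffOn hO hid a' b')).contDiffAt (hO.mem_nhds h) |>.differentiableAt one_ne_zero)
        (hZ.differentiableAt (hO.mem_nhds h))
      rw [dbar_radStep_sub differentiableAt_fun_id] at hd
      rw [hd]
      ring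
    · rw [indicator_of_notMem h, indicator_of_notMem h, zero_div]
  · refine integrableOn_dbar_radStep_mul hO hid hab (isCompact_shell_ann ha (by linarith))
      ((hZ.continuousOn.mono shell_subset).div (by fun_prop) fun z hz h => ?_)
    rw [sub_eq_zero.1 h] at hw
    exact hw.not_ge hz.2.2
  · refine integrableOn_dbar_radStep_mul hO hid hab' (isCompact_shell_ann (by linarith) hb)
      ((hZ.continuousOn.mono shell_subset).div (by fun_prop) fun z hz h => ?_)
    rw [sub_eq_zero.1 h] at hw'
    exact hw'.not_ge hz.2.1

/-- Moment relations between `X` and `Y` near the unit circle, expressing that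
`conj X = Y` there in the weak sense. -/
def WeakReflection (ρ : ℝ) (X Y : ℂ → ℂ) : Prop :=
  ∀ a b w, ρ < a → a < b → b < 1 → ‖w‖ ^ 2 < a →
    conj (stepCauchy ρ a b X w) =
      -∫ ω in ann ρ 1, dbar (radStep (fun ω => ω) a b) ω * (Y ω * ω⁻¹ / (1 - conj w * ω))

theorem one_sub_conj_mul_ne_zero {w ω : ℂ} (hw : ‖w‖ ^ 2 < 1) (hω : ‖ω‖ ^ 2 < 1) :
    1 - conj w * ω ≠ 0 := by
  intro h
  have h1 : ‖conj w * ω‖ = 1 := by rw [← sub_eq_zero.1 h, norm_one]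
  rw [norm_mul, norm_conj] at h1
  have h2 : ‖w‖ < 1 := by nlinarith [norm_nonneg w]
  have h3 : ‖ω‖ < 1 := by nlinarith [norm_nonneg ω]
  nlinarith [norm_nonneg w, norm_nonneg ω]

/-- The reflected Cauchy transform. -/
def stepRefl (ρ a b : ℝ) (Z : ℂ → ℂ) (w : ℂ) : ℂ :=
  ∫ ω in ann ρ 1, dbar (radStep (fun ω => ω) a b) ω * (Z ω * ω⁻¹ / (1 - conj w * ω))

theorem stepRefl_eq {ρ a b : ℝ} {Z : ℂ → ℂ} {w : ℂ} (hw : w ≠ 0) :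
    stepRefl ρ a b Z w = (conj w)⁻¹ * stepCauchy ρ a b (fun ω => Z ω * ω⁻¹) (conj w)⁻¹ := by
  rw [stepRefl, stepCauchy, ← integral_const_mul]
  congr 1
  funext ω
  have h0 : conj w ≠ 0 := (map_ne_zero _).2 hw
  have : (conj w)⁻¹ - ω = (conj w)⁻¹ * (1 - conj w * ω) := by field_simp
  rw [this, mul_comm ((conj w)⁻¹) (1 - conj w * ω), ← div_div]
  field_simp

theorem WeakReflection.pi_mul_eq {ρ a b : ℝ} {X Y : ℂ → ℂ} (hρ : 0 ≤ ρ)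
    (hX : DifferentiableOn ℂ X (ann ρ 1)) (hY : DifferentiableOn ℂ Y (ann ρ 1))
    (H : WeakReflection ρ X Y) (ha : ρ < a) (hab : a < b) {w : ℂ} (hw : w ∈ ann b 1) :
    Real.pi * X w = stepCauchy ρ a b X w + conj (stepRefl ρ a b Y w) := by
  obtain ⟨a', h1, h2⟩ := exists_between hw.2
  obtain ⟨b', h3, h4⟩ := exists_between h2
  rw [pi_mul_eq_stepCauchy_sub ha hab h3 h4 hX hw.1 h1]
  have h5 := H a' b' w (ha.trans (hab.trans (hw.1.trans h1))) h3 h4 h1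
  have h6 : stepRefl ρ a b Y w = stepRefl ρ a' b' Y w := by
    refine integral_dbar_radStep_mul_congr (isOpen_ann ρ 1) differentiableOn_id hab h3
      (isCompact_shell_ann ?_ ?_) ?_
    · exact lt_min ha (ha.trans (hab.trans (hw.1.trans h1)))
    · exact max_lt (hw.1.trans hw.2) h4
    · refine (hY.mul (DifferentiableOn.fun_inv differentiableOn_id fun z hz => ne_zero_of_mem_ann hρ hz)).div
        (by fun_prop) fun z hz => one_sub_conj_mul_ne_zero hw.2 hz.2
  rw [h6, stepRefl, ← neg_eq_iff_eq_neg.2 h5, map_neg, conj_conj, sub_eq_add_neg]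

/-- Functions satisfying the moment relations extend across the circle by reflection. -/
theorem WeakReflection.exists_extension {ρ s : ℝ} {X Y : ℂ → ℂ} (hρ : 0 ≤ ρ) (hs : ρ < s)
    (hs1 : s < 1) (hX : DifferentiableOn ℂ X (ann ρ 1)) (hY : DifferentiableOn ℂ Y (ann ρ 1))
    (H : WeakReflection ρ X Y) (H' : WeakReflection ρ Y X) :
    ∃ X', DifferentiableOn ℂ X' (ann s s⁻¹) ∧
      ∀ ω ∈ ann s 1, X' ω = X ω ∧ X' (conj ω)⁻¹ = conj (Y ω) := by
  obtain ⟨a, ha, has⟩ := exists_between hs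
  have hpi : (Real.pi : ℂ) ≠ 0 := by exact_mod_cast Real.pi_ne_zero
  have hO := isOpen_ann ρ 1
  have hid : DifferentiableOn ℂ (fun ω : ℂ => ω) (ann ρ 1) := differentiableOn_id
  have hs0 : 0 < s := hρ.trans_lt hs
  have hinv : DifferentiableOn ℂ (fun ω : ℂ => ω⁻¹) (ann ρ 1) :=
    DifferentiableOn.fun_inv differentiableOn_id fun z hz => ne_zero_of_mem_ann hρ hz
  refine ⟨fun w => (stepCauchy ρ a s X w + conj (stepRefl ρ a s Y w)) / Real.pi, ?_, ?_⟩
  · intro w hw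
    refine (((differentiableAt_stepCauchy ha has hs1 hX hw.1).add ?_).div_const
      _).differentiableWithinAt
    have hw0 := ne_zero_of_mem_ann hs0.le hw
    set g : ℂ → ℂ := fun z => z⁻¹ * stepCauchy ρ a s (fun ω => Y ω * ω⁻¹) z⁻¹ with hg
    have hgd : DifferentiableAt ℂ g (conj w) := by
      have hc : conj w ≠ 0 := (map_ne_zero _).2 hw0
      have hi : DifferentiableAt ℂ (fun z : ℂ => z⁻¹) (conj w) := differentiableAt_inv hc
      have hS : DifferentiableAt ℂ (stepCauchy ρ a s fun ω => Y ω * ω⁻¹) (conj w)⁻¹ :=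
        differentiableAt_stepCauchy ha has hs1 (hY.fun_mul hinv) ?_
      · exact hi.fun_mul (DifferentiableAt.comp (g := stepCauchy ρ a s fun ω => Y ω * ω⁻¹) (conj w) hS hi)
      rw [norm_sq_inv_conj, lt_inv_comm₀ hs0 (hs0.trans hw.1)]
      exact hw.2
    have h1 : DifferentiableAt ℂ (conj ∘ g ∘ conj) w := by
      simpa using hgd.conj_conj
    refine h1.congr_of_eventuallyEq ?_
    filter_upwards [isOpen_ne.mem_nhds hw0] with z hz
    rw [stepRefl_eq hz]
    rfl
  · intro ω hω
    have hω0 := ne_zero_of_mem_ann hs0.le hω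
    refine ⟨?_, ?_⟩
    · beta_reduce
      rw [← H.pi_mul_eq hρ hX hY ha has hω, mul_div_cancel_left₀ _ hpi]
    · beta_reduce
      rw [div_eq_iff hpi]
      have hcω : conj ω ≠ 0 := (map_ne_zero _).2 hω0
      have h1 := H'.pi_mul_eq hρ hY hX ha has hω
      have h2 : conj (Y ω) * Real.pi =
          conj (stepCauchy ρ a s Y ω) + stepRefl ρ a s X ω := by
        rw [mul_comm, ← conj_ofReal, ← map_mul, h1, map_add, conj_conj]
      have hm (Z : ℂ → ℂ) : stepRefl ρ a s Z 0 =
          ∫ ω in ann ρ 1, dbar (radStep (fun ω => ω) a s) ω * (Z ω * ω⁻¹) := by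
        simp only [stepRefl, map_zero, zero_mul, sub_zero, div_one]
      have hM : conj (stepRefl ρ a s X 0) = stepRefl ρ a s Y 0 := by
        have h3 := H a s 0 ha has hs1 (by simp; linarith)
        have h4 : stepCauchy ρ a s X 0 = -stepRefl ρ a s X 0 := by
          rw [hm, stepCauchy, ← integral_neg]
          congr 1
          funext z
          rw [zero_sub, div_neg, mul_neg, div_eq_mul_inv]
        rw [h4, map_neg] at h3
        exact neg_injective h3
      have hK := isCompact_shell_ann (σ := 1) ha hs1
      have hne : ∀ z ∈ shell (ann ρ 1) (fun ω => ω) a s, ω - z ≠ 0 := fun z hz h => by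
        have := hω.1
        rw [sub_eq_zero.1 h] at this
        exact this.not_ge hz.2.2
      have hne' : ∀ z ∈ ann ρ 1, 1 - conj ω * z ≠ 0 := fun z hz =>
        one_sub_conj_mul_ne_zero hω.2 hz.2
      have hint0 (Z : ℂ → ℂ) (hZ : DifferentiableOn ℂ Z (ann ρ 1)) : IntegrableOn
          (fun z => dbar (radStep (fun ω => ω) a s) z * (Z z * z⁻¹)) (ann ρ 1) :=
        integrableOn_dbar_radStep_mul hO hid has hK
          ((hZ.fun_mul hinv).continuousOn.mono shell_subset)
      have hint1 : IntegrableOn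
          (fun z => dbar (radStep (fun ω => ω) a s) z * (Y z / (ω - z))) (ann ρ 1) :=
        integrableOn_dbar_radStep_mul hO hid has hK
          ((hY.continuousOn.mono shell_subset).div (by fun_prop) hne)
      have hint2 : IntegrableOn
          (fun z => dbar (radStep (fun ω => ω) a s) z * (X z * z⁻¹ / (1 - conj ω * z)))
          (ann ρ 1) :=
        integrableOn_dbar_radStep_mul hO hid has hK
          (((hX.fun_mul hinv).continuousOn.mono shell_subset).div (by fun_prop)
            fun z hz => hne' z hz.1)
      have h5 : stepRefl ρ a s Y (conj ω)⁻¹ = stepRefl ρ a s Y 0 + stepCauchy ρ a s Y ω := by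
        rw [hm, stepCauchy, ← integral_add (hint0 Y hY) hint1, stepRefl]
        refine setIntegral_congr_fun hO.measurableSet fun z hz => ?_
        by_cases hzs : z ∈ shell (ann ρ 1) (fun ω => ω) a s
        · have h6 := hne z hzs
          have hz0 := ne_zero_of_mem_ann hρ hz
          have h7 : 1 - conj (conj ω)⁻¹ * z = (ω - z) / ω := by
            rw [map_inv₀, conj_conj]
            field_simp
          rw [h7]
          field_simp
          ring
        · rw [dbar_radStep_eq_zero differentiableAt_fun_id has fun h' => hzs ⟨hz, h'⟩]
          simp
      have h6 : stepCauchy ρ a s X (conj ω)⁻¹ = stepRefl ρ a s X ω - stepRefl ρ a s X 0 := by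
        rw [hm, stepCauchy, stepRefl, ← integral_sub hint2 (hint0 X hX)]
        refine setIntegral_congr_fun hO.measurableSet fun z hz => ?_
        have hz0 := ne_zero_of_mem_ann hρ hz
        have h8 := hne' z hz
        have h7 : (conj ω)⁻¹ - z = (1 - conj ω * z) / conj ω := by field_simp
        rw [h7]
        field_simp
        ring
      rw [h2, h5, h6, map_add, ← hM, conj_conj]
      ring

/-- A radial cutoff near an end times a function of the annular coordinate, extended by zero. -/
def chartTest (W : Set ℂ) (ζ : ℂ → ℂ) (a b : ℝ) (φ : ℂ → ℂ) : ℂ → ℂ :=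
  W.indicator fun z => radStep ζ a b z * φ (ζ z)

theorem abs_det_restrictScalars_toSpanSingleton (d : ℂ) :
    |(ContinuousLinearMap.restrictScalars ℝ (ContinuousLinearMap.toSpanSingleton ℂ d)).det| =
      ‖d‖ ^ 2 := by
  have h : (ContinuousLinearMap.restrictScalars ℝ (ContinuousLinearMap.toSpanSingleton ℂ d)).det =
      Algebra.norm ℝ d := by
    conv_rhs => rw [← ContinuousLinearMap.det_toSpanSingleton d]
    exact LinearMap.det_restrictScalars
      (f := (ContinuousLinearMap.toSpanSingleton ℂ d : ℂ →ₗ[ℂ] ℂ))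
  rw [h, Algebra.norm_complex_apply, abs_of_nonneg (normSq_nonneg _), normSq_eq_norm_sq]

section
variable {Ω W : Set ℂ} {f : ℂ → ℂ} {ρ : ℝ} {k : ℕ} {c : ℂ} {ζ ψ : ℂ → ℂ}

namespace AnnulusChart

theorem norm_sq_eq (hC : AnnulusChart W f ρ k c ζ ψ) {z : ℂ} (hz : z ∈ W) :
    ‖f z‖ ^ 2 = (‖ζ z‖ ^ 2) ^ k := by
  rw [hC.eq_pow z hz, norm_mul, hC.norm_c, one_mul, norm_pow, ← pow_mul, ← pow_mul, mul_comm]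

theorem continuousOn_inv (hC : AnnulusChart W f ρ k c ζ ψ) : ContinuousOn ψ (ann ρ 1) :=
  fun ω hω => (hC.differentiableAt ω hω.1 hω.2).continuousAt.continuousWithinAt

theorem image_eq (hC : AnnulusChart W f ρ k c ζ ψ) : ψ '' ann ρ 1 = W := by
  ext z
  constructor
  · rintro ⟨ω, hω, rfl⟩
    exact hC.mem ω hω.1 hω.2
  · exact fun hz => ⟨ζ z, hC.mapsTo z hz, hC.left_inv z hz⟩

theorem injOn (hC : AnnulusChart W f ρ k c ζ ψ) : InjOn ψ (ann ρ 1) := fun x hx y hy h => by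
  rw [← hC.right_inv x hx.1 hx.2, h, hC.right_inv y hy.1 hy.2]

theorem isCompact_shell (hC : AnnulusChart W f ρ k c ζ ψ) {a b : ℝ} (ha : ρ < a) (hb : b < 1) :
    IsCompact (shell W ζ a b) := by
  have e : shell W ζ a b = ψ '' shell (ann ρ 1) (fun ω => ω) a b := by
    ext z
    constructor
    · exact fun h => ⟨ζ z, ⟨hC.mapsTo z h.1, h.2⟩, hC.left_inv z h.1⟩
    · rintro ⟨ω, hω, rfl⟩
      refine ⟨hC.mem ω hω.1.1 hω.1.2, ?_⟩
      rw [hC.right_inv ω hω.1.1 hω.1.2]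
      exact hω.2
  rw [e]
  exact (isCompact_shell_ann ha hb).image_of_continuousOn (hC.continuousOn_inv.mono shell_subset)

theorem eventually_notMem (hC : AnnulusChart W f ρ k c ζ ψ) (hΩ : IsOpen Ω)
    (hf : IsProperOntoDisc Ω f) {a : ℝ} (ha : ρ < a) {z : ℂ} (hz : z ∈ Ω)
    (hn : ¬ (z ∈ W ∧ a ≤ ‖ζ z‖ ^ 2)) : ∀ᶠ w in 𝓝 z, ¬ (w ∈ W ∧ a ≤ ‖ζ w‖ ^ 2) := by
  have h1 := hf.norm_sq_lt hz
  have hk : ContinuousAt (fun t : ℝ => t ^ k) 1 := by fun_prop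
  have h2 : ∀ᶠ t in 𝓝[<] (1 : ℝ), ‖f z‖ ^ 2 < t ^ k :=
    (hk.eventually (lt_mem_nhds (by simpa using h1))).filter_mono nhdsWithin_le_nhds
  obtain ⟨t, h3, ht0, h4⟩ := (h2.and (Ioo_mem_nhdsLT zero_lt_one)).exists
  have hfc : ContinuousAt (fun w => ‖f w‖ ^ 2) z :=
    ((hf.1.continuousOn.continuousAt (hΩ.mem_nhds hz)).norm).pow 2
  have hK := (hC.isCompact_shell ha h4).isClosed
  have h5 : z ∉ shell W ζ a t := fun h => hn ⟨h.1, h.2.1⟩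
  have h6 : ∀ᶠ w in 𝓝 z, w ∉ shell W ζ a t := hK.isOpen_compl.mem_nhds h5
  filter_upwards [h6, hfc.eventually (gt_mem_nhds h3)] with w hw1 hw2 hw3
  refine hw1 ⟨hw3.1, hw3.2, ?_⟩
  rw [hC.norm_sq_eq hw3.1] at hw2
  exact (lt_of_pow_lt_pow_left₀ k ht0.le hw2).le

end AnnulusChart

variable {a a' : ℝ} {φ φ' : ℂ → ℂ} {V : Set ℂ}

theorem chartTest_eventuallyEq_zero (hC : AnnulusChart W f ρ k c ζ ψ) (hΩ : IsOpen Ω)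
    (hf : IsProperOntoDisc Ω f) (ha : ρ < a) (hab : a < a') {z : ℂ} (hz : z ∈ Ω)
    (hn : ¬ (z ∈ W ∧ a ≤ ‖ζ z‖ ^ 2)) : ∀ᶠ w in 𝓝 z, chartTest W ζ a a' φ w = 0 := by
  filter_upwards [hC.eventually_notMem hΩ hf ha hz hn] with w hw
  by_cases hwW : w ∈ W
  · rw [chartTest, indicator_of_mem hwW, radStep, stepFn_of_le hab, ofReal_zero, zero_mul]
    by_contra! h
    exact hw ⟨hwW, h.le⟩
  · exact indicator_of_notMem hwW _

theorem chartTest_eventuallyEq (hC : AnnulusChart W f ρ k c ζ ψ) {z : ℂ} (hz : z ∈ W) :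
    chartTest W ζ a a' φ =ᶠ[𝓝 z] fun z => radStep ζ a a' z * φ (ζ z) := by
  filter_upwards [hC.isOpen.mem_nhds hz] with w hw
  exact indicator_of_mem hw _

theorem dbar_chartTest (hC : AnnulusChart W f ρ k c ζ ψ) {z : ℂ} (hz : z ∈ W)
    (hφ : DifferentiableAt ℂ φ (ζ z)) :
    dbar (chartTest W ζ a a' φ) z = dbar (radStep ζ a a') z * φ (ζ z) := by
  have hζ := hC.differentiableOn.differentiableAt (hC.isOpen.mem_nhds hz)
  rw [dbar_congr (chartTest_eventuallyEq hC hz)]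
  exact dbar_mul_right (v := fun z => φ (ζ z))
    (((radStep_contDiffOn hC.isOpen hC.differentiableOn a a').contDiffAt
      (hC.isOpen.mem_nhds hz)).differentiableAt one_ne_zero) (hφ.comp z hζ)

theorem chartTest_contDiffOn (hC : AnnulusChart W f ρ k c ζ ψ) (hΩ : IsOpen Ω)
    (hf : IsProperOntoDisc Ω f) (ha : ρ < a) (hab : a < a') (hV : IsOpen V)
    (hφ : DifferentiableOn ℂ φ V) (haV : ∀ ω, a ≤ ‖ω‖ ^ 2 → ‖ω‖ ^ 2 ≤ 1 → ω ∈ V) :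
    ContDiffOn ℝ 1 (chartTest W ζ a a' φ) Ω := by
  intro z hz
  refine ContDiffAt.contDiffWithinAt ?_
  by_cases h : z ∈ W ∧ a ≤ ‖ζ z‖ ^ 2
  · have h1 := hC.isOpen.mem_nhds h.1
    have h2 : ContDiffAt ℂ 1 ζ z := (hC.differentiableOn.contDiffOn hC.isOpen).contDiffAt h1
    have h3 : ContDiffAt ℂ 1 φ (ζ z) := (hφ.contDiffOn hV).contDiffAt
      (hV.mem_nhds (haV _ h.2 (hC.mapsTo z h.1).2.le))
    exact (((radStep_contDiffOn hC.isOpen hC.differentiableOn a a').contDiffAt h1).mul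
      ((h3.comp z h2).restrict_scalars ℝ)).congr_of_eventuallyEq (chartTest_eventuallyEq hC h.1)
  · exact (contDiffAt_const (c := (0 : ℂ))).congr_of_eventuallyEq
      (chartTest_eventuallyEq_zero hC hΩ hf ha hab hz h)

theorem isCompact_closed_ann (a : ℝ) : IsCompact {ω : ℂ | a ≤ ‖ω‖ ^ 2 ∧ ‖ω‖ ^ 2 ≤ 1} := by
  have hc : Continuous fun ω : ℂ => ‖ω‖ ^ 2 := by fun_prop
  refine (isCompact_closedBall (0 : ℂ) 1).of_isClosed_subset
    ((isClosed_le continuous_const hc).inter (isClosed_le hc continuous_const)) fun ω h => ?_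
  rw [mem_closedBall_zero_iff]
  exact (sq_le_one_iff₀ (norm_nonneg _)).1 h.2

theorem norm_radStep_le_one (ζ : ℂ → ℂ) (a b : ℝ) (z : ℂ) : ‖radStep ζ a b z‖ ≤ 1 := by
  rw [radStep, norm_real, Real.norm_of_nonneg (stepFn_nonneg _ _ _)]
  exact stepFn_le_one _ _ _

theorem chartTest_bddOn (hC : AnnulusChart W f ρ k c ζ ψ) (hΩ : IsOpen Ω)
    (hf : IsProperOntoDisc Ω f) (ha : ρ < a) (hab : a < a') (hV : IsOpen V)
    (hφ : DifferentiableOn ℂ φ V) (haV : ∀ ω, a ≤ ‖ω‖ ^ 2 → ‖ω‖ ^ 2 ≤ 1 → ω ∈ V) :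
    BddOn Ω (chartTest W ζ a a' φ) := by
  refine ⟨(chartTest_contDiffOn hC hΩ hf ha hab hV hφ haV).continuousOn, ?_⟩
  obtain ⟨C, hCb⟩ := (isCompact_closed_ann a).exists_bound_of_continuousOn
    (hφ.continuousOn.mono fun ω hω => haV ω hω.1 hω.2)
  refine ⟨max C 0, fun z _ => ?_⟩
  by_cases h : z ∈ W
  · rw [chartTest, indicator_of_mem h, norm_mul]
    by_cases h' : a ≤ ‖ζ z‖ ^ 2
    · refine (mul_le_of_le_one_left (norm_nonneg _) (norm_radStep_le_one _ _ _ _)).trans ?_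
      exact (hCb _ ⟨h', (hC.mapsTo z h).2.le⟩).trans (le_max_left _ _)
    · rw [radStep, stepFn_of_le hab (not_le.1 h').le]
      simp
  · rw [chartTest, indicator_of_notMem h]
    simp

theorem dbar_chartTest_eq_zero (hC : AnnulusChart W f ρ k c ζ ψ) (hΩ : IsOpen Ω)
    (hf : IsProperOntoDisc Ω f) (ha : ρ < a) (hab : a < a') (hV : IsOpen V)
    (hφ : DifferentiableOn ℂ φ V) (haV : ∀ ω, a ≤ ‖ω‖ ^ 2 → ‖ω‖ ^ 2 ≤ 1 → ω ∈ V) :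
    ∀ z ∈ Ω \ shell W ζ a a', dbar (chartTest W ζ a a' φ) z = 0 := by
  intro z hz
  by_cases h : z ∈ W ∧ a ≤ ‖ζ z‖ ^ 2
  · rw [dbar_chartTest hC h.1 (hφ.differentiableAt (hV.mem_nhds (haV _ h.2
      (hC.mapsTo z h.1).2.le))), dbar_radStep_eq_zero
      (hC.differentiableOn.differentiableAt (hC.isOpen.mem_nhds h.1)) hab
      fun h' => hz.2 ⟨h.1, h'⟩, zero_mul]
  · exact dbar_eq_zero_of_eventually (chartTest_eventuallyEq_zero hC hΩ hf ha hab hz.1 h)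

theorem chartTest_boundary (hC : AnnulusChart W f ρ k c ζ ψ)
    (hf : IsProperOntoDisc Ω f) (ha : ρ < a) (hab : a < a') (ha1 : a' < 1)
    (hφ : ContinuousOn φ {ω | a ≤ ‖ω‖ ^ 2 ∧ ‖ω‖ ^ 2 ≤ 1})
    (hφ' : ContinuousOn φ' {ω | a ≤ ‖ω‖ ^ 2 ∧ ‖ω‖ ^ 2 ≤ 1})
    (hrefl : ∀ ω, ‖ω‖ ^ 2 = 1 → conj (φ ω) = φ' ω) {ε : ℝ} (hε : 0 < ε) :
    ∃ K' ⊆ Ω, IsCompact K' ∧ ∀ z ∈ Ω \ K',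
      ‖conj (chartTest W ζ a a' φ z) - chartTest W ζ a a' φ' z‖ ≤ ε := by
  set S := {ω : ℂ | a ≤ ‖ω‖ ^ 2 ∧ ‖ω‖ ^ 2 ≤ 1}
  have hD : ContinuousOn (fun ω => ‖conj (φ ω) - φ' ω‖) S :=
    ((continuous_conj.comp_continuousOn hφ).sub hφ').norm
  have hbad : IsCompact (S ∩ (fun ω => ‖conj (φ ω) - φ' ω‖) ⁻¹' Ici ε) :=
    (isCompact_closed_ann a).of_isClosed_subset
      (hD.preimage_isClosed_of_isClosed (isCompact_closed_ann a).isClosed isClosed_Ici)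
      inter_subset_left
  have ht : ∃ t, a' ≤ t ∧ t < 1 ∧ ∀ ω ∈ S, t < ‖ω‖ ^ 2 → ‖conj (φ ω) - φ' ω‖ ≤ ε := by
    rcases (S ∩ (fun ω => ‖conj (φ ω) - φ' ω‖) ⁻¹' Ici ε).eq_empty_or_nonempty with he | hne
    · refine ⟨a', le_rfl, ha1, fun ω hω _ => ?_⟩
      by_contra! h
      exact (he ▸ (⟨hω, h.le⟩ : ω ∈ S ∩ _) : ω ∈ (∅ : Set ℂ))
    · obtain ⟨ω₀, h0, hmax⟩ := hbad.exists_isMaxOn hne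
        (f := fun ω : ℂ => ‖ω‖ ^ 2) (by fun_prop)
      refine ⟨max a' (‖ω₀‖ ^ 2), le_max_left _ _, max_lt ha1 ?_, fun ω hω h => ?_⟩
      · refine lt_of_le_of_ne h0.1.2 fun h => ?_
        have h2 : ε ≤ ‖conj (φ ω₀) - φ' ω₀‖ := h0.2
        rw [hrefl ω₀ h, sub_self, norm_zero] at h2
        linarith
      · by_contra! h'
        have h2 : ‖ω‖ ^ 2 ≤ ‖ω₀‖ ^ 2 := hmax (⟨hω, h'.le⟩ : ω ∈ S ∩ _)
        exact ((le_max_right _ _).trans_lt h).not_ge h2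
  obtain ⟨t, ht1, ht2, ht3⟩ := ht
  have ht0 : 0 ≤ t := hC.ρ_pos.le.trans (ha.le.trans (hab.le.trans ht1))
  refine ⟨{z | z ∈ Ω ∧ ‖f z‖ ^ 2 ≤ t ^ k}, fun z hz => hz.1,
    hf.isCompact_sublevel (pow_lt_one₀ ht0 ht2 hC.k_pos.ne'), fun z hz => ?_⟩
  by_cases hzW : z ∈ W
  · have h1 : t < ‖ζ z‖ ^ 2 := by
      by_contra! h
      refine hz.2 ⟨hz.1, ?_⟩
      rw [hC.norm_sq_eq hzW]
      exact pow_le_pow_left₀ (by positivity) h k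
    rw [chartTest, chartTest, indicator_of_mem hzW, indicator_of_mem hzW, radStep,
      stepFn_of_ge hab (ht1.trans h1.le), ofReal_one, one_mul, one_mul]
    exact ht3 _ ⟨(hab.le.trans ht1).trans h1.le, (hC.mapsTo z hzW).2.le⟩ h1
  · rw [chartTest, chartTest, indicator_of_notMem hzW, indicator_of_notMem hzW]
    simpa using hε.le

theorem integral_dbar_chartTest (hC : AnnulusChart W f ρ k c ζ ψ) (hΩ : IsOpen Ω) (hWΩ : W ⊆ Ω)
    (hf : IsProperOntoDisc Ω f) {ρ' : ℝ} (hρ : ρ ≤ ρ') (ha : ρ' < a) (hab : a < a')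
    (hV : IsOpen V)
    (hφ : DifferentiableOn ℂ φ V) (haV : ∀ ω, a ≤ ‖ω‖ ^ 2 → ‖ω‖ ^ 2 ≤ 1 → ω ∈ V) (h : ℂ → ℂ) :
    ∫ z in Ω, dbar (chartTest W ζ a a' φ) z * h z =
      ∫ ω in ann ρ' 1, dbar (radStep (fun ω => ω) a a') ω *
        (φ ω * ω⁻¹ * (ω * h (ψ ω) * deriv ψ ω)) := by
  have haρ := hρ.trans_lt ha
  have e1 : ∫ z in Ω, dbar (chartTest W ζ a a' φ) z * h z =
      ∫ z in W, dbar (chartTest W ζ a a' φ) z * h z := by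
    refine setIntegral_eq_of_subset_of_forall_sdiff_eq_zero hΩ.measurableSet hWΩ fun z hz => ?_
    rw [dbar_chartTest_eq_zero hC hΩ hf haρ hab hV hφ haV z ⟨hz.1, fun h => hz.2 h.1⟩, zero_mul]
  have e2 : ∫ ω in ann ρ 1, dbar (radStep (fun ω => ω) a a') ω *
        (φ ω * ω⁻¹ * (ω * h (ψ ω) * deriv ψ ω)) =
      ∫ ω in ann ρ' 1, dbar (radStep (fun ω => ω) a a') ω *
        (φ ω * ω⁻¹ * (ω * h (ψ ω) * deriv ψ ω)) := by
    refine setIntegral_eq_of_subset_of_forall_sdiff_eq_zero (isOpen_ann ρ 1).measurableSet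
      (ann_mono hρ le_rfl) fun ω hω => ?_
    rw [dbar_radStep_eq_zero differentiableAt_fun_id hab fun h => hω.2 ⟨ha.trans_le h.1, hω.1.2⟩,
      zero_mul]
  have hder : ∀ ω ∈ ann ρ 1, HasDerivAt ψ (deriv ψ ω) ω := fun ω hω =>
    (hC.differentiableAt ω hω.1 hω.2).hasDerivAt
  rw [e1, ← e2, ← hC.image_eq, integral_image_eq_integral_abs_det_fderiv_smul volume
    (isOpen_ann ρ 1).measurableSet
    (fun ω hω => ((hder ω hω).hasFDerivAt.restrictScalars ℝ).hasFDerivWithinAt) hC.injOn]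
  refine setIntegral_congr_fun (isOpen_ann ρ 1).measurableSet fun ω hω => ?_
  have hψW := hC.mem ω hω.1 hω.2
  have hζψ := hC.right_inv ω hω.1 hω.2
  have hdet : |(ContinuousLinearMap.restrictScalars ℝ
      (ContinuousLinearMap.toSpanSingleton ℂ (deriv ψ ω))).det| = ‖deriv ψ ω‖ ^ 2 :=
    abs_det_restrictScalars_toSpanSingleton _
  have hζd := hC.differentiableOn.differentiableAt (hC.isOpen.mem_nhds hψW)
  have hprod : deriv ζ (ψ ω) * deriv ψ ω = 1 := by
    have h1 := hζd.hasDerivAt.comp ω (hder ω hω)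
    refine h1.unique ((hasDerivAt_id ω).congr_of_eventuallyEq ?_)
    filter_upwards [(isOpen_ann ρ 1).mem_nhds hω] with x hx
    exact hC.right_inv x hx.1 hx.2
  rw [hC.image_eq]
  by_cases hs : a ≤ ‖ω‖ ^ 2
  · rw [dbar_chartTest hC hψW (hφ.differentiableAt (hV.mem_nhds (by
      rw [hζψ]; exact haV _ hs hω.2.le))), dbar_radStep hζd, dbar_radStep differentiableAt_fun_id,
      hζψ, deriv_id'', map_one, mul_one, hdet]
    have hω0 := ne_zero_of_mem_ann hC.ρ_pos.le hω
    have h2 : ((‖deriv ψ ω‖ ^ 2 : ℝ) : ℂ) = deriv ψ ω * conj (deriv ψ ω) := by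
      rw [mul_conj']
      norm_cast
    have h3 : conj (deriv ζ (ψ ω)) * conj (deriv ψ ω) = 1 := by rw [← map_mul, hprod, map_one]
    rw [real_smul, h2]
    linear_combination (deriv ψ ω * (deriv (stepFn a a') (‖ω‖ ^ 2) : ℝ) * ω * φ ω * h (ψ ω)) * h3
      - (deriv (stepFn a a') (‖ω‖ ^ 2) : ℝ) * ω * φ ω * h (ψ ω) * deriv ψ ω *
        (inv_mul_cancel₀ hω0)
  · rw [dbar_chartTest_eq_zero hC hΩ hf haρ hab hV hφ haV _ ⟨hWΩ hψW, fun h => hs (by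
      have := h.2.1
      rwa [hζψ] at this)⟩, dbar_radStep_eq_zero differentiableAt_fun_id hab fun h => hs h.1]
    simp
end

/-- Equality of the boundary pairings of `h₁` and `h₂` with conjugate boundary data. -/
def KernelRelation (Ω : Set ℂ) (b : ℂ) (h₁ h₂ : ℂ → ℂ) : Prop :=
  ∀ (u v : ℂ → ℂ) (K : Set ℂ), ContDiffOn ℝ 1 u Ω → BddOn Ω u → ContDiffOn ℝ 1 v Ω → BddOn Ω v →
    IsCompact K → K ⊆ Ω → b ∉ K → (∀ z ∈ Ω \ K, dbar u z = 0) → (∀ z ∈ Ω \ K, dbar v z = 0) →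
    (∀ᶠ z in 𝓝 b, u z = 0) → (∀ᶠ z in 𝓝 b, v z = 0) →
    (∀ ε > 0, ∃ K' ⊆ Ω, IsCompact K' ∧ ∀ z ∈ Ω \ K', ‖conj (u z) - v z‖ ≤ ε) →
    conj (∫ z in Ω, dbar u z * h₁ z) = ∫ z in Ω, dbar v z * h₂ z

section
variable {Ω W : Set ℂ} {f : ℂ → ℂ} {ρ : ℝ} {k : ℕ} {c : ℂ} {ζ ψ : ℂ → ℂ}

theorem KernelRelation.conj_integral_eq {b : ℂ} {h₁ h₂ : ℂ → ℂ} (H : KernelRelation Ω b h₁ h₂)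
    (hb : b ∈ Ω)
    (hC : AnnulusChart W f ρ k c ζ ψ) (hΩ : IsOpen Ω) (hWΩ : W ⊆ Ω)
    (hf : IsProperOntoDisc Ω f) {ρ' : ℝ} (hρ : ρ ≤ ρ') (hbρ : b ∈ W → ‖ζ b‖ ^ 2 ≤ ρ')
    {a a' : ℝ} (ha : ρ' < a) (hab : a < a') (ha1 : a' < 1) {V V' : Set ℂ} {φ φ' : ℂ → ℂ}
    (hV : IsOpen V) (hφ : DifferentiableOn ℂ φ V)
    (haV : ∀ ω, a ≤ ‖ω‖ ^ 2 → ‖ω‖ ^ 2 ≤ 1 → ω ∈ V)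
    (hV' : IsOpen V') (hφ' : DifferentiableOn ℂ φ' V')
    (haV' : ∀ ω, a ≤ ‖ω‖ ^ 2 → ‖ω‖ ^ 2 ≤ 1 → ω ∈ V')
    (hrefl : ∀ ω, ‖ω‖ ^ 2 = 1 → conj (φ ω) = φ' ω) :
    conj (∫ ω in ann ρ' 1, dbar (radStep (fun ω => ω) a a') ω *
        (φ ω * ω⁻¹ * (ω * h₁ (ψ ω) * deriv ψ ω))) =
      ∫ ω in ann ρ' 1, dbar (radStep (fun ω => ω) a a') ω *
        (φ' ω * ω⁻¹ * (ω * h₂ (ψ ω) * deriv ψ ω)) := by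
  have haρ := hρ.trans_lt ha
  rw [← integral_dbar_chartTest hC hΩ hWΩ hf hρ ha hab hV hφ haV,
    ← integral_dbar_chartTest hC hΩ hWΩ hf hρ ha hab hV' hφ' haV']
  have hbn : ¬ (b ∈ W ∧ a ≤ ‖ζ b‖ ^ 2) := fun h => (ha.trans_le h.2).not_ge (hbρ h.1)
  exact H _ _ (shell W ζ a a') (chartTest_contDiffOn hC hΩ hf haρ hab hV hφ haV)
    (chartTest_bddOn hC hΩ hf haρ hab hV hφ haV)
    (chartTest_contDiffOn hC hΩ hf haρ hab hV' hφ' haV')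
    (chartTest_bddOn hC hΩ hf haρ hab hV' hφ' haV') (hC.isCompact_shell haρ ha1)
    (shell_subset.trans hWΩ) (fun h => hbn ⟨h.1, h.2.1⟩)
    (dbar_chartTest_eq_zero hC hΩ hf haρ hab hV hφ haV)
    (dbar_chartTest_eq_zero hC hΩ hf haρ hab hV' hφ' haV')
    (chartTest_eventuallyEq_zero hC hΩ hf haρ hab hb hbn)
    (chartTest_eventuallyEq_zero hC hΩ hf haρ hab hb hbn)
    fun ε hε => chartTest_boundary hC hf haρ hab ha1
      (hφ.continuousOn.mono fun ω h => haV ω h.1 h.2)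
      (hφ'.continuousOn.mono fun ω h => haV' ω h.1 h.2) hrefl hε

theorem KernelRelation.weakReflection {b : ℂ} {h₁ h₂ : ℂ → ℂ} (H : KernelRelation Ω b h₁ h₂)
    (hb : b ∈ Ω) (hC : AnnulusChart W f ρ k c ζ ψ) (hΩ : IsOpen Ω) (hWΩ : W ⊆ Ω)
    (hf : IsProperOntoDisc Ω f) {ρ' : ℝ} (hρ : ρ ≤ ρ') (hbρ : b ∈ W → ‖ζ b‖ ^ 2 ≤ ρ') :
    WeakReflection ρ' (fun ω => ω * h₁ (ψ ω) * deriv ψ ω) (fun ω => ω * h₂ (ψ ω) * deriv ψ ω) ∧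
    WeakReflection ρ' (fun ω => ω * h₂ (ψ ω) * deriv ψ ω)
      (fun ω => ω * h₁ (ψ ω) * deriv ψ ω) := by
  have hρ0 : 0 ≤ ρ' := hC.ρ_pos.le.trans hρ
  have key : ∀ a w : _, ‖(w : ℂ)‖ ^ 2 < a → a < 1 → ∀ ω : ℂ, a ≤ ‖ω‖ ^ 2 → ‖ω‖ ^ 2 ≤ 1 →
      w - ω ≠ 0 ∧ 1 - conj w * ω ≠ 0 := by
    intro a w hw ha ω h1 h2
    refine ⟨fun h => ?_, fun h => ?_⟩
    · rw [sub_eq_zero.1 h] at hw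
      exact hw.not_ge h1
    · have h3 : ‖conj w * ω‖ = 1 := by rw [← sub_eq_zero.1 h, norm_one]
      rw [norm_mul, norm_conj] at h3
      have h4 : ‖w‖ < 1 := by nlinarith [norm_nonneg w]
      have h5 : ‖ω‖ ≤ 1 := by nlinarith [norm_nonneg ω]
      nlinarith [norm_nonneg w, norm_nonneg ω]
  have hVo : ∀ w : ℂ, IsOpen {ω : ℂ | w - ω ≠ 0} := fun w => isOpen_ne_fun (by fun_prop) (by fun_prop)
  have hVo' : ∀ w : ℂ, IsOpen {ω : ℂ | 1 - conj w * ω ≠ 0} :=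
    fun w => isOpen_ne_fun (by fun_prop) (by fun_prop)
  have hφ : ∀ w : ℂ, DifferentiableOn ℂ (fun ω => ω / (w - ω)) {ω : ℂ | w - ω ≠ 0} := fun w =>
    DifferentiableOn.div (by fun_prop) (by fun_prop) fun ω h => h
  have hφ' : ∀ w : ℂ, DifferentiableOn ℂ (fun ω => -(1 / (1 - conj w * ω)))
      {ω : ℂ | 1 - conj w * ω ≠ 0} := fun w =>
    (DifferentiableOn.div (by fun_prop) (by fun_prop) fun ω h => h).neg
  have hrefl : ∀ a w : _, ‖(w : ℂ)‖ ^ 2 < a → a < 1 → ∀ ω : ℂ, ‖ω‖ ^ 2 = 1 →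
      conj (ω / (w - ω)) = -(1 / (1 - conj w * ω)) := by
    intro a w hw ha ω h
    obtain ⟨h1, h2⟩ := key a w hw ha ω (by rw [h]; exact ha.le) h.le
    have h3 : conj w - conj ω ≠ 0 := by
      rw [← map_sub]
      exact (map_ne_zero _).2 h1
    have h4 : ω * conj ω = 1 := by
      rw [mul_conj']
      exact_mod_cast h
    rw [map_div₀, map_sub, ← neg_div, div_eq_div_iff h3 h2]
    linear_combination (- conj w) * h4
  have e1 (a a' : ℝ) (w : ℂ) (X : ℂ → ℂ) :
      ∫ ω in ann ρ' 1, dbar (radStep (fun ω => ω) a a') ω * (ω / (w - ω) * ω⁻¹ * X ω) =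
        stepCauchy ρ' a a' X w := by
    refine setIntegral_congr_fun (isOpen_ann ρ' 1).measurableSet fun ω hω => ?_
    have := ne_zero_of_mem_ann hρ0 hω
    congr 1
    field_simp
  have e2 (a a' : ℝ) (w : ℂ) (X : ℂ → ℂ) :
      ∫ ω in ann ρ' 1, dbar (radStep (fun ω => ω) a a') ω *
        (-(1 / (1 - conj w * ω)) * ω⁻¹ * X ω) =
        -∫ ω in ann ρ' 1, dbar (radStep (fun ω => ω) a a') ω * (X ω * ω⁻¹ / (1 - conj w * ω)) := by
    rw [← integral_neg]
    congr 1
    funext ω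
    simp only [div_eq_mul_inv]
    ring
  constructor
  · intro a a' w ha hab ha1 hw
    have h1 := H.conj_integral_eq hb hC hΩ hWΩ hf hρ hbρ ha hab ha1 (hVo w) (hφ w)
      (fun ω h h' => (key a w hw (hab.trans ha1) ω h h').1) (hVo' w) (hφ' w)
      (fun ω h h' => (key a w hw (hab.trans ha1) ω h h').2) (hrefl a w hw (hab.trans ha1))
    rwa [e1 a a' w fun ω => ω * h₁ (ψ ω) * deriv ψ ω,
      e2 a a' w fun ω => ω * h₂ (ψ ω) * deriv ψ ω] at h1
  · intro a a' w ha hab ha1 hw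
    have h1 := H.conj_integral_eq hb hC hΩ hWΩ hf hρ hbρ ha hab ha1 (hVo' w) (hφ' w)
      (fun ω h h' => (key a w hw (hab.trans ha1) ω h h').2) (hVo w) (hφ w)
      (fun ω h h' => (key a w hw (hab.trans ha1) ω h h').1) fun ω h => by
        rw [← hrefl a w hw (hab.trans ha1) ω h, conj_conj]
    rw [e1 a a' w fun ω => ω * h₂ (ψ ω) * deriv ψ ω,
      e2 a a' w fun ω => ω * h₁ (ψ ω) * deriv ψ ω] at h1
    rw [← h1, conj_conj]

/-- The Garabedian-type kernel of an Ahlfors map extends across each annular end. -/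
theorem IsAhlforsMap.exists_extension {b : ℂ} {g : ℂ → ℂ} (hg : IsAhlforsMap Ω b g) (hb : b ∈ Ω)
    (hC : AnnulusChart W f ρ k c ζ ψ) (hΩ : IsOpen Ω) (hΩc : IsPreconnected Ω) (hWΩ : W ⊆ Ω)
    (hf : IsProperOntoDisc Ω f) :
    ∃ s E₀ E₁, ρ < s ∧ s < 1 ∧ DifferentiableOn ℂ E₀ (ann s s⁻¹) ∧
      DifferentiableOn ℂ E₁ (ann s s⁻¹) ∧ (∃ ω ∈ ann s 1, E₁ ω ≠ 0) ∧
      ∀ ω ∈ ann s 1, E₀ ω = g (ψ ω) * E₁ ω ∧ E₀ (conj ω)⁻¹ = conj (E₀ ω) ∧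
        E₁ (conj ω)⁻¹ = conj (g (ψ ω) * E₀ ω) := by
  obtain ⟨κ, hκ, ⟨z₁, hz₁, hz₁0⟩, hrel⟩ := hg.exists_kernel hΩ hb
  have R1 : KernelRelation Ω b (fun z => g z * κ z) (fun z => g z * κ z) :=
    fun u v K h1 h2 h3 h4 h5 h6 h7 h8 h9 h10 h11 h12 =>
      (hrel u v K h1 h2 h3 h4 h5 h6 h7 h8 h9 h10 h11 h12).1
  have R2 : KernelRelation Ω b (fun z => g z ^ 2 * κ z) κ :=
    fun u v K h1 h2 h3 h4 h5 h6 h7 h8 h9 h10 h11 h12 =>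
      (hrel u v K h1 h2 h3 h4 h5 h6 h7 h8 h9 h10 h11 h12).2
  obtain ⟨ρ', hρ, hρ1, hbρ⟩ : ∃ ρ', ρ ≤ ρ' ∧ ρ' < 1 ∧ (b ∈ W → ‖ζ b‖ ^ 2 ≤ ρ') := by
    by_cases h : b ∈ W
    · exact ⟨‖ζ b‖ ^ 2, (hC.mapsTo b h).1.le, (hC.mapsTo b h).2, fun _ => le_rfl⟩
    · exact ⟨ρ, le_rfl, hC.ρ_lt, fun h' => absurd h' h⟩
  have hρ0 : 0 ≤ ρ' := hC.ρ_pos.le.trans hρ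
  obtain ⟨s, hs, hs1⟩ := exists_between hρ1
  have hψ : DifferentiableOn ℂ ψ (ann ρ' 1) := fun ω hω =>
    (hC.differentiableAt ω (hρ.trans_lt hω.1) hω.2).differentiableWithinAt
  have hψ' := hψ.deriv (isOpen_ann ρ' 1)
  have hmaps : MapsTo ψ (ann ρ' 1) (Ω \ {b}) := fun ω hω => by
    refine ⟨hWΩ (hC.mem ω (hρ.trans_lt hω.1) hω.2), fun h => ?_⟩
    have h1 := hC.mem ω (hρ.trans_lt hω.1) hω.2
    have h2 := hC.right_inv ω (hρ.trans_lt hω.1) hω.2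
    rw [mem_singleton_iff.1 h] at h1 h2
    have := hbρ h1
    rw [h2] at this
    exact hω.1.not_ge this
  have hX (h : ℂ → ℂ) (hh : DifferentiableOn ℂ h (Ω \ {b})) :
      DifferentiableOn ℂ (fun ω => ω * h (ψ ω) * deriv ψ ω) (ann ρ' 1) :=
    (differentiableOn_id.fun_mul (hh.comp hψ hmaps)).fun_mul hψ'
  have hgd := hg.1.mono (sdiff_subset : Ω \ {b} ⊆ Ω)
  obtain ⟨W1, W1'⟩ := R1.weakReflection hb hC hΩ hWΩ hf hρ hbρ
  obtain ⟨W2, W2'⟩ := R2.weakReflection hb hC hΩ hWΩ hf hρ hbρ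
  obtain ⟨E₀, hE₀, hE₀r⟩ := W1.exists_extension hρ0 hs hs1 (hX _ (hgd.mul hκ))
    (hX _ (hgd.mul hκ)) W1'
  obtain ⟨E₁, hE₁, hE₁r⟩ := W2'.exists_extension hρ0 hs hs1 (hX _ hκ)
    (hX _ ((hgd.pow 2).mul hκ)) W2
  refine ⟨s, E₀, E₁, hρ.trans_lt hs, hs1, hE₀, hE₁, ?_, fun ω hω => ?_⟩
  · by_contra! h0
    have hann : ∀ ω ∈ ann s 1, κ (ψ ω) = 0 := fun ω hω => by
      have h1 := (hE₁r ω hω).1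
      rw [h0 ω hω] at h1
      have hω' : ω ∈ ann ρ 1 := ann_mono (hρ.trans hs.le) le_rfl hω
      have h2 : deriv ψ ω ≠ 0 := fun h => by
        have hζd := hC.differentiableOn.differentiableAt (hC.isOpen.mem_nhds
          (hC.mem ω hω'.1 hω'.2))
        have h3 := hζd.hasDerivAt.comp ω (hC.differentiableAt ω hω'.1 hω'.2).hasDerivAt
        have h4 : deriv ζ (ψ ω) * deriv ψ ω = 1 := by
          refine h3.unique ((hasDerivAt_id ω).congr_of_eventuallyEq ?_)
          filter_upwards [(isOpen_ann ρ 1).mem_nhds hω'] with x hx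
          exact hC.right_inv x hx.1 hx.2
        rw [h, mul_zero] at h4
        exact zero_ne_one h4
      have h3 := ne_zero_of_mem_ann (hρ0.trans hs.le) hω
      rcases mul_eq_zero.1 h1.symm with h4 | h4
      · exact (mul_eq_zero.1 h4).resolve_left h3
      · exact absurd h4 h2
    obtain ⟨t, ht, ht1⟩ := exists_between hs1
    have ht0 : 0 ≤ t := (hρ0.trans hs.le).trans ht.le
    have hω₀ : ((√t : ℝ) : ℂ) ∈ ann s 1 := by
      rw [ann, mem_ofPred_eq, norm_real, Real.norm_of_nonneg (Real.sqrt_nonneg t),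
        Real.sq_sqrt ht0]
      exact ⟨ht, ht1⟩
    set ω₀ : ℂ := ((√t : ℝ) : ℂ)
    have hω₁ : ω₀ ∈ ann ρ' 1 := ann_mono hs.le le_rfl hω₀
    have hW0 := hC.mem ω₀ (hρ.trans_lt hω₁.1) hω₁.2
    have hO : IsOpen (Ω \ {b}) := hΩ.sdiff isClosed_singleton
    have h5 : κ =ᶠ[𝓝 (ψ ω₀)] 0 := by
      have h6 : ∀ᶠ z in 𝓝 (ψ ω₀), ζ z ∈ ann s 1 := by
        refine (hC.differentiableOn.continuousOn.continuousAt
          (hC.isOpen.mem_nhds hW0)).eventually_mem ?_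
        rw [hC.right_inv ω₀ (hρ.trans_lt hω₁.1) hω₁.2]
        exact (isOpen_ann s 1).mem_nhds hω₀
      filter_upwards [h6, hC.isOpen.mem_nhds hW0] with z hz hzW
      have := hann _ hz
      rwa [hC.left_inv z hzW] at this
    exact hz₁0 ((hκ.analyticOnNhd hO).eqOn_of_preconnected_of_eventuallyEq
      (analyticOnNhd_const (v := (0 : ℂ))) (hΩc.sdiff_singleton hΩ b) (hmaps hω₁) h5 hz₁)
  · obtain ⟨h1, h2⟩ := hE₀r ω hω
    obtain ⟨h3, h4⟩ := hE₁r ω hω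
    refine ⟨?_, ?_, ?_⟩
    · rw [h1, h3]
      simp only [Pi.mul_apply]
      ring
    · rw [h2, h1]
    · rw [h4, h1]
      congr 1
      simp only [Pi.mul_apply, Pi.pow_apply]
      ring
end

theorem isPreconnected_ann {s t : ℝ} (hs : 0 < s) (ht : 0 < t) : IsPreconnected (ann s t) := by
  have e : ann s t = exp '' {w : ℂ | Real.log s < 2 * w.re ∧ 2 * w.re < Real.log t} := by
    ext ω
    constructor
    · intro h
      have h0 := ne_zero_of_mem_ann hs.le h
      have h1 : 0 < ‖ω‖ ^ 2 := by positivity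
      refine ⟨log ω, ?_, exp_log h0⟩
      rw [mem_ofPred_eq, log_re]
      have h2 : 2 * Real.log ‖ω‖ = Real.log (‖ω‖ ^ 2) := by
        rw [Real.log_pow]
        norm_num
      rw [h2]
      exact ⟨Real.log_lt_log hs h.1, Real.log_lt_log h1 h.2⟩
    · rintro ⟨w, hw, rfl⟩
      have h3 : ‖exp w‖ ^ 2 = Real.exp (2 * w.re) := by
        rw [norm_exp, ← Real.exp_nat_mul]
        norm_num
      rw [ann, mem_ofPred_eq, h3]
      exact ⟨(Real.log_lt_iff_lt_exp hs).1 hw.1, (Real.lt_log_iff_exp_lt ht).1 hw.2⟩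
  rw [e]
  refine IsPreconnected.image (Convex.isPreconnected ?_) _ continuous_exp.continuousOn
  have h1 : IsLinearMap ℝ fun w : ℂ => 2 * w.re :=
    ⟨fun x y => by rw [add_re, mul_add], fun c x => by simp; ring⟩
  exact (convex_halfSpace_gt h1 _).inter (convex_halfSpace_lt h1 _)

/-- A square integrable function near the unit circle has no poles there. -/
theorem not_eventually_pole {s : ℝ} (hs1 : s < 1) {Y : ℂ → ℂ}
    (hY : IntegrableOn (fun ω => ‖Y ω‖ ^ 2) (ann s 1)) {p : ℂ} (hp : ‖p‖ = 1) {c : ℝ}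
    (hc : 0 < c) : ¬ ∀ᶠ ω in 𝓝 p, ‖ω‖ < 1 → c ≤ ‖Y ω‖ * ‖ω - p‖ := by
  intro h
  have hO := isOpen_ann s 1
  obtain ⟨δ, hδ, hball⟩ := Metric.eventually_nhds_iff.1 h
  set B : ℝ → Set ℂ := fun r => ball ((1 - r : ℝ) * p) (r / 2) with hB
  have hvol : Tendsto (volume ∘ B) (𝓝[>] 0) (𝓝 0) := by
    have : volume ∘ B = fun r => ENNReal.ofReal (r / 2) ^ 2 * NNReal.pi := by
      funext r
      exact Complex.volume_ball _ _
    rw [this]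
    have h1 : Tendsto (fun r : ℝ => ENNReal.ofReal (r / 2)) (𝓝 0) (𝓝 0) := by
      have : Continuous fun r : ℝ => ENNReal.ofReal (r / 2) :=
        ENNReal.continuous_ofReal.comp (by fun_prop)
      simpa using this.tendsto 0
    have h2 := ENNReal.Tendsto.mul_const (b := (NNReal.pi : ENNReal)) (ENNReal.Tendsto.pow (n := 2) h1)
      (Or.inr (by simp))
    simpa using h2.mono_left nhdsWithin_le_nhds
  have hlim := (integrable_indicator_iff hO.measurableSet).2 hY
    |>.tendsto_setIntegral_nhds_zero hvol
  have hsmall : ∀ᶠ r : ℝ in 𝓝[>] 0, r < 1 ∧ 3 * r / 2 < δ ∧ s < (1 - 3 * r / 2) ^ 2 ∧ 3 * r / 2 < 1 := by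
    refine Filter.Eventually.filter_mono nhdsWithin_le_nhds ?_
    refine (gt_mem_nhds zero_lt_one).and (((Continuous.tendsto' (by fun_prop) 0 0
      (by norm_num)).eventually (gt_mem_nhds hδ)).and ?_)
    exact ((Continuous.tendsto' (f := fun r : ℝ => (1 - 3 * r / 2) ^ 2) (by fun_prop) 0 1
      (by norm_num)).eventually (lt_mem_nhds hs1)).and ((Continuous.tendsto' (by fun_prop) 0 0
      (by norm_num)).eventually (gt_mem_nhds zero_lt_one))
  have hpos : 0 < Real.pi * c ^ 2 / 9 := by positivity
  obtain ⟨r, ⟨hr1, hr2, hr3, hr5⟩, hr4, hr0⟩ := (hsmall.and ((hlim.eventually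
    (gt_mem_nhds hpos)).and self_mem_nhdsWithin)).exists
  have hr0 : 0 < r := hr0
  refine hr4.not_ge ?_
  have hdist : ∀ ω ∈ B r, ‖ω‖ < 1 ∧ 1 - 3 * r / 2 < ‖ω‖ ∧ ‖ω - p‖ < 3 * r / 2 := by
    intro ω hω
    have h1 : ‖ω - (1 - r : ℝ) * p‖ < r / 2 := by
      rw [← dist_eq_norm]
      exact hω
    have h2 : ‖((1 - r : ℝ) : ℂ) * p‖ = 1 - r := by
      rw [norm_mul, hp, mul_one, norm_real, Real.norm_of_nonneg (by linarith)]
    refine ⟨?_, ?_, ?_⟩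
    · have := norm_le_norm_add_norm_sub' ω ((1 - r : ℝ) * p)
      linarith
    · have := norm_le_norm_add_norm_sub' (((1 - r : ℝ) : ℂ) * p) ω
      rw [norm_sub_rev] at this
      linarith
    · have h3 : ω - p = (ω - (1 - r : ℝ) * p) - r * p := by
        push_cast
        ring
      have h4 : ‖(r : ℂ) * p‖ = r := by
        rw [norm_mul, hp, mul_one, norm_real, Real.norm_of_nonneg hr0.le]
      rw [h3]
      have := norm_sub_le (ω - (1 - r : ℝ) * p) (r * p)
      linarith
  have hann : B r ⊆ ann s 1 := fun ω hω => by
    obtain ⟨h1, h2, -⟩ := hdist ω hω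
    refine ⟨hr3.trans_le (pow_le_pow_left₀ (by linarith) h2.le 2), ?_⟩
    nlinarith [norm_nonneg ω]
  have hlow : ∀ ω ∈ B r, (2 * c / (3 * r)) ^ 2 ≤ ‖Y ω‖ ^ 2 := fun ω hω => by
    obtain ⟨h1, h2, h3⟩ := hdist ω hω
    have h4 := hball (dist_eq_norm ω p ▸ h3.trans hr2) h1
    refine pow_le_pow_left₀ (by positivity) ?_ 2
    rw [div_le_iff₀ (by positivity)]
    nlinarith [norm_nonneg (Y ω)]
  have hintegr := hY.mono_set hann
  have e1 : ∫ ω in B r, (ann s 1).indicator (fun ω => ‖Y ω‖ ^ 2) ω = ∫ ω in B r, ‖Y ω‖ ^ 2 :=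
    setIntegral_congr_fun measurableSet_ball fun ω hω => indicator_of_mem (hann hω) _
  rw [e1]
  have e2 : ∫ _ in B r, (2 * c / (3 * r)) ^ 2 = Real.pi * c ^ 2 / 9 := by
    rw [setIntegral_const, measureReal_def, Complex.volume_ball, smul_eq_mul]
    rw [ENNReal.toReal_mul, ENNReal.toReal_pow, ENNReal.toReal_ofReal (by positivity)]
    simp only [ENNReal.coe_toReal, NNReal.coe_real_pi]
    field_simp
    ring
  rw [← e2]
  refine setIntegral_mono_on ?_ hintegr measurableSet_ball hlow
  exact integrableOn_const (by simp [hB, Complex.volume_ball, ENNReal.mul_eq_top])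

theorem eq_of_eventually_mul_eq {D u v : ℂ → ℂ} {p : ℂ} (hD : AnalyticAt ℂ D p)
    (hne : ¬ ∀ᶠ z in 𝓝 p, D z = 0) (hu : ContinuousAt u p) (hv : ContinuousAt v p)
    (h : ∀ᶠ z in 𝓝 p, D z * u z = D z * v z) : u p = v p := by
  have h1 : ∀ᶠ z in 𝓝[≠] p, D z ≠ 0 := hD.eventually_eq_zero_or_eventually_ne_zero.resolve_left hne
  have h2 : u =ᶠ[𝓝[≠] p] v := by
    filter_upwards [h1, h.filter_mono nhdsWithin_le_nhds] with z hz1 hz2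
    exact mul_left_cancel₀ hz1 hz2
  exact tendsto_nhds_unique ((hu.tendsto.mono_left nhdsWithin_le_nhds).congr' h2)
    (hv.tendsto.mono_left nhdsWithin_le_nhds)

/-- Local quotients of holomorphic functions glue to a global one. -/
theorem exists_quotient {U : Set ℂ} (hU : IsOpen U) {N D : ℂ → ℂ} (hD : DifferentiableOn ℂ D U)
    (hne : ∀ p ∈ U, ¬ ∀ᶠ z in 𝓝 p, D z = 0)
    (hloc : ∀ p ∈ U, ∃ h : ℂ → ℂ, AnalyticAt ℂ h p ∧ ∀ᶠ z in 𝓝 p, N z = D z * h z) :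
    ∃ H : ℂ → ℂ, DifferentiableOn ℂ H U ∧ ∀ z ∈ U, N z = D z * H z := by
  classical
  choose! h hh hhe using hloc
  refine ⟨fun z => h z z, fun p hp => ?_, fun z hz => (hhe z hz).self_of_nhds⟩
  refine ((hh p hp).differentiableAt.congr_of_eventuallyEq ?_).differentiableWithinAt
  filter_upwards [hU.mem_nhds hp, (hh p hp).eventually_analyticAt,
    (hhe p hp).eventually_nhds] with z hz h1 h2
  refine eq_of_eventually_mul_eq (hD.analyticAt (hU.mem_nhds hz)) (hne z hz)
    (hh z hz).continuousAt h1.continuousAt ?_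
  filter_upwards [h2, hhe z hz] with w hw1 hw2
  rw [← hw1, ← hw2]

theorem exists_local_quotient_of_pow {N D h : ℂ → ℂ} {p : ℂ} {m : ℕ}
    (hD : ∀ᶠ z in 𝓝 p, D z = (z - p) ^ m * h z) (hh : AnalyticAt ℂ h p) (hhp : h p ≠ 0)
    {n : ℕ} (hmn : m ≤ n) {g : ℂ → ℂ} (hg : AnalyticAt ℂ g p)
    (hN : ∀ᶠ z in 𝓝 p, N z = (z - p) ^ n * g z) :
    ∃ q : ℂ → ℂ, AnalyticAt ℂ q p ∧ ∀ᶠ z in 𝓝 p, N z = D z * q z := by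
  refine ⟨fun z => (z - p) ^ (n - m) * (g z / h z), ?_, ?_⟩
  · exact ((analyticAt_id.sub analyticAt_const).pow _).mul (hg.div hh hhp)
  · filter_upwards [hD, hN, hh.continuousAt.eventually_ne hhp] with z h1 h2 h3
    rw [h1, h2, ← Nat.add_sub_cancel' hmn, pow_add, Nat.add_sub_cancel' hmn]
    field_simp

/-- Either `N / D` is holomorphic at `p`, or it has a pole there. -/
theorem exists_local_quotient_or {N D : ℂ → ℂ} {p : ℂ} (hN : AnalyticAt ℂ N p)
    (hD : AnalyticAt ℂ D p) (hne : ¬ ∀ᶠ z in 𝓝 p, D z = 0) :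
    (∃ q : ℂ → ℂ, AnalyticAt ℂ q p ∧ ∀ᶠ z in 𝓝 p, N z = D z * q z) ∨
      ∃ c > 0, ∀ᶠ z in 𝓝 p, c * ‖D z‖ ≤ ‖N z‖ * ‖z - p‖ := by
  obtain ⟨m, h, hh, hhp, hhe⟩ := hD.exists_eventuallyEq_pow_smul_nonzero_iff.2 hne
  simp only [smul_eq_mul] at hhe
  by_cases hN0 : ∀ᶠ z in 𝓝 p, N z = 0
  · refine Or.inl ⟨fun _ => 0, analyticAt_const, ?_⟩
    filter_upwards [hN0] with z hz
    rw [hz, mul_zero]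
  obtain ⟨n, g, hg, hgp, hge⟩ := hN.exists_eventuallyEq_pow_smul_nonzero_iff.2 hN0
  simp only [smul_eq_mul] at hge
  rcases le_or_gt m n with hmn | hmn
  · exact Or.inl (exists_local_quotient_of_pow hhe hh hhp hmn hg hge)
  refine Or.inr ⟨‖g p‖ / 2 / (‖h p‖ + 1), by positivity, ?_⟩
  have h1 : ∀ᶠ z in 𝓝 p, ‖g p‖ / 2 < ‖g z‖ :=
    hg.continuousAt.norm.tendsto.eventually (lt_mem_nhds (half_lt_self (norm_pos_iff.2 hgp)))
  have h2 : ∀ᶠ z in 𝓝 p, ‖h z‖ < ‖h p‖ + 1 :=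
    hh.continuousAt.norm.tendsto.eventually (gt_mem_nhds (lt_add_one _))
  filter_upwards [hhe, hge, h1, h2, ball_mem_nhds p zero_lt_one] with z e1 e2 h3 h4 h5
  rw [mem_ball, dist_eq_norm] at h5
  rw [e1, e2, norm_mul, norm_mul, norm_pow, norm_pow]
  have h6 : ‖z - p‖ ^ m ≤ ‖z - p‖ ^ (n + 1) :=
    pow_le_pow_of_le_one (norm_nonneg _) h5.le hmn
  have h7 : ‖g p‖ / 2 / (‖h p‖ + 1) * ‖h z‖ ≤ ‖g z‖ := by
    rw [div_mul_eq_mul_div, div_le_iff₀ (by positivity)]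
    exact mul_le_mul h3.le h4.le (norm_nonneg _) (norm_nonneg _)
  calc ‖g p‖ / 2 / (‖h p‖ + 1) * (‖z - p‖ ^ m * ‖h z‖)
      = ‖z - p‖ ^ m * (‖g p‖ / 2 / (‖h p‖ + 1) * ‖h z‖) := by ring
    _ ≤ ‖z - p‖ ^ (n + 1) * ‖g z‖ := mul_le_mul h6 h7 (by positivity) (by positivity)
    _ = _ := by ring

theorem not_eventually_eq_zero {U : Set ℂ} (hU : IsOpen U) (hc : IsPreconnected U) {D : ℂ → ℂ}
    (hD : DifferentiableOn ℂ D U) {q : ℂ} (hq : q ∈ U) (hDq : D q ≠ 0) {p : ℂ} (hp : p ∈ U) :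
    ¬ ∀ᶠ z in 𝓝 p, D z = 0 := fun h =>
  hDq ((hD.analyticOnNhd hU).eqOn_zero_of_preconnected_of_eventuallyEq_zero hc hp h hq)

theorem exists_quotient_across {s : ℝ} (hs0 : 0 < s) (hs1 : s < 1) {N D Y : ℂ → ℂ}
    (hN : DifferentiableOn ℂ N (ann s s⁻¹)) (hD : DifferentiableOn ℂ D (ann s s⁻¹))
    (hY : DifferentiableOn ℂ Y (ann s 1)) (hYN : ∀ ω ∈ ann s 1, D ω * Y ω = N ω)
    {q : ℂ} (hq : q ∈ ann s s⁻¹) (hDq : D q ≠ 0)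
    (hintegr : IntegrableOn (fun ω => ‖Y ω‖ ^ 2) (ann s 1)) :
    ∃ t, s < t ∧ t < 1 ∧ ∃ H : ℂ → ℂ, DifferentiableOn ℂ H (ann t t⁻¹) ∧
      (∀ ω ∈ ann t 1, H ω = Y ω) ∧ ∀ ω ∈ ann t t⁻¹, N ω = D ω * H ω := by
  have hO := isOpen_ann s s⁻¹
  have hs2 : 1 < s⁻¹ := (one_lt_inv₀ hs0).2 hs1
  have hDA : ∀ p ∈ ann s s⁻¹, AnalyticAt ℂ D p := fun p hp => hD.analyticAt (hO.mem_nhds hp)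
  have hne : ∀ p ∈ ann s s⁻¹, ¬ ∀ᶠ z in 𝓝 p, D z = 0 := fun p hp =>
    not_eventually_eq_zero hO (isPreconnected_ann hs0 (by positivity)) hD hq hDq hp
  have hcirc : ∀ p : ℂ, ‖p‖ = 1 → p ∈ ann s s⁻¹ := fun p hp => by
    rw [ann, mem_ofPred_eq, hp]
    norm_num
    exact ⟨hs1, hs2⟩
  set V : Set ℂ := {p | p ∈ ann s s⁻¹ ∧
    ∃ h : ℂ → ℂ, AnalyticAt ℂ h p ∧ ∀ᶠ z in 𝓝 p, N z = D z * h z} with hV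
  have hVo : IsOpen V := by
    refine isOpen_iff_mem_nhds.2 fun p hp => ?_
    obtain ⟨hp, h, hh, he⟩ := hp
    filter_upwards [hO.mem_nhds hp, hh.eventually_analyticAt, he.eventually_nhds] with z h1 h2 h3
    exact ⟨h1, h, h2, h3⟩
  have hsph : sphere (0 : ℂ) 1 ⊆ V := fun p hp => by
    have hp : ‖p‖ = 1 := by simpa using hp
    have hpa := hcirc p hp
    refine ⟨hpa, (exists_local_quotient_or (hN.analyticAt (hO.mem_nhds hpa)) (hDA p hpa)
      (hne p hpa)).resolve_right ?_⟩
    rintro ⟨c, hc, hev⟩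
    refine not_eventually_pole hs1 hintegr hp hc ?_
    have h1 : ∀ᶠ z in 𝓝 p, z ≠ p → D z ≠ 0 := eventually_nhdsWithin_iff.1
      ((hDA p hpa).eventually_eq_zero_or_eventually_ne_zero.resolve_left (hne p hpa))
    filter_upwards [hev, h1, hO.mem_nhds hpa] with z hz1 hz2 hz3 hz4
    have hz5 : z ∈ ann s 1 := ⟨hz3.1, by nlinarith [norm_nonneg z]⟩
    have hz6 : 0 < ‖D z‖ := norm_pos_iff.2 (hz2 fun h => by
      rw [h, hp] at hz4
      exact lt_irrefl _ hz4)
    rw [← hYN z hz5, norm_mul] at hz1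
    nlinarith
  obtain ⟨δ, hδ, hthick⟩ := (isCompact_sphere (0 : ℂ) 1).exists_thickening_subset_open hVo hsph
  have hm : max s (1 / (1 + δ)) < 1 := max_lt hs1 (by rw [div_lt_one (by positivity)]; linarith)
  obtain ⟨t, ht, ht1⟩ := exists_between hm
  have hst : s < t := (le_max_left _ _).trans_lt ht
  have hδt : 1 / (1 + δ) < t := (le_max_right _ _).trans_lt ht
  have ht0 : 0 < t := hs0.trans hst
  have htinv : t⁻¹ < 1 + δ := by
    rw [inv_lt_comm₀ ht0 (by positivity), ← one_div]
    exact hδt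
  have htV : ann t t⁻¹ ⊆ V := fun ω hω => by
    refine hthick (mem_thickening_iff.2 ⟨ω / ‖ω‖, ?_, ?_⟩)
    · have := ne_zero_of_mem_ann ht0.le hω
      simp [this]
    · have h0 := ne_zero_of_mem_ann ht0.le hω
      have h0' : 0 < ‖ω‖ := norm_pos_iff.2 h0
      have h1 : ω - ω / ‖ω‖ = (ω / ‖ω‖) * ((‖ω‖ - 1 : ℝ) : ℂ) := by
        have : (‖ω‖ : ℂ) ≠ 0 := by exact_mod_cast h0'.ne'
        push_cast
        field_simp
      rw [dist_eq_norm, h1, norm_mul, norm_div, norm_real, norm_real, Real.norm_eq_abs,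
        Real.norm_eq_abs, abs_of_pos h0', div_self h0'.ne', one_mul]
      have h2 := hω.1
      have h3 := hω.2
      have h4 : 2 ≤ t + t⁻¹ := by
        have : t * t⁻¹ = 1 := mul_inv_cancel₀ ht0.ne'
        nlinarith [sq_nonneg (t - 1), inv_pos.2 ht0]
      rw [abs_lt]
      constructor
      · nlinarith
      · nlinarith
  have hsub : ann t t⁻¹ ⊆ ann s s⁻¹ := fun ω hω => (htV hω).1
  obtain ⟨H, hH, hHe⟩ := exists_quotient (isOpen_ann t t⁻¹) (N := N) (hD.mono hsub)
    (fun p hp => hne p (hsub hp)) fun p hp => (htV hp).2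
  refine ⟨t, hst, ht1, H, hH, fun ω hω => ?_, hHe⟩
  have ht2 : 1 ≤ t⁻¹ := (one_le_inv₀ ht0).2 ht1.le
  have hω1 : ω ∈ ann t t⁻¹ := ann_mono le_rfl ht2 hω
  have hω2 : ω ∈ ann s 1 := ann_mono hst.le le_rfl hω
  refine eq_of_eventually_mul_eq (hDA ω (hsub hω1)) (hne ω (hsub hω1))
    ((hH.differentiableAt ((isOpen_ann t t⁻¹).mem_nhds hω1)).continuousAt)
    ((hY.differentiableAt ((isOpen_ann s 1).mem_nhds hω2)).continuousAt) ?_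
  filter_upwards [(isOpen_ann t t⁻¹).mem_nhds hω1, (isOpen_ann s 1).mem_nhds hω2] with z h1 h2
  rw [← hHe z h1, hYN z h2]

/-- All exponents of `p` are at most `N`. -/
def ExpLE (N : ℕ) (p : MvPolynomial (Fin 2) ℂ) : Prop := ∀ m ∈ p.support, ∀ i, m i ≤ N

theorem exists_expLE (p q : MvPolynomial (Fin 2) ℂ) : ∃ N, ExpLE N p ∧ ExpLE N q := by
  refine ⟨max p.totalDegree q.totalDegree, fun m hm i => ?_, fun m hm i => ?_⟩
  · exact ((Finsupp.le_degree i m).trans (MvPolynomial.le_totalDegree hm)).trans (le_max_left _ _)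
  · exact ((Finsupp.le_degree i m).trans (MvPolynomial.le_totalDegree hm)).trans (le_max_right _ _)

/-- The polynomial with conjugated coefficients and reversed exponents. -/
def revEval (N : ℕ) (p : MvPolynomial (Fin 2) ℂ) (x y : ℂ) : ℂ :=
  ∑ m ∈ p.support, conj (p.coeff m) * x ^ (N - m 0) * y ^ (N - m 1)

/-- The polynomial homogenized in its second variable. -/
def homEval (N : ℕ) (p : MvPolynomial (Fin 2) ℂ) (x y₀ y₁ : ℂ) : ℂ :=
  ∑ m ∈ p.support, p.coeff m * x ^ m 0 * (y₀ ^ m 1 * y₁ ^ (N - m 1))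

theorem eval_pair (p : MvPolynomial (Fin 2) ℂ) (x y : ℂ) :
    MvPolynomial.eval ![x, y] p = ∑ m ∈ p.support, p.coeff m * x ^ m 0 * y ^ m 1 := by
  rw [MvPolynomial.eval_eq']
  refine Finset.sum_congr rfl fun m _ => ?_
  rw [Fin.prod_univ_two]
  simp [mul_assoc]

theorem homEval_mul {N : ℕ} {p : MvPolynomial (Fin 2) ℂ} (hp : ExpLE N p) (x y e : ℂ) :
    homEval N p x (y * e) e = e ^ N * MvPolynomial.eval ![x, y] p := by
  rw [eval_pair, homEval, Finset.mul_sum]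
  refine Finset.sum_congr rfl fun m hm => ?_
  rw [mul_pow, ← Nat.add_sub_cancel' (hp m hm 1), pow_add, Nat.add_sub_cancel' (hp m hm 1)]
  ring

theorem pow_mul_conj_homEval {N : ℕ} {p : MvPolynomial (Fin 2) ℂ} (hp : ExpLE N p) {x : ℂ}
    (hx : x ≠ 0) (y e : ℂ) :
    x ^ N * conj (homEval N p (conj x)⁻¹ (conj (y * e)) (conj (y * (y * e)))) =
      (y * e) ^ N * revEval N p x y := by
  rw [revEval, homEval, map_sum, Finset.mul_sum, Finset.mul_sum]
  refine Finset.sum_congr rfl fun m hm => ?_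
  simp only [map_mul, map_pow, map_inv₀, conj_conj]
  have e1 : x ^ N * x⁻¹ ^ m 0 = x ^ (N - m 0) := by
    rw [inv_pow, ← div_eq_mul_inv, pow_sub₀ _ hx (hp m hm 0), div_eq_mul_inv]
  have e2 : (y * e) ^ m 1 * (y * (y * e)) ^ (N - m 1) = (y * e) ^ N * y ^ (N - m 1) := by
    rw [mul_pow y (y * e), mul_left_comm, ← pow_add, Nat.add_sub_cancel' (hp m hm 1)]
    ring
  calc x ^ N * (conj (p.coeff m) * x⁻¹ ^ m 0 * ((y * e) ^ m 1 * ((y * (y * e)) ^ (N - m 1))))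
      = conj (p.coeff m) * (x ^ N * x⁻¹ ^ m 0) *
          ((y * e) ^ m 1 * (y * (y * e)) ^ (N - m 1)) := by ring
    _ = _ := by rw [e1, e2]; ring

theorem differentiableOn_homEval {U : Set ℂ} (N : ℕ) (p : MvPolynomial (Fin 2) ℂ)
    {x y₀ y₁ : ℂ → ℂ} (hx : DifferentiableOn ℂ x U) (h₀ : DifferentiableOn ℂ y₀ U)
    (h₁ : DifferentiableOn ℂ y₁ U) :
    DifferentiableOn ℂ (fun z => homEval N p (x z) (y₀ z) (y₁ z)) U := by
  unfold homEval
  fun_prop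

theorem differentiableOn_revEval {U : Set ℂ} (N : ℕ) (p : MvPolynomial (Fin 2) ℂ)
    {x y : ℂ → ℂ} (hx : DifferentiableOn ℂ x U) (hy : DifferentiableOn ℂ y U) :
    DifferentiableOn ℂ (fun z => revEval N p (x z) (y z)) U := by
  unfold revEval
  fun_prop

theorem differentiableOn_eval_pair {U : Set ℂ} (p : MvPolynomial (Fin 2) ℂ)
    {x y : ℂ → ℂ} (hx : DifferentiableOn ℂ x U) (hy : DifferentiableOn ℂ y U) :
    DifferentiableOn ℂ (fun z => MvPolynomial.eval ![x z, y z] p) U := by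
  simp only [eval_pair]
  fun_prop

theorem inv_conj_eq_smul {ω : ℂ} : (conj ω)⁻¹ = ((‖ω‖ ^ 2)⁻¹ : ℝ) • ω := by
  rw [inv_def, conj_conj, normSq_conj, normSq_eq_norm_sq, real_smul, mul_comm]

/-- A function holomorphic across the unit circle varies slowly under reflection. -/
theorem exists_norm_sub_reflection_le {t : ℝ} (ht0 : 0 < t) (ht1 : t < 1) {H : ℂ → ℂ}
    (hH : DifferentiableOn ℂ H (ann t t⁻¹)) :
    ∃ C, ∀ ω ∈ ann ((t + 1) / 2) 1, ‖H ω‖ ≤ C ∧ ‖H ω - H (conj ω)⁻¹‖ ≤ C * (1 - ‖ω‖ ^ 2) := by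
  set τ := (t + 1) / 2 with hτ
  have hτ0 : 0 < τ := by positivity
  have hO := isOpen_ann t t⁻¹
  have htτ : t < τ := by linarith
  set K : Set ℂ := {ω | τ ≤ ‖ω‖ ^ 2 ∧ ‖ω‖ ^ 2 ≤ τ⁻¹} with hK
  have hKU : K ⊆ ann t t⁻¹ := fun ω hω =>
    ⟨htτ.trans_le hω.1, hω.2.trans_lt ((inv_lt_inv₀ hτ0 ht0).2 htτ)⟩
  have hKc : IsCompact K := by
    refine Metric.isCompact_of_isClosed_isBounded ?_ ?_
    · have hc : Continuous fun ω : ℂ => ‖ω‖ ^ 2 := by fun_prop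
      exact (isClosed_le continuous_const hc).inter (isClosed_le hc continuous_const)
    · refine (isBounded_iff_forall_norm_le).2 ⟨τ⁻¹ + 1, fun ω hω => ?_⟩
      have := hω.2
      nlinarith [norm_nonneg ω, sq_nonneg (‖ω‖ - 1)]
  obtain ⟨M₀, hM₀⟩ := hKc.exists_bound_of_continuousOn (hH.continuousOn.mono hKU)
  obtain ⟨M₁, hM₁⟩ := hKc.exists_bound_of_continuousOn ((hH.deriv hO).continuousOn.mono hKU)
  have hτ1 : τ < 1 := by linarith
  have hτi : 1 ≤ τ⁻¹ := (one_le_inv₀ hτ0).2 hτ1.le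
  refine ⟨max M₀ (max M₁ 0 * τ⁻¹), fun ω hω => ?_⟩
  have hω1 := hω.1
  have hω2 := hω.2
  have hωK : ω ∈ K := ⟨hω1.le, hω2.le.trans hτi⟩
  refine ⟨(hM₀ ω hωK).trans (le_max_left _ _), ?_⟩
  have hn0 : 0 < ‖ω‖ ^ 2 := hτ0.trans hω1
  have hl : 1 ≤ (‖ω‖ ^ 2)⁻¹ := (one_le_inv₀ hn0).2 hω2.le
  have hseg : segment ℝ (conj ω)⁻¹ ω ⊆ K := by
    rintro x ⟨a, b, ha, hb, hab, rfl⟩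
    rw [inv_conj_eq_smul, smul_smul, ← add_smul]
    set l := (‖ω‖ ^ 2)⁻¹ with hldef
    have h1 : 1 ≤ a * l + b := by nlinarith
    have h2 : a * l + b ≤ l := by nlinarith
    have h3 : l * ‖ω‖ ^ 2 = 1 := inv_mul_cancel₀ hn0.ne'
    have h4 : ‖(a * l + b) • ω‖ ^ 2 = (a * l + b) ^ 2 * ‖ω‖ ^ 2 := by
      rw [norm_smul, mul_pow, Real.norm_eq_abs, sq_abs]
    rw [hK, mem_ofPred_eq, h4]
    constructor
    · nlinarith
    · have h5 : (a * l + b) ^ 2 ≤ l ^ 2 := pow_le_pow_left₀ (by linarith) h2 2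
      have h6 : l ≤ τ⁻¹ := (inv_le_inv₀ hn0 hτ0).2 hω1.le
      calc (a * l + b) ^ 2 * ‖ω‖ ^ 2 ≤ l ^ 2 * ‖ω‖ ^ 2 := by gcongr
        _ = l * (l * ‖ω‖ ^ 2) := by ring
        _ ≤ _ := by rw [h3, mul_one]; exact h6
  have h7 := (convex_segment (𝕜 := ℝ) (conj ω)⁻¹ ω).norm_image_sub_le_of_norm_deriv_le
    (f := H) (C := M₁)
    (fun x hx => hH.differentiableAt (hO.mem_nhds (hKU (hseg hx))))
    (fun x hx => hM₁ x (hseg hx)) (left_mem_segment ℝ _ _) (right_mem_segment ℝ _ _)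
  refine h7.trans ?_
  have h8 : ‖ω - (conj ω)⁻¹‖ ≤ τ⁻¹ * (1 - ‖ω‖ ^ 2) := by
    rw [inv_conj_eq_smul]
    nth_rewrite 1 [← one_smul ℝ ω]
    rw [← sub_smul, norm_smul, Real.norm_eq_abs, abs_of_nonpos (by linarith)]
    have h9 : -(1 - (‖ω‖ ^ 2)⁻¹) = (‖ω‖ ^ 2)⁻¹ * (1 - ‖ω‖ ^ 2) := by
      rw [mul_sub, inv_mul_cancel₀ hn0.ne']
      ring
    rw [h9]
    have h10 : (‖ω‖ ^ 2)⁻¹ ≤ τ⁻¹ := (inv_le_inv₀ hn0 hτ0).2 hω1.le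
    have h11 : ‖ω‖ ≤ 1 := by nlinarith [norm_nonneg ω]
    calc (‖ω‖ ^ 2)⁻¹ * (1 - ‖ω‖ ^ 2) * ‖ω‖ ≤ (‖ω‖ ^ 2)⁻¹ * (1 - ‖ω‖ ^ 2) * 1 := by
          refine mul_le_mul_of_nonneg_left h11 (mul_nonneg (by positivity) (by linarith))
      _ ≤ _ := by
          rw [mul_one]
          exact mul_le_mul_of_nonneg_right h10 (by linarith)
  have h12 : 0 ≤ 1 - ‖ω‖ ^ 2 := by linarith
  calc M₁ * ‖ω - (conj ω)⁻¹‖ ≤ max M₁ 0 * (τ⁻¹ * (1 - ‖ω‖ ^ 2)) := by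
        refine mul_le_mul (le_max_left _ _) h8 (norm_nonneg _) (le_max_right _ _)
    _ = max M₁ 0 * τ⁻¹ * (1 - ‖ω‖ ^ 2) := by ring
    _ ≤ _ := mul_le_mul_of_nonneg_right (le_max_right _ _) h12

section
variable {Ω W : Set ℂ} {f g ζ ψ : ℂ → ℂ} {ρ : ℝ} {k : ℕ} {c b : ℂ}

theorem AnnulusChart.deriv_mul_deriv (hC : AnnulusChart W f ρ k c ζ ψ) {ω : ℂ}
    (hω : ω ∈ ann ρ 1) : deriv ζ (ψ ω) * deriv ψ ω = 1 := by
  have hψW := hC.mem ω hω.1 hω.2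
  have h1 := (hC.differentiableOn.differentiableAt (hC.isOpen.mem_nhds hψW)).hasDerivAt.comp ω
    (hC.differentiableAt ω hω.1 hω.2).hasDerivAt
  refine h1.unique ((hasDerivAt_id ω).congr_of_eventuallyEq ?_)
  filter_upwards [(isOpen_ann ρ 1).mem_nhds hω] with x hx
  exact hC.right_inv x hx.1 hx.2

theorem AnnulusChart.deriv_eq (hC : AnnulusChart W f ρ k c ζ ψ) {z : ℂ} (hz : z ∈ W) :
    deriv f z = c * (k * ζ z ^ (k - 1) * deriv ζ z) := by
  have h1 := ((hC.differentiableOn.differentiableAt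
    (hC.isOpen.mem_nhds hz)).hasDerivAt.fun_pow k).const_mul c
  refine (h1.congr_of_eventuallyEq ?_).deriv
  filter_upwards [hC.isOpen.mem_nhds hz] with w hw using hC.eq_pow w hw

theorem AnnulusChart.comp_eq (hC : AnnulusChart W f ρ k c ζ ψ) {ω : ℂ}
    (hω : ω ∈ ann ρ 1) : f (ψ ω) = c * ω ^ k := by
  rw [hC.eq_pow _ (hC.mem ω hω.1 hω.2), hC.right_inv ω hω.1 hω.2]

theorem AnnulusChart.deriv_mul_eq (hC : AnnulusChart W f ρ k c ζ ψ) {ω : ℂ}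
    (hω : ω ∈ ann ρ 1) : deriv f (ψ ω) * (ω * deriv ψ ω / k) = f (ψ ω) := by
  have hk : (k : ℂ) ≠ 0 := Nat.cast_ne_zero.2 hC.k_pos.ne'
  have h1 := hC.deriv_mul_deriv hω
  rw [hC.deriv_eq (hC.mem ω hω.1 hω.2), hC.right_inv ω hω.1 hω.2, hC.comp_eq hω]
  have h2 : ω ^ k = ω ^ (k - 1) * ω := by rw [← pow_succ, Nat.sub_add_cancel hC.k_pos]
  rw [h2]
  calc c * (k * ω ^ (k - 1) * deriv ζ (ψ ω)) * (ω * deriv ψ ω / k)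
      = c * (ω ^ (k - 1) * ω) * (deriv ζ (ψ ω) * deriv ψ ω) * (k / k) := by ring
    _ = _ := by rw [h1, div_self hk, mul_one, mul_one]

theorem AnnulusChart.comp_ne_zero (hC : AnnulusChart W f ρ k c ζ ψ) {z : ℂ} (hz : z ∈ W) :
    f z ≠ 0 ∧ deriv f z ≠ 0 := by
  have hω : ζ z ∈ ann ρ 1 := hC.mapsTo z hz
  have h0 : f z ≠ 0 := by
    rw [hC.eq_pow z hz]
    refine mul_ne_zero (fun h => ?_) (pow_ne_zero _ (ne_zero_of_mem_ann hC.ρ_pos.le hω))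
    have := hC.norm_c
    rw [h, norm_zero] at this
    exact zero_ne_one this
  refine ⟨h0, fun h => h0 ?_⟩
  have h1 := hC.deriv_mul_eq hω
  rw [hC.left_inv z hz, h, zero_mul] at h1
  exact h1.symm

theorem AnnulusChart.integrableOn_deriv (hC : AnnulusChart W f ρ k c ζ ψ)
    (hA : volume W < ⊤) : IntegrableOn (fun ω => ‖ω * deriv ψ ω / k‖ ^ 2) (ann ρ 1) := by
  have hd : DifferentiableOn ℂ ψ (ann ρ 1) := fun ω hω =>
    (hC.differentiableAt ω hω.1 hω.2).differentiableWithinAt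
  have hd' : ContinuousOn (deriv ψ) (ann ρ 1) := (hd.deriv (isOpen_ann ρ 1)).continuousOn
  have hms := (isOpen_ann ρ 1).measurableSet
  have h1 : IntegrableOn (fun ω => ‖deriv ψ ω‖ ^ 2) (ann ρ 1) := by
    refine ⟨(hd'.norm.pow 2).aestronglyMeasurable hms, ?_⟩
    have h2 := lintegral_abs_det_fderiv_eq_addHaar_image volume hms
      (fun ω hω => ((hC.differentiableAt ω hω.1
        hω.2).hasDerivAt.hasFDerivAt.restrictScalars ℝ).hasFDerivWithinAt) hC.injOn
    rw [hC.image_eq] at h2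
    rw [hasFiniteIntegral_iff_ofReal (ae_of_all _ fun ω => by positivity)]
    refine lt_of_eq_of_lt ?_ hA
    rw [← h2]
    refine lintegral_congr fun ω => ?_
    rw [abs_det_restrictScalars_toSpanSingleton]
  refine h1.mono' (((continuousOn_id.mul hd').div_const _).norm.pow 2
    |>.aestronglyMeasurable hms) ?_
  refine (ae_restrict_iff' hms).2 (ae_of_all _ fun ω hω => ?_)
  have hk : (1 : ℝ) ≤ k := by exact_mod_cast hC.k_pos
  have hω1 : ‖ω‖ ≤ 1 := by nlinarith [hω.2, norm_nonneg ω]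
  rw [Real.norm_of_nonneg (by positivity)]
  refine pow_le_pow_left₀ (norm_nonneg _) ?_ 2
  rw [norm_div, norm_mul, norm_natCast, div_le_iff₀ (by positivity)]
  nlinarith [norm_nonneg (deriv ψ ω)]

theorem AnnulusChart.not_eventually_comp_eq_zero (hC : AnnulusChart W f ρ k c ζ ψ)
    (hΩ : IsOpen Ω) (hΩc : IsPreconnected Ω) (hWΩ : W ⊆ Ω) {u : ℂ → ℂ}
    (hu : DifferentiableOn ℂ u Ω) {q : ℂ} (hq : q ∈ Ω) (huq : u q ≠ 0) {ω : ℂ}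
    (hω : ω ∈ ann ρ 1) : ¬ ∀ᶠ w in 𝓝 ω, u (ψ w) = 0 := by
  intro h
  have hψW := hC.mem ω hω.1 hω.2
  refine not_eventually_eq_zero hΩ hΩc hu hq huq (hWΩ hψW) ?_
  have h1 : Tendsto ζ (𝓝 (ψ ω)) (𝓝 ω) := by
    have := (hC.differentiableOn.differentiableAt (hC.isOpen.mem_nhds hψW)).continuousAt.tendsto
    rwa [hC.right_inv ω hω.1 hω.2] at this
  filter_upwards [h1.eventually h, hC.isOpen.mem_nhds hψW] with z h2 h3
  rwa [hC.left_inv z h3] at h2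

theorem IsAhlforsMap.exists_ne_zero (hg : IsAhlforsMap Ω b g) (hΩ : IsOpen Ω) (hb : b ∈ Ω) :
    ∃ q ∈ Ω, g q ≠ 0 := by
  by_contra! h
  have h1 : g =ᶠ[𝓝 b] fun _ => 0 := by
    filter_upwards [hΩ.mem_nhds hb] with z hz using h z hz
  have h2 := hg.2.2.2.1
  rw [h1.deriv_eq] at h2
  simp at h2

theorem IsAhlforsMap.exists_chart_estimate (hg : IsAhlforsMap Ω b g) (hb : b ∈ Ω)
    (hC : AnnulusChart W f ρ k c ζ ψ) (hΩ : IsOpen Ω) (hΩc : IsPreconnected Ω) (hWΩ : W ⊆ Ω)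
    (hf : IsProperOntoDisc Ω f) (hA : volume Ω < ⊤) {P Q : MvPolynomial (Fin 2) ℂ} {N : ℕ}
    (hP : ExpLE N P) (hQ : ExpLE N Q)
    (hPQ : ∀ z ∈ Ω,
      deriv f z * MvPolynomial.eval ![f z, g z] Q = MvPolynomial.eval ![f z, g z] P)
    (hP0 : ∃ z ∈ Ω, MvPolynomial.eval ![f z, g z] P ≠ 0) :
    ∃ t C : ℝ, t < 1 ∧ (∃ z ∈ W, revEval N P (f z) (g z) ≠ 0) ∧
      ∀ z ∈ W, t < ‖ζ z‖ ^ 2 → ‖f z / deriv f z‖ ≤ C ∧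
        ‖conj (f z / deriv f z) * f z * revEval N P (f z) (g z) - revEval N Q (f z) (g z)‖ ≤
          C * (1 - ‖f z‖ ^ 2) * ‖revEval N P (f z) (g z)‖ := by
  obtain ⟨s, E₀, E₁, hρs, hs1, hE₀, hE₁, ⟨ω₁, hω₁, hω₁0⟩, hE⟩ :=
    hg.exists_extension hb hC hΩ hΩc hWΩ hf
  have hs0 : 0 < s := hC.ρ_pos.trans hρs
  have hs2 : 1 ≤ s⁻¹ := (one_le_inv₀ hs0).2 hs1.le
  have hsub1 : ann s 1 ⊆ ann s s⁻¹ := ann_mono le_rfl hs2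
  have hsubρ : ann s 1 ⊆ ann ρ 1 := ann_mono hρs.le le_rfl
  set F : ℂ → ℂ := fun ω => c * ω ^ k with hF
  have hFd : Differentiable ℂ F := by fun_prop
  have hc0 : c ≠ 0 := fun h => by simpa [h] using hC.norm_c
  have hF0 : ∀ ω : ℂ, ω ≠ 0 → F ω ≠ 0 := fun ω h => mul_ne_zero hc0 (pow_ne_zero _ h)
  have hFf : ∀ ω ∈ ann s 1, f (ψ ω) = F ω := fun ω hω => hC.comp_eq (hsubρ hω)
  have hFr : ∀ ω, F (conj ω)⁻¹ = (conj (F ω))⁻¹ := fun ω => by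
    have h1 : conj c = c⁻¹ := by rw [inv_def, normSq_eq_norm_sq, hC.norm_c]; simp
    simp only [hF, map_mul, map_pow, mul_inv, inv_pow, h1, inv_inv]
  have hψd : DifferentiableOn ℂ ψ (ann s 1) := fun ω hω =>
    (hC.differentiableAt ω (hsubρ hω).1 hω.2).differentiableWithinAt
  have hψΩ : MapsTo ψ (ann s 1) Ω := fun ω hω => hWΩ (hC.mem ω (hsubρ hω).1 hω.2)
  set Y : ℂ → ℂ := fun ω => ω * deriv ψ ω / k with hY
  have hYd : DifferentiableOn ℂ Y (ann s 1) :=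
    (differentiableOn_id.mul (hψd.deriv (isOpen_ann s 1))).div_const _
  set p₁ : ℂ → ℂ := fun ω => homEval N P (F ω) (E₀ ω) (E₁ ω) with hp₁
  set q₁ : ℂ → ℂ := fun ω => homEval N Q (F ω) (E₀ ω) (E₁ ω) with hq₁
  have hp₁d : DifferentiableOn ℂ p₁ (ann s s⁻¹) :=
    differentiableOn_homEval N P hFd.differentiableOn hE₀ hE₁
  have hq₁d : DifferentiableOn ℂ q₁ (ann s s⁻¹) :=
    differentiableOn_homEval N Q hFd.differentiableOn hE₀ hE₁
  have hin : ∀ R : MvPolynomial (Fin 2) ℂ, ExpLE N R → ∀ ω ∈ ann s 1,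
      homEval N R (F ω) (E₀ ω) (E₁ ω) =
        E₁ ω ^ N * MvPolynomial.eval ![f (ψ ω), g (ψ ω)] R := fun R hR ω hω => by
    rw [(hE ω hω).1, homEval_mul hR, hFf ω hω]
  have hout : ∀ R : MvPolynomial (Fin 2) ℂ, ExpLE N R → ∀ ω ∈ ann s 1,
      F ω ^ N * conj (homEval N R (F (conj ω)⁻¹) (E₀ (conj ω)⁻¹) (E₁ (conj ω)⁻¹)) =
        (g (ψ ω) * E₁ ω) ^ N * revEval N R (f (ψ ω)) (g (ψ ω)) := fun R hR ω hω => by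
    obtain ⟨h1, h2, h3⟩ := hE ω hω
    rw [hFr, h2, h3, h1, pow_mul_conj_homEval hR (hF0 ω (ne_zero_of_mem_ann hs0.le hω)),
      hFf ω hω]
  have hYN : ∀ ω ∈ ann s 1, p₁ ω * Y ω = F ω * q₁ ω := fun ω hω => by
    rw [hp₁, hq₁]
    beta_reduce
    rw [hin P hP ω hω, hin Q hQ ω hω, ← hPQ _ (hψΩ hω), ← hFf ω hω,
      ← hC.deriv_mul_eq (hsubρ hω), hY]
    ring
  have hE₁ne : ∀ p ∈ ann s s⁻¹, ∀ᶠ z in 𝓝[≠] p, E₁ z ≠ 0 := fun p hp =>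
    (hE₁.analyticAt ((isOpen_ann _ _).mem_nhds hp)).eventually_eq_zero_or_eventually_ne_zero
      |>.resolve_left (not_eventually_eq_zero (isOpen_ann _ _)
        (isPreconnected_ann hs0 (by positivity)) hE₁ (hsub1 hω₁) hω₁0 hp)
  have hcomp : ∀ u : ℂ → ℂ, DifferentiableOn ℂ u Ω → (∃ q ∈ Ω, u q ≠ 0) → ∀ p ∈ ann s 1,
      ∀ᶠ z in 𝓝[≠] p, u (ψ z) ≠ 0 := fun u hu ⟨q, hq, huq⟩ p hp => by
    refine AnalyticAt.eventually_eq_zero_or_eventually_ne_zero (f := fun z => u (ψ z))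
      ((hu.comp hψd hψΩ).analyticAt ((isOpen_ann _ _).mem_nhds hp)) |>.resolve_left ?_
    exact hC.not_eventually_comp_eq_zero hΩ hΩc hWΩ hu hq huq (hsubρ hp)
  obtain ⟨ω₂, hω₂, hω₂0⟩ : ∃ ω ∈ ann s 1, p₁ ω ≠ 0 := by
    obtain ⟨w, h1, h2, h3⟩ := ((hE₁ne ω₁ (hsub1 hω₁)).and ((hcomp _
      (differentiableOn_eval_pair P hf.1 hg.1) hP0 ω₁ hω₁).and
      (mem_nhdsWithin_of_mem_nhds ((isOpen_ann s 1).mem_nhds hω₁)))).exists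
    refine ⟨w, h3, ?_⟩
    rw [hp₁]
    beta_reduce
    rw [hin P hP w h3]
    exact mul_ne_zero (pow_ne_zero _ h1) h2
  obtain ⟨t, hst, ht1, H, hH, hHY, hHe⟩ := exists_quotient_across hs0 hs1
    (hFd.differentiableOn.mul hq₁d) hp₁d hYd hYN (hsub1 hω₂) hω₂0
    ((hC.integrableOn_deriv ((measure_mono hWΩ).trans_lt hA)).mono_set hsubρ)
  have ht0 : 0 < t := hs0.trans hst
  have hsubt : ann t 1 ⊆ ann s 1 := ann_mono hst.le le_rfl
  have hti : t⁻¹ ≤ s⁻¹ := (inv_le_inv₀ ht0 hs0).2 hst.le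
  have ht2 : 1 ≤ t⁻¹ := (one_le_inv₀ ht0).2 ht1.le
  have hrefl : ∀ ω ∈ ann t 1, (conj ω)⁻¹ ∈ ann t t⁻¹ := fun ω hω => by
    have := inv_conj_mem_ann ht0 one_pos hω
    rw [inv_one] at this
    exact ann_mono ht1.le le_rfl this
  have hkey : ∀ ω ∈ ann t 1, revEval N Q (f (ψ ω)) (g (ψ ω)) =
      F ω * revEval N P (f (ψ ω)) (g (ψ ω)) * conj (H (conj ω)⁻¹) := by
    have hid : ∀ ω ∈ ann t 1, (g (ψ ω) * E₁ ω) ^ N * revEval N Q (f (ψ ω)) (g (ψ ω)) =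
        (g (ψ ω) * E₁ ω) ^ N *
          (F ω * revEval N P (f (ψ ω)) (g (ψ ω)) * conj (H (conj ω)⁻¹)) := fun ω hω => by
      have h1 := hHe _ (hrefl ω hω)
      have h2 := hF0 ω (ne_zero_of_mem_ann ht0.le hω)
      have h3 : conj (F (conj ω)⁻¹ * q₁ (conj ω)⁻¹) =
        conj (p₁ (conj ω)⁻¹ * H (conj ω)⁻¹) := congrArg conj h1
      rw [hFr, map_mul _ (conj (F ω))⁻¹, map_mul _ (p₁ _), map_inv₀, conj_conj] at h3
      have h4 := hout P hP ω (hsubt hω)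
      have h5 := hout Q hQ ω (hsubt hω)
      have h6 : conj (q₁ (conj ω)⁻¹) = F ω * (conj (p₁ (conj ω)⁻¹) * conj (H (conj ω)⁻¹)) := by
        rw [← h3, mul_inv_cancel_left₀ h2]
      calc _ = F ω ^ N * conj (q₁ (conj ω)⁻¹) := h5.symm
        _ = F ω * conj (H (conj ω)⁻¹) * (F ω ^ N * conj (p₁ (conj ω)⁻¹)) := by rw [h6]; ring
        _ = F ω * conj (H (conj ω)⁻¹) *
            ((g (ψ ω) * E₁ ω) ^ N * revEval N P (f (ψ ω)) (g (ψ ω))) := by rw [← h4]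
        _ = _ := by ring
    intro ω hω
    have hω' := hsubt hω
    have hψω := (hψd.differentiableAt ((isOpen_ann s 1).mem_nhds hω'))
    have hnhds := hΩ.mem_nhds (hψΩ hω')
    have hrev : ∀ R, ContinuousAt (fun ω => revEval N R (f (ψ ω)) (g (ψ ω))) ω := fun R =>
      ContinuousAt.comp (g := fun z => revEval N R (f z) (g z))
        ((differentiableOn_revEval N R hf.1 hg.1).differentiableAt hnhds).continuousAt
        hψω.continuousAt
    have hA1 : AnalyticAt ℂ (fun ω => (g (ψ ω) * E₁ ω) ^ N) ω := by
      refine AnalyticAt.fun_pow (AnalyticAt.fun_mul ?_ ?_) N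
      · exact (hg.1.comp hψd hψΩ).analyticAt ((isOpen_ann _ _).mem_nhds hω')
      · exact hE₁.analyticAt ((isOpen_ann _ _).mem_nhds (hsub1 hω'))
    refine eq_of_eventually_mul_eq (D := fun ω => (g (ψ ω) * E₁ ω) ^ N)
      (u := fun ω => revEval N Q (f (ψ ω)) (g (ψ ω)))
      (v := fun ω => F ω * revEval N P (f (ψ ω)) (g (ψ ω)) * conj (H (conj ω)⁻¹))
      hA1 (fun hev => ?_) (hrev Q) ?_ ?_
    · obtain ⟨w, h1, h2, h3⟩ := ((hE₁ne ω (hsub1 hω')).and ((hcomp g hg.1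
        (hg.exists_ne_zero hΩ hb) ω hω').and (hev.filter_mono nhdsWithin_le_nhds))).exists
      exact pow_ne_zero N (mul_ne_zero h2 h1) h3
    · refine (hFd.continuous.continuousAt.mul (hrev P)).mul ?_
      refine ContinuousAt.comp continuous_conj.continuousAt ?_
      refine ContinuousAt.comp (g := H)
        ((hH.differentiableAt ((isOpen_ann _ _).mem_nhds (hrefl ω hω))).continuousAt) ?_
      exact continuous_conj.continuousAt.inv₀
        ((map_ne_zero _).2 (ne_zero_of_mem_ann ht0.le hω))
    · filter_upwards [(isOpen_ann t 1).mem_nhds hω] with w hw using hid w hw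
  obtain ⟨C, hCH⟩ := exists_norm_sub_reflection_le ht0 ht1 hH
  refine ⟨(t + 1) / 2, C, by linarith, ?_, fun z hz hzt => ?_⟩
  · by_contra! hzero
    refine not_eventually_eq_zero (isOpen_ann s s⁻¹) (isPreconnected_ann hs0 (by positivity))
      hp₁d (hsub1 hω₂) hω₂0 (p := (conj ω₁)⁻¹) ?_ ?_
    · have := inv_conj_mem_ann hs0 one_pos hω₁
      rw [inv_one] at this
      exact ann_mono hs1.le le_rfl this
    · have h1 : ann 1 s⁻¹ ∈ 𝓝 (conj ω₁)⁻¹ := by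
        have := inv_conj_mem_ann hs0 one_pos hω₁
        rw [inv_one] at this
        exact (isOpen_ann _ _).mem_nhds this
      filter_upwards [h1] with w hw
      have h2 := inv_conj_mem_ann one_pos (inv_pos.2 hs0) hw
      rw [inv_inv, inv_one] at h2
      have h3 := hout P hP _ h2
      rw [hzero _ (hC.mem _ (hsubρ h2).1 h2.2), mul_zero, map_inv₀, conj_conj, inv_inv] at h3
      have h4 := hF0 _ (ne_zero_of_mem_ann hs0.le h2)
      exact (map_eq_zero _).1 ((mul_eq_zero.1 h3).resolve_left (pow_ne_zero N h4))
  · set ω := ζ z with hω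
    have hz1 := hC.mapsTo z hz
    have hωt : ω ∈ ann ((t + 1) / 2) 1 := ⟨hzt, hz1.2⟩
    have hωt' : ω ∈ ann t 1 := ⟨by linarith, hz1.2⟩
    have hψz : ψ ω = z := hC.left_inv z hz
    obtain ⟨hfz, hfz'⟩ := hC.comp_ne_zero hz
    have hYz : f z / deriv f z = H ω := by
      rw [hHY ω hωt', div_eq_iff hfz', mul_comm, ← hψz]
      exact (hC.deriv_mul_eq hz1).symm
    obtain ⟨h1, h2⟩ := hCH ω hωt
    have hk := hkey ω hωt'
    have hFz := hFf ω (hsubt hωt')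
    rw [hψz] at hk hFz
    rw [hYz]
    refine ⟨h1, ?_⟩
    have h3 : conj (H ω) * f z * revEval N P (f z) (g z) - revEval N Q (f z) (g z) =
        conj (H ω - H (conj ω)⁻¹) * (f z * revEval N P (f z) (g z)) := by
      rw [hk, ← hFz, map_sub]
      ring
    have hfn : ‖f z‖ ^ 2 ≤ ‖ω‖ ^ 2 := by
      rw [hC.norm_sq_eq hz]
      exact pow_le_of_le_one (by positivity) hz1.2.le hC.k_pos.ne'
    have hf1 : ‖f z‖ ≤ 1 := by nlinarith [norm_nonneg (f z), hz1.2]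
    have hC0 : 0 ≤ C := (norm_nonneg _).trans h1
    rw [h3, norm_mul, norm_mul, RCLike.norm_conj]
    calc ‖H ω - H (conj ω)⁻¹‖ * (‖f z‖ * ‖revEval N P (f z) (g z)‖)
        ≤ (C * (1 - ‖f z‖ ^ 2)) * (1 * ‖revEval N P (f z) (g z)‖) := by
          refine mul_le_mul (h2.trans ?_) ?_ (by positivity) ?_
          · exact mul_le_mul_of_nonneg_left (by linarith) hC0
          · exact mul_le_mul_of_nonneg_right hf1 (norm_nonneg _)
          · exact mul_nonneg hC0 (by linarith [hz1.2])
      _ = _ := by ring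
end

theorem IsProperOntoDisc.not_eventually_deriv_eq_zero {Ω : Set ℂ} {f : ℂ → ℂ}
    (hΩ : IsFinConnDomain Ω) (hf : IsProperOntoDisc Ω f) {z : ℂ} (hz : z ∈ Ω) :
    ¬ ∀ᶠ w in 𝓝 z, deriv f w = 0 := fun h => by
  obtain ⟨δ, hδ, hball⟩ := Metric.eventually_nhds_iff_ball.1 (h.and (hΩ.1.mem_nhds hz))
  refine hf.not_eventually_const hΩ hz ?_
  filter_upwards [ball_mem_nhds z hδ] with w hw
  exact isOpen_ball.is_const_of_deriv_eq_zero (convex_ball z δ).isPreconnected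
    (hf.1.mono fun x hx => (hball x hx).2) (fun x hx => (hball x hx).1) hw (mem_ball_self hδ)

theorem exists_boundary_estimate {Ω : Set ℂ} (hΩ : IsFinConnDomain Ω) (hA : volume Ω < ⊤)
    {f : ℂ → ℂ} (hf : IsProperOntoDisc Ω f) {b : ℂ} (hb : b ∈ Ω) {g : ℂ → ℂ}
    (hg : IsAhlforsMap Ω b g) {P Q : MvPolynomial (Fin 2) ℂ}
    (hQ : ∃ z ∈ Ω, MvPolynomial.eval ![f z, g z] Q ≠ 0)
    (hPQ : ∀ z ∈ Ω,
      deriv f z * MvPolynomial.eval ![f z, g z] Q = MvPolynomial.eval ![f z, g z] P) :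
    ∃ (r C : ℝ) (p q : ℂ → ℂ), 0 ≤ r ∧ r < 1 ∧ DifferentiableOn ℂ p Ω ∧ DifferentiableOn ℂ q Ω ∧
      (∃ z ∈ Ω, p z ≠ 0) ∧ ∀ z ∈ Ω, r < ‖f z‖ ^ 2 → f z ≠ 0 ∧ deriv f z ≠ 0 ∧
        ‖f z / deriv f z‖ ≤ C ∧
        ‖conj (f z / deriv f z) * f z * p z - q z‖ ≤ C * (1 - ‖f z‖ ^ 2) * ‖p z‖ := by
  obtain ⟨hΩo, hΩc, -, -⟩ := id hΩ
  obtain ⟨N, hP, hQN⟩ := exists_expLE P Q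
  have hP0 : ∃ z ∈ Ω, MvPolynomial.eval ![f z, g z] P ≠ 0 := by
    by_contra! h
    obtain ⟨z, hz, hQz⟩ := hQ
    refine hf.not_eventually_deriv_eq_zero hΩ hz ?_
    have hc := ((differentiableOn_eval_pair Q hf.1 hg.1).differentiableAt
      (hΩo.mem_nhds hz)).continuousAt.eventually_ne hQz
    filter_upwards [hc, hΩo.mem_nhds hz] with w h1 h2
    exact (mul_eq_zero.1 ((hPQ w h2).trans (h w h2))).resolve_right h1
  obtain ⟨r, hr, ι, W, ρ, k, c, ζ, ψ, hι, hC, hcov⟩ := exists_collar hΩ hf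
  choose t C ht hne hest using fun i => hg.exists_chart_estimate hb (hC i).2 hΩo
    hΩc.isPreconnected (hC i).1 hf hA hP hQN hPQ hP0
  have hev : ∀ᶠ x : ℝ in 𝓝[<] 1, ∀ i, t i < x := eventually_all.2 fun i =>
    (lt_mem_nhds (ht i)).filter_mono nhdsWithin_le_nhds
  obtain ⟨r', ⟨h1, h2, h3⟩, h4⟩ := ((hev.and (((lt_mem_nhds hr).filter_mono
    nhdsWithin_le_nhds).and ((lt_mem_nhds zero_lt_one).filter_mono
    nhdsWithin_le_nhds))).and self_mem_nhdsWithin).exists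
  have hr' : r' < 1 := h4
  obtain ⟨C', hC'⟩ := (Set.finite_range C).bddAbove
  refine ⟨r', C', fun z => revEval N P (f z) (g z), fun z => revEval N Q (f z) (g z), h3.le, hr',
    differentiableOn_revEval N P hf.1 hg.1, differentiableOn_revEval N Q hf.1 hg.1, ?_,
    fun z hz hzr => ?_⟩
  · obtain ⟨z, hz, hzf⟩ : ∃ z ∈ Ω, f z = (Real.sqrt ((r' + 1) / 2) : ℂ) := by
      have : (Real.sqrt ((r' + 1) / 2) : ℂ) ∈ f '' Ω := by
        rw [hf.2.1, mem_ball_zero_iff, norm_real, Real.norm_of_nonneg (Real.sqrt_nonneg _),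
          Real.sqrt_lt' one_pos]
        linarith
      exact this
    have hn : ‖f z‖ ^ 2 = (r' + 1) / 2 := by
      rw [hzf, norm_real, Real.norm_of_nonneg (Real.sqrt_nonneg _), Real.sq_sqrt (by linarith)]
    obtain ⟨i, -⟩ := hcov z hz (by linarith)
    obtain ⟨w, hw, hw0⟩ := hne i
    exact ⟨w, (hC i).1 hw, hw0⟩
  · obtain ⟨i, hi⟩ := hcov z hz (h2.trans hzr)
    obtain ⟨hf0, hf1⟩ := (hC i).2.comp_ne_zero hi
    have hζ : ‖f z‖ ^ 2 ≤ ‖ζ i z‖ ^ 2 := by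
      rw [(hC i).2.norm_sq_eq hi]
      exact pow_le_of_le_one (by positivity) ((hC i).2.mapsTo z hi).2.le (hC i).2.k_pos.ne'
    obtain ⟨h5, h6⟩ := hest i z hi (((h1 i).trans hzr).trans_le hζ)
    have hCi : C i ≤ C' := hC' (mem_range_self i)
    refine ⟨hf0, hf1, h5.trans hCi, h6.trans ?_⟩
    have := (hf.norm_sq_lt hz).le
    gcongr

theorem IntegrableOn.of_eqOn_zero_off_isCompact {U K : Set ℂ} {h : ℂ → ℝ} (hK : IsCompact K)
    (hKU : K ⊆ U) (hh : ContinuousOn h U) (h0 : ∀ z ∈ U \ K, h z = 0) (hU : MeasurableSet U) :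
    IntegrableOn h U :=
  IntegrableOn.of_forall_sdiff_eq_zero ((hh.mono hKU).integrableOn_compact hK) hU h0

theorem dbar_potential {f G : ℂ → ℂ} {a : ℝ → ℝ} {z : ℂ} (ha : ContDiff ℝ 1 a)
    (hf : DifferentiableAt ℂ f z) (hf' : DifferentiableAt ℂ (deriv f) z)
    (hG : DifferentiableAt ℂ G z) :
    dbar (fun w => ((a (‖f w‖ ^ 2) : ℝ) : ℂ) * ((Real.sqrt (1 + ‖G w‖ ^ 2) : ℝ) : ℂ) *
      conj (f w) * deriv f w) z =
    (((deriv a (‖f z‖ ^ 2) * ‖f z‖ ^ 2 + a (‖f z‖ ^ 2)) * Real.sqrt (1 + ‖G z‖ ^ 2) *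
      ‖deriv f z‖ ^ 2 : ℝ) : ℂ) + ((a (‖f z‖ ^ 2) / (2 * Real.sqrt (1 + ‖G z‖ ^ 2)) : ℝ) : ℂ) *
      (G z * conj (deriv G z) * conj (f z) * deriv f z) := by
  have hpos : 0 < 1 + ‖G z‖ ^ 2 := by positivity
  have hsq : HasDerivAt (fun t : ℝ => Real.sqrt (1 + t)) (1 / (2 * Real.sqrt (1 + ‖G z‖ ^ 2)))
      (‖G z‖ ^ 2) := by
    simpa using ((hasDerivAt_id (‖G z‖ ^ 2)).const_add 1).sqrt hpos.ne'
  have hA : DifferentiableAt ℝ a (‖f z‖ ^ 2) := ha.differentiable one_ne_zero _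
  have d1 : DifferentiableAt ℝ (fun w => ((a (‖f w‖ ^ 2) : ℝ) : ℂ)) z := by
    obtain ⟨L, hL, -⟩ := hasFDerivAt_comp_norm_sq hA hf
    exact hL.differentiableAt
  have d2 : DifferentiableAt ℝ (fun w => ((Real.sqrt (1 + ‖G w‖ ^ 2) : ℝ) : ℂ)) z := by
    obtain ⟨L, hL, -⟩ := hasFDerivAt_comp_norm_sq hsq.differentiableAt hG
    exact hL.differentiableAt
  have d3 : DifferentiableAt ℝ (fun w => conj (f w)) z :=
    Complex.conjCLE.differentiable.differentiableAt.comp z (hf.restrictScalars ℝ)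
  have e1 := dbar_comp_norm_sq (a := a) hA hf
  have e2 := dbar_comp_norm_sq (a := fun t => Real.sqrt (1 + t)) hsq.differentiableAt hG
  rw [hsq.deriv] at e2
  rw [dbar_mul_right (u := fun w => ((a (‖f w‖ ^ 2) : ℝ) : ℂ) *
      ((Real.sqrt (1 + ‖G w‖ ^ 2) : ℝ) : ℂ) * conj (f w)) ((d1.fun_mul d2).fun_mul d3) hf',
    dbar_mul (u := fun w => ((a (‖f w‖ ^ 2) : ℝ) : ℂ) * ((Real.sqrt (1 + ‖G w‖ ^ 2) : ℝ) : ℂ))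
      (d1.fun_mul d2) d3, dbar_mul d1 d2, e1, e2, dbar_conj hf]
  have n1 : ((‖f z‖ : ℝ) : ℂ) ^ 2 = f z * conj (f z) := (mul_conj' _).symm
  have n2 : ((‖deriv f z‖ : ℝ) : ℂ) ^ 2 = deriv f z * conj (deriv f z) := (mul_conj' _).symm
  push_cast
  rw [n1, n2]
  ring

theorem IsProperOntoDisc.integrableOn_sqrt_mul {Ω : Set ℂ} {f G : ℂ → ℂ} (hΩ : IsOpen Ω)
    (hf : IsProperOntoDisc Ω f) (hG : DifferentiableOn ℂ G Ω)
    (hfG : IntegrableOn (fun z => ‖deriv f z‖ * ‖deriv G z‖) Ω) :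
    IntegrableOn (fun z => Real.sqrt (1 + ‖G z‖ ^ 2) * ‖deriv f z‖ ^ 2) Ω := by
  set h : ℂ → ℝ := fun z => Real.sqrt (1 + ‖G z‖ ^ 2) * ‖deriv f z‖ ^ 2 with hh
  have hfd := hf.1.deriv hΩ
  have hhc : ContinuousOn h Ω := by
    refine ContinuousOn.mul ?_ (hfd.continuousOn.norm.pow 2)
    exact (continuousOn_const.add (hG.continuousOn.norm.pow 2)).sqrt
  have hh0 : ∀ z, 0 ≤ h z := fun z => by positivity
  set S : ℝ → Set ℂ := fun t => {z | z ∈ Ω ∧ ‖f z‖ ^ 2 ≤ t} with hS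
  have hSc : ∀ t < 1, IsCompact (S t) := fun t ht => hf.isCompact_sublevel ht
  have hSΩ : ∀ t, S t ⊆ Ω := fun t z hz => hz.1
  have hSint : ∀ t < 1, IntegrableOn h (S t) := fun t ht =>
    (hhc.mono (hSΩ t)).integrableOn_compact (hSc t ht)
  have hM : IntegrableOn ((S (3 / 4)).indicator h) Ω := by
    have := (integrable_indicator_iff (hSc (3 / 4) (by norm_num)).measurableSet).2
      (hSint (3 / 4) (by norm_num))
    exact this.integrableOn
  set I := ∫ z in Ω, (4 * (S (3 / 4)).indicator h z + 2 * (‖deriv f z‖ * ‖deriv G z‖)) with hI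
  have hbound : ∀ c < 1, ∫ z in S c, h z ≤ I := by
    intro c hc
    obtain ⟨d, hcd, hd⟩ := exists_between hc
    set a : ℝ → ℝ := fun t => (t - 1) * (1 - stepFn c d t) with ha
    have had : ContDiff ℝ 1 a :=
      (contDiff_id.sub contDiff_const).mul (contDiff_const.sub (stepFn_contDiff (n := 1) c d))
    have hstep := (stepFn_contDiff (n := 1) c d).differentiable one_ne_zero
    have hda : ∀ t, deriv a t = (1 - stepFn c d t) + (t - 1) * (-deriv (stepFn c d) t) :=
      fun t => by
        have h1 : HasDerivAt a (1 * (1 - stepFn c d t) + (t - 1) * (-deriv (stepFn c d) t)) t :=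
          ((hasDerivAt_id t).sub_const 1).mul ((hstep t).hasDerivAt.const_sub 1)
        rw [h1.deriv, one_mul]
    set u : ℂ → ℂ := fun w => ((a (‖f w‖ ^ 2) : ℝ) : ℂ) *
      ((Real.sqrt (1 + ‖G w‖ ^ 2) : ℝ) : ℂ) * conj (f w) * deriv f w with hu
    have huC : ContDiffOn ℝ 1 u Ω := by
      have c1 := contDiffOn_comp_norm_sq had hΩ hf.1
      have c2 : ContDiffOn ℝ 1 (fun w => ((Real.sqrt (1 + ‖G w‖ ^ 2) : ℝ) : ℂ)) Ω := by
        have hGc : ContDiffOn ℝ 1 G Ω := (hG.contDiffOn hΩ).restrict_scalars ℝ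
        exact Complex.ofRealCLM.contDiff.comp_contDiffOn
          ((contDiffOn_const.add (hGc.norm_sq ℝ)).sqrt fun z _ => by positivity)
      have c3 : ContDiffOn ℝ 1 (fun w => conj (f w)) Ω :=
        conjCLE.contDiff.comp_contDiffOn ((hf.1.contDiffOn hΩ).restrict_scalars ℝ)
      have c4 : ContDiffOn ℝ 1 (deriv f) Ω := (hfd.contDiffOn hΩ).restrict_scalars ℝ
      exact ((c1.mul c2).mul c3).mul c4
    have hu0 : ∀ z ∈ Ω \ S d, u z = 0 := fun z hz => by
      have : d ≤ ‖f z‖ ^ 2 := not_lt.1 fun h => hz.2 ⟨hz.1, h.le⟩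
      simp [hu, ha, stepFn_of_ge hcd this]
    have hintegr := integrableOn_dbar hΩ (hSc d hd) (hSΩ d) huC hu0
    have hzero := setIntegral_dbar_eq_zero hΩ (hSc d hd) (hSΩ d) huC hu0
    have hre : ∫ z in Ω, (dbar u z).re = 0 := by
      have h1 := integral_re (𝕜 := ℂ) hintegr
      simp only [RCLike.re_to_complex] at h1
      rw [h1, hzero, zero_re]
    have hpt : ∀ z ∈ Ω, (1 - stepFn c d (‖f z‖ ^ 2)) * h z ≤
        2 * (dbar u z).re + (4 * (S (3 / 4)).indicator h z +
          2 * (‖deriv f z‖ * ‖deriv G z‖)) := by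
      intro z hz
      have hfz := hf.norm_sq_lt hz
      have hnh := hΩ.mem_nhds hz
      rw [hu, dbar_potential had (hf.1.differentiableAt hnh) (hfd.differentiableAt hnh)
        (hG.differentiableAt hnh), add_re, ofReal_re, re_ofReal_mul, hda]
      set t := ‖f z‖ ^ 2 with ht
      set η := 1 - stepFn c d t with hη
      have hη0 : 0 ≤ η := sub_nonneg.2 (stepFn_le_one c d t)
      have hη1 : η ≤ 1 := by linarith [stepFn_nonneg c d t]
      have ht0 : 0 ≤ t := by positivity
      have hs' := deriv_stepFn_nonneg hcd t
      set θ := Real.sqrt (1 + ‖G z‖ ^ 2) with hθ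
      have hθ1 : ‖G z‖ ≤ θ := Real.le_sqrt_of_sq_le (by linarith)
      have hθ0 : 0 < θ := Real.sqrt_pos.2 (by positivity)
      have hat : a t = (t - 1) * η := rfl
      have hE : -(‖deriv f z‖ * ‖deriv G z‖) ≤ a t / (2 * θ) *
          (G z * conj (deriv G z) * conj (f z) * deriv f z).re := by
        refine (abs_le.1 (?_ : |a t / (2 * θ) *
          (G z * conj (deriv G z) * conj (f z) * deriv f z).re| ≤ _)).1
        rw [abs_mul, abs_div, abs_of_pos (by positivity : 0 < 2 * θ)]
        have b1 : |a t| ≤ 1 := by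
          rw [hat, abs_le]
          constructor <;> nlinarith
        have b2 := abs_re_le_norm (G z * conj (deriv G z) * conj (f z) * deriv f z)
        rw [norm_mul, norm_mul, norm_mul, RCLike.norm_conj, RCLike.norm_conj] at b2
        have b3 : ‖f z‖ ≤ 1 := by nlinarith [norm_nonneg (f z)]
        calc |a t| / (2 * θ) * |(G z * conj (deriv G z) * conj (f z) * deriv f z).re|
            ≤ 1 / (2 * θ) * (θ * ‖deriv G z‖ * 1 * ‖deriv f z‖) := by
              gcongr
              exact b2.trans (by gcongr)
          _ = ‖deriv f z‖ * ‖deriv G z‖ / 2 := by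
              field_simp
          _ ≤ _ := by
              have : 0 ≤ ‖deriv f z‖ * ‖deriv G z‖ := by positivity
              linarith
      have hcoef : (2 * t - 1) * η ≤ (η + (t - 1) * -deriv (stepFn c d) t) * t + a t := by
        rw [hat]
        have : 0 ≤ (1 - t) * deriv (stepFn c d) t * t :=
          mul_nonneg (mul_nonneg (by linarith) hs') ht0
        nlinarith
      have hmain : (2 * t - 1) * η * h z ≤
          ((η + (t - 1) * -deriv (stepFn c d) t) * t + a t) * θ * ‖deriv f z‖ ^ 2 := by
        rw [mul_assoc _ θ]
        exact mul_le_mul_of_nonneg_right hcoef (hh0 z)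
      have hind : η * h z ≤ 2 * ((2 * t - 1) * η * h z) + 4 * (S (3 / 4)).indicator h z := by
        by_cases h34 : t ≤ 3 / 4
        · rw [indicator_of_mem (show z ∈ S (3 / 4) from ⟨hz, h34⟩)]
          have x1 : 0 ≤ t * (η * h z) := mul_nonneg ht0 (mul_nonneg hη0 (hh0 z))
          have x2 : η * h z ≤ h z := mul_le_of_le_one_left (hh0 z) hη1
          nlinarith [hh0 z]
        · rw [indicator_of_notMem (fun h => h34 h.2)]
          have x1 : 0 ≤ (t - 3 / 4) * (η * h z) :=
            mul_nonneg (by linarith) (mul_nonneg hη0 (hh0 z))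
          nlinarith
      linarith
    have hηc : ContinuousOn (fun z => (1 - stepFn c d (‖f z‖ ^ 2)) * h z) Ω := by
      refine ContinuousOn.mul (continuousOn_const.sub ?_) hhc
      exact (stepFn_contDiff (n := 1) c d).continuous.comp_continuousOn (hf.1.continuousOn.norm.pow 2)
    have hηint : IntegrableOn (fun z => (1 - stepFn c d (‖f z‖ ^ 2)) * h z) Ω := by
      refine IntegrableOn.of_eqOn_zero_off_isCompact (hSc d hd) (hSΩ d) hηc (fun z hz => ?_)
        hΩ.measurableSet
      have : d ≤ ‖f z‖ ^ 2 := not_lt.1 fun h => hz.2 ⟨hz.1, h.le⟩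
      simp [stepFn_of_ge hcd this]
    have hJ : IntegrableOn (fun z => 4 * (S (3 / 4)).indicator h z +
        2 * (‖deriv f z‖ * ‖deriv G z‖)) Ω := (hM.const_mul 4).add (hfG.const_mul 2)
    have hR : IntegrableOn (fun z => 2 * (dbar u z).re) Ω := hintegr.re.const_mul 2
    calc ∫ z in S c, h z = ∫ z in S c, (1 - stepFn c d (‖f z‖ ^ 2)) * h z :=
          setIntegral_congr_fun (hSc c hc).measurableSet fun z hz => by
            rw [stepFn_of_le hcd hz.2, sub_zero, one_mul]
      _ ≤ ∫ z in Ω, (1 - stepFn c d (‖f z‖ ^ 2)) * h z := by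
          refine setIntegral_mono_set hηint (ae_of_all _ fun z => ?_) (hSΩ c).eventuallyLE
          exact mul_nonneg (sub_nonneg.2 (stepFn_le_one c d _)) (hh0 z)
      _ ≤ ∫ z in Ω, (2 * (dbar u z).re + (4 * (S (3 / 4)).indicator h z +
          2 * (‖deriv f z‖ * ‖deriv G z‖))) :=
          setIntegral_mono_on hηint (hR.add hJ) hΩ.measurableSet hpt
      _ = I := by
          rw [integral_add hR hJ, integral_const_mul, hre, mul_zero, zero_add]
  set cs : ℕ → ℝ := fun n => 1 - 1 / ((n : ℝ) + 1) with hcs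
  have hcs1 : ∀ n, cs n < 1 := fun n => sub_lt_self 1 (by positivity)
  have hcover : AECover (volume.restrict Ω) atTop fun n => S (cs n) := by
    refine ⟨(ae_restrict_iff' hΩ.measurableSet).2 (ae_of_all _ fun z hz => ?_),
      fun n => (hSc _ (hcs1 n)).measurableSet⟩
    have h1 : Tendsto cs atTop (𝓝 1) := by
      simpa [hcs] using tendsto_one_div_add_atTop_nhds_zero_nat.const_sub (1 : ℝ)
    filter_upwards [h1.eventually (lt_mem_nhds (hf.norm_sq_lt hz))] with n hn
    exact ⟨hz, hn.le⟩
  refine hcover.integrable_of_integral_bounded_of_nonneg_ae I (fun n => ?_) (ae_of_all _ hh0)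
    (Eventually.of_forall fun n => ?_)
  · exact (hSint _ (hcs1 n)).mono_measure Measure.restrict_le_self
  · rw [Measure.restrict_restrict_of_subset (hSΩ _)]
    exact hbound _ (hcs1 n)

theorem deriv_one_sub_stepFn (c d t : ℝ) :
    deriv (fun t => 1 - stepFn c d t) t = -deriv (stepFn c d) t := by
  rw [deriv_const_sub]

theorem contDiff_one_sub_stepFn (c d : ℝ) : ContDiff ℝ 1 fun t => 1 - stepFn c d t :=
  contDiff_const.sub (stepFn_contDiff (n := 1) c d)

theorem IsProperOntoDisc.one_sub_stepFn_eq_zero {Ω : Set ℂ} {f : ℂ → ℂ} {c d : ℝ} (hcd : c < d)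
    {z : ℂ} (hz : z ∈ Ω \ {z | z ∈ Ω ∧ ‖f z‖ ^ 2 ≤ d}) : 1 - stepFn c d (‖f z‖ ^ 2) = 0 := by
  rw [stepFn_of_ge hcd (not_lt.1 fun h => hz.2 ⟨hz.1, h.le⟩), sub_self]

theorem IsProperOntoDisc.integral_deriv_stepFn_mul {Ω : Set ℂ} {f H : ℂ → ℂ} (hΩ : IsOpen Ω)
    (hf : IsProperOntoDisc Ω f) (hH : DifferentiableOn ℂ H Ω) {c d : ℝ} (hcd : c < d)
    (hd : d < 1) :
    IntegrableOn (fun z => ((deriv (stepFn c d) (‖f z‖ ^ 2) : ℝ) : ℂ) *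
      (H z * f z * conj (deriv f z))) Ω ∧
    ∫ z in Ω, ((deriv (stepFn c d) (‖f z‖ ^ 2) : ℝ) : ℂ) * (H z * f z * conj (deriv f z)) = 0 := by
  have h := integral_dbar_mul_eq_zero hΩ (hf.isCompact_sublevel hd) (fun z hz => hz.1)
    (contDiffOn_comp_norm_sq (contDiff_one_sub_stepFn c d) hΩ hf.1)
    (fun z hz => by rw [one_sub_stepFn_eq_zero hcd hz, ofReal_zero]) hH
  have he : EqOn (fun z => dbar (fun w => ((1 - stepFn c d (‖f w‖ ^ 2) : ℝ) : ℂ)) z * H z)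
      (fun z => -(((deriv (stepFn c d) (‖f z‖ ^ 2) : ℝ) : ℂ) *
        (H z * f z * conj (deriv f z)))) Ω := fun z hz => by
    beta_reduce
    rw [dbar_comp_norm_sq (a := fun t => 1 - stepFn c d t)
      ((contDiff_one_sub_stepFn c d).differentiable one_ne_zero _)
      (hf.1.differentiableAt (hΩ.mem_nhds hz)), deriv_one_sub_stepFn]
    push_cast
    ring
  have h1 := h.1.congr_fun he hΩ.measurableSet
  have h2 := h.2
  rw [setIntegral_congr_fun hΩ.measurableSet he, integral_neg, neg_eq_zero] at h2
  exact ⟨by simpa using h1.neg, h2⟩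

theorem IsProperOntoDisc.integral_deriv_mul_one_sub_stepFn {Ω : Set ℂ} {f G : ℂ → ℂ}
    (hΩ : IsOpen Ω) (hf : IsProperOntoDisc Ω f) (hG : DifferentiableOn ℂ G Ω) {c d : ℝ}
    (hcd : c < d) (hd : d < 1) :
    IntegrableOn (fun z => ((deriv (stepFn c d) (‖f z‖ ^ 2) : ℝ) : ℂ) *
      (G z * deriv f z * conj (f z))) Ω ∧
    ∫ z in Ω, deriv G z * ((1 - stepFn c d (‖f z‖ ^ 2) : ℝ) : ℂ) =
      ∫ z in Ω, ((deriv (stepFn c d) (‖f z‖ ^ 2) : ℝ) : ℂ) *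
        (G z * deriv f z * conj (f z)) := by
  have hK := hf.isCompact_sublevel hd
  set K : Set ℂ := {z | z ∈ Ω ∧ ‖f z‖ ^ 2 ≤ d} with hKd
  have hKΩ : K ⊆ Ω := fun z hz => hz.1
  have hsc : ContinuousOn (fun z => ‖f z‖ ^ 2) Ω := hf.1.continuousOn.norm.pow 2
  have c1 := contDiffOn_comp_norm_sq (contDiff_one_sub_stepFn c d) hΩ hf.1
  have c2 : ContDiffOn ℝ 1 (fun w => conj (G w)) Ω :=
    conjCLE.contDiff.comp_contDiffOn ((hG.contDiffOn hΩ).restrict_scalars ℝ)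
  have h0 : ∀ z ∈ Ω \ K, ((1 - stepFn c d (‖f z‖ ^ 2) : ℝ) : ℂ) * conj (G z) = 0 :=
    fun z hz => by rw [one_sub_stepFn_eq_zero hcd hz, ofReal_zero, zero_mul]
  have hz := setIntegral_dbar_eq_zero hΩ hK hKΩ (c1.mul c2) h0
  have hsd : Continuous (deriv (stepFn c d)) :=
    (stepFn_contDiff (n := 1) c d).continuous_deriv le_rfl
  have i1 : IntegrableOn (fun z => ((deriv (stepFn c d) (‖f z‖ ^ 2) : ℝ) : ℂ) *
      (G z * deriv f z * conj (f z))) Ω := by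
    refine IntegrableOn.of_forall_sdiff_eq_zero (s := K) (ContinuousOn.integrableOn_compact hK
      (ContinuousOn.mono ?_ hKΩ)) hΩ.measurableSet fun z hz => ?_
    · exact (Complex.continuous_ofReal.comp_continuousOn (hsd.comp_continuousOn hsc)).mul
        ((hG.continuousOn.mul (hf.1.deriv hΩ).continuousOn).mul
          (Complex.continuous_conj.comp_continuousOn hf.1.continuousOn))
    · rw [deriv_stepFn_of_gt hcd (not_le.1 fun h => hz.2 ⟨hz.1, h⟩), ofReal_zero, zero_mul]
  have i2 : IntegrableOn (fun z => deriv G z * ((1 - stepFn c d (‖f z‖ ^ 2) : ℝ) : ℂ)) Ω := by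
    refine IntegrableOn.of_forall_sdiff_eq_zero (s := K) (ContinuousOn.integrableOn_compact hK
      (ContinuousOn.mono ?_ hKΩ)) hΩ.measurableSet fun z hz => ?_
    · exact (hG.deriv hΩ).continuousOn.mul c1.continuousOn
    · rw [one_sub_stepFn_eq_zero hcd hz, ofReal_zero, mul_zero]
  refine ⟨i1, ?_⟩
  have he : EqOn (dbar fun w => ((1 - stepFn c d (‖f w‖ ^ 2) : ℝ) : ℂ) * conj (G w))
      (fun z => conj (deriv G z * ((1 - stepFn c d (‖f z‖ ^ 2) : ℝ) : ℂ) -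
        ((deriv (stepFn c d) (‖f z‖ ^ 2) : ℝ) : ℂ) * (G z * deriv f z * conj (f z)))) Ω := by
    intro z hz
    have hn := hΩ.mem_nhds hz
    rw [dbar_mul (u := fun w => ((1 - stepFn c d (‖f w‖ ^ 2) : ℝ) : ℂ))
      ((c1.differentiableOn one_ne_zero).differentiableAt hn)
      ((c2.differentiableOn one_ne_zero).differentiableAt hn),
      dbar_comp_norm_sq (a := fun t => 1 - stepFn c d t)
      ((contDiff_one_sub_stepFn c d).differentiable one_ne_zero _)
      (hf.1.differentiableAt hn), deriv_one_sub_stepFn, dbar_conj (hG.differentiableAt hn)]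
    simp only [map_sub, map_mul, conj_ofReal, conj_conj]
    push_cast
    ring
  rw [setIntegral_congr_fun hΩ.measurableSet he, integral_conj, map_eq_zero,
    integral_sub i2 i1, sub_eq_zero] at hz
  exact hz

theorem exists_abs_deriv_stepFn_le : ∃ M : ℝ, 0 ≤ M ∧ ∀ a b t : ℝ, a < b →
    |deriv (stepFn a b) t| ≤ M / (b - a) := by
  have hc : Continuous (deriv Real.smoothTransition) :=
    (Real.smoothTransition.contDiff (n := 1)).continuous_deriv le_rfl
  obtain ⟨M, hM⟩ := isCompact_Icc.exists_bound_of_continuousOn (s := Icc (0 : ℝ) 1)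
    hc.continuousOn
  have hM0 : 0 ≤ M := (norm_nonneg _).trans (hM 0 (by simp))
  refine ⟨M, hM0, fun a b t hab => ?_⟩
  have hpos : 0 < b - a := sub_pos.2 hab
  rcases lt_or_ge t a with h | h
  · rw [deriv_stepFn_of_lt hab h, abs_zero]; positivity
  rcases lt_or_ge b t with h' | h'
  · rw [deriv_stepFn_of_gt hab h', abs_zero]; positivity
  have h1 : HasDerivAt (stepFn a b)
      (deriv Real.smoothTransition ((t - a) / (b - a)) * (1 / (b - a))) t :=
    ((Real.smoothTransition.contDiff (n := 1)).differentiable one_ne_zero _).hasDerivAt.comp t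
      (((hasDerivAt_id t).sub_const a).div_const (b - a))
  rw [h1.deriv, abs_mul, abs_of_pos (by positivity : 0 < 1 / (b - a)), mul_one_div]
  gcongr
  exact hM _ ⟨by apply div_nonneg <;> linarith, (div_le_one hpos).2 (by linarith)⟩

theorem IsProperOntoDisc.integral_deriv_eq_zero {Ω : Set ℂ} {f G H : ℂ → ℂ} (hΩ : IsOpen Ω)
    (hf : IsProperOntoDisc Ω f) (hG : DifferentiableOn ℂ G Ω) (hintegr : IntegrableOn (deriv G) Ω)
    (hGf : IntegrableOn (fun z => ‖G z‖ * ‖deriv f z‖ ^ 2) Ω) (hH : DifferentiableOn ℂ H Ω)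
    {r C : ℝ} (hr : r < 1)
    (hest : ∀ z ∈ Ω, r < ‖f z‖ ^ 2 →
      ‖G z * deriv f z * conj (f z) - H z * f z * conj (deriv f z)‖ ≤
        C * (1 - ‖f z‖ ^ 2) * (‖G z‖ * ‖deriv f z‖ ^ 2)) :
    ∫ z in Ω, deriv G z = 0 := by
  obtain ⟨M, hM0, hM⟩ := exists_abs_deriv_stepFn_le
  set e : ℕ → ℝ := fun n => 1 / ((n : ℝ) + 1) with he
  have he0 : ∀ n, 0 < e n := fun n => by positivity
  have heT : Tendsto e atTop (𝓝 0) := tendsto_one_div_add_atTop_nhds_zero_nat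
  have hcT : Tendsto (fun n => 1 - 2 * e n) atTop (𝓝 1) := by
    simpa using (heT.const_mul 2).const_sub 1
  have hcd : ∀ n, 1 - 2 * e n < 1 - e n := fun n => by linarith [he0 n]
  have hd : ∀ n, 1 - e n < 1 := fun n => by linarith [he0 n]
  set s : ℕ → ℝ → ℝ := fun n => stepFn (1 - 2 * e n) (1 - e n) with hs
  set F : ℕ → ℂ → ℂ := fun n z => ((deriv (s n) (‖f z‖ ^ 2) : ℝ) : ℂ) *
    (G z * deriv f z * conj (f z)) - ((deriv (s n) (‖f z‖ ^ 2) : ℝ) : ℂ) *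
    (H z * f z * conj (deriv f z)) with hF
  have hFi : ∀ n, IntegrableOn (F n) Ω := fun n =>
    (hf.integral_deriv_mul_one_sub_stepFn hΩ hG (hcd n) (hd n)).1.sub
      (hf.integral_deriv_stepFn_mul hΩ hH (hcd n) (hd n)).1
  have hFe : ∀ n, ∫ z in Ω, F n z =
      ∫ z in Ω, deriv G z * ((1 - s n (‖f z‖ ^ 2) : ℝ) : ℂ) := fun n => by
    rw [hF, integral_sub (hf.integral_deriv_mul_one_sub_stepFn hΩ hG (hcd n) (hd n)).1
      (hf.integral_deriv_stepFn_mul hΩ hH (hcd n) (hd n)).1,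
      (hf.integral_deriv_stepFn_mul hΩ hH (hcd n) (hd n)).2, sub_zero,
      (hf.integral_deriv_mul_one_sub_stepFn hΩ hG (hcd n) (hd n)).2]
  have hev : ∀ z ∈ Ω, ∀ᶠ n in atTop, ‖f z‖ ^ 2 < 1 - 2 * e n := fun z hz =>
    hcT.eventually (lt_mem_nhds (hf.norm_sq_lt hz))
  have hF0 : Tendsto (fun n => ∫ z in Ω, F n z) atTop (𝓝 (∫ z in Ω, (0 : ℂ))) := by
    refine tendsto_integral_filter_of_dominated_convergence
      (fun z => 2 * M * |C| * (‖G z‖ * ‖deriv f z‖ ^ 2))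
      (Eventually.of_forall fun n => (hFi n).aestronglyMeasurable) ?_ (hGf.const_mul _) ?_
    · filter_upwards [hcT.eventually (lt_mem_nhds hr)] with n hn
      refine (ae_restrict_iff' hΩ.measurableSet).2 (ae_of_all _ fun z hz => ?_)
      have hw : 0 ≤ ‖G z‖ * ‖deriv f z‖ ^ 2 := by positivity
      simp only [hF]
      rw [← mul_sub, norm_mul, norm_real, Real.norm_eq_abs]
      rcases lt_or_ge (‖f z‖ ^ 2) (1 - 2 * e n) with h | h
      · rw [deriv_stepFn_of_lt (hcd n) h, abs_zero, zero_mul]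
        positivity
      · have h1 := hM (1 - 2 * e n) (1 - e n) (‖f z‖ ^ 2) (hcd n)
        have hen := he0 n
        have h2 := hest z hz (hn.trans_le h)
        have h3 := hf.norm_sq_lt hz
        calc |deriv (s n) (‖f z‖ ^ 2)| *
              ‖G z * deriv f z * conj (f z) - H z * f z * conj (deriv f z)‖
            ≤ M / (1 - e n - (1 - 2 * e n)) *
              (|C| * (2 * e n) * (‖G z‖ * ‖deriv f z‖ ^ 2)) := by
              refine mul_le_mul h1 (h2.trans ?_) (norm_nonneg _)
                (div_nonneg hM0 (by linarith [hcd n]))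
              refine mul_le_mul_of_nonneg_right ?_ hw
              exact mul_le_mul (le_abs_self C) (by linarith) (by linarith) (abs_nonneg C)
          _ = _ := by
              rw [show 1 - e n - (1 - 2 * e n) = e n by ring]
              field_simp
    · refine (ae_restrict_iff' hΩ.measurableSet).2 (ae_of_all _ fun z hz => ?_)
      refine tendsto_const_nhds.congr' ?_
      filter_upwards [hev z hz] with n hn
      rw [hF]
      beta_reduce
      rw [deriv_stepFn_of_lt (hcd n) hn]
      simp
  have hL : Tendsto (fun n => ∫ z in Ω, deriv G z * ((1 - s n (‖f z‖ ^ 2) : ℝ) : ℂ)) atTop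
      (𝓝 (∫ z in Ω, deriv G z)) := by
    refine tendsto_integral_filter_of_dominated_convergence (fun z => ‖deriv G z‖)
      (Eventually.of_forall fun n => ?_) (Eventually.of_forall fun n => ae_of_all _ fun z => ?_)
      hintegr.norm ?_
    · refine ContinuousOn.aestronglyMeasurable ?_ hΩ.measurableSet
      exact (hG.deriv hΩ).continuousOn.mul
        (contDiffOn_comp_norm_sq (contDiff_one_sub_stepFn _ _) hΩ hf.1).continuousOn
    · rw [norm_mul, norm_real, Real.norm_eq_abs]
      refine mul_le_of_le_one_right (norm_nonneg _) (abs_le.2 ⟨?_, ?_⟩)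
      · linarith [stepFn_le_one (1 - 2 * e n) (1 - e n) (‖f z‖ ^ 2)]
      · linarith [stepFn_nonneg (1 - 2 * e n) (1 - e n) (‖f z‖ ^ 2)]
    · refine (ae_restrict_iff' hΩ.measurableSet).2 (ae_of_all _ fun z hz => ?_)
      refine tendsto_const_nhds.congr' ?_
      filter_upwards [hev z hz] with n hn
      rw [hs]
      beta_reduce
      rw [stepFn_of_le (hcd n) hn.le]
      simp
  simp only [hFe, integral_zero] at hF0
  exact tendsto_nhds_unique hL hF0

theorem finite_zeros_of_isCompact {K : Set ℂ} (hK : IsCompact K) {D : ℂ → ℂ}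
    (hD : ∀ z ∈ K, ∀ᶠ w in 𝓝[≠] z, D w ≠ 0) : {z | z ∈ K ∧ D z = 0}.Finite := by
  by_contra h
  obtain ⟨x, hxK, hx⟩ := Set.Infinite.exists_accPt_of_subset_isCompact h hK fun z hz => hz.1
  obtain ⟨y, ⟨hyx, hy⟩, hy'⟩ := ((accPt_iff_frequently.1 hx).and_eventually
    (eventually_nhdsWithin_iff.1 (hD x hxK))).exists
  exact hy' hyx hy.2

theorem exists_pow_mul_of_iteratedDeriv_eq_zero {g G : ℂ → ℂ} {z : ℂ} {m : ℕ}
    (hG : ∀ᶠ w in 𝓝 z, HasDerivAt G (g w) w) (h0 : G z = 0)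
    (hg : ∀ k < m, iteratedDeriv k g z = 0) :
    ∃ h : ℂ → ℂ, AnalyticAt ℂ h z ∧ ∀ᶠ w in 𝓝 z, G w = (w - z) ^ m * h w := by
  have hGa : AnalyticAt ℂ G z := by
    refine analyticAt_iff_eventually_differentiableAt.2 ?_
    filter_upwards [hG] with w hw using hw.differentiableAt
  have hde : deriv G =ᶠ[𝓝 z] g := by filter_upwards [hG] with w hw using hw.deriv
  refine (natCast_le_analyticOrderAt hGa).1
    ((natCast_le_analyticOrderAt_iff_iteratedDeriv_eq_zero hGa).2 fun k hk => ?_)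
  cases k with
  | zero => simpa using h0
  | succ k => rw [iteratedDeriv_succ', hde.iteratedDeriv_eq k, hg k (by omega)]

theorem BergmanFun.integrableOn {Ω : Set ℂ} {g : ℂ → ℂ} (hΩ : IsOpen Ω) (hA : volume Ω < ⊤)
    (hg : BergmanFun Ω g) : IntegrableOn g Ω := by
  have h1 : IntegrableOn (fun _ : ℂ => (1 : ℝ)) Ω := integrableOn_const hA.ne
  refine (h1.add hg.2).mono' (hg.1.continuousOn.aestronglyMeasurable hΩ.measurableSet)
    (ae_of_all _ fun z => ?_)
  simp only [Pi.add_apply]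
  nlinarith [sq_nonneg (‖g z‖ - 1)]

theorem IsProperOntoDisc.integrableOn_norm_deriv_sq {Ω : Set ℂ} {f : ℂ → ℂ} (hΩ : IsOpen Ω)
    (hf : IsProperOntoDisc Ω f) : IntegrableOn (fun z => ‖deriv f z‖ ^ 2) Ω := by
  simpa using hf.integrableOn_sqrt_mul (G := fun _ => 0) hΩ (differentiableOn_const 0) (by simp)

theorem IsProperOntoDisc.integrableOn_norm_mul_deriv_sq {Ω : Set ℂ} {f g G : ℂ → ℂ}
    (hΩ : IsOpen Ω) (hf : IsProperOntoDisc Ω f) (hg : BergmanFun Ω g)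
    (hG : ∀ z ∈ Ω, HasDerivAt G (g z) z) :
    IntegrableOn (fun z => ‖G z‖ * ‖deriv f z‖ ^ 2) Ω := by
  have hGd : DifferentiableOn ℂ G Ω := fun z hz => (hG z hz).differentiableAt.differentiableWithinAt
  have hfd := hf.1.deriv hΩ
  have h1 : IntegrableOn (fun z => ‖deriv f z‖ * ‖deriv G z‖) Ω := by
    refine ((hf.integrableOn_norm_deriv_sq hΩ).add hg.2).mono'
      ((hfd.continuousOn.norm.mul (hGd.deriv hΩ).continuousOn.norm).aestronglyMeasurable
        hΩ.measurableSet) ((ae_restrict_iff' hΩ.measurableSet).2 (ae_of_all _ fun z hz => ?_))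
    simp only [Pi.add_apply]
    rw [(hG z hz).deriv, norm_mul, norm_norm, norm_norm]
    nlinarith [sq_nonneg (‖deriv f z‖ - ‖g z‖), sq_nonneg (‖deriv f z‖ + ‖g z‖)]
  refine (hf.integrableOn_sqrt_mul hΩ hGd h1).mono'
    ((hGd.continuousOn.norm.mul (hfd.continuousOn.norm.pow 2)).aestronglyMeasurable
      hΩ.measurableSet) (ae_of_all _ fun z => ?_)
  rw [Real.norm_eq_abs, abs_of_nonneg (by positivity)]
  gcongr
  exact Real.le_sqrt_of_sq_le (by linarith)

theorem exists_vanishing_data {Ω : Set ℂ} (hΩ : IsFinConnDomain Ω) (hA : volume Ω < ⊤)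
    {f : ℂ → ℂ} (hf : IsProperOntoDisc Ω f) {r C : ℝ} {p q : ℂ → ℂ} (hr1 : r < 1)
    (hp : DifferentiableOn ℂ p Ω) (hq : DifferentiableOn ℂ q Ω) (hp0 : ∃ z ∈ Ω, p z ≠ 0)
    (hest : ∀ z ∈ Ω, r < ‖f z‖ ^ 2 → f z ≠ 0 ∧ deriv f z ≠ 0 ∧
        ‖f z / deriv f z‖ ≤ C ∧
        ‖conj (f z / deriv f z) * f z * p z - q z‖ ≤ C * (1 - ‖f z‖ ^ 2) * ‖p z‖) :
    ∃ (Z : Set ℂ) (m : ℂ → ℕ), Z.Finite ∧ Z ⊆ Ω ∧ ∀ g G : ℂ → ℂ, BergmanFun Ω g →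
      (∀ z ∈ Ω, HasDerivAt G (g z) z) →
      (∀ w ∈ Z, G w = 0 ∧ ∀ k < m w, iteratedDeriv k g w = 0) → ∫ z in Ω, g z = 0 := by
  obtain ⟨hΩo, hΩc, -, -⟩ := id hΩ
  set D : ℂ → ℂ := fun z => f z ^ 2 * p z with hDdef
  have hD : DifferentiableOn ℂ D Ω := (hf.1.pow 2).mul hp
  have hpne : ∀ z ∈ Ω, ∀ᶠ w in 𝓝[≠] z, p w ≠ 0 := fun z hz => by
    obtain ⟨x, hx, hpx⟩ := hp0
    exact (hp.analyticAt (hΩo.mem_nhds hz)).eventually_eq_zero_or_eventually_ne_zero.resolve_left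
      (not_eventually_eq_zero hΩo hΩc.isPreconnected hp hx hpx hz)
  have hfne : ∀ z ∈ Ω, ∀ᶠ w in 𝓝[≠] z, f w ≠ 0 := fun z hz =>
    (hf.1.analyticAt (hΩo.mem_nhds hz)).eventually_eq_zero_or_eventually_ne_zero.resolve_left
      fun h => hf.not_eventually_const hΩ hz (by
        filter_upwards [h] with w hw; rw [hw, h.self_of_nhds])
  have hDne : ∀ z ∈ Ω, ∀ᶠ w in 𝓝[≠] z, D w ≠ 0 := fun z hz => by
    filter_upwards [hpne z hz, hfne z hz] with w h1 h2 using mul_ne_zero (pow_ne_zero 2 h2) h1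
  have hDne' : ∀ z ∈ Ω, ¬ ∀ᶠ w in 𝓝 z, D w = 0 := fun z hz h => by
    obtain ⟨w, h1, h2⟩ := ((hDne z hz).and (h.filter_mono nhdsWithin_le_nhds)).exists
    exact h1 h2
  have hfac : ∀ z, ∃ m : ℕ, z ∈ Ω → ∃ h : ℂ → ℂ, AnalyticAt ℂ h z ∧ h z ≠ 0 ∧
      ∀ᶠ w in 𝓝 z, D w = (w - z) ^ m * h w := fun z => by
    by_cases hz : z ∈ Ω
    · obtain ⟨m, h, hh⟩ := (hD.analyticAt
        (hΩo.mem_nhds hz)).exists_eventuallyEq_pow_smul_nonzero_iff.2 (hDne' z hz)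
      exact ⟨m, fun _ => ⟨h, hh⟩⟩
    · exact ⟨0, fun h => absurd h hz⟩
  choose m hm using hfac
  set r' := max r (1 / 2) with hr'
  have hr'1 : r' < 1 := max_lt hr1 (by norm_num)
  have hK := hf.isCompact_sublevel hr'1
  refine ⟨_, m, finite_zeros_of_isCompact hK (D := D) fun z hz => hDne z hz.1,
    fun z hz => hz.1.1, fun g G hg hG hZ => ?_⟩
  have hGd : DifferentiableOn ℂ G Ω := fun z hz =>
    (hG z hz).differentiableAt.differentiableWithinAt
  have hfd := hf.1.deriv hΩo
  have hN : DifferentiableOn ℂ (fun z => G z * q z * deriv f z) Ω := (hGd.mul hq).mul hfd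
  obtain ⟨H, hH, hHe⟩ := exists_quotient (N := fun z => G z * q z * deriv f z) hΩo hD hDne'
    fun x hx => by
      have hxn := hΩo.mem_nhds hx
      rcases lt_or_ge r' (‖f x‖ ^ 2) with hlt | hle
      · refine (exists_local_quotient_or (hN.analyticAt hxn) (hD.analyticAt hxn)
          (hDne' x hx)).resolve_right ?_
        rintro ⟨c, hc, hev⟩
        have hcf : ContinuousAt (fun z => ‖f z‖ ^ 2) x :=
          (hf.1.differentiableAt hxn).continuousAt.norm.pow 2
        have hct : Tendsto (fun z => 2 * C * ‖G z‖ * ‖deriv f z‖ * ‖z - x‖) (𝓝[≠] x) (𝓝 0) := by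
          have : ContinuousAt (fun z => 2 * C * ‖G z‖ * ‖deriv f z‖ * ‖z - x‖) x :=
            ((continuousAt_const.mul (hGd.differentiableAt hxn).continuousAt.norm).mul
              (hfd.differentiableAt hxn).continuousAt.norm).mul
              (continuousAt_id.sub continuousAt_const).norm
          simpa [ContinuousAt] using this.tendsto.mono_left nhdsWithin_le_nhds
        obtain ⟨z, h1, h2, h3, h4, h5⟩ := ((hct.eventually (gt_mem_nhds (half_pos hc))).and
          ((hpne x hx).and ((hev.filter_mono nhdsWithin_le_nhds).and
          (((hcf.eventually (lt_mem_nhds hlt)).filter_mono nhdsWithin_le_nhds).and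
            (mem_nhdsWithin_of_mem_nhds hxn))))).exists
        obtain ⟨e1, e2, e3, e4⟩ := hest z h5 ((le_max_left _ _).trans_lt h4)
        have hlt1 := hf.norm_sq_lt h5
        have hhalf : 1 / 2 < ‖f z‖ ^ 2 := (le_max_right _ _).trans_lt h4
        have hf1 : ‖f z‖ ≤ 1 := by nlinarith [norm_nonneg (f z)]
        have hC : 0 ≤ C := (norm_nonneg _).trans e3
        have hqb : ‖q z‖ ≤ 2 * C * ‖p z‖ := by
          have a1 : ‖conj (f z / deriv f z) * f z * p z‖ ≤ C * 1 * ‖p z‖ := by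
            rw [norm_mul, norm_mul, RCLike.norm_conj]
            gcongr
          have a2 : C * (1 - ‖f z‖ ^ 2) * ‖p z‖ ≤ C * 1 * ‖p z‖ := by
            gcongr
            linarith [sq_nonneg ‖f z‖]
          have a3 := norm_sub_norm_le (q z) (conj (f z / deriv f z) * f z * p z)
          rw [norm_sub_rev] at a3
          linarith
        have hpz : 0 < ‖p z‖ := norm_pos_iff.2 h2
        rw [hDdef] at h3
        simp only [norm_mul, norm_pow] at h3
        have b1 : c * (1 / 2 * ‖p z‖) ≤ c * (‖f z‖ ^ 2 * ‖p z‖) := by gcongr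
        have b2 : ‖G z‖ * ‖q z‖ * ‖deriv f z‖ * ‖z - x‖ ≤
            ‖G z‖ * (2 * C * ‖p z‖) * ‖deriv f z‖ * ‖z - x‖ := by gcongr
        have b3 := mul_lt_mul_of_pos_right h1 hpz
        linarith
      · by_cases hDx : D x = 0
        · obtain ⟨h, hh, hhx, hhe⟩ := hm x hx
          obtain ⟨hG0, hgk⟩ := hZ x ⟨⟨hx, hle⟩, hDx⟩
          obtain ⟨k, hk, hke⟩ := exists_pow_mul_of_iteratedDeriv_eq_zero (m := m x)
            (by filter_upwards [hxn] with w hw using hG w hw) hG0 hgk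
          refine exists_local_quotient_of_pow hhe hh hhx le_rfl
            (g := fun z => k z * q z * deriv f z)
            ((hk.fun_mul (hq.analyticAt hxn)).fun_mul (hfd.analyticAt hxn)) ?_
          filter_upwards [hke] with w hw
          rw [hw]; ring
        · refine (exists_local_quotient_or (hN.analyticAt hxn) (hD.analyticAt hxn)
            (hDne' x hx)).resolve_right ?_
          rintro ⟨c, hc, hev⟩
          have := hev.self_of_nhds
          rw [sub_self, norm_zero, mul_zero] at this
          exact absurd this (not_le.2 (mul_pos hc (norm_pos_iff.2 hDx)))
  have hdG : EqOn (deriv G) g Ω := fun z hz => (hG z hz).deriv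
  rw [← setIntegral_congr_fun hΩo.measurableSet hdG]
  refine hf.integral_deriv_eq_zero hΩo hGd
    ((hg.integrableOn hΩo hA).congr_fun hdG.symm hΩo.measurableSet)
    (hf.integrableOn_norm_mul_deriv_sq hΩo hg hG) hH hr'1 (C := 2 * C) fun x hx hlt => ?_
  have hxn := hΩo.mem_nhds hx
  have cf := (hf.1.differentiableAt hxn).continuousAt
  have cf' := (hfd.differentiableAt hxn).continuousAt
  have cG := (hGd.differentiableAt hxn).continuousAt
  have cH := (hH.differentiableAt hxn).continuousAt
  have c1 : ContinuousAt (fun z => ‖G z * deriv f z * conj (f z) - H z * f z * conj (deriv f z)‖)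
      x := (((cG.mul cf').mul (Complex.continuous_conj.continuousAt.comp cf)).sub
        ((cH.mul cf).mul (Complex.continuous_conj.continuousAt.comp cf'))).norm
  have c2 : ContinuousAt (fun z => 2 * C * (1 - ‖f z‖ ^ 2) * (‖G z‖ * ‖deriv f z‖ ^ 2)) x :=
    (continuousAt_const.mul (continuousAt_const.sub (cf.norm.pow 2))).mul
      (cG.norm.mul (cf'.norm.pow 2))
  refine le_of_tendsto_of_tendsto (c1.tendsto.mono_left (nhdsWithin_le_nhds (s := {x}ᶜ)))
    (c2.tendsto.mono_left nhdsWithin_le_nhds) ?_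
  filter_upwards [hpne x hx, nhdsWithin_le_nhds ((cf.norm.pow 2).eventually (lt_mem_nhds hlt)),
    nhdsWithin_le_nhds hxn] with z h1 h2 h3
  obtain ⟨e1, e2, e3, e4⟩ := hest z h3 ((le_max_left _ _).trans_lt h2)
  have hlt1 := hf.norm_sq_lt h3
  have hhalf : 1 / 2 < ‖f z‖ ^ 2 := (le_max_right _ _).trans_lt h2
  have hf1 : ‖f z‖ ≤ 1 := by nlinarith [norm_nonneg (f z)]
  have hC : 0 ≤ C := (norm_nonneg _).trans e3
  have hpz : 0 < ‖p z‖ := norm_pos_iff.2 h1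
  have hfz : 1 / 2 ≤ ‖f z‖ := by nlinarith [norm_nonneg (f z)]
  have hce : conj (deriv f z) ≠ 0 := (map_ne_zero _).2 e2
  have hHz := hHe z h3
  have key : f z * p z * (G z * deriv f z * conj (f z) - H z * f z * conj (deriv f z)) =
      (conj (f z / deriv f z) * f z * p z - q z) * (G z * deriv f z * conj (deriv f z)) := by
    have e5 : conj (f z / deriv f z) * conj (deriv f z) = conj (f z) := by
      rw [map_div₀, div_mul_cancel₀ _ hce]
    simp only [hDdef] at hHz
    linear_combination (-(f z * p z * G z * deriv f z)) * e5 + conj (deriv f z) * hHz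
  have hkn := congrArg norm key
  rw [norm_mul, norm_mul (f z), norm_mul (conj (f z / deriv f z) * f z * p z - q z), norm_mul,
    norm_mul, RCLike.norm_conj] at hkn
  set E := ‖G z * deriv f z * conj (f z) - H z * f z * conj (deriv f z)‖ with hE
  have hE0 : 0 ≤ E := norm_nonneg _
  have k1 : 1 / 2 * ‖p z‖ * E ≤ ‖f z‖ * ‖p z‖ * E := by gcongr
  have k2 := mul_le_mul_of_nonneg_right e4 (by positivity : 0 ≤ ‖G z‖ * ‖deriv f z‖ * ‖deriv f z‖)
  refine le_of_mul_le_mul_left ?_ hpz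
  linarith

/-- The Bergman space as a space of functions on `ℂ`. -/
def bergmanSubmodule (Ω : Set ℂ) (hΩ : IsOpen Ω) : Submodule ℂ (ℂ → ℂ) where
  carrier := {g | BergmanFun Ω g}
  zero_mem' := ⟨differentiableOn_const 0, by simp⟩
  add_mem' := fun {g h} hg hh => by
    refine ⟨hg.1.add hh.1, ((hg.2.add hh.2).const_mul 2).mono'
      (((hg.1.add hh.1).continuousOn.norm.pow 2).aestronglyMeasurable hΩ.measurableSet)
      (ae_of_all _ fun z => ?_)⟩
    simp only [Pi.add_apply, norm_pow, norm_norm]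
    nlinarith [norm_add_le (g z) (h z), sq_nonneg (‖g z‖ - ‖h z‖), norm_nonneg (g z + h z),
      norm_nonneg (g z), norm_nonneg (h z)]
  smul_mem' := fun c g hg => by
    refine ⟨hg.1.const_smul c, ?_⟩
    simp only [Pi.smul_apply, norm_smul, mul_pow]
    exact hg.2.const_mul _

theorem exists_linearMap_of_add_mul {B : Submodule ℂ (ℂ → ℂ)} {φ : (ℂ → ℂ) → ℂ}
    (h : ∀ g₁ ∈ B, ∀ g₂ ∈ B, ∀ c : ℂ, φ (fun z => g₁ z + c * g₂ z) = φ g₁ + c * φ g₂) :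
    ∃ L : B →ₗ[ℂ] ℂ, ∀ g : B, L g = φ g := by
  have h0 : φ 0 = 0 := by
    have := h 0 B.zero_mem 0 B.zero_mem 1
    simp only [Pi.zero_apply, mul_zero, add_zero, one_mul] at this
    exact left_eq_add.1 this
  refine ⟨{ toFun := fun g => φ g, map_add' := fun x y => ?_, map_smul' := fun c x => ?_ },
    fun _ => rfl⟩
  · have := h x x.2 y y.2 1
    simp only [one_mul] at this
    exact this
  · have := h 0 B.zero_mem x x.2 c
    simp only [Pi.zero_apply, zero_add, h0] at this
    exact this

/-- The functionals `g ↦ g⁽ᵏ⁾(w)` with `w ∈ Ω`. -/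
def evalFunctionals (Ω : Set ℂ) (B : Submodule ℂ (ℂ → ℂ)) : Set (B →ₗ[ℂ] ℂ) :=
  {L | ∃ w ∈ Ω, ∃ k : ℕ, ∀ g : B, L g = iteratedDeriv k g w}

/-- The functionals integrating along a segment contained in `Ω`. -/
def segFunctionals (Ω : Set ℂ) (B : Submodule ℂ (ℂ → ℂ)) : Set (B →ₗ[ℂ] ℂ) :=
  {L | ∃ p q : ℂ, segment ℝ p q ⊆ Ω ∧ ∀ g : B, L g = segInt g p q}

theorem exists_mem_evalFunctionals {Ω : Set ℂ} (hΩ : IsOpen Ω) {w : ℂ} (hw : w ∈ Ω) (k : ℕ) :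
    ∃ L ∈ evalFunctionals Ω (bergmanSubmodule Ω hΩ), ∀ g, L g = iteratedDeriv k g w := by
  obtain ⟨L, hL⟩ := exists_linearMap_of_add_mul (B := bergmanSubmodule Ω hΩ)
    (φ := fun g => iteratedDeriv k g w) fun g₁ h₁ g₂ h₂ c => by
      have d1 : ContDiffAt ℂ k g₁ w := (h₁.1.contDiffOn hΩ).contDiffAt (hΩ.mem_nhds hw)
      have d2 : ContDiffAt ℂ k g₂ w := (h₂.1.contDiffOn hΩ).contDiffAt (hΩ.mem_nhds hw)
      have := iteratedDeriv_fun_add d1 (d2.const_smul c)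
      exact this.trans (congrArg _ (iteratedDeriv_const_smul d2 c))
  exact ⟨L, ⟨w, hw, k, hL⟩, hL⟩

theorem PolyPath.exists_mem_span_segFunctionals {Ω : Set ℂ} (hΩ : IsOpen Ω) {p q : ℂ}
    {Φ : (ℂ → ℂ) → ℂ} (H : PolyPath Ω p q Φ) :
    ∃ L ∈ Submodule.span ℂ (segFunctionals Ω (bergmanSubmodule Ω hΩ)), ∀ g, L g = Φ g := by
  induction H with
  | refl hp => exact ⟨0, Submodule.zero_mem _, fun g => by simp⟩
  | @step q r Φ h hs ih =>
    obtain ⟨L, hL, hLΦ⟩ := ih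
    obtain ⟨L', hL'⟩ := exists_linearMap_of_add_mul (B := bergmanSubmodule Ω hΩ)
      (φ := fun g => segInt g q r) fun g₁ h₁ g₂ h₂ c =>
        segInt_add_mul c (h₁.1.continuousOn.mono hs) (h₂.1.continuousOn.mono hs)
    refine ⟨L + L', Submodule.add_mem _ hL (Submodule.subset_span ⟨q, r, hs, hL'⟩), fun g => ?_⟩
    rw [LinearMap.add_apply, hLΦ, hL']

theorem isGenQuadratureDomain_of_mem_span {Ω : Set ℂ} (hΩ : IsOpen Ω)
    {L : bergmanSubmodule Ω hΩ →ₗ[ℂ] ℂ} (hL : ∀ g, L g = ∫ z in Ω, (g : ℂ → ℂ) z)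
    (hmem : L ∈ Submodule.span ℂ (evalFunctionals Ω (bergmanSubmodule Ω hΩ) ∪
      segFunctionals Ω (bergmanSubmodule Ω hΩ))) : IsGenQuadratureDomain Ω := by
  rw [Submodule.span_union, Submodule.mem_sup] at hmem
  obtain ⟨y, hy, x, hx, hyx⟩ := hmem
  obtain ⟨N, a, E, rfl⟩ := Submodule.mem_span_set'.1 hy
  obtain ⟨M, b, S, rfl⟩ := Submodule.mem_span_set'.1 hx
  choose w hw k hk using fun j => (E j).2
  choose p q hpq hS using fun m => (S m).2
  have hσ : ∀ (m : Fin M) (t : ℝ), HasDerivAt (fun t : ℝ => p m + t * (q m - p m))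
      (q m - p m) t := fun m t => by
    simpa using ((hasDerivAt_id (t : ℂ)).comp_ofReal.mul_const (q m - p m)).const_add (p m)
  refine ⟨N, M, w, k, fun j i => if i = k j then a j else 0, b,
    fun m t => p m + t * (q m - p m), hw, fun m => ⟨?_, ∅, ?_⟩,
    fun m t ht => hpq m (segment_param_mem ht), fun g hg => ?_⟩
  · exact fun t _ => (hσ m t).continuousAt.continuousWithinAt
  · refine ContDiff.contDiffOn ?_
    exact contDiff_const.add (Complex.ofRealCLM.contDiff.mul contDiff_const)
  · have h1 := hL ⟨g, hg⟩
    rw [← hyx] at h1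
    simp only [LinearMap.add_apply, LinearMap.sum_apply, LinearMap.smul_apply, smul_eq_mul, hk,
      hS] at h1
    rw [← h1]
    congr 1
    · refine Finset.sum_congr rfl fun j _ => ?_
      simp only [ite_mul, zero_mul]
      rw [Finset.sum_ite_eq' (Finset.range (k j + 1)) (k j), if_pos (by simp),
        iteratedDerivWithin_of_isOpen hΩ (hw j)]
    · refine Finset.sum_congr rfl fun m _ => ?_
      simp only [(hσ m _).deriv]
      rfl

theorem isGenQuadratureDomain_of_vanishing_data {Ω : Set ℂ} (hΩ : IsFinConnDomain Ω)
    (hA : volume Ω < ⊤) {Z : Set ℂ} {m : ℂ → ℕ} (hZ : Z.Finite) (hZΩ : Z ⊆ Ω)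
    (h : ∀ g G : ℂ → ℂ, BergmanFun Ω g → (∀ z ∈ Ω, HasDerivAt G (g z) z) →
      (∀ w ∈ Z, G w = 0 ∧ ∀ k < m w, iteratedDeriv k g w = 0) → ∫ z in Ω, g z = 0) :
    IsGenQuadratureDomain Ω := by
  obtain ⟨hΩo, hΩc, hfin, -⟩ := hΩ
  obtain ⟨z₀, hz₀⟩ := hΩc.nonempty
  obtain ⟨s, hs, hsl, hsp⟩ := exists_finite_periods hΩo hfin
  have hsL : ∀ Φ : s, ∃ L ∈ Submodule.span ℂ (segFunctionals Ω (bergmanSubmodule Ω hΩo)),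
      ∀ g, L g = Φ.1 g := fun Φ => by
    obtain ⟨p, hp⟩ := hsl Φ Φ.2
    exact hp.exists_mem_span_segFunctionals hΩo
  choose A hAm hA' using hsL
  have hp : ∀ w : Z, ∃ Φ, PolyPath Ω z₀ w Φ := fun w =>
    PolyPath.exists_of_isPreconnected hΩo hΩc.isPreconnected hz₀ (hZΩ w.2)
  choose Ψ hΨ using hp
  choose B hBm hB using fun w => (hΨ w).exists_mem_span_segFunctionals hΩo
  choose E hEm hE using fun x : (w : Z) × Fin (m w) =>
    exists_mem_evalFunctionals hΩo (hZΩ x.1.2) (x.2 : ℕ)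
  obtain ⟨L, hL⟩ := exists_linearMap_of_add_mul (B := bergmanSubmodule Ω hΩo)
    (φ := fun g => ∫ z in Ω, g z) fun g₁ h₁ g₂ h₂ c => by
      rw [integral_add (BergmanFun.integrableOn hΩo hA h₁)
        ((BergmanFun.integrableOn hΩo hA h₂).const_mul c), integral_const_mul]
  have := hs.to_subtype
  have := hZ.to_subtype
  refine isGenQuadratureDomain_of_mem_span hΩo hL ?_
  have hmem : L ∈ Submodule.span ℂ (Set.range (Sum.elim (Sum.elim A B) E)) := by
    refine mem_span_of_iInf_ker_le_ker fun g hg => ?_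
    simp only [Submodule.mem_iInf, LinearMap.mem_ker, Sum.forall, Sum.elim_inl,
      Sum.elim_inr] at hg
    obtain ⟨⟨g1, g2⟩, g3⟩ := hg
    have hgB : BergmanFun Ω g := g.2
    obtain ⟨G, hG⟩ := PolyPath.exists_primitive hΩo hgB.1
      (hsp g hgB.1 fun Φ hΦ => (hA' ⟨Φ, hΦ⟩ g).symm.trans (g1 _))
    rw [LinearMap.mem_ker, hL]
    refine h g (fun z => G z - G z₀) hgB (fun z hz => (hG z hz).sub_const _) fun w hw => ⟨?_, ?_⟩
    · rw [← (hΨ ⟨w, hw⟩).eq_sub hgB.1.continuousOn hG, ← hB, g2]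
    · intro k hk
      have := g3 ⟨⟨w, hw⟩, ⟨k, hk⟩⟩
      rwa [hE] at this
  refine Submodule.span_le.2 ?_ hmem
  rintro _ ⟨(x | x) | x, rfl⟩
  · exact Submodule.span_mono subset_union_right (hAm x)
  · exact Submodule.span_mono subset_union_right (hBm x)
  · exact Submodule.subset_span (Or.inl (hEm x))

end

/-- if some proper holomorphic map `f` of `Ω` onto the unit disc has derivative
`f'` a rational function of `f` and an Ahlfors map `fb`, then `Ω` is a generalized quadrature
domain. -/
theorem stmt_16 (Ω : Set ℂ) (hΩ : IsFinConnDomain Ω) (hA : volume Ω < ⊤)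
    (f : ℂ → ℂ) (hf : IsProperOntoDisc Ω f)
    (b : ℂ) (hb : b ∈ Ω) (fb : ℂ → ℂ) (hfb : IsAhlforsMap Ω b fb)
    (P Q : MvPolynomial (Fin 2) ℂ)
    (hQ : ∃ z ∈ Ω, MvPolynomial.eval ![f z, fb z] Q ≠ 0)
    (hPQ : ∀ z ∈ Ω,
      deriv f z * MvPolynomial.eval ![f z, fb z] Q = MvPolynomial.eval ![f z, fb z] P) :
    IsGenQuadratureDomain Ω := by
  obtain ⟨r, C, p, q, -, hr, hp, hq, hp0, hest⟩ :=
    exists_boundary_estimate hΩ hA hf hb hfb hQ hPQ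
  obtain ⟨Z, m, hZ, hZΩ, h⟩ := exists_vanishing_data hΩ hA hf hr hp hq hp0 hest
  exact isGenQuadratureDomain_of_vanishing_data hΩ hA hZ hZΩ h
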